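/- Let ℱ be a finite collection of connected planar graphs. Then there exists a function g : ℕ → ℕ of polynomial growth such that for every graph G, the elimination distance of G to an ℱ-minor-free graph satisfies ed_{¬ℱ}(G) ≤ g(nm_ℱ(G)). -/

import Mathlib

/-- `φ` is a minor model of `H` in `G`: branch sets are connected (hence nonempty) and
pairwise disjoint, and every edge of `H` is realized by an edge of `G` between the
corresponding branch sets. -/
def IsMinorModel {V W : Type} (G : SimpleGraph V) (H : SimpleGraph W) (φ : W → Set V) :
    Prop :=
  (∀ w : W, (G.induce (φ w)).Connected) ∧
  (∀ w₁ w₂ : W, w₁ ≠ w₂ → Disjoint (φ w₁) (φ w₂)) ∧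
  (∀ w₁ w₂ : W, H.Adj w₁ w₂ → ∃ x ∈ φ w₁, ∃ y ∈ φ w₂, G.Adj x y)

/-- `H` is a minor of `G`. -/
def IsMinorOf {W V : Type} (H : SimpleGraph W) (G : SimpleGraph V) : Prop :=
  ∃ φ : W → Set V, IsMinorModel G H φ
/-- `G` is an `F`-necklace of length `t` with beads `S 0, …, S (t-1)`: the beads
partition `V(G)`, each bead induces a graph isomorphic to a member of the family `F`,
there is exactly one edge between consecutive beads, and there are no edges between any
other pair of beads. -/
def IsNecklaceWith {V κ : Type} {β : κ → Type} (F : ∀ i : κ, SimpleGraph (β i))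
    (G : SimpleGraph V) (t : ℕ) (S : Fin t → Set V) : Prop :=
  (∀ v : V, ∃ i : Fin t, v ∈ S i) ∧
  (∀ i j : Fin t, i ≠ j → Disjoint (S i) (S j)) ∧
  (∀ i : Fin t, ∃ b : κ, Nonempty ((G.induce (S i)) ≃g F b)) ∧
  (∀ i j : Fin t, (j : ℕ) = (i : ℕ) + 1 →
    ∃! p : V × V, p.1 ∈ S i ∧ p.2 ∈ S j ∧ G.Adj p.1 p.2) ∧
  (∀ i j : Fin t, (i : ℕ) + 1 < (j : ℕ) →
    ∀ x ∈ S i, ∀ y ∈ S j, ¬ G.Adj x y)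

/-- `G` is an `F`-necklace of length `t`. -/
def IsNecklace {V κ : Type} {β : κ → Type} (F : ∀ i : κ, SimpleGraph (β i))
    (G : SimpleGraph V) (t : ℕ) : Prop :=
  ∃ S : Fin t → Set V, IsNecklaceWith F G t S

/-- `G` is a uniform necklace with structure `(H, x, y)` of length `t`, with beads
`S 0, …, S (t-1)`: the beads partition `V(G)`, each bead induces a copy of `H`,
there is exactly one edge between consecutive beads and no edge between non-consecutive
beads, and the isomorphisms can be chosen so that the unique edge between the `i`-th and
`(i+1)`-st beads joins the image of `x` in bead `i` to the image of `y` in bead `i+1`. -/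
def IsUniformNecklaceWith {V W : Type} (H : SimpleGraph W) (x y : W)
    (G : SimpleGraph V) (t : ℕ) (S : Fin t → Set V) : Prop :=
  (∀ v : V, ∃ i : Fin t, v ∈ S i) ∧
  (∀ i j : Fin t, i ≠ j → Disjoint (S i) (S j)) ∧
  (∀ i j : Fin t, (j : ℕ) = (i : ℕ) + 1 →
    ∃! p : V × V, p.1 ∈ S i ∧ p.2 ∈ S j ∧ G.Adj p.1 p.2) ∧
  (∀ i j : Fin t, (i : ℕ) + 1 < (j : ℕ) →
    ∀ a ∈ S i, ∀ b ∈ S j, ¬ G.Adj a b) ∧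
  ∃ f : ∀ i : Fin t, H ≃g (G.induce (S i)),
    ∀ i j : Fin t, (j : ℕ) = (i : ℕ) + 1 →
      G.Adj ((f i) x).val ((f j) y).val
/-- Some `F`-necklace of length `t` is a minor of `G`. -/
def HasNecklaceMinor {V κ : Type} {β : κ → Type} (F : ∀ i : κ, SimpleGraph (β i))
    (G : SimpleGraph V) (t : ℕ) : Prop :=
  ∃ (W : Type) (_ : Fintype W) (N : SimpleGraph W), IsNecklace F N t ∧ IsMinorOf N G

/-- `nm_F(G)`: the largest length of an `F`-necklace that is a minor of `G`. -/
noncomputable def necklaceMinorNumber {V κ : Type} {β : κ → Type}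
    (F : ∀ i : κ, SimpleGraph (β i)) (G : SimpleGraph V) : ℕ :=
  sSup {t | HasNecklaceMinor F G t}
/-- The complete graph on five vertices. -/
def K5 : SimpleGraph (Fin 5) := ⊤

/-- The complete bipartite graph with parts of size three. -/
def K33 : SimpleGraph (Fin 3 ⊕ Fin 3) := completeBipartiteGraph (Fin 3) (Fin 3)
/-- `ElimLE G Base A k` holds iff the elimination distance of `G[A]` to the class of
graphs described by the base predicate `Base` is at most `k`: either the base predicate
already holds, or from each connected component one vertex can be deleted so that the
remainder has elimination distance at most `k - 1`. -/
inductive ElimLE {V : Type} (G : SimpleGraph V) (Base : Set V → Prop) : Set V → ℕ → Prop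
  | base (A : Set V) (k : ℕ) (h : Base A) : ElimLE G Base A k
  | step (A : Set V) (k : ℕ)
      (v : (G.induce A).ConnectedComponent → ↥A)
      (hv : ∀ C : (G.induce A).ConnectedComponent, v C ∈ C.supp)
      (h : ∀ C : (G.induce A).ConnectedComponent,
        ElimLE G Base ((Subtype.val '' C.supp) \ {(v C).val}) k) :
      ElimLE G Base A (k + 1)

/-- The elimination distance of `G` to a forest. -/
noncomputable def edForest {V : Type} (G : SimpleGraph V) : ℕ :=
  sInf {k | ElimLE G (fun A => (G.induce A).IsAcyclic) Set.univ k}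

namespace NK
open Classical

open Set (toFinite sdiff_subset mem_iUnion ncard_le_ncard subset_union_left)
open Set (subset_biUnion_of_mem mem_singleton_iff union_subset ncard_union_le subset_univ)
open Set (mem_ofPred_eq ncard_eq_toFinset_card subset_union_right subset_iUnion ncard_lt_ncard)
open Set (mem_union insert_subset inter_subset_right ncard_coe_finset mem_biUnion)
open Set (sdiff_subset_sdiff_right ncard_insert_of_notMem ncard_insert_le mem_insert_iff iUnion)
open Set (subset_insert disjoint_left)
open Set (univ)
open Finset (mem_filter card_le_card card_union_le mem_product card_biUnion_le_card_mul card_erase_add_one card_filter add_sum_erase)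
variable {V : Type} {G : SimpleGraph V}

theorem disj {A B : Set V} (h : Disjoint A B) ⦃a : V⦄ : a ∈ A → a ∉ B :=
  fun x => Set.disjoint_left.1 h x

def Conn (G : SimpleGraph V) (Q : Set V) : Prop :=
  Q.Nonempty ∧ ∀ M : Set V, (∃ q ∈ Q, q ∈ M) →
    (∀ u ∈ Q, u ∈ M → ∀ v ∈ Q, G.Adj u v → v ∈ M) → Q ⊆ M

def SAdj (G : SimpleGraph V) (A B : Set V) : Prop := ∃ a ∈ A, ∃ b ∈ B, G.Adj a b

theorem SAdj.symm {A B : Set V} (h : SAdj G A B) : SAdj G B A := by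
  obtain ⟨a, ha, b, hb, h⟩ := h
  exact ⟨b, hb, a, ha, h.symm⟩

theorem SAdj.mono {A B A' B' : Set V} (h : SAdj G A B) (hA : A ⊆ A')
    (hB : B ⊆ B') : SAdj G A' B' := by
  obtain ⟨a, ha, b, hb, h⟩ := h
  exact ⟨a, hA ha, b, hB hb, h⟩

theorem Conn.nonempty {Q : Set V} (h : Conn G Q) : Q.Nonempty := h.1

theorem Conn.closed {Q : Set V} (h : Conn G Q) (M : Set V) {q : V}
    (hq : q ∈ Q) (hqM : q ∈ M)
    (hc : ∀ u ∈ Q, u ∈ M → ∀ v ∈ Q, G.Adj u v → v ∈ M) : Q ⊆ M := h.2 M ⟨q, hq, hqM⟩ hc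

theorem Conn.cross {Q : Set V} (h : Conn G Q) (M : Set V) {q r : V}
    (hq : q ∈ Q) (hqM : q ∈ M) (hr : r ∈ Q) (hrM : r ∉ M) :
    ∃ u ∈ Q, u ∈ M ∧ ∃ v ∈ Q, v ∉ M ∧ G.Adj u v := by
  by_contra hcon
  apply hrM
  refine h.closed M hq hqM ?_ hr
  intro u hu huM v hv huv
  by_contra hvM
  exact hcon ⟨u, hu, huM, v, hv, hvM, huv⟩

theorem conn_of_base {Q : Set V} (x : V) (hx : x ∈ Q)
    (h : ∀ y ∈ Q, ∃ R ⊆ Q, Conn G R ∧ x ∈ R ∧ y ∈ R) : Conn G Q := by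
  refine ⟨⟨x, hx⟩, ?_⟩
  rintro M ⟨q, hq, hqM⟩ hc
  have hxM : x ∈ M := by
    obtain ⟨R, hRQ, hR, hxR, hqR⟩ := h q hq
    exact hR.closed M hqR hqM (fun u hu huM v hv huv => hc u (hRQ hu) huM v (hRQ hv) huv) hxR
  intro y hy
  obtain ⟨R, hRQ, hR, hxR, hyR⟩ := h y hy
  exact hR.closed M hxR hxM (fun u hu huM v hv huv => hc u (hRQ hu) huM v (hRQ hv) huv) hyR

theorem conn_singleton (G : SimpleGraph V) (x : V) : Conn G {x} := by
  refine ⟨⟨x, rfl⟩, ?_⟩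
  rintro M ⟨q, hq, hqM⟩ _ y hy
  simp at hq hy
  subst hq; subst hy; exact hqM

theorem Conn.union {A B : Set V} (hA : Conn G A) (hB : Conn G B)
    (h : (A ∩ B).Nonempty) : Conn G (A ∪ B) := by
  obtain ⟨x, hxA, hxB⟩ := h
  refine conn_of_base x (Or.inl hxA) ?_
  rintro y (hy | hy)
  · exact ⟨A, subset_union_left, hA, hxA, hy⟩
  · exact ⟨B, subset_union_right, hB, hxB, hy⟩

theorem conn_pair {a b : V} (h : G.Adj a b) : Conn G {a, b} := by
  refine ⟨⟨a, by simp⟩, ?_⟩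
  rintro M ⟨q, hq, hqM⟩ hc
  have hab : a ∈ M ∧ b ∈ M := by
    simp at hq
    rcases hq with rfl | rfl
    · exact ⟨hqM, hc _ (by simp) hqM _ (by simp) h⟩
    · exact ⟨hc _ (by simp) hqM _ (by simp) h.symm, hqM⟩
  rintro y (rfl | rfl)
  · exact hab.1
  · exact hab.2

theorem Conn.union_adj {A B : Set V} (hA : Conn G A) (hB : Conn G B)
    (h : SAdj G A B) : Conn G (A ∪ B) := by
  obtain ⟨a, ha, b, hb, hab⟩ := h
  have h1 : Conn G (A ∪ {a, b}) := hA.union (conn_pair hab) ⟨a, ha, by simp⟩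
  have h2 := h1.union hB ⟨b, by simp, hb⟩
  have : A ∪ {a, b} ∪ B = A ∪ B := by
    ext x; simp only [mem_union, mem_insert_iff, mem_singleton_iff]
    constructor
    · rintro ((h | rfl | rfl) | h) <;> tauto
    · tauto
  rwa [this] at h2

theorem Conn.insert_adj {A : Set V} (hA : Conn G A) {a b : V} (ha : a ∈ A)
    (h : G.Adj a b) : Conn G (insert b A) := by
  have := hA.union_adj (conn_singleton G b) ⟨a, ha, b, rfl, h⟩
  rwa [Set.union_singleton] at this

theorem Conn.mono {G G' : SimpleGraph V} {Q : Set V} (h : Conn G Q) (hG : G ≤ G') : Conn G' Q :=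
  ⟨h.1, fun M hM hc => h.2 M hM (fun u hu huM v hv huv => hc u hu huM v hv (hG huv))⟩

theorem Conn.mono_on {G G' : SimpleGraph V} {Q : Set V} (h : Conn G Q)
    (hG : ∀ u ∈ Q, ∀ v ∈ Q, G.Adj u v → G'.Adj u v) : Conn G' Q :=
  ⟨h.1, fun M hM hc => h.2 M hM
    (fun u hu huM v hv huv => hc u hu huM v hv (hG u hu v hv huv))⟩

theorem Conn.biUnion {ι : Type} {Γ : SimpleGraph ι} {I : Set ι}
    (hI : Conn Γ I) (B : ι → Set V) (hB : ∀ i ∈ I, Conn G (B i))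
    (hadj : ∀ i ∈ I, ∀ j ∈ I, Γ.Adj i j → SAdj G (B i) (B j)) :
    Conn G (⋃ i ∈ I, B i) := by
  obtain ⟨i0, hi0⟩ := hI.1
  obtain ⟨x0, hx0⟩ := (hB i0 hi0).1
  refine ⟨⟨x0, mem_biUnion hi0 hx0⟩, ?_⟩
  rintro M ⟨q, hq, hqM⟩ hc
  simp only [mem_iUnion] at hq
  obtain ⟨j, hj, hqj⟩ := hq
  have key : ∀ i ∈ I, (∃ u ∈ B i, u ∈ M) → B i ⊆ M := by
    rintro i hi ⟨u, hu, huM⟩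
    exact (hB i hi).closed M hu huM (fun a ha haM b hb hab =>
      hc a (mem_biUnion hi ha) haM b (mem_biUnion hi hb) hab)
  have h1 : I ⊆ {i | B i ⊆ M} := by
    refine hI.closed _ hj (key j hj ⟨q, hqj, hqM⟩) ?_
    intro u hu huM v hv huv
    obtain ⟨a, ha, b, hb, hab⟩ := hadj u hu v hv huv
    exact key v hv ⟨b, hb, hc a (mem_biUnion hu ha) (huM ha) b (mem_biUnion hv hb) hab⟩
  intro y hy
  simp only [mem_iUnion] at hy
  obtain ⟨i, hi, hyi⟩ := hy
  exact h1 hi hyi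

theorem Conn.union_pieces {A : Set V} (hA : Conn G A) {U : Set V}
    (h : ∀ y ∈ U, ∃ R ⊆ U ∪ A, Conn G R ∧ y ∈ R ∧ ((R ∩ A).Nonempty ∨ SAdj G A R)) :
    Conn G (A ∪ U) := by
  obtain ⟨x, hx⟩ := hA.1
  refine conn_of_base x (Or.inl hx) ?_
  rintro y (hy | hy)
  · exact ⟨A, subset_union_left, hA, hx, hy⟩
  · obtain ⟨R, hR, hRc, hyR, h⟩ := h y hy
    refine ⟨A ∪ R, ?_, ?_, Or.inl hx, Or.inr hyR⟩
    · rintro z (hz | hz)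
      · exact Or.inl hz
      · exact (hR hz).symm
    · rcases h with h | h
      · exact hA.union hRc (by rwa [Set.inter_comm])
      · exact hA.union_adj hRc h

theorem conn_iff_induce {Q : Set V} : Conn G Q ↔ (G.induce Q).Connected := by
  constructor
  · intro h
    obtain ⟨x, hx⟩ := h.1
    have : Q ⊆ {y | ∃ hy : y ∈ Q, (G.induce Q).Reachable ⟨x, hx⟩ ⟨y, hy⟩} := by
      refine h.closed _ hx ⟨hx, SimpleGraph.Reachable.refl _⟩ ?_
      rintro u hu ⟨_, hur⟩ v hv huv
      refine ⟨hv, hur.trans (SimpleGraph.Adj.reachable ?_)⟩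
      simpa using huv
    have hne : Nonempty Q := ⟨⟨x, hx⟩⟩
    refine SimpleGraph.Connected.mk ?_
    have key : ∀ y : Q, (G.induce Q).Reachable ⟨x, hx⟩ y := fun y => (this y.2).2
    exact fun a b => (key a).symm.trans (key b)
  · intro h
    obtain ⟨x⟩ := h.nonempty
    refine ⟨⟨x, x.2⟩, ?_⟩
    rintro M ⟨q, hq, hqM⟩ hc y hy
    obtain ⟨w⟩ := h.preconnected ⟨q, hq⟩ ⟨y, hy⟩
    have : ∀ (a b : Q), (G.induce Q).Walk a b → a.1 ∈ M → b.1 ∈ M := by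
      intro a b w
      induction w with
      | nil => exact id
      | cons h _ ih =>
        intro ha
        exact ih (hc _ (Subtype.property _) ha _ (Subtype.property _) (by simpa using h))
    exact this _ _ w hqM

def comp (G : SimpleGraph V) (X : Set V) (x : V) : Set V := {y | ∃ Q ⊆ X, Conn G Q ∧ x ∈ Q ∧ y ∈ Q}

theorem comp_subset (G : SimpleGraph V) (X : Set V) (x : V) : comp G X x ⊆ X := by
  rintro y ⟨Q, hQ, _, _, hy⟩
  exact hQ hy

theorem mem_comp {X : Set V} {x : V} (hx : x ∈ X) : x ∈ comp G X x :=
  ⟨{x}, by simpa using hx, conn_singleton G x, rfl, rfl⟩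

theorem comp_conn {X : Set V} {x : V} (hx : x ∈ X) : Conn G (comp G X x) := by
  refine conn_of_base x (mem_comp hx) ?_
  rintro y ⟨Q, hQ, hQc, hxQ, hyQ⟩
  exact ⟨Q, fun z hz => ⟨Q, hQ, hQc, hxQ, hz⟩, hQc, hxQ, hyQ⟩

def IsComp (G : SimpleGraph V) (X C : Set V) : Prop :=
  Conn G C ∧ C ⊆ X ∧ ∀ a ∈ C, ∀ b ∈ X, G.Adj a b → b ∈ C

theorem comp_isComp {X : Set V} {x : V} (hx : x ∈ X) :
    IsComp G X (comp G X x) := by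
  refine ⟨comp_conn hx, comp_subset G X x, ?_⟩
  rintro a ⟨Q, hQ, hQc, hxQ, haQ⟩ b hb hab
  exact ⟨insert b Q, insert_subset hb hQ, hQc.insert_adj haQ hab, Or.inr hxQ, Or.inl rfl⟩

theorem IsComp.subset_of_conn {X C Q : Set V} (h : IsComp G X C)
    (hQ : Conn G Q) (hQX : Q ⊆ X) (hm : (Q ∩ C).Nonempty) : Q ⊆ C := by
  obtain ⟨q, hq, hqC⟩ := hm
  exact hQ.closed C hq hqC (fun u _ huC v hv huv => h.2.2 u huC v (hQX hv) huv)

theorem IsComp.eq_of_inter {X C C' : Set V} (h : IsComp G X C)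
    (h' : IsComp G X C') (hm : (C ∩ C').Nonempty) : C = C' :=
  Set.Subset.antisymm (h'.subset_of_conn h.1 h.2.1 hm)
    (h.subset_of_conn h'.1 h'.2.1 (by rwa [Set.inter_comm]))

theorem IsComp.eq_comp {X C : Set V} (h : IsComp G X C) {x : V}
    (hx : x ∈ C) : C = comp G X x :=
  h.eq_of_inter (comp_isComp (h.2.1 hx)) ⟨x, hx, mem_comp (h.2.1 hx)⟩

theorem IsComp.disjoint {X C C' : Set V} (h : IsComp G X C)
    (h' : IsComp G X C') (hne : C ≠ C') : Disjoint C C' := by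
  rw [Set.disjoint_iff_inter_eq_empty]
  by_contra hc
  exact hne (h.eq_of_inter h' (Set.nonempty_iff_ne_empty.mpr hc))

theorem conn_in_comp {X Q : Set V} (hQ : Conn G Q) (hQX : Q ⊆ X) :
    ∃ C, IsComp G X C ∧ Q ⊆ C := by
  obtain ⟨q, hq⟩ := hQ.1
  exact ⟨comp G X q, comp_isComp (hQX hq), fun y hy => ⟨Q, hQX, hQ, hq, hy⟩⟩

def nbr (G : SimpleGraph V) (X : Set V) : Set V := {y | y ∉ X ∧ ∃ x ∈ X, G.Adj x y}

theorem isComp_nbr {C : Set V} (h : Conn G C) {S : Set V}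
    (hS : nbr G C ⊆ S) (hd : Disjoint C S) : IsComp G Sᶜ C := by
  refine ⟨h, fun x hx hxS => disj hd hx hxS, ?_⟩
  intro a ha b hb hab
  by_contra hbC
  exact hb (hS ⟨hbC, a, ha, hab⟩)

theorem IsComp.nbr_subset {S C : Set V} (h : IsComp G Sᶜ C) :
    nbr G C ⊆ S := by
  rintro y ⟨hy, x, hx, hxy⟩
  by_contra hyS
  exact hy (h.2.2 x hx y hyS hxy)

def inside (G : SimpleGraph V) (X : Set V) : SimpleGraph V where
  Adj a b := G.Adj a b ∧ a ∈ X ∧ b ∈ X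
  symm := ⟨fun _ _ h => ⟨h.1.symm, h.2.2, h.2.1⟩⟩
  loopless := ⟨fun _ h => G.loopless.irrefl _ h.1⟩

theorem inside_le (G : SimpleGraph V) (X : Set V) : inside G X ≤ G := fun _ _ h => h.1

theorem conn_inside {X Q : Set V} (h : Conn G Q) (hQ : Q ⊆ X) :
    Conn (inside G X) Q := h.mono_on (fun _ hu _ hv huv => ⟨huv, hQ hu, hQ hv⟩)

theorem conn_inside_subset {X Q : Set V} (h : Conn (inside G X) Q)
    (hm : (Q ∩ X).Nonempty) : Q ⊆ X := by
  obtain ⟨q, hq, hqX⟩ := hm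
  exact h.closed X hq hqX (fun _ _ _ _ _ huv => huv.2.2)

def MinorIn {W : Type} (G : SimpleGraph V) (H : SimpleGraph W) (X : Set V) : Prop :=
  ∃ φ : W → Set V, (∀ w, Conn G (φ w)) ∧ (∀ w, φ w ⊆ X) ∧
    (∀ w w', w ≠ w' → Disjoint (φ w) (φ w')) ∧
    (∀ w w', H.Adj w w' → SAdj G (φ w) (φ w'))

theorem MinorIn.mono {W : Type} {H : SimpleGraph W} {X Y : Set V}
    (h : MinorIn G H X) (hXY : X ⊆ Y) : MinorIn G H Y := by
  obtain ⟨φ, h1, h2, h3, h4⟩ := h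
  exact ⟨φ, h1, fun w => (h2 w).trans hXY, h3, h4⟩

theorem MinorIn.mono_graph {W : Type} {G G' : SimpleGraph V} {H : SimpleGraph W} {X : Set V}
    (h : MinorIn G H X) (hG : G ≤ G') : MinorIn G' H X := by
  obtain ⟨φ, h1, h2, h3, h4⟩ := h
  refine ⟨φ, fun w => (h1 w).mono hG, h2, h3, fun w w' hw => ?_⟩
  obtain ⟨a, ha, b, hb, hab⟩ := h4 w w' hw
  exact ⟨a, ha, b, hb, hG hab⟩

theorem minorIn_univ {W : Type} {H : SimpleGraph W} :
    MinorIn G H univ ↔ IsMinorOf H G := by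
  constructor
  · rintro ⟨φ, h1, _, h3, h4⟩
    exact ⟨φ, fun w => conn_iff_induce.mp (h1 w), h3, h4⟩
  · rintro ⟨φ, h1, h3, h4⟩
    exact ⟨φ, fun w => conn_iff_induce.mpr (h1 w), fun _ => subset_univ _, h3, h4⟩

theorem Conn.image {U : Type} {K : SimpleGraph U} {Q : Set U} (h : Conn K Q)
    (f : U → V) (hf : ∀ a ∈ Q, ∀ b ∈ Q, K.Adj a b → G.Adj (f a) (f b)) : Conn G (f '' Q) := by
  have := h.biUnion (G := G) (fun i => {f i}) (fun i _ => conn_singleton G _)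
    (fun i hi j hj hij => ⟨f i, rfl, f j, rfl, hf i hi j hj hij⟩)
  convert this using 1
  ext x; simp [eq_comm]

theorem minorIn_iff_induce {W : Type} {H : SimpleGraph W} {X : Set V} :
    MinorIn G H X ↔ IsMinorOf H (G.induce X) := by
  rw [← minorIn_univ]
  constructor
  · rintro ⟨φ, h1, h2, h3, h4⟩
    refine ⟨fun w => Subtype.val ⁻¹' φ w, fun w => ?_, fun _ => subset_univ _, ?_, ?_⟩
    · obtain ⟨x, hx⟩ := (h1 w).1
      refine ⟨⟨⟨x, h2 w hx⟩, hx⟩, ?_⟩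
      rintro M ⟨q, hq, hqM⟩ hc
      have := (h1 w).closed (Subtype.val '' M) hq ⟨q, hqM, rfl⟩ (by
        rintro u hu ⟨u', hu', rfl⟩ v hv huv
        exact ⟨⟨v, h2 w hv⟩, hc u' hu hu' _ hv (by simpa using huv), rfl⟩)
      intro y hy
      obtain ⟨z, hz, hzy⟩ := this hy
      rwa [Subtype.ext hzy] at hz
    · intro w w' hww
      exact (h3 w w' hww).preimage _
    · intro w w' hww
      obtain ⟨a, ha, b, hb, hab⟩ := h4 w w' hww
      exact ⟨⟨a, h2 _ ha⟩, ha, ⟨b, h2 _ hb⟩, hb, by simpa using hab⟩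
  · rintro ⟨φ, h1, _, h3, h4⟩
    refine ⟨fun w => Subtype.val '' φ w, fun w => ?_, ?_, ?_, ?_⟩
    · exact (h1 w).image _ (fun a _ b _ hab => by simpa using hab)
    · rintro w _ ⟨x, _, rfl⟩
      exact x.2
    · intro w w' hww
      exact (Set.disjoint_image_iff Subtype.val_injective).mpr (h3 w w' hww)
    · intro w w' hww
      obtain ⟨a, ha, b, hb, hab⟩ := h4 w w' hww
      exact ⟨a, ⟨a, ha, rfl⟩, b, ⟨b, hb, rfl⟩, by simpa using hab⟩

def Sep (G : SimpleGraph V) (A B W : Set V) : Prop :=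
  ∀ Q, Conn G Q → Disjoint Q W → (Q ∩ A).Nonempty → (Q ∩ B).Nonempty → False

def Linked (G : SimpleGraph V) (A B : Set V) (k : ℕ) : Prop :=
  ∃ Q : Fin k → Set V, (∀ i, Conn G (Q i)) ∧ (∀ i j, i ≠ j → Disjoint (Q i) (Q j)) ∧
    (∀ i, (Q i ∩ A).Nonempty) ∧ (∀ i, (Q i ∩ B).Nonempty)

def reach (G : SimpleGraph V) (A W : Set V) : Set V :=
  {v | ∃ Q, Conn G Q ∧ Disjoint Q W ∧ (Q ∩ A).Nonempty ∧ v ∈ Q}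

theorem reach_base {A W : Set V} {a : V} (ha : a ∈ A) (hW : a ∉ W) :
    a ∈ reach G A W := ⟨{a}, conn_singleton G a, by simpa using hW, ⟨a, rfl, ha⟩, rfl⟩

theorem reach_step {A W : Set V} {a b : V} (ha : a ∈ reach G A W)
    (hab : G.Adj a b) (hb : b ∉ W) : b ∈ reach G A W := by
  obtain ⟨Q, hQ, hd, ⟨x, hx, hxA⟩, haQ⟩ := ha
  exact ⟨insert b Q, hQ.insert_adj haQ hab, by simp [Set.disjoint_insert_left, hb, hd],
    ⟨x, Or.inr hx, hxA⟩, Or.inl rfl⟩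

theorem reach_disjoint {A W : Set V} : Disjoint (reach G A W) W := by
  rw [disjoint_left]
  rintro a ⟨Q, _, hd, _, haQ⟩ haW
  exact disj hd haQ haW

theorem Sep.reach_disj {A B W : Set V} (h : Sep G A B W) :
    Disjoint (reach G A W) (reach G B W) := by
  rw [disjoint_left]
  rintro a ⟨Q, hQ, hd, ⟨x, hx, hxA⟩, haQ⟩ ⟨Q', hQ', hd', ⟨x', hx', hxA'⟩, haQ'⟩
  exact h (Q ∪ Q') (hQ.union hQ' ⟨a, haQ, haQ'⟩) (by simp [hd, hd'])
    ⟨x, Or.inl hx, hxA⟩ ⟨x', Or.inr hx', hxA'⟩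

theorem Sep.symm {A B W : Set V} (h : Sep G A B W) : Sep G B A W :=
  fun Q h1 h2 h3 h4 => h Q h1 h2 h4 h3

def delE (G : SimpleGraph V) (x y : V) : SimpleGraph V where
  Adj a b := G.Adj a b ∧ ¬ (a = x ∧ b = y) ∧ ¬ (a = y ∧ b = x)
  symm := ⟨fun _ _ h => ⟨h.1.symm, by tauto, by tauto⟩⟩
  loopless := ⟨fun _ h => G.loopless.irrefl _ h.1⟩

theorem delE_le (G : SimpleGraph V) (x y : V) : delE G x y ≤ G := fun _ _ h => h.1

theorem delE_comm (G : SimpleGraph V) (x y : V) : delE G x y = delE G y x := by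
  ext a b; simp only [delE]; tauto

theorem delE_lt {x y : V} (h : G.Adj x y) : delE G x y < G := by
  refine lt_of_le_of_ne (delE_le G x y) ?_
  intro he
  rw [← he] at h
  exact h.2.1 ⟨rfl, rfl⟩

theorem sep_delE_insert {A B W : Set V} {x y : V}
    (h : Sep (delE G x y) A B W) : Sep G A B (insert x W) := by
  intro Q hQ hd
  rw [Set.disjoint_insert_right] at hd
  refine h Q (hQ.mono_on ?_) hd.2
  intro u hu v hv huv
  refine ⟨huv, ?_, ?_⟩
  · rintro ⟨rfl, _⟩; exact hd.1 hu
  · rintro ⟨_, rfl⟩; exact hd.1 hv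

theorem menger_side {A B W : Set V} {x y : V}
    (hW : Sep (delE G x y) A B W) (hx : x ∈ reach (delE G x y) A W)
    (hy : y ∈ reach (delE G x y) B W) {S : Set V}
    (hS : Sep (inside (delE G x y) (reach (delE G x y) A W ∪ W)) A (insert x W) S) :
    Sep G A B S := by
  set G' := delE G x y with hG'
  set L := reach G' A W with hL
  have hLW : Disjoint L W := reach_disjoint
  have hLR : Disjoint L (reach G' B W) := hW.reach_disj
  intro Q hQ hd ⟨a, haQ, haA⟩ ⟨b, hbQ, hbB⟩
  set M := reach (inside G' (L ∪ W)) A S with hM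
  have hMW : ∀ m ∈ M, m ∉ insert x W := by
    rintro m ⟨R, hR, hRd, hRA, hmR⟩ hm
    exact hS R hR hRd hRA ⟨m, hmR, hm⟩
  have hML : M ⊆ L := by
    rintro m hm
    have hm' := hMW m hm
    obtain ⟨R, hR, hRd, ⟨r, hrR, hrA⟩, hmR⟩ := hm
    have : R ⊆ L ∪ W := conn_inside_subset hR ⟨r, hrR, by
      by_cases h : r ∈ W
      · exact Or.inr h
      · exact Or.inl (reach_base hrA h)⟩
    rcases this hmR with h | h
    · exact h
    · exact absurd (Or.inr h) hm'
  have haS : a ∉ S := disj hd haQ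
  have haM : a ∈ M := reach_base haA haS
  have hbM : b ∉ M := by
    intro hb
    have hbL := hML hb
    exact disj hLR hbL (reach_base hbB (disj hLW hbL))
  obtain ⟨u, huQ, huM, v, hvQ, hvM, huv⟩ := hQ.cross M haQ haM hbQ hbM
  have huL := hML huM
  have hux : u ≠ x := by
    rintro rfl
    exact hMW _ huM (Or.inl rfl)
  have huy : u ≠ y := by
    rintro rfl
    exact disj hLR huL hy
  have huv' : G'.Adj u v := ⟨huv, fun h => hux h.1, fun h => huy h.1⟩
  have hvLW : v ∈ L ∪ W := by
    by_cases h : v ∈ W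
    · exact Or.inr h
    · exact Or.inl (reach_step huL huv' h)
  exact hvM (reach_step huM ⟨huv', Or.inl huL, hvLW⟩ (disj hd hvQ))

theorem linked_index [Finite V] {A B : Set V} {k : ℕ} (h : Linked G A B k)
    (hB : B.ncard = k) : ∃ P : V → Set V, (∀ b ∈ B, Conn G (P b)) ∧
      (∀ b ∈ B, ∀ b' ∈ B, b ≠ b' → Disjoint (P b) (P b')) ∧
      (∀ b ∈ B, (P b ∩ A).Nonempty) ∧ (∀ b ∈ B, P b ∩ B = {b}) := by
  obtain ⟨Q, h1, h2, h3, h4⟩ := h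
  choose f hfQ hfB using h4
  have hinj : Function.Injective f := by
    intro i j hij
    by_contra hne
    exact disj (h2 i j hne) (hfQ i) (hij ▸ hfQ j)
  have hrange : Set.range f = B := by
    apply Set.eq_of_subset_of_ncard_le
    · rintro _ ⟨i, rfl⟩; exact hfB i
    · rw [hB, ← Set.image_univ, Set.ncard_image_of_injective _ hinj]
      simp
    · exact toFinite _
  have hg : ∀ b ∈ B, ∃ i, f i = b := fun b hb => by rwa [← hrange] at hb
  refine ⟨fun b => if hb : b ∈ B then Q (hg b hb).choose else ∅, ?_, ?_, ?_, ?_⟩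
  · intro b hb; simp only [hb, dif_pos]; exact h1 _
  · intro b hb b' hb' hne
    simp only [hb, hb', dif_pos]
    apply h2
    intro he
    apply hne
    rw [← (hg b hb).choose_spec, ← (hg b' hb').choose_spec, he]
  · intro b hb; simp only [hb, dif_pos]; exact h3 _
  · intro b hb
    simp only [hb, dif_pos]
    ext z
    simp only [Set.mem_inter_iff, mem_singleton_iff]
    constructor
    · rintro ⟨hz, hzB⟩
      obtain ⟨j, rfl⟩ := hg z hzB
      rw [← (hg b hb).choose_spec]
      by_contra hne
      exact disj (h2 j (hg b hb).choose (fun h => hne (by rw [h]))) (hfQ j) hz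
    · rintro rfl
      refine ⟨?_, hb⟩
      have := hfQ (hg z hb).choose
      rwa [(hg z hb).choose_spec] at this

theorem linked_of_index [Finite V] {A B : Set V} {k : ℕ} {I : Set V}
    (hI : I.ncard = k) (P : V → Set V) (h1 : ∀ b ∈ I, Conn G (P b))
    (h2 : ∀ b ∈ I, ∀ b' ∈ I, b ≠ b' → Disjoint (P b) (P b'))
    (h3 : ∀ b ∈ I, (P b ∩ A).Nonempty) (h4 : ∀ b ∈ I, (P b ∩ B).Nonempty) : Linked G A B k := by
  have : Nonempty (Fin k ≃ I) := by
    have := Fintype.ofFinite I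
    refine ⟨(Fintype.equivFinOfCardEq ?_).symm⟩
    rw [← hI, ← Nat.card_coe_set_eq, Nat.card_eq_fintype_card]
  obtain ⟨e⟩ := this
  refine ⟨fun i => P (e i), fun i => h1 _ (e i).2, ?_, fun i => h3 _ (e i).2, fun i => h4 _ (e i).2⟩
  intro i j hij
  refine h2 _ (e i).2 _ (e j).2 ?_
  intro h
  exact hij (e.injective (Subtype.ext h))

theorem menger [Finite V] (G : SimpleGraph V) (A B : Set V) (k : ℕ)
    (h : ∀ W, Sep G A B W → k ≤ W.ncard) : Linked G A B k := by
  revert A B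
  have hwf : WellFoundedLT (SimpleGraph V) := inferInstance
  induction G using hwf.wf.induction with
  | h G ih =>
  intro A B h
  by_cases hE : ∃ x y, G.Adj x y
  swap
  · push Not at hE
    have hk : k ≤ (A ∩ B).ncard := by
      apply h
      intro Q hQ hd ⟨a, haQ, haA⟩ ⟨b, hbQ, hbB⟩
      have : Q ⊆ {a} := hQ.closed {a} haQ rfl (fun u _ _ v _ huv => absurd huv (hE u v))
      have hba : b = a := this hbQ
      subst hba
      exact disj hd haQ ⟨haA, hbB⟩
    obtain ⟨I, hI, hIk⟩ := Set.exists_subset_card_eq hk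
    refine linked_of_index hIk (fun b => {b}) (fun b _ => conn_singleton G b) ?_ ?_ ?_
    · intro b _ b' _ hne; simpa using hne
    · intro b hb; exact ⟨b, rfl, (hI hb).1⟩
    · intro b hb; exact ⟨b, rfl, (hI hb).2⟩
  · obtain ⟨x0, y0, hxy0⟩ := hE
    by_cases hG' : ∀ W, Sep (delE G x0 y0) A B W → k ≤ W.ncard
    · obtain ⟨Q, h1, h2, h3, h4⟩ := ih _ (delE_lt hxy0) A B hG'
      exact ⟨Q, fun i => (h1 i).mono (delE_le G x0 y0), h2, h3, h4⟩
    push Not at hG'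
    obtain ⟨W, hW, hWk⟩ := hG'
    have hnW : ¬ Sep G A B W := fun h' => absurd (h W h') (by omega)
    have hor : ∃ x y, G.Adj x y ∧ Sep (delE G x y) A B W ∧ x ∈ reach (delE G x y) A W ∧
        y ∈ reach (delE G x y) B W := by
      unfold Sep at hnW
      push Not at hnW
      obtain ⟨Q, hQ, hd, ⟨a, haQ, haA⟩, ⟨b, hbQ, hbB⟩, -⟩ := hnW
      have hLR := hW.reach_disj
      have haL : a ∈ reach (delE G x0 y0) A W := reach_base haA (disj hd haQ)
      have hbR : b ∈ reach (delE G x0 y0) B W := reach_base hbB (disj hd hbQ)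
      obtain ⟨u, huQ, huL, v, hvQ, hvL, huv⟩ := hQ.cross _ haQ haL hbQ
        (fun hb => disj hLR hb hbR)
      obtain ⟨u', huQ', huR, v', hvQ', hvR, huv'⟩ := hQ.cross _ hbQ hbR haQ
        (fun hb => disj hLR haL hb)
      have e1 : (u = x0 ∧ v = y0) ∨ (u = y0 ∧ v = x0) := by
        by_contra hcon
        exact hvL (reach_step huL ⟨huv, by tauto, by tauto⟩ (disj hd hvQ))
      have e2 : (u' = x0 ∧ v' = y0) ∨ (u' = y0 ∧ v' = x0) := by
        by_contra hcon
        exact hvR (reach_step huR ⟨huv', by tauto, by tauto⟩ (disj hd hvQ'))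
      have hne : u ≠ u' := by
        rintro rfl
        exact disj hLR huL huR
      rcases e1 with ⟨rfl, rfl⟩ | ⟨rfl, rfl⟩
      · rcases e2 with ⟨rfl, rfl⟩ | ⟨rfl, rfl⟩
        · exact absurd rfl hne
        · exact ⟨_, _, hxy0, hW, huL, huR⟩
      · rcases e2 with ⟨rfl, rfl⟩ | ⟨rfl, rfl⟩
        · exact ⟨v', u', hxy0.symm, by rwa [delE_comm], by rwa [delE_comm], by rwa [delE_comm]⟩
        · exact absurd rfl hne
    clear hW
    obtain ⟨x, y, hxy, hW, hx, hy⟩ := hor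
    have hxW : x ∉ W := disj reach_disjoint hx
    have hyW : y ∉ W := disj reach_disjoint hy
    have hWx : (insert x W).ncard = k := by
      have := h _ (sep_delE_insert hW)
      rw [ncard_insert_of_notMem hxW] at this ⊢
      omega
    have hWy : (insert y W).ncard = k := by
      rw [ncard_insert_of_notMem hyW]
      rw [ncard_insert_of_notMem hxW] at hWx
      omega
    set G' := delE G x y with hG'
    set L := reach G' A W with hL
    set R := reach G' B W with hR
    have hLR : Disjoint L R := hW.reach_disj
    have hlt : ∀ X, inside G' X < G := fun X => lt_of_le_of_lt (inside_le G' X) (delE_lt hxy)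
    obtain ⟨P, p1, p2, p3, p4⟩ := linked_index (ih _ (hlt (L ∪ W)) A (insert x W)
      (fun S hS => h S (menger_side hW hx hy hS))) hWx
    obtain ⟨Q, q1, q2, q3, q4⟩ := linked_index (ih _ (hlt (R ∪ W)) B (insert y W)
      (fun S hS => h S (by
        have e : delE G y x = G' := delE_comm G y x
        have hW' : Sep (delE G y x) B A W := by rw [e]; exact hW.symm
        refine (menger_side hW' ?_ ?_ ?_).symm
        · rw [e]; exact hy
        · rw [e]; exact hx
        · rw [e]; exact hS))) hWy
    have hPLW : ∀ w ∈ insert x W, P w ⊆ L ∪ W := by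
      intro w hw
      refine conn_inside_subset (p1 w hw) ?_
      have : w ∈ P w ∩ insert x W := by rw [p4 w hw]; rfl
      refine ⟨w, this.1, ?_⟩
      rcases hw with rfl | hw
      · exact Or.inl hx
      · exact Or.inr hw
    have hQRW : ∀ w ∈ insert y W, Q w ⊆ R ∪ W := by
      intro w hw
      refine conn_inside_subset (q1 w hw) ?_
      have : w ∈ Q w ∩ insert y W := by rw [q4 w hw]; rfl
      refine ⟨w, this.1, ?_⟩
      rcases hw with rfl | hw
      · exact Or.inl hy
      · exact Or.inr hw
    have hPQ : ∀ w ∈ insert x W, ∀ w' ∈ insert y W, ∀ z, z ∈ P w → z ∈ Q w' →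
        z = w ∧ z = w' := by
      intro w hw w' hw' z hz hz'
      have hzW : z ∈ W := by
        rcases hPLW w hw hz with h1 | h1
        · rcases hQRW w' hw' hz' with h2 | h2
          · exact absurd h2 (disj hLR h1)
          · exact h2
        · exact h1
      have e1 : z ∈ P w ∩ insert x W := ⟨hz, Or.inr hzW⟩
      have e2 : z ∈ Q w' ∩ insert y W := ⟨hz', Or.inr hzW⟩
      rw [p4 w hw] at e1; rw [q4 w' hw'] at e2
      exact ⟨e1, e2⟩
    have hle : ∀ X, inside G' X ≤ G := fun X => (hlt X).le
    let τ : V → V := fun w => if w = x then y else w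
    have hτ : ∀ w ∈ insert x W, τ w ∈ insert y W := by
      intro w hw
      by_cases hwx : w = x
      · simp [τ, hwx]
      · simp only [τ, hwx, if_false]
        rcases hw with hw | hw
        · exact absurd hw hwx
        · exact Or.inr hw
    have hτi : ∀ w ∈ insert x W, ∀ w' ∈ insert x W, w ≠ w' → τ w ≠ τ w' := by
      intro w hw w' hw' hne
      simp only [τ]
      split_ifs with h1 h2 h2
      · exact absurd (h1.trans h2.symm) hne
      · rintro rfl; rcases hw' with h3 | h3
        · exact h2 h3
        · exact hyW h3
      · rintro rfl; rcases hw with h3 | h3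
        · exact h1 h3
        · exact hyW h3
      · exact hne
    have hmem : ∀ w ∈ insert x W, w ∈ P w := fun w hw => by
      have : w ∈ P w ∩ insert x W := by rw [p4 w hw]; rfl
      exact this.1
    have hmem' : ∀ w ∈ insert y W, w ∈ Q w := fun w hw => by
      have : w ∈ Q w ∩ insert y W := by rw [q4 w hw]; rfl
      exact this.1
    refine linked_of_index hWx (fun w => P w ∪ Q (τ w)) ?_ ?_ ?_ ?_
    · intro w hw
      have c1 := (p1 w hw).mono (hle _)
      have c2 := (q1 (τ w) (hτ w hw)).mono (hle _)
      by_cases hwx : w = x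
      · refine c1.union_adj c2 ⟨w, hmem w hw, τ w, hmem' _ (hτ w hw), ?_⟩
        simp only [τ, hwx, if_true]; exact hxy
      · refine c1.union c2 ⟨w, hmem w hw, ?_⟩
        have : τ w = w := by simp [τ, hwx]
        rw [this]; exact hmem' w (by rw [← this]; exact hτ w hw)
    · intro w hw w' hw' hne
      rw [disjoint_left]
      have key : ∀ w ∈ insert x W, ∀ w' ∈ insert x W, w ≠ w' → ∀ z, z ∈ P w → z ∈ Q (τ w') →
          False := by
        intro w hw w' hw' hne z hz hz'
        obtain ⟨e1, e2⟩ := hPQ w hw _ (hτ w' hw') z hz hz'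
        have hzW : z ∈ W := by
          rcases hPLW w hw hz with h1 | h1
          · rcases hQRW _ (hτ w' hw') hz' with h2 | h2
            · exact absurd h2 (disj hLR h1)
            · exact h2
          · exact h1
        simp only [τ] at e2
        split_ifs at e2 with h1
        · exact hyW (e2 ▸ hzW)
        · exact hne (e1.symm.trans e2)
      rintro z (hz | hz) (hz' | hz')
      · exact disj (p2 w hw w' hw' hne) hz hz'
      · exact key w hw w' hw' hne z hz hz'
      · exact key w' hw' w hw hne.symm z hz' hz
      · exact disj (q2 _ (hτ w hw) _ (hτ w' hw') (hτi w hw w' hw' hne)) hz hz'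
    · intro w hw
      exact (p3 w hw).mono (Set.inter_subset_inter_left _ subset_union_left)
    · intro w hw
      exact (q3 _ (hτ w hw)).mono (Set.inter_subset_inter_left _ subset_union_right)

def KMinor (G : SimpleGraph V) (s : ℕ) (X : Set V) : Prop := MinorIn G (⊤ : SimpleGraph (Fin s)) X

theorem greedy_clique (H : SimpleGraph V) (m : ℕ) : ∀ (s : ℕ) (A : Finset V),
    (∀ a ∈ A, (A.filter (fun b => ¬ H.Adj a b)).card ≤ m) → s * m ≤ A.card → (0 < m) →
    ∃ K ⊆ A, K.card = s ∧ ∀ a ∈ K, ∀ b ∈ K, a ≠ b → H.Adj a b := by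
  intro s
  induction s with
  | zero => intro A _ _ _; exact ⟨∅, by simp, by simp, by simp⟩
  | succ s ih =>
    intro A hA hc hm
    have hne : A.Nonempty := by
      rw [← Finset.card_pos]
      have : 0 < (s + 1) * m := by positivity
      omega
    obtain ⟨a, ha⟩ := hne
    have hsplit := Finset.card_filter_add_card_filter_not (s := A) (fun b => H.Adj a b)
    have := hA a ha
    obtain ⟨K, hK, hKs, hKc⟩ := ih (A.filter (fun b => H.Adj a b)) (by
      intro b hb
      refine le_trans (card_le_card ?_) (hA b (mem_filter.mp hb).1)
      intro c hc
      simp only [mem_filter] at hc ⊢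
      exact ⟨hc.1.1, hc.2⟩) (by
      have : (s + 1) * m = s * m + m := by ring
      omega) hm
    have haK : a ∉ K := by
      intro h
      have := (mem_filter.mp (hK h)).2
      exact H.loopless.irrefl a this
    refine ⟨insert a K, ?_, ?_, ?_⟩
    · intro b hb
      rcases Finset.mem_insert.mp hb with rfl | hb
      · exact ha
      · exact (mem_filter.mp (hK hb)).1
    · rw [Finset.card_insert_of_notMem haK, hKs]
    · intro b hb c hc hbc
      rcases Finset.mem_insert.mp hb with rfl | hb' <;>
        rcases Finset.mem_insert.mp hc with rfl | hc'
      · exact absurd rfl hbc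
      · exact (mem_filter.mp (hK hc')).2
      · exact (mem_filter.mp (hK hb')).2.symm
      · exact hKc b hb' c hc' hbc

theorem kminor_of_clique {H : SimpleGraph V} {K : Finset V} {s : ℕ} (hs : K.card = s)
    (h : ∀ a ∈ K, ∀ b ∈ K, a ≠ b → H.Adj a b) : KMinor H s (K : Set V) := by
  have e : Fin s ≃ K := (Fintype.equivFinOfCardEq (by simpa using hs)).symm
  refine ⟨fun i => {(e i).1}, fun i => conn_singleton _ _, ?_, ?_, ?_⟩
  · intro i; simp
  · intro i j hij
    simp only [Set.disjoint_singleton]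
    intro h; exact hij (e.injective (Subtype.ext h))
  · intro i j hij
    refine ⟨_, rfl, _, rfl, h _ (e i).2 _ (e j).2 ?_⟩
    intro h; exact hij (e.injective (Subtype.ext h))

def dd (s : ℕ) : ℕ := (3 * s + 2) * (2 * s ^ 2 + s + 1)

theorem dense_kminor (H : SimpleGraph V) (s : ℕ) (N : Finset V) (hN : N.card ≤ 2 * dd s)
    (hne : N.Nonempty)
    (hdeg : ∀ u ∈ N, dd s ≤ (N.filter (fun b => H.Adj u b)).card) : KMinor H s (N : Set V) := by
  by_contra hcon
  set d := dd s with hd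
  have hdN : d ≤ N.card := by
    obtain ⟨u, hu⟩ := hne
    exact (hdeg u hu).trans (Finset.card_filter_le _ _)
  have hds : s ≤ d := by
    rw [hd]; unfold dd
    nlinarith [Nat.zero_le (s^2), Nat.zero_le (s^3)]
  obtain ⟨X, hXN, hXs⟩ := Finset.exists_subset_card_eq (hds.trans hdN)
  let e : Fin s ≃ X := (Fintype.equivFinOfCardEq (by simpa using hXs)).symm
  let x : Fin s → V := fun i => (e i).1
  have hx : ∀ i, x i ∈ X := fun i => (e i).2
  have hxi : ∀ i j, x i = x j → i = j := fun i j h => e.injective (Subtype.ext h)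
  have main : ∀ P : Finset (Fin s × Fin s), (∀ p ∈ P, p.1 ≠ p.2) → ∃ c : Fin s × Fin s → Finset V,
      (∀ p, (c p).card ≤ 2) ∧ (∀ p, c p ⊆ N \ X) ∧ (∀ p q, p ≠ q → Disjoint (c p) (c q)) ∧
      (∀ p, p ∉ P → c p = ∅) ∧
      ∀ p ∈ P, Conn H (insert (x p.1) (c p : Set V)) ∧
        SAdj H (insert (x p.1) (c p : Set V)) {x p.2} := by
    intro P
    induction P using Finset.induction_on with
    | empty => intro _; exact ⟨fun _ => ∅, by simp, by simp, by simp, by simp, by simp⟩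
    | insert p P hp ih =>
      intro hP
      obtain ⟨c, c1, c2, c3, c4, c5⟩ := ih (fun q hq => hP q (Finset.mem_insert_of_mem hq))
      set U := X ∪ P.biUnion c with hU
      have hUc : U.card ≤ 2 * s ^ 2 + s := by
        refine (card_union_le _ _).trans ?_
        have h1 : (P.biUnion c).card ≤ P.card * 2 := card_biUnion_le_card_mul _ _ _
          (fun q _ => c1 q)
        have h2 : P.card ≤ s * s := by
          have := Finset.card_le_univ P
          simpa using this
        rw [hXs]; nlinarith
      have hcU : ∀ q, c q ⊆ U := by
        intro q
        by_cases hq : q ∈ P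
        · exact (Finset.subset_biUnion_of_mem c hq).trans Finset.subset_union_right
        · rw [c4 q hq]; simp
      have upd : ∀ D : Finset V, D.card ≤ 2 → D ⊆ N \ U →
          Conn H (insert (x p.1) (D : Set V)) → SAdj H (insert (x p.1) (D : Set V)) {x p.2} →
          ∃ c : Fin s × Fin s → Finset V,
      (∀ p, (c p).card ≤ 2) ∧ (∀ p, c p ⊆ N \ X) ∧ (∀ p q, p ≠ q → Disjoint (c p) (c q)) ∧
      (∀ q, q ∉ insert p P → c q = ∅) ∧
      ∀ q ∈ insert p P, Conn H (insert (x q.1) (c q : Set V)) ∧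
        SAdj H (insert (x q.1) (c q : Set V)) {x q.2} := by
        intro D hD2 hDU hDc hDa
        have hDd : ∀ q, Disjoint D (c q) := by
          intro q
          rw [Finset.disjoint_left]
          intro a ha haq
          exact (Finset.mem_sdiff.mp (hDU ha)).2 (hcU q haq)
        refine ⟨fun q => if q = p then D else c q, ?_, ?_, ?_, ?_, ?_⟩
        · intro q; dsimp only; split_ifs
          · exact hD2
          · exact c1 q
        · intro q; dsimp only; split_ifs
          · intro a ha
            have := Finset.mem_sdiff.mp (hDU ha)
            exact Finset.mem_sdiff.mpr ⟨this.1, fun h => this.2 (Finset.mem_union_left _ h)⟩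
          · exact c2 q
        · intro q r hqr; dsimp only; split_ifs with h1 h2
          · exact absurd (h1.trans h2.symm) hqr
          · exact hDd r
          · exact (hDd q).symm
          · exact c3 q r hqr
        · intro q hq
          simp only [Finset.mem_insert, not_or] at hq
          simp only [hq.1, if_false]
          exact c4 q hq.2
        · intro q hq
          dsimp only
          split_ifs with h1
          · subst h1; exact ⟨hDc, hDa⟩
          · exact c5 q ((Finset.mem_insert.mp hq).resolve_left h1)
      have hpne : p.1 ≠ p.2 := hP p (Finset.mem_insert_self _ _)
      set a0 := x p.1 with ha0
      set b0 := x p.2 with hb0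
      have ha0N : a0 ∈ N := hXN (hx _)
      have hb0N : b0 ∈ N := hXN (hx _)
      by_cases hadj : H.Adj a0 b0
      · refine upd ∅ (by simp) (by simp) ?_ ⟨a0, by simp, b0, rfl, hadj⟩
        simpa using conn_singleton H a0
      set A := (N.filter (fun b => H.Adj a0 b)) \ U with hA
      set B := (N.filter (fun b => H.Adj b0 b)) \ U with hB
      have memA : ∀ a, a ∈ A ↔ (a ∈ N ∧ H.Adj a0 a) ∧ a ∉ U := by intro a; simp [hA]
      have memB : ∀ a, a ∈ B ↔ (a ∈ N ∧ H.Adj b0 a) ∧ a ∉ U := by intro a; simp [hB]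
      by_cases hAB : ∃ a ∈ A, ∃ b ∈ B, a = b ∨ H.Adj a b
      · obtain ⟨a, ha, b, hb, h⟩ := hAB
        rw [memA] at ha; rw [memB] at hb
        have hca : Conn H {a, a0} := conn_pair ha.1.2.symm
        rcases h with rfl | h
        · refine upd {a} (by simp) ?_ ?_ ⟨a, by simp, b0, rfl, hb.1.2.symm⟩
          · simp [ha.1.1, ha.2]
          · rw [Set.pair_comm] at hca; simpa using hca
        · refine upd {a, b} Finset.card_le_two ?_ ?_ ⟨b, by simp, b0, rfl, hb.1.2.symm⟩
          · intro z hz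
            simp only [Finset.mem_insert, Finset.mem_singleton] at hz
            rcases hz with rfl | rfl
            · simp [ha.1.1, ha.2]
            · simp [hb.1.1, hb.2]
          · have := hca.insert_adj (a := a) (b := b) (by simp) h
            convert this using 1
            ext z; simp only [Finset.coe_insert, Finset.coe_singleton, mem_insert_iff,
              mem_singleton_iff]; tauto
      · exfalso
        push Not at hAB
        have hAc : d - U.card ≤ A.card := by
          have h1 := Finset.le_card_sdiff U (N.filter (fun b => H.Adj a0 b))
          exact (Nat.sub_le_sub_right (hdeg a0 ha0N) _).trans h1
        have hBc : d - U.card ≤ B.card := by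
          have h1 := Finset.le_card_sdiff U (N.filter (fun b => H.Adj b0 b))
          exact (Nat.sub_le_sub_right (hdeg b0 hb0N) _).trans h1
        have hdisj : Disjoint A B := by
          rw [Finset.disjoint_left]
          intro a ha hb
          exact (hAB a ha a hb).1 rfl
        have hABN : A ∪ B ⊆ N := by
          intro a ha
          rcases Finset.mem_union.mp ha with h | h
          · exact ((memA a).mp h).1.1
          · exact ((memB a).mp h).1.1
        have hABc : A.card + B.card ≤ N.card := by
          rw [← Finset.card_union_of_disjoint hdisj]
          exact card_le_card hABN
        have hdU : (3 * s + 1) * (U.card + 1) ≤ d - U.card := by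
          have : (3 * s + 2) * (U.card + 1) ≤ d := by
            rw [hd]; unfold dd
            exact Nat.mul_le_mul_left _ (by omega)
          have e : (3 * s + 2) * (U.card + 1) = (3 * s + 1) * (U.card + 1) + U.card + 1 := by ring
          omega
        have hmiss : ∀ a ∈ A, (A.filter (fun b => ¬ H.Adj a b)).card ≤ 3 * U.card + 3 := by
          intro a ha
          have h1 := Finset.card_filter_add_card_filter_not (s := A) (fun b => H.Adj a b)
          have h2 : N.filter (fun b => H.Adj a b) ⊆ A.filter (fun b => H.Adj a b) ∪ (N \ (A ∪ B)) := by
            intro b hb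
            simp only [mem_filter, Finset.mem_union, Finset.mem_sdiff] at hb ⊢
            by_cases hbA : b ∈ A
            · exact Or.inl ⟨hbA, hb.2⟩
            · right
              refine ⟨hb.1, ?_⟩
              rintro (h | h)
              · exact hbA h
              · exact (hAB a ha b h).2 hb.2
          have h3 := (card_le_card h2).trans (card_union_le _ _)
          have h4 := hdeg a ((memA a).mp ha).1.1
          have h5 : (N \ (A ∪ B)).card = N.card - (A.card + B.card) := by
            rw [Finset.card_sdiff_of_subset hABN, Finset.card_union_of_disjoint hdisj]
          omega
        obtain ⟨K, hKA, hKs, hK⟩ := greedy_clique H _ s A hmiss (by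
          refine le_trans ?_ (hdU.trans hAc)
          have : s * (3 * U.card + 3) = 3 * s * (U.card + 1) := by ring
          rw [this]
          exact Nat.mul_le_mul_right _ (by omega)) (by omega)
        refine hcon ((kminor_of_clique hKs hK).mono ?_)
        intro z hz
        exact_mod_cast hABN (Finset.mem_union_left _ (hKA hz))
  obtain ⟨c, c1, c2, c3, c4, c5⟩ := main (Finset.univ.filter (fun p => p.1 < p.2))
    (fun p hp => (mem_filter.mp hp).2.ne)
  apply hcon
  have c5' : ∀ i j : Fin s, Conn H (insert (x i) (c (i, j) : Set V)) := by
    intro i j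
    by_cases h : i < j
    · exact (c5 (i, j) (by simp [h])).1
    · rw [c4 (i, j) (by simp [h])]; simpa using conn_singleton H (x i)
  refine ⟨fun i => insert (x i) (⋃ j, (c (i, j) : Set V)), ?_, ?_, ?_, ?_⟩
  · intro i
    refine conn_of_base (x i) (Or.inl rfl) ?_
    rintro y (rfl | hy)
    · exact ⟨{x i}, by simp, conn_singleton _ _, rfl, rfl⟩
    · simp only [mem_iUnion] at hy
      obtain ⟨j, hj⟩ := hy
      refine ⟨insert (x i) (c (i, j) : Set V), ?_, c5' i j, Or.inl rfl, Or.inr hj⟩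
      exact Set.insert_subset_insert (subset_iUnion (fun j => (c (i, j) : Set V)) j)
  · intro i
    refine insert_subset (hXN (hx i)) ?_
    refine Set.iUnion_subset (fun j => ?_)
    intro z hz
    exact (Finset.mem_sdiff.mp (c2 _ hz)).1
  · intro i j hij
    rw [disjoint_left]
    rintro z (rfl | hz) (hz' | hz')
    · exact hij (hxi _ _ hz')
    · simp only [mem_iUnion] at hz'
      obtain ⟨k, hk⟩ := hz'
      exact (Finset.mem_sdiff.mp (c2 _ hk)).2 (hx i)
    · simp only [mem_iUnion] at hz
      obtain ⟨k, hk⟩ := hz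
      subst hz'
      exact (Finset.mem_sdiff.mp (c2 _ hk)).2 (hx j)
    · simp only [mem_iUnion] at hz hz'
      obtain ⟨k, hk⟩ := hz
      obtain ⟨l, hl⟩ := hz'
      exact Finset.disjoint_left.mp (c3 (i, k) (j, l) (by
        intro h; exact hij (congrArg Prod.fst h))) hk hl
  · have key : ∀ i j : Fin s, i < j → SAdj H (insert (x i) (⋃ j, (c (i, j) : Set V)))
        (insert (x j) (⋃ k, (c (j, k) : Set V))) := by
      intro i j h
      refine (c5 (i, j) (by simp [h])).2.mono ?_ ?_
      · exact Set.insert_subset_insert (subset_iUnion (fun j => (c (i, j) : Set V)) j)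
      · simp
    intro i j hij
    rcases lt_or_gt_of_ne (show i ≠ j from hij) with h | h
    · exact key i j h
    · exact (key j i h).symm

noncomputable def dg (H : SimpleGraph V) (X : Finset V) (v : V) : ℕ :=
  (X.filter (fun b => H.Adj v b)).card

noncomputable def es (H : SimpleGraph V) (X : Finset V) : ℕ := ∑ v ∈ X, dg H X v

def con (H : SimpleGraph V) (x y : V) : SimpleGraph V where
  Adj a b := a ≠ b ∧ a ≠ y ∧ b ≠ y ∧ (H.Adj a b ∨ (a = x ∧ H.Adj y b) ∨ (b = x ∧ H.Adj a y))
  symm := ⟨fun a b h => ⟨h.1.symm, h.2.2.1, h.2.1, by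
    rcases h.2.2.2 with h | h | h
    · exact Or.inl h.symm
    · exact Or.inr (Or.inr ⟨h.1, h.2.symm⟩)
    · exact Or.inr (Or.inl ⟨h.1, h.2.symm⟩)⟩⟩
  loopless := ⟨fun _ h => h.1 rfl⟩

theorem con_minor {H : SimpleGraph V} {x y : V} (hxy : H.Adj x y) {X : Finset V} (hx : x ∈ X)
    (hy : y ∈ X) {s : ℕ} (h : KMinor (con H x y) s ((X.erase y : Finset V) : Set V)) :
    KMinor H s (X : Set V) := by
  obtain ⟨φ, h1, h2, h3, h4⟩ := h
  have hyφ : ∀ w, y ∉ φ w := fun w hw => by simpa using h2 w hw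
  let ψ : V → Set V := fun a => if a = x then {x, y} else {a}
  have hψself : ∀ a, a ∈ ψ a := by
    intro a; simp only [ψ]; split_ifs with h
    · simp [h]
    · rfl
  have hψc : ∀ a, Conn H (ψ a) := by
    intro a; simp only [ψ]; split_ifs
    · exact conn_pair hxy
    · exact conn_singleton _ _
  have hψadj : ∀ a b, (con H x y).Adj a b → SAdj H (ψ a) (ψ b) := by
    rintro a b ⟨_, _, _, h | ⟨rfl, h⟩ | ⟨rfl, h⟩⟩
    · exact ⟨a, hψself a, b, hψself b, h⟩
    · exact ⟨y, by simp [ψ], b, hψself b, h⟩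
    · exact ⟨a, hψself a, y, by simp [ψ], h⟩
  refine ⟨fun w => ⋃ u ∈ φ w, ψ u, fun w => ?_, fun w => ?_, ?_, ?_⟩
  · exact (h1 w).biUnion ψ (fun i _ => hψc i) (fun i _ j _ hij => hψadj i j hij)
  · refine Set.iUnion₂_subset (fun u hu => ?_)
    simp only [ψ]
    split_ifs
    · intro z hz
      rcases hz with rfl | rfl
      · exact hx
      · exact hy
    · intro z hz
      obtain rfl : z = u := hz
      have := h2 w hu
      simp at this
      exact this.1
  · intro w w' hww
    simp only [Set.disjoint_iUnion_left, Set.disjoint_iUnion_right]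
    have hd := disj (h3 w w' hww)
    intro u hu v hv
    have huv : u ≠ v := by rintro rfl; first | exact hd hu hv | exact hd hv hu
    have huy : u ≠ y := by rintro rfl; exact hyφ _ hu
    have hvy : v ≠ y := by rintro rfl; exact hyφ _ hv
    simp only [ψ]
    split_ifs with e1 e2
    · exact absurd (e1.trans e2.symm) huv.symm
    · simp; grind
    · simp; grind
    · simpa using huv.symm
  · intro w w' hww
    obtain ⟨a, ha, b, hb, hab⟩ := h4 w w' hww
    exact (hψadj a b hab).mono (subset_biUnion_of_mem ha) (subset_biUnion_of_mem hb)

theorem con_count {H : SimpleGraph V} {x y : V} (hxy : H.Adj x y) {X : Finset V} (hx : x ∈ X)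
    (hy : y ∈ X) : es H X ≤ es (con H x y) (X.erase y) +
      2 * (X.filter (fun b => H.Adj x b ∧ H.Adj y b)).card + 2 := by
  have hne : x ≠ y := hxy.ne
  set T := X.filter (fun b => H.Adj x b ∧ H.Adj y b) with hT
  set X' := X.erase y with hX'
  have hx' : x ∈ X' := by simp [hX', hx, hne]
  have e1 : es H X = dg H X y + (dg H X x + ∑ v ∈ X'.erase x, dg H X v) := by
    unfold es
    rw [add_sum_erase X' _ hx', add_sum_erase X _ hy]
  have e2 : es (con H x y) X' = dg (con H x y) X' x + ∑ v ∈ X'.erase x, dg (con H x y) X' v := by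
    unfold es
    rw [add_sum_erase X' _ hx']
  have e3 : dg H X x + dg H X y ≤ dg (con H x y) X' x + T.card + 2 := by
    unfold dg
    rw [← Finset.card_union_add_card_inter]
    have i1 : X.filter (fun b => H.Adj x b) ∩ X.filter (fun b => H.Adj y b) ⊆ T := by
      intro b; simp [hT]; tauto
    have i2 : X.filter (fun b => H.Adj x b) ∪ X.filter (fun b => H.Adj y b) ⊆
        X'.filter (fun b => (con H x y).Adj x b) ∪ {x, y} := by intro b; simp [hX', con]; grind
    have := card_le_card i1
    have := (card_le_card i2).trans (card_union_le _ _)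
    have : ({x, y} : Finset V).card ≤ 2 := Finset.card_le_two
    omega
  have e4 : ∑ v ∈ X'.erase x, dg H X v ≤ ∑ v ∈ X'.erase x, dg (con H x y) X' v + T.card := by
    have : T = (X'.erase x).filter (fun b => H.Adj x b ∧ H.Adj y b) := by
      ext b; simp [hT, hX']
      intro h1 h2
      simp [h1.ne.symm, h2.ne.symm]
    rw [this, card_filter, ← Finset.sum_add_distrib]
    apply Finset.sum_le_sum
    intro v hv
    simp [hX'] at hv
    unfold dg
    split_ifs with h
    · have : X.filter (fun b => H.Adj v b) ⊆ X'.filter (fun b => (con H x y).Adj v b) ∪ {y} := by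
        intro b; simp [hX', con]; grind [H.ne_of_adj]
      have := (card_le_card this).trans (card_union_le _ _)
      simpa using this
    · by_cases hvy : H.Adj v y
      · have : X.filter (fun b => H.Adj v b) ⊆
            insert y ((X'.filter (fun b => (con H x y).Adj v b)).erase x) := by
          intro b; simp [hX', con]
          intro hb hvb
          by_cases hby : b = y
          · exact Or.inl hby
          · right
            refine ⟨?_, ⟨hby, hb⟩, hvb.ne, hv.2.1, hby, Or.inl hvb⟩
            rintro rfl; exact h ⟨hvb.symm, hvy.symm⟩
        have h1 := (card_le_card this).trans (Finset.card_insert_le _ _)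
        have h2 : x ∈ X'.filter (fun b => (con H x y).Adj v b) := by
          simp [hX', con, hx, hne, hv, hvy]
        have := card_erase_add_one h2
        omega
      · apply card_le_card
        intro b; simp [hX', con]
        intro hb hvb
        have hby : b ≠ y := by rintro rfl; exact hvy hvb
        exact ⟨⟨hby, hb⟩, hvb.ne, hv.2.1, hby, Or.inl hvb⟩
  omega

theorem delE_count {H : SimpleGraph V} {x y : V} (hxy : H.Adj x y) {X : Finset V} (hx : x ∈ X)
    (hy : y ∈ X) : es H X = es (delE H x y) X + 2 := by
  have hne : x ≠ y := hxy.ne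
  have hx' : x ∈ X.erase y := by simp [hx, hne]
  have e0 : ∀ K : SimpleGraph V, es K X =
      dg K X y + (dg K X x + ∑ v ∈ (X.erase y).erase x, dg K X v) := by
    intro K
    unfold es
    rw [add_sum_erase (X.erase y) _ hx', add_sum_erase X _ hy]
  have e1 : dg H X x = dg (delE H x y) X x + 1 := by
    unfold dg
    have : X.filter (fun b => (delE H x y).Adj x b) = (X.filter (fun b => H.Adj x b)).erase y := by
      ext b; simp [delE, hne]; tauto
    rw [this, card_erase_add_one]
    simp [hy, hxy]
  have e2 : dg H X y = dg (delE H x y) X y + 1 := by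
    unfold dg
    have : X.filter (fun b => (delE H x y).Adj y b) = (X.filter (fun b => H.Adj y b)).erase x := by
      ext b; simp [delE, hne.symm]; tauto
    rw [this, card_erase_add_one]
    simp [hx, hxy.symm]
  have e3 : ∑ v ∈ (X.erase y).erase x, dg H X v =
      ∑ v ∈ (X.erase y).erase x, dg (delE H x y) X v := by
    apply Finset.sum_congr rfl
    intro v hv
    simp at hv
    unfold dg
    congr 1
    ext b; simp [delE, hv.1, hv.2.1]
  rw [e0, e0, e1, e2, e3]; ring

theorem iso_count {H : SimpleGraph V} {v : V} {X : Finset V} (hv : v ∈ X) (h : dg H X v = 0) :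
    es H X = es H (X.erase v) := by
  unfold es
  rw [← add_sum_erase X _ hv, h, zero_add]
  apply Finset.sum_congr rfl
  intro a ha
  unfold dg at h ⊢
  congr 1
  ext b
  simp only [mem_filter, Finset.mem_erase]
  constructor
  · rintro ⟨hb, hab⟩
    refine ⟨⟨?_, hb⟩, hab⟩
    rintro rfl
    rw [Finset.card_eq_zero] at h
    have : a ∈ X.filter (fun c => H.Adj b c) := by simp [(Finset.mem_erase.mp ha).2, hab.symm]
    rw [h] at this; simp at this
  · tauto

theorem mader (s : ℕ) : ∀ (n : ℕ) (m : ℕ) (H : SimpleGraph V) (X : Finset V), X.card = n →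
    es H X = m → X.Nonempty → 2 * dd s * X.card ≤ es H X → KMinor H s (X : Set V) := by
  have hd : 2 ≤ dd s := by
    unfold dd
    calc 2 ≤ 2 * 1 := by norm_num
      _ ≤ _ := Nat.mul_le_mul (by omega) (by omega)
  intro n
  induction n using Nat.strong_induction_on with
  | _ n ihn =>
  intro m
  induction m using Nat.strong_induction_on with
  | _ m ihm =>
  intro H X hXn hm hX hE
  have hXpos : 0 < X.card := Finset.card_pos.mpr hX
  have hedge : ∃ x ∈ X, ∃ y ∈ X, H.Adj x y := by
    by_contra! hcon
    have : es H X = 0 := by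
      unfold es
      apply Finset.sum_eq_zero
      intro v hv
      unfold dg
      rw [Finset.card_eq_zero, Finset.filter_eq_empty_iff]
      exact fun b hb => hcon v hv b hb
    have : 0 < 2 * dd s * X.card := by positivity
    omega
  obtain ⟨x, hx, y, hy, hxy⟩ := hedge
  have hX2 : 2 ≤ X.card := by
    have : ({x, y} : Finset V) ⊆ X := by
      intro z hz; simp at hz; rcases hz with rfl | rfl <;> assumption
    have := card_le_card this
    rwa [Finset.card_pair hxy.ne] at this
  by_cases hbig : 2 * dd s * X.card + 2 ≤ es H X
  · have := delE_count hxy hx hy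
    have := ihm (es (delE H x y) X) (by omega) (delE H x y) X hXn rfl hX (by omega)
    exact this.mono_graph (delE_le H x y)
  have herase : ∀ y ∈ X, 2 * dd s * (X.erase y).card + 2 * dd s = 2 * dd s * X.card := by
    intro y hy
    rw [← card_erase_add_one hy]; ring
  by_cases hcon : ∃ x ∈ X, ∃ y ∈ X, H.Adj x y ∧
      (X.filter (fun b => H.Adj x b ∧ H.Adj y b)).card < dd s
  · obtain ⟨x, hx, y, hy, hxy, hlt⟩ := hcon
    have h1 := con_count hxy hx hy
    have h2 := herase y hy
    refine con_minor hxy hx hy (ihn (X.erase y).card ?_ _ _ _ rfl rfl ⟨x, ?_⟩ ?_)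
    · rw [← hXn]; exact Finset.card_erase_lt_of_mem hy
    · simp [hx, hxy.ne]
    · omega
  by_cases hiso : ∃ v ∈ X, dg H X v = 0
  · obtain ⟨v, hv, h0⟩ := hiso
    have h1 := iso_count hv h0
    have h2 := herase v hv
    have := ihn (X.erase v).card (by rw [← hXn]; exact Finset.card_erase_lt_of_mem hv) _ H
      (X.erase v) rfl rfl (by
        rw [← Finset.card_pos]
        have := card_erase_add_one hv
        omega) (by omega)
    exact this.mono (by intro z hz; exact (Finset.mem_erase.mp hz).2)
  push Not at hcon hiso
  have hv : ∃ v ∈ X, dg H X v ≤ 2 * dd s := by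
    by_contra! hc
    have : X.card • (2 * dd s + 1) ≤ es H X := Finset.card_nsmul_le_sum _ _ _ (fun v hv => hc v hv)
    simp only [smul_eq_mul] at this
    nlinarith
  obtain ⟨v, hvX, hv2⟩ := hv
  have := dense_kminor H s (X.filter (fun b => H.Adj v b)) hv2
    (by rw [← Finset.card_pos]; exact Nat.pos_of_ne_zero (hiso v hvX)) (by
      intro u hu
      simp only [mem_filter] at hu
      refine (hcon v hvX u hu.1 hu.2).trans (card_le_card ?_)
      intro b; simp only [mem_filter]; tauto)
  exact this.mono (by intro z hz; exact (mem_filter.mp hz).1)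

theorem MinorIn.lift {U W : Type} {K : SimpleGraph U} {H : SimpleGraph W}
    {X : Set V} {Y : Set U} (h : MinorIn K H Y) (B : U → Set V) (b1 : ∀ u ∈ Y, Conn G (B u))
    (b2 : ∀ u ∈ Y, B u ⊆ X) (b3 : ∀ u ∈ Y, ∀ v ∈ Y, u ≠ v → Disjoint (B u) (B v))
    (b4 : ∀ u ∈ Y, ∀ v ∈ Y, K.Adj u v → SAdj G (B u) (B v)) : MinorIn G H X := by
  obtain ⟨φ, a1, a2, a3, a4⟩ := h
  refine ⟨fun w => ⋃ u ∈ φ w, B u, fun w => ?_, fun w => ?_, ?_, ?_⟩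
  · exact (a1 w).biUnion B (fun i hi => b1 i (a2 w hi))
      (fun i hi j hj hij => b4 i (a2 w hi) j (a2 w hj) hij)
  · exact Set.iUnion₂_subset (fun u hu => b2 u (a2 w hu))
  · intro w w' hww
    rw [disjoint_left]
    intro z hz hz'
    simp only [mem_iUnion] at hz hz'
    obtain ⟨u, hu, hzu⟩ := hz
    obtain ⟨v, hv, hzv⟩ := hz'
    have huv : u ≠ v := by
      rintro rfl
      exact disj (a3 w w' hww) hu hv
    exact disj (b3 u (a2 w hu) v (a2 w' hv) huv) hzu hzv
  · intro w w' hww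
    obtain ⟨a, ha, b, hb, hab⟩ := a4 w w' hww
    exact (b4 a (a2 w ha) b (a2 w' hb) hab).mono (subset_biUnion_of_mem ha)
      (subset_biUnion_of_mem hb)

def Sparse (G : SimpleGraph V) (d : ℕ) : Prop :=
  ∀ (α : Type) (I : Finset α) (B : α → Set V), (∀ i ∈ I, Conn G (B i)) →
    (∀ i ∈ I, ∀ j ∈ I, i ≠ j → Disjoint (B i) (B j)) →
    ∀ E : Finset (α × α), (∀ p ∈ E, p.1 ∈ I ∧ p.2 ∈ I ∧ p.1 ≠ p.2 ∧ SAdj G (B p.1) (B p.2)) →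
      E.card ≤ d * I.card

theorem sparse_of_no_kminor {s : ℕ} (h : ¬ KMinor G s univ) :
    Sparse G (2 * dd s) := by
  intro α I B h1 h2 E hE
  by_contra! hcon
  let Γ : SimpleGraph α :=
    { Adj := fun a b => a ≠ b ∧ SAdj G (B a) (B b)
      symm := ⟨fun _ _ h => ⟨h.1.symm, h.2.symm⟩⟩
      loopless := ⟨fun _ h => h.1 rfl⟩ }
  have hEs : E.card ≤ es Γ I := by
    have : E ⊆ (I.sigma (fun v => I.filter (fun b => Γ.Adj v b))).image (fun p => (p.1, p.2)) := by
      intro p hp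
      obtain ⟨a, b, c, d⟩ := hE p hp
      simp only [Finset.mem_image, Finset.mem_sigma, mem_filter]
      exact ⟨⟨p.1, p.2⟩, ⟨a, b, c, d⟩, rfl⟩
    refine (card_le_card this).trans (Finset.card_image_le.trans ?_)
    rw [Finset.card_sigma]
    unfold es dg
    apply le_of_eq
    congr!
  have hne : I.Nonempty := by
    rw [Finset.nonempty_iff_ne_empty]
    rintro rfl
    have : E = ∅ := by
      rw [Finset.eq_empty_iff_forall_notMem]
      intro p hp
      exact absurd (hE p hp).1 (by simp)
    rw [this] at hcon
    simp at hcon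
  refine h ((mader s _ _ Γ I rfl rfl hne (by omega)).lift B (fun i hi => h1 i hi)
    (fun _ _ => subset_univ _) (fun i hi j hj hij => h2 i hi j hj hij)
    (fun i hi j hj hij => hij.2))

theorem Sparse.bip {d : ℕ} (h : Sparse G d) {α γ : Type} (I : Finset α)
    (J : Finset γ) (B : α → Set V) (C : γ → Set V) (hB : ∀ i ∈ I, Conn G (B i))
    (hC : ∀ j ∈ J, Conn G (C j)) (hBB : ∀ i ∈ I, ∀ j ∈ I, i ≠ j → Disjoint (B i) (B j))
    (hCC : ∀ i ∈ J, ∀ j ∈ J, i ≠ j → Disjoint (C i) (C j))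
    (hBC : ∀ i ∈ I, ∀ j ∈ J, Disjoint (B i) (C j)) (E : Finset (α × γ))
    (hE : ∀ p ∈ E, p.1 ∈ I ∧ p.2 ∈ J ∧ SAdj G (B p.1) (C p.2)) :
    E.card ≤ d * (I.card + J.card) := by
  have key := h (α ⊕ γ) (I.disjSum J) (Sum.elim B C) ?_ ?_
    (E.map ⟨fun p => (Sum.inl p.1, Sum.inr p.2), fun p q hpq => by
      simp at hpq; exact Prod.ext hpq.1 hpq.2⟩) ?_
  · simpa using key
  · rintro (i | j) hi
    · exact hB i (by simpa using hi)
    · exact hC j (by simpa using hi)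
  · rintro (i | j) hi (i' | j') hi' hne
    · exact hBB i (by simpa using hi) i' (by simpa using hi') (by simpa using hne)
    · exact hBC i (by simpa using hi) j' (by simpa using hi')
    · exact (hBC i' (by simpa using hi') j (by simpa using hi)).symm
    · exact hCC j (by simpa using hi) j' (by simpa using hi') (by simpa using hne)
  · intro p hp
    simp only [Finset.mem_map] at hp
    obtain ⟨q, hq, rfl⟩ := hp
    obtain ⟨a, b, c⟩ := hE q hq
    exact ⟨Finset.inl_mem_disjSum.mpr a, Finset.inr_mem_disjSum.mpr b, Sum.inl_ne_inr, c⟩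

theorem Sparse.mono_graph {G G' : SimpleGraph V} {d : ℕ} (h : Sparse G d) (hG : G' ≤ G) :
    Sparse G' d := by
  intro α I B h1 h2 E hE
  refine h α I B (fun i hi => (h1 i hi).mono hG) h2 E (fun p hp => ?_)
  obtain ⟨a, b, c, x, hx, y, hy, hxy⟩ := hE p hp
  exact ⟨a, b, c, x, hx, y, hy, hG hxy⟩

def HavenIn (G : SimpleGraph V) (C : Set V) (p : ℕ) (β : Set V → Set V) : Prop :=
  (∀ S ⊆ C, S.ncard ≤ p → IsComp G (C \ S) (β S)) ∧
  (∀ S S', S ⊆ S' → S' ⊆ C → S'.ncard ≤ p → β S' ⊆ β S)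

def SplP (G : SimpleGraph V) (c κ k q : ℕ) (A : Set V) : Prop :=
  ∃ (Z I : Set V) (L : Finset (Set V)), Z ⊆ A ∧ I ⊆ A ∧
    (∀ C, IsComp G (A \ Z) C → (nbr G C).ncard ≤ k) ∧
    I.ncard + c * q ≤ c * L.card ∧ Z.ncard + c * q ≤ 2 * c * L.card ∧
    (∀ B ∈ L, Conn G B ∧ B ⊆ A \ I ∧ κ ≤ (nbr G B ∩ (I ∪ nbr G A)).ncard) ∧
    (∀ B ∈ L, ∀ B' ∈ L, B ≠ B' → Disjoint B B')

theorem SplP.mono {c κ k q q' : ℕ} {A : Set V} (h : SplP G c κ k q A)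
    (hq : q' ≤ q) : SplP G c κ k q' A := by
  obtain ⟨Z, I, L, h1, h2, h3, h4, h5, h6, h7⟩ := h
  have : c * q' ≤ c * q := Nat.mul_le_mul_left _ hq
  exact ⟨Z, I, L, h1, h2, h3, by omega, by omega, h6, h7⟩

theorem splP_trivial {c κ k : ℕ} {A : Set V}
    (h : ∀ C, IsComp G A C → (nbr G C).ncard ≤ k) : SplP G c κ k 0 A :=
  ⟨∅, ∅, ∅, by simp, by simp, by simpa using h, by simp, by simp, by simp, by simp⟩

theorem nbr_subset_of_noedge {A B : Set V} (h : ¬ SAdj G A B) :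
    nbr G A ⊆ nbr G (A ∪ B) := by
  rintro y ⟨hy, x, hx, hxy⟩
  refine ⟨?_, x, Or.inl hx, hxy⟩
  rintro (h' | h')
  · exact hy h'
  · exact h ⟨x, hx, y, h', hxy⟩

theorem conn_side {A B Q : Set V} (h : ¬ SAdj G A B) (hQ : Conn G Q)
    (hQAB : Q ⊆ A ∪ B) : Q ⊆ A ∨ Q ⊆ B := by
  by_cases hm : (Q ∩ A).Nonempty
  · left
    obtain ⟨q, hq, hqA⟩ := hm
    refine hQ.closed A hq hqA ?_
    intro u _ huA v hv huv
    rcases hQAB hv with h' | h'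
    · exact h'
    · exact absurd ⟨u, huA, v, h', huv⟩ h
  · right
    intro q hq
    rcases hQAB hq with h' | h'
    · exact absurd ⟨q, hq, h'⟩ hm
    · exact h'

theorem isComp_side {A B Z1 Z2 C : Set V} (h : ¬ SAdj G A B)
    (hZ2 : Disjoint A Z2) (hZ1 : Disjoint B Z1)
    (hC : IsComp G ((A ∪ B) \ (Z1 ∪ Z2)) C) :
    IsComp G (A \ Z1) C ∨ IsComp G (B \ Z2) C := by
  have hCsub := hC.2.1
  rcases conn_side h hC.1 (fun x hx => (hCsub hx).1) with hCA | hCB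
  · left
    refine ⟨hC.1, fun x hx => ⟨hCA hx, fun hz => (hCsub hx).2 (Or.inl hz)⟩, ?_⟩
    intro a ha b hb hab
    refine hC.2.2 a ha b ⟨Or.inl hb.1, ?_⟩ hab
    rintro (hz | hz)
    · exact hb.2 hz
    · exact disj hZ2 hb.1 hz
  · right
    refine ⟨hC.1, fun x hx => ⟨hCB hx, fun hz => (hCsub hx).2 (Or.inr hz)⟩, ?_⟩
    intro a ha b hb hab
    refine hC.2.2 a ha b ⟨Or.inr hb.1, ?_⟩ hab
    rintro (hz | hz)
    · exact disj hZ1 hb.1 hz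
    · exact hb.2 hz

theorem SplP.union [Finite V] {c κ k q1 q2 : ℕ} {A1 A2 : Set V}
    (h1 : SplP G c κ k q1 A1) (h2 : SplP G c κ k q2 A2) (hd : Disjoint A1 A2)
    (hn : ¬ SAdj G A1 A2) : SplP G c κ k (q1 + q2) (A1 ∪ A2) := by
  obtain ⟨Z1, I1, L1, a1, a2, a3, a4, a5, a6, a7⟩ := h1
  obtain ⟨Z2, I2, L2, b1, b2, b3, b4, b5, b6, b7⟩ := h2
  have hdL : ∀ B ∈ L1, ∀ B' ∈ L2, Disjoint B B' := fun B hB B' hB' =>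
    hd.mono (((a6 B hB).2.1).trans sdiff_subset) (((b6 B' hB').2.1).trans sdiff_subset)
  have hLd : Disjoint L1 L2 := by
    rw [Finset.disjoint_left]
    intro B hB hB'
    obtain ⟨x, hx⟩ := (a6 B hB).1.1
    exact disj (hdL B hB B hB') hx hx
  have hn' : ¬ SAdj G A2 A1 := fun h => hn h.symm
  refine ⟨Z1 ∪ Z2, I1 ∪ I2, L1 ∪ L2, Set.union_subset_union a1 b1, Set.union_subset_union a2 b2,
    ?_, ?_, ?_, ?_, ?_⟩
  · intro C hC
    rcases isComp_side hn (hd.mono_right b1) (hd.symm.mono_right a1) hC with h | h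
    · exact a3 C h
    · exact b3 C h
  · rw [Finset.card_union_of_disjoint hLd]
    have := ncard_union_le I1 I2
    rw [Nat.mul_add, Nat.mul_add]; omega
  · rw [Finset.card_union_of_disjoint hLd]
    have := ncard_union_le Z1 Z2
    rw [Nat.mul_add, Nat.mul_add]; omega
  · intro B hB
    rcases Finset.mem_union.mp hB with h | h
    · obtain ⟨c1, c2, c3⟩ := a6 B h
      refine ⟨c1, ?_, c3.trans (ncard_le_ncard ?_ (toFinite _))⟩
      · intro x hx
        refine ⟨Or.inl (c2 hx).1, ?_⟩
        rintro (hI | hI)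
        · exact (c2 hx).2 hI
        · exact disj hd (c2 hx).1 (b2 hI)
      · rintro x ⟨hx, hx' | hx'⟩
        · exact ⟨hx, Or.inl (Or.inl hx')⟩
        · exact ⟨hx, Or.inr (nbr_subset_of_noedge hn hx')⟩
    · obtain ⟨c1, c2, c3⟩ := b6 B h
      refine ⟨c1, ?_, c3.trans (ncard_le_ncard ?_ (toFinite _))⟩
      · intro x hx
        refine ⟨Or.inr (c2 hx).1, ?_⟩
        rintro (hI | hI)
        · exact disj hd (a2 hI) (c2 hx).1
        · exact (c2 hx).2 hI
      · rintro x ⟨hx, hx' | hx'⟩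
        · exact ⟨hx, Or.inl (Or.inr hx')⟩
        · have := nbr_subset_of_noedge hn' hx'
          rw [Set.union_comm A2 A1] at this
          exact ⟨hx, Or.inr this⟩
  · intro B hB B' hB' hne
    rcases Finset.mem_union.mp hB with h | h <;> rcases Finset.mem_union.mp hB' with h' | h'
    · exact a7 B h B' h' hne
    · exact hdL B h B' h'
    · exact (hdL B' h' B h).symm
    · exact b7 B h B' h' hne

theorem splP_comps [Finite V] {c κ k : ℕ} : ∀ (n : ℕ) (A : Set V)
    (Q : Finset (Set V)), A.ncard = n → (∀ C ∈ Q, IsComp G A C ∧ SplP G c κ k 1 C) →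
    (∀ C, IsComp G A C → SplP G c κ k 0 C) → SplP G c κ k Q.card A := by
  intro n
  induction n using Nat.strong_induction_on with
  | _ n ih =>
  intro A Q hA hQ hall
  by_cases hne : A.Nonempty
  swap
  · have hQe : Q = ∅ := by
      rw [Finset.eq_empty_iff_forall_notMem]
      intro C hC
      obtain ⟨x, hx⟩ := (hQ C hC).1.1.1
      exact hne ⟨x, (hQ C hC).1.2.1 hx⟩
    subst hQe
    refine splP_trivial ?_
    intro C hC
    obtain ⟨x, hx⟩ := hC.1.1
    exact absurd ⟨x, hC.2.1 hx⟩ hne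
  obtain ⟨x, hx⟩ := hne
  set C := comp G A x with hC
  have hCc : IsComp G A C := comp_isComp hx
  have hnadj : ¬ SAdj G C (A \ C) := by
    rintro ⟨a, ha, b, hb, hab⟩
    exact hb.2 (hCc.2.2 a ha b hb.1 hab)
  have hcomp : ∀ D, IsComp G (A \ C) D → IsComp G A D := by
    intro D hD
    refine ⟨hD.1, hD.2.1.trans sdiff_subset, ?_⟩
    intro a ha b hb hab
    by_cases hbC : b ∈ C
    · exact absurd ⟨b, hbC, a, hD.2.1 ha, hab.symm⟩ hnadj
    · exact hD.2.2 a ha b ⟨hb, hbC⟩ hab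
  have hcomp' : ∀ D, IsComp G A D → D ≠ C → IsComp G (A \ C) D := by
    intro D hD hne
    refine ⟨hD.1, fun y hy => ⟨hD.2.1 hy, fun h => ?_⟩, fun a ha b hb hab => hD.2.2 a ha b hb.1 hab⟩
    exact disj (hD.disjoint hCc hne) hy h
  have hlt : (A \ C).ncard < n := by
    rw [← hA]
    refine ncard_lt_ncard ?_ (toFinite _)
    refine ⟨sdiff_subset, fun h => (h hx).2 (mem_comp hx)⟩
  have hrec := ih _ hlt (A \ C) (Q.erase C) rfl (by
    intro D hD
    rw [Finset.mem_erase] at hD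
    exact ⟨hcomp' D (hQ D hD.2).1 hD.1, (hQ D hD.2).2⟩) (fun D hD => hall D (hcomp D hD))
  have hAeq : C ∪ (A \ C) = A := Set.union_sdiff_cancel hCc.2.1
  by_cases hCQ : C ∈ Q
  · have := (hQ C hCQ).2.union hrec Set.disjoint_sdiff_right hnadj
    rw [hAeq, add_comm, card_erase_add_one hCQ] at this
    exact this
  · have := (hall C hCc).union hrec Set.disjoint_sdiff_right hnadj
    rwa [hAeq, Finset.erase_eq_of_notMem hCQ, zero_add] at this

theorem splP_conn [Finite V] {c κ : ℕ} {X : Set V}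
    (hX : ∀ C ⊆ X, ∀ β, ¬ HavenIn G C c β) : ∀ (n : ℕ) (C : Set V), C.ncard = n → C ⊆ X →
    Conn G C → κ ≤ (nbr G C).ncard → SplP G c κ (κ + c) 1 C := by
  intro n
  induction n using Nat.strong_induction_on with
  | _ n ih =>
  intro C hCn hCX hC hκ
  have nb : ∀ S ⊆ C, ∀ B, IsComp G (C \ S) B → nbr G B ⊆ (nbr G B \ C) ∪ S := by
    intro S hS B hB y hy
    by_cases hyC : y ∈ C
    · right
      by_contra hyS
      obtain ⟨hyB, x, hx, hxy⟩ := hy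
      exact hyB (hB.2.2 x hx y ⟨hyC, hyS⟩ hxy)
    · exact Or.inl ⟨hy, hyC⟩
  have nb2 : ∀ B ⊆ C, nbr G B \ C ⊆ nbr G C := by
    rintro B hB y ⟨⟨hyB, x, hx, hxy⟩, hyC⟩
    exact ⟨hyC, x, hB hx, hxy⟩
  have hS : ∃ S ⊆ C, S.ncard ≤ c ∧ ¬ ∃! B, IsComp G (C \ S) B ∧ κ ≤ (nbr G B \ C).ncard := by
    by_contra! hcon
    let β : Set V → Set V := fun S => if h : S ⊆ C ∧ S.ncard ≤ c then (hcon S h.1 h.2).choose else ∅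
    have hβ : ∀ S, S ⊆ C → S.ncard ≤ c → (IsComp G (C \ S) (β S) ∧ κ ≤ (nbr G (β S) \ C).ncard) ∧
        ∀ B, (IsComp G (C \ S) B ∧ κ ≤ (nbr G B \ C).ncard) → B = β S := by
      intro S h1 h2
      have e : β S = (hcon S h1 h2).choose := by simp only [β, h1, h2, and_self, dif_pos]
      rw [e]
      exact ⟨(hcon S h1 h2).choose_spec.1, fun B hB => (hcon S h1 h2).choose_spec.2 B hB⟩
    apply hX C hCX β
    refine ⟨fun S h1 h2 => (hβ S h1 h2).1.1, ?_⟩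
    intro S S' hSS hS' hc
    have hSc : S.ncard ≤ c := (ncard_le_ncard hSS (toFinite _)).trans hc
    obtain ⟨⟨b1, b2⟩, _⟩ := hβ S' hS' hc
    obtain ⟨B, hB, hBsub⟩ := conn_in_comp (X := C \ S) b1.1
      (fun x hx => ⟨(b1.2.1 hx).1, fun h => (b1.2.1 hx).2 (hSS h)⟩)
    have : B = β S := by
      apply (hβ S (hSS.trans hS') hSc).2
      refine ⟨hB, b2.trans (ncard_le_ncard ?_ (toFinite _))⟩
      rintro y ⟨⟨_, x, hx, hxy⟩, hyC⟩
      exact ⟨⟨fun h => hyC (hB.2.1 h).1, x, hBsub hx, hxy⟩, hyC⟩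
    rw [← this]; exact hBsub
  obtain ⟨S, hSC, hSc, hSn⟩ := hS
  have small : ∀ B, IsComp G (C \ S) B → (nbr G B \ C).ncard < κ → (nbr G B).ncard ≤ κ + c := by
    intro B hB hlt
    have h1 := ncard_le_ncard (nb S hSC B hB) (toFinite _)
    have h2 := ncard_union_le (nbr G B \ C) S
    omega
  by_cases h0 : ∃ B, IsComp G (C \ S) B ∧ κ ≤ (nbr G B \ C).ncard
  swap
  · push Not at h0
    refine ⟨S, ∅, {C}, hSC, by simp, fun B hB => small B hB (h0 B hB), by simp, by simp; omega, ?_, ?_⟩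
    · intro B hB
      rw [Finset.mem_singleton] at hB
      subst hB
      exact ⟨hC, by simp, by simpa using hκ⟩
    · simp only [Finset.mem_singleton]
      rintro B rfl B' rfl h
      exact absurd rfl h
  · obtain ⟨B1, hB1, hB1κ⟩ := h0
    have h2 : ∃ B2, B2 ≠ B1 ∧ IsComp G (C \ S) B2 ∧ κ ≤ (nbr G B2 \ C).ncard := by
      by_contra! hcon
      refine hSn ⟨B1, ⟨hB1, hB1κ⟩, ?_⟩
      rintro B ⟨hB, hBκ⟩
      by_contra hne
      exact absurd hBκ (not_le.mpr (hcon B hne hB))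
    obtain ⟨B2, hne, hB2, hB2κ⟩ := h2
    have hdis := hB2.disjoint hB1 hne
    have hlt : ∀ B, IsComp G (C \ S) B → B.ncard < n := by
      intro B hB
      rw [← hCn]
      refine ncard_lt_ncard ⟨hB.2.1.trans sdiff_subset, ?_⟩ (toFinite _)
      intro hCB
      have e1 : B = B1 := hB.eq_of_inter hB1 (by
        obtain ⟨x, hx⟩ := hB1.1.1
        exact ⟨x, hCB (hB1.2.1 hx).1, hx⟩)
      have e2 : B = B2 := hB.eq_of_inter hB2 (by
        obtain ⟨x, hx⟩ := hB2.1.1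
        exact ⟨x, hCB (hB2.2.1 hx).1, hx⟩)
      exact hne (e2.symm.trans e1)
    have hone : ∀ B, IsComp G (C \ S) B → κ ≤ (nbr G B \ C).ncard → SplP G c κ (κ + c) 1 B := by
      intro B hB hBκ
      exact ih _ (hlt B hB) B rfl ((hB.2.1.trans sdiff_subset).trans hCX) hB.1
        (hBκ.trans (ncard_le_ncard sdiff_subset (toFinite _)))
    have := splP_comps (c := c) (κ := κ) (k := κ + c) _ (C \ S) {B1, B2} rfl (by
      intro B hB
      rw [Finset.mem_insert, Finset.mem_singleton] at hB
      rcases hB with rfl | rfl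
      · exact ⟨hB1, hone _ hB1 hB1κ⟩
      · exact ⟨hB2, hone _ hB2 hB2κ⟩) (by
      intro B hB
      by_cases hBκ : κ ≤ (nbr G B \ C).ncard
      · exact (hone B hB hBκ).mono (by omega)
      · refine splP_trivial ?_
        intro B' hB'
        have : B' = B := by
          refine Set.Subset.antisymm hB'.2.1 ?_
          obtain ⟨x, hx⟩ := hB'.1.1
          exact hB'.subset_of_conn hB.1 subset_rfl ⟨x, hB'.2.1 hx, hx⟩
        rw [this]
        exact small B hB (by omega))
    rw [Finset.card_pair hne.symm] at this
    obtain ⟨Z, I, L, a1, a2, a3, a4, a5, a6, a7⟩ := this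
    refine ⟨Z ∪ S, I ∪ S, L, union_subset (a1.trans sdiff_subset) hSC,
      union_subset (a2.trans sdiff_subset) hSC, ?_, ?_, ?_, ?_, a7⟩
    · intro D hD
      apply a3
      rwa [Set.sdiff_sdiff, Set.union_comm]
    · have := ncard_union_le I S
      omega
    · have := ncard_union_le Z S
      omega
    · intro B hB
      obtain ⟨c1, c2, c3⟩ := a6 B hB
      refine ⟨c1, ?_, c3.trans (ncard_le_ncard ?_ (toFinite _))⟩
      · intro x hx
        refine ⟨(c2 hx).1.1, ?_⟩
        rintro (h | h)
        · exact (c2 hx).2 h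
        · exact (c2 hx).1.2 h
      · rintro x ⟨hx, hx' | hx'⟩
        · exact ⟨hx, Or.inl (Or.inl hx')⟩
        · refine ⟨hx, ?_⟩
          obtain ⟨hxn, y, hy, hyx⟩ := hx'
          by_cases hxC : x ∈ C
          · left; right
            by_contra hxS
            exact hxn ⟨hxC, hxS⟩
          · exact Or.inr ⟨hxC, y, hy.1, hyx⟩

theorem isComp_of_conn {A B : Set V} (hA : Conn G A) (h : IsComp G A B) :
    B = A := by
  refine Set.Subset.antisymm h.2.1 ?_
  obtain ⟨x, hx⟩ := h.1.1
  exact h.subset_of_conn hA subset_rfl ⟨x, h.2.1 hx, hx⟩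

theorem spl [Finite V] {c κ d : ℕ} {X : Set V} (hsp : Sparse G d)
    (hκ : 2 * d * (1 + c) ≤ κ)
    (hX : ∀ C ⊆ X, ∀ β, ¬ HavenIn G C c β) :
    ∃ Z ⊆ X, (∀ C, IsComp G (X \ Z) C → (nbr G C).ncard ≤ κ + c) ∧
      κ * Z.ncard ≤ 4 * c * d * (nbr G X).ncard := by
  have h := splP_comps (G := G) (c := c) (κ := κ) (k := κ + c) _ X ∅ rfl (by simp) (by
    intro C hC
    by_cases hCκ : κ ≤ (nbr G C).ncard
    · exact (splP_conn hX _ C rfl hC.2.1 hC.1 hCκ).mono (by omega)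
    · refine splP_trivial ?_
      intro B hB
      rw [isComp_of_conn hC.1 hB]; omega)
  obtain ⟨Z, I, L, a1, a2, a3, a4, a5, a6, a7⟩ := h
  refine ⟨Z, a1, a3, ?_⟩
  have hfin : (I ∪ nbr G X).Finite := toFinite _
  have hb := hsp.bip L hfin.toFinset id (fun v => {v}) (fun B hB => (a6 B hB).1)
    (fun v _ => conn_singleton G v) a7 (by simp)
    (by
      intro B hB v hv
      simp only [id, Set.disjoint_singleton_right]
      intro hvB
      have := (a6 B hB).2.1 hvB
      rcases (hfin.mem_toFinset.mp hv) with h | h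
      · exact this.2 h
      · exact h.1 this.1)
    ((L ×ˢ hfin.toFinset).filter (fun p => p.2 ∈ nbr G p.1)) (by
      intro p hp
      simp only [mem_filter, mem_product] at hp
      obtain ⟨⟨h1, h2⟩, h3, x, hx, hxy⟩ := hp
      exact ⟨h1, h2, x, hx, p.2, rfl, hxy⟩)
  have hlow : L.card * κ ≤ ((L ×ˢ hfin.toFinset).filter (fun p => p.2 ∈ nbr G p.1)).card := by
    rw [card_filter, Finset.sum_product]
    rw [← smul_eq_mul]
    refine Finset.card_nsmul_le_sum _ _ _ ?_
    intro B hB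
    rw [← card_filter]
    refine (a6 B hB).2.2.trans ?_
    rw [ncard_eq_toFinset_card _ (toFinite _)]
    apply card_le_card
    intro v hv
    simp only [Set.Finite.mem_toFinset] at hv
    simp only [mem_filter, Set.Finite.mem_toFinset]
    exact ⟨hv.2, hv.1⟩
  rw [← ncard_eq_toFinset_card] at hb
  have hu := ncard_union_le I (nbr G X)
  simp only [Finset.card_empty, mul_zero, add_zero] at a4 a5
  set ℓ := L.card
  set N := (nbr G X).ncard
  have h1 : ℓ * κ ≤ d * (ℓ + (c * ℓ + N)) :=
    (hlow.trans hb).trans (Nat.mul_le_mul_left _ (by omega))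
  have h2 : ℓ * κ ≤ 2 * d * N := by
    have : ℓ * (2 * d * (1 + c)) ≤ ℓ * κ := Nat.mul_le_mul_left _ hκ
    nlinarith
  calc κ * Z.ncard ≤ κ * (2 * c * ℓ) := Nat.mul_le_mul_left _ a5
    _ = 2 * c * (ℓ * κ) := by ring
    _ ≤ 2 * c * (2 * d * N) := Nat.mul_le_mul_left _ h2
    _ = 4 * c * d * N := by ring

theorem torso {d m : ℕ} (hsp : Sparse G d) {α γ : Type} (I : Finset α)
    (J : Finset γ) (B : α → Set V) (C : γ → Set V) (hB : ∀ i ∈ I, Conn G (B i))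
    (hC : ∀ j ∈ J, Conn G (C j)) (hBB : ∀ i ∈ I, ∀ j ∈ I, i ≠ j → Disjoint (B i) (B j))
    (hCC : ∀ i ∈ J, ∀ j ∈ J, i ≠ j → Disjoint (C i) (C j))
    (hBC : ∀ i ∈ I, ∀ j ∈ J, Disjoint (B i) (C j))
    (hm : ∀ j ∈ J, (I.filter (fun i => SAdj G (B i) (C j))).card ≤ m)
    (E : Finset (α × α))
    (hE : ∀ p ∈ E, p.1 ∈ I ∧ p.2 ∈ I ∧ p.1 ≠ p.2 ∧
      ∃ j ∈ J, SAdj G (B p.1) (C j) ∧ SAdj G (B p.2) (C j)) :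
    E.card ≤ (1 + m ^ 2) * (d * I.card) := by
  let T := (E ×ˢ J).powerset.filter (fun P => (∀ t ∈ P, SAdj G (B t.1.1) (C t.2) ∧
    SAdj G (B t.1.2) (C t.2)) ∧ (∀ t ∈ P, ∀ t' ∈ P, t.1 = t'.1 → t = t') ∧
      (∀ t ∈ P, ∀ t' ∈ P, t.2 = t'.2 → t = t'))
  have hT : T.Nonempty := ⟨∅, by simp [T]⟩
  obtain ⟨P, hP, hmax⟩ := Finset.exists_max_image T Finset.card hT
  simp only [T, mem_filter, Finset.mem_powerset] at hP
  obtain ⟨hPs, hP1, hP2, hP3⟩ := hP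
  have hPE : ∀ t ∈ P, t.1 ∈ E ∧ t.2 ∈ J := fun t ht => mem_product.mp (hPs ht)
  set E0 := P.image Prod.fst with hE0
  set J0 := P.image Prod.snd with hJ0
  have cE0 : E0.card = P.card := Finset.card_image_of_injOn (fun a ha b hb h => hP2 a ha b hb h)
  have cJ0 : J0.card = P.card := Finset.card_image_of_injOn (fun a ha b hb h => hP3 a ha b hb h)
  have hrest : (E \ E0) ⊆ J0.biUnion (fun j => (I.filter (fun i => SAdj G (B i) (C j))) ×ˢ
      (I.filter (fun i => SAdj G (B i) (C j)))) := by
    intro e he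
    rw [Finset.mem_sdiff] at he
    obtain ⟨h1, h2, h3, j, hj, h4, h5⟩ := hE e he.1
    rw [Finset.mem_biUnion]
    refine ⟨j, ?_, by simp [h1, h2, h4, h5]⟩
    by_contra hjJ
    have hn : (e, j) ∉ P := fun h => hjJ (Finset.mem_image.mpr ⟨_, h, rfl⟩)
    have hle := hmax (insert (e, j) P) (by
      simp only [T, mem_filter, Finset.mem_powerset]
      refine ⟨?_, ?_, ?_, ?_⟩
      · rw [Finset.insert_subset_iff]
        exact ⟨mem_product.mpr ⟨he.1, hj⟩, hPs⟩
      · intro t ht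
        rw [Finset.mem_insert] at ht
        rcases ht with rfl | ht
        · exact ⟨h4, h5⟩
        · exact hP1 t ht
      · intro t ht t' ht' htt
        rw [Finset.mem_insert] at ht ht'
        rcases ht with rfl | ht <;> rcases ht' with rfl | ht'
        · rfl
        · exact absurd (Finset.mem_image.mpr ⟨t', ht', htt.symm⟩) he.2
        · exact absurd (Finset.mem_image.mpr ⟨t, ht, htt⟩) he.2
        · exact hP2 t ht t' ht' htt
      · intro t ht t' ht' htt
        rw [Finset.mem_insert] at ht ht'
        rcases ht with rfl | ht <;> rcases ht' with rfl | ht'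
        · rfl
        · exact absurd (Finset.mem_image.mpr ⟨t', ht', htt.symm⟩) hjJ
        · exact absurd (Finset.mem_image.mpr ⟨t, ht, htt⟩) hjJ
        · exact hP3 t ht t' ht' htt)
    rw [Finset.card_insert_of_notMem hn] at hle
    omega
  have c1 : (E \ E0).card ≤ J0.card * m ^ 2 := by
    refine (card_le_card hrest).trans (card_biUnion_le_card_mul _ _ _ ?_)
    intro j hj
    obtain ⟨t, ht, rfl⟩ := Finset.mem_image.mp hj
    rw [Finset.card_product, sq]
    exact Nat.mul_le_mul (hm _ (hPE t ht).2) (hm _ (hPE t ht).2)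
  let B' : α → Set V := fun i => B i ∪ ⋃ t ∈ {t | t ∈ P ∧ t.1.1 = i}, C t.2
  have c2 : E0.card ≤ d * I.card := by
    refine hsp α I B' ?_ ?_ E0 ?_
    · intro i hi
      refine (hB i hi).union_pieces ?_
      intro y hy
      simp only [mem_iUnion, mem_ofPred_eq] at hy
      obtain ⟨t, ⟨ht, hti⟩, hy⟩ := hy
      refine ⟨C t.2, ?_, hC _ (hPE t ht).2, hy, Or.inr ?_⟩
      · intro z hz
        left
        simp only [mem_iUnion, mem_ofPred_eq]
        exact ⟨t, ⟨ht, hti⟩, hz⟩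
      · rw [← hti]; exact (hP1 t ht).1
    · intro i hi j hj hij
      rw [disjoint_left]
      intro z hz hz'
      simp only [B', mem_union, mem_iUnion, mem_ofPred_eq] at hz hz'
      rcases hz with hz | ⟨t, ⟨ht, hti⟩, hz⟩ <;> rcases hz' with hz' | ⟨t', ⟨ht', hti'⟩, hz'⟩
      · exact disj (hBB i hi j hj hij) hz hz'
      · exact disj (hBC i hi _ (hPE t' ht').2) hz hz'
      · exact disj (hBC j hj _ (hPE t ht).2) hz' hz
      · by_cases htt : t.2 = t'.2
        · have := hP3 t ht t' ht' htt
          subst this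
          exact hij (hti.symm.trans hti')
        · exact disj (hCC _ (hPE t ht).2 _ (hPE t' ht').2 htt) hz hz'
    · intro e he
      obtain ⟨t, ht, rfl⟩ := Finset.mem_image.mp he
      obtain ⟨h1, h2, h3, _⟩ := hE _ (hPE t ht).1
      refine ⟨h1, h2, h3, ?_⟩
      refine (hP1 t ht).2.symm.mono ?_ (subset_union_left)
      intro z hz
      right
      simp only [mem_iUnion, mem_ofPred_eq]
      exact ⟨t, ⟨ht, rfl⟩, hz⟩
  have hsub : E0 ⊆ E := by
    intro e he
    obtain ⟨t, ht, rfl⟩ := Finset.mem_image.mp he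
    exact (hPE t ht).1
  have := Finset.card_sdiff_add_card_eq_card hsub
  have h3 : E.card ≤ (1 + m ^ 2) * E0.card := by
    rw [cJ0, ← cE0] at c1
    nlinarith
  exact h3.trans (Nat.mul_le_mul_left _ c2)

def XY (G : SimpleGraph V) (D Z Y : Set V) : Set V :=
  {x | x ∈ Y ∨ ∃ C, IsComp G (D \ Z) C ∧ SAdj G C Y ∧ x ∈ C}

def Adm (G : SimpleGraph V) (Nf : Set V → Prop) (k : ℕ) (D Z : Set V) : Prop :=
  Z ⊆ D ∧ ∀ C, IsComp G (D \ Z) C → ¬ Nf C ∧ (nbr G C).ncard ≤ k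

theorem XY_subset {D Z Y : Set V} (hZ : Z ⊆ D) (hY : Y ⊆ Z) :
    XY G D Z Y ⊆ D := by
  rintro x (h | ⟨C, hC, _, hx⟩)
  · exact hZ (hY h)
  · exact (hC.2.1 hx).1

theorem XY_diff {D Z Y : Set V} (_hY : Y ⊆ Z) :
    XY G D Z Y \ Y ⊆ D \ Z := by
  rintro x ⟨h | ⟨C, hC, _, hx⟩, hxY⟩
  · exact absurd h hxY
  · exact hC.2.1 hx

theorem XY_closed {D Z Y : Set V} {x y : V}
    (hx : x ∈ XY G D Z Y) (hy : y ∈ D \ Z) (hxy : G.Adj x y) : y ∈ XY G D Z Y := by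
  right
  rcases hx with hx | ⟨C, hC, h1, h2⟩
  · exact ⟨comp G (D \ Z) y, comp_isComp hy, ⟨y, mem_comp hy, x, hx, hxy.symm⟩, mem_comp hy⟩
  · exact ⟨C, hC, h1, hC.2.2 x h2 y hy hxy⟩

theorem exchange [Finite V] {Nf : Set V → Prop} {c κ d : ℕ} {D Z Y : Set V}
    (hsp : Sparse G d) (hκ : 2 * d * (1 + c) ≤ κ)
    (hmono : ∀ X Y, X ⊆ Y → Nf X → Nf Y)
    (hfree : ∀ X, ¬ Nf X → ∀ C ⊆ X, ∀ β, ¬ HavenIn G C c β)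
    (hZ : Adm G Nf (κ + c) D Z) (hmin : ∀ Z', Adm G Nf (κ + c) D Z' → Z.ncard ≤ Z'.ncard)
    (hY : Y ⊆ Z) (hlt : 4 * c * d * (nbr G (XY G D Z Y)).ncard < κ * Y.ncard) :
    Nf (XY G D Z Y) := by
  by_contra hn
  obtain ⟨Z', hZ'X, hZ'k, hZ'c⟩ := spl hsp hκ (hfree _ hn)
  set X := XY G D Z Y with hX
  have hlt' : Z'.ncard < Y.ncard := by
    have : κ * Z'.ncard < κ * Y.ncard := lt_of_le_of_lt hZ'c hlt
    exact Nat.lt_of_mul_lt_mul_left this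
  have hnadj : ¬ SAdj G (X \ Z') ((D \ Z) \ X) := by
    rintro ⟨x, hx, y, hy, hxy⟩
    exact hy.2 (XY_closed hx.1 hy.1 hxy)
  have hXD : X ⊆ D := XY_subset hZ.1 hY
  have hadm : Adm G Nf (κ + c) D ((Z \ Y) ∪ Z') := by
    refine ⟨union_subset (sdiff_subset.trans hZ.1) (hZ'X.trans hXD), ?_⟩
    intro Q hQ
    have hsub : D \ ((Z \ Y) ∪ Z') ⊆ (X \ Z') ∪ ((D \ Z) \ X) := by
      rintro x ⟨hxD, hx⟩
      by_cases hxX : x ∈ X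
      · exact Or.inl ⟨hxX, fun h => hx (Or.inr h)⟩
      · right
        refine ⟨⟨hxD, fun hxZ => hx (Or.inl ⟨hxZ, fun hxY => hxX (Or.inl hxY)⟩)⟩, hxX⟩
    rcases conn_side hnadj hQ.1 (hQ.2.1.trans hsub) with hs | hs
    · have hXZ : ∀ x ∈ X \ Z', x ∈ D \ ((Z \ Y) ∪ Z') := by
        rintro x ⟨hxX, hxZ'⟩
        refine ⟨hXD hxX, ?_⟩
        rintro (h | h)
        · exact (XY_diff hY ⟨hxX, h.2⟩).2 h.1
        · exact hxZ' h
      refine ⟨fun h => hn (hmono _ _ (hs.trans sdiff_subset) h), hZ'k Q ⟨hQ.1, hs, ?_⟩⟩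
      intro a ha b hb hab
      exact hQ.2.2 a ha b (hXZ b hb) hab
    · apply hZ.2
      refine ⟨hQ.1, hs.trans sdiff_subset, ?_⟩
      intro a ha b hb hab
      refine hQ.2.2 a ha b ⟨hb.1, ?_⟩ hab
      rintro (h | h)
      · exact hb.2 h.1
      · exact (hs ha).2 (XY_closed (hZ'X h) (hs ha).1 hab.symm)
  have h1 := hmin _ hadm
  have h2 := ncard_union_le (Z \ Y) Z'
  have h3 := Set.ncard_sdiff_add_ncard_of_subset hY (toFinite _)
  omega

theorem bad_count {α γ : Type} (P : Finset γ) (f : γ → α) (U : Finset α) (μ : ℕ) :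
    (U.filter (fun z => μ ≤ (P.filter (fun p => f p = z)).card)).card * μ ≤ P.card := by
  set U' := U.filter (fun z => μ ≤ (P.filter (fun p => f p = z)).card) with hU'
  calc U'.card * μ ≤ ∑ z ∈ U', (P.filter (fun p => f p = z)).card := by
        rw [← smul_eq_mul]
        refine Finset.card_nsmul_le_sum _ _ _ ?_
        intro z hz
        exact (mem_filter.mp hz).2
    _ = (U'.biUnion (fun z => P.filter (fun p => f p = z))).card := by
        rw [Finset.card_biUnion]
        intro a _ b _ hab
        rw [Function.onFun, Finset.disjoint_left]
        intro p hp hp'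
        rw [mem_filter] at hp hp'
        exact hab (hp.2.symm.trans hp'.2)
    _ ≤ P.card := by
        refine card_le_card ?_
        intro p hp
        rw [Finset.mem_biUnion] at hp
        obtain ⟨z, _, hp⟩ := hp
        exact (mem_filter.mp hp).1

theorem exists_Y [Finite V] {c κ d k2 : ℕ} {D Z : Set V}
    (hsp : Sparse G d) (hc : 1 ≤ c) (hd : 1 ≤ d) (hcκ : c ≤ κ)
    (hk2 : 64 * c * d ^ 2 * (1 + d * (1 + 256 * d ^ 2)) < k2) (hk2d : 2 * d ≤ k2)
    (hκ : 8 * c * d * (16 * d * (2 + k2 ^ 2)) < κ)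
    (hZD : Z ⊆ D) (hZ : ∀ C, IsComp G (D \ Z) C → (nbr G C).ncard ≤ κ + c)
    (hS : 7 * (nbr G D).ncard ≤ Z.ncard) (hne : Z.Nonempty) :
    ∃ Y ⊆ Z, Y.ncard ≤ κ + c ∧ 4 * c * d * (nbr G (XY G D Z Y)).ncard < κ * Y.ncard := by
  set S := nbr G D with hSdef
  have fU : (Z ∪ S).Finite := toFinite _
  have fC : {C | IsComp G (D \ Z) C}.Finite := toFinite _
  set U := fU.toFinset with hU
  set Cs := fC.toFinset with hCs
  have mU : ∀ x, x ∈ U ↔ x ∈ Z ∪ S := fun x => fU.mem_toFinset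
  have mC : ∀ C, C ∈ Cs ↔ IsComp G (D \ Z) C := fun C => fC.mem_toFinset
  have hZS : Disjoint Z S := by
    rw [disjoint_left]
    intro x hx hxS
    exact hxS.1 (hZD hx)
  have hM : U.card = Z.ncard + S.ncard := by
    rw [hU, ← ncard_eq_toFinset_card, Set.ncard_union_eq hZS]
  set M := U.card with hMdef
  have hUC : ∀ u ∈ U, ∀ C ∈ Cs, u ∉ C := by
    intro u hu C hC h
    have := ((mC C).mp hC).2.1 h
    rcases (mU u).mp hu with h' | h'
    · exact this.2 h'
    · exact h'.1 this.1
  have hnC : ∀ C ∈ Cs, nbr G C ⊆ ↑U := by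
    rintro C hC y ⟨hy, x, hx, hxy⟩
    have hC' := (mC C).mp hC
    rw [Finset.mem_coe, mU]
    by_cases hyD : y ∈ D
    · left
      by_contra hyZ
      exact hy (hC'.2.2 x hx y ⟨hyD, hyZ⟩ hxy)
    · exact Or.inr ⟨hyD, x, (hC'.2.1 hx).1, hxy⟩
  have hdC : ∀ C ∈ Cs, ∀ C' ∈ Cs, C ≠ C' → Disjoint C C' := fun C hC C' hC' h =>
    ((mC C).mp hC).disjoint ((mC C').mp hC') h
  have hadjC : ∀ u ∈ U, ∀ C ∈ Cs, (SAdj G {u} C ↔ u ∈ nbr G C) := by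
    intro u hu C hC
    constructor
    · rintro ⟨a, rfl, b, hb, hab⟩
      exact ⟨hUC a hu C hC, b, hb, hab.symm⟩
    · rintro ⟨_, b, hb, hab⟩
      exact ⟨u, rfl, b, hb, hab.symm⟩
  set Li := Cs.filter (fun C => (nbr G C).ncard ≤ k2) with hLi
  set Hv := Cs.filter (fun C => k2 < (nbr G C).ncard) with hHv
  set h := Hv.card with hh
  set E1 := (U ×ˢ U).filter (fun p => G.Adj p.1 p.2) with hE1
  have e1 : E1.card ≤ d * M := by
    refine hsp V U (fun v => {v}) (fun v _ => conn_singleton G v) (by simp) E1 ?_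
    intro p hp
    simp only [hE1, mem_filter, mem_product] at hp
    exact ⟨hp.1.1, hp.1.2, hp.2.ne, p.1, rfl, p.2, rfl, hp.2⟩
  set E2 := (U ×ˢ U).filter (fun p => p.1 ≠ p.2 ∧ ∃ C ∈ Li, p.1 ∈ nbr G C ∧ p.2 ∈ nbr G C) with hE2
  have e2 : E2.card ≤ (1 + k2 ^ 2) * (d * M) := by
    refine torso (m := k2) hsp U Li (fun v => {v}) id (fun v _ => conn_singleton G v) ?_ (by simp) ?_ ?_ ?_ E2 ?_
    · intro C hC
      exact ((mC C).mp (mem_filter.mp hC).1).1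
    · intro C hC C' hC' hne
      exact hdC C (mem_filter.mp hC).1 C' (mem_filter.mp hC').1 hne
    · intro u hu C hC
      simp only [id, Set.disjoint_singleton_left]
      exact hUC u hu C (mem_filter.mp hC).1
    · intro C hC
      obtain ⟨h1, h2⟩ := mem_filter.mp hC
      refine le_trans ?_ h2
      rw [← ncard_coe_finset]
      refine ncard_le_ncard ?_ (toFinite _)
      intro u hu
      simp only [Finset.coe_filter, id] at hu
      exact (hadjC u hu.1 C h1).mp hu.2
    · intro p hp
      simp only [hE2, mem_filter, mem_product] at hp
      obtain ⟨⟨h1, h2⟩, h3, C, hC, h4, h5⟩ := hp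
      have hC' : C ∈ Cs := by simp only [hLi, mem_filter] at hC; exact hC.1
      exact ⟨h1, h2, h3, C, by simpa [hLi] using hC, (hadjC _ h1 C hC').mpr h4, (hadjC _ h2 C hC').mpr h5⟩
  set T := E1 ∪ E2 with hT
  have eT : T.card ≤ (2 + k2 ^ 2) * (d * M) := by
    refine (card_union_le _ _).trans ?_
    nlinarith
  set E3 := (Hv ×ˢ U).filter (fun p => p.2 ∈ nbr G p.1) with hE3
  have e3 : E3.card ≤ d * (h + M) := by
    refine hsp.bip Hv U id (fun v => {v}) ?_ (fun v _ => conn_singleton G v) ?_ (by simp) ?_ E3 ?_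
    · intro C hC
      exact ((mC C).mp (mem_filter.mp hC).1).1
    · intro C hC C' hC' hne
      exact hdC C (mem_filter.mp hC).1 C' (mem_filter.mp hC').1 hne
    · intro C hC u hu
      simp only [id, Set.disjoint_singleton_right]
      exact hUC u hu C (mem_filter.mp hC).1
    · intro p hp
      simp only [hE3, mem_filter, mem_product] at hp
      obtain ⟨⟨h1, h2⟩, h3, x, hx, hxy⟩ := hp
      exact ⟨h1, h2, x, hx, p.2, rfl, hxy⟩
  have e3' : h * k2 ≤ E3.card := by
    rw [hE3, card_filter, Finset.sum_product]
    rw [← smul_eq_mul]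
    refine Finset.card_nsmul_le_sum _ _ _ ?_
    intro C hC
    rw [← card_filter]
    obtain ⟨h1, h2⟩ := mem_filter.mp hC
    refine h2.le.trans ?_
    rw [ncard_eq_toFinset_card _ (toFinite _)]
    apply card_le_card
    intro v hv
    simp only [Set.Finite.mem_toFinset] at hv
    simp only [mem_filter]
    exact ⟨hnC C h1 hv, hv⟩
  have hhM : h ≤ M := by
    have h1 : h * (2 * d) ≤ d * (h + M) := ((Nat.mul_le_mul_left _ hk2d).trans e3').trans e3
    have h2 : d * h ≤ d * M := by nlinarith
    exact Nat.le_of_mul_le_mul_left h2 hd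
  have hhk : h * k2 ≤ 2 * d * M := (e3'.trans e3).trans (by nlinarith)
  set μ := 16 * d * (2 + k2 ^ 2) with hμ
  set bad1 := U.filter (fun z => μ ≤ (T.filter (fun p => p.1 = z)).card) with hb1
  set bad2 := U.filter (fun z => 16 * d ≤ (E3.filter (fun p => p.2 = z)).card) with hb2
  have b1 : bad1.card * 16 ≤ M := by
    have h1 := (bad_count T Prod.fst U μ).trans eT
    have h2 : (d * (2 + k2 ^ 2)) * (bad1.card * 16) ≤ (d * (2 + k2 ^ 2)) * M := by
      calc _ = bad1.card * μ := by rw [hμ]; ring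
        _ ≤ _ := h1
        _ = _ := by ring
    exact Nat.le_of_mul_le_mul_left h2 (by positivity)
  have b2 : bad2.card * 8 ≤ M := by
    have h1 := (bad_count E3 Prod.snd U (16 * d)).trans e3
    have h2 : (2 * d) * (bad2.card * 8) ≤ (2 * d) * M := by
      calc _ = bad2.card * (16 * d) := by ring
        _ ≤ _ := h1
        _ ≤ _ := by nlinarith
    exact Nat.le_of_mul_le_mul_left h2 (by positivity)
  set good := U.filter (fun z => z ∈ Z ∧ (T.filter (fun p => p.1 = z)).card < μ ∧
    (E3.filter (fun p => p.2 = z)).card < 16 * d) with hgood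
  have fS : S.Finite := toFinite _
  have gM : M ≤ 2 * good.card := by
    have hsub : U ⊆ good ∪ (fS.toFinset ∪ (bad1 ∪ bad2)) := by
      intro z hz
      simp only [hgood, hb1, hb2, Finset.mem_union, mem_filter, Set.Finite.mem_toFinset]
      by_cases h1 : μ ≤ (T.filter (fun p => p.1 = z)).card
      · exact Or.inr (Or.inr (Or.inl ⟨hz, h1⟩))
      by_cases h2 : 16 * d ≤ (E3.filter (fun p => p.2 = z)).card
      · exact Or.inr (Or.inr (Or.inr ⟨hz, h2⟩))
      rcases (mU z).mp hz with h3 | h3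
      · exact Or.inl ⟨hz, h3, by omega, by omega⟩
      · exact Or.inr (Or.inl h3)
    have h1 := card_le_card hsub
    have h2 := card_union_le good (fS.toFinset ∪ (bad1 ∪ bad2))
    have h3 := card_union_le fS.toFinset (bad1 ∪ bad2)
    have h4 := card_union_le bad1 bad2
    rw [← ncard_eq_toFinset_card] at h3
    omega
  have nX : ∀ Y ⊆ Z, ∀ x ∈ nbr G (XY G D Z Y), x ∈ U ∧ x ∉ Y ∧
      ((∃ z ∈ Y, G.Adj z x) ∨ ∃ C ∈ Cs, (∃ z ∈ Y, z ∈ nbr G C) ∧ x ∈ nbr G C) := by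
    rintro Y hY x ⟨hx, w, hw, hwx⟩
    have hwD := XY_subset hZD hY hw
    refine ⟨?_, fun h => hx (Or.inl h), ?_⟩
    · rw [mU]
      by_cases hxD : x ∈ D
      · left
        by_contra hxZ
        exact hx (XY_closed hw ⟨hxD, hxZ⟩ hwx)
      · exact Or.inr ⟨hxD, w, hwD, hwx⟩
    · rcases hw with hw | ⟨C, hC, ⟨a, ha, z, hz, haz⟩, hwC⟩
      · exact Or.inl ⟨w, hw, hwx⟩
      · right
        have hC' := (mC C).mpr hC
        refine ⟨C, hC', ⟨z, hz, hUC z ((mU z).mpr (Or.inl (hY hz))) C hC', a, ha, haz⟩, ?_, w, hwC, hwx⟩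
        intro hxC
        exact hx (Or.inr ⟨C, hC, ⟨a, ha, z, hz, haz⟩, hxC⟩)
  have lightT : ∀ z ∈ U, ∀ x ∈ U, x ≠ z → (G.Adj z x ∨ ∃ C ∈ Li, z ∈ nbr G C ∧ x ∈ nbr G C) →
      x ∈ (T.filter (fun p => p.1 = z)).image Prod.snd := by
    intro z hz x hx hxz hh
    rw [Finset.mem_image]
    refine ⟨(z, x), ?_, rfl⟩
    rw [mem_filter]
    refine ⟨?_, rfl⟩
    rw [hT, Finset.mem_union]
    rcases hh with hh | hh
    · left; simp only [hE1, mem_filter, mem_product]; exact ⟨⟨hz, hx⟩, hh⟩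
    · right; simp only [hE2, mem_filter, mem_product]
      exact ⟨⟨hz, hx⟩, hxz.symm, hh⟩
  have lh : ∀ C ∈ Cs, C ∈ Li ∨ C ∈ Hv := by
    intro C hC
    simp only [hLi, hHv, mem_filter]
    by_cases h1 : (nbr G C).ncard ≤ k2
    · exact Or.inl ⟨hC, h1⟩
    · exact Or.inr ⟨hC, by omega⟩
  have hκpos : 1 ≤ κ := hc.trans hcκ
  by_cases hcase : ∃ z ∈ good, ∀ C ∈ Hv, z ∉ nbr G C
  · obtain ⟨z, hz, hzH⟩ := hcase
    obtain ⟨hzU, hzZ, hz1, hz2⟩ := mem_filter.mp hz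
    refine ⟨{z}, by simpa using hzZ, by simp; omega, ?_⟩
    have hsub : nbr G (XY G D Z {z}) ⊆ ↑((T.filter (fun p => p.1 = z)).image Prod.snd) := by
      intro x hx
      obtain ⟨hxU, hxz, hh⟩ := nX {z} (by simpa using hzZ) x hx
      refine lightT z hzU x hxU hxz ?_
      rcases hh with ⟨z', hz', hh⟩ | ⟨C, hC, ⟨z', hz', hz'C⟩, hxC⟩
      · rw [mem_singleton_iff] at hz'; subst hz'; exact Or.inl hh
      · rw [mem_singleton_iff] at hz'; subst hz'
        right
        rcases lh C hC with h1 | h1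
        · exact ⟨C, h1, hz'C, hxC⟩
        · exact absurd hz'C (hzH C h1)
    have h1 := ncard_le_ncard hsub (toFinite _)
    rw [ncard_coe_finset] at h1
    have h2 := h1.trans Finset.card_image_le
    rw [Set.ncard_singleton, mul_one]
    calc 4 * c * d * (nbr G (XY G D Z {z})).ncard ≤ 4 * c * d * μ := Nat.mul_le_mul_left _ (by omega)
      _ ≤ 8 * c * d * μ := by gcongr; omega
      _ < κ := hκ
  · push Not at hcase
    let rel : Set V → Set V → Prop := fun C C' => C ≠ C' ∧ ∃ z ∈ good, z ∈ nbr G C ∧ z ∈ nbr G C'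
    set E4 := (Hv ×ˢ Hv).filter (fun p => rel p.1 p.2) with hE4
    have hgU : ∀ z ∈ good, z ∈ U := fun z hz => (mem_filter.mp hz).1
    have hHC : ∀ C ∈ Hv, C ∈ Cs := fun C hC => (mem_filter.mp hC).1
    have e4 : E4.card ≤ (1 + (16 * d) ^ 2) * (d * h) := by
      refine torso (m := 16 * d) hsp Hv good id (fun v => {v}) ?_ (fun v _ => conn_singleton G v) ?_ (by simp) ?_ ?_ E4 ?_
      · intro C hC
        exact ((mC C).mp (hHC C hC)).1
      · intro C hC C' hC' hne
        exact hdC C (hHC C hC) C' (hHC C' hC') hne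
      · intro C hC u hu
        simp only [id, Set.disjoint_singleton_right]
        exact hUC u (hgU u hu) C (hHC C hC)
      · intro z hz
        obtain ⟨hzU, hzZ, hz1, hz2⟩ := mem_filter.mp hz
        refine le_trans ?_ hz2.le
        refine Finset.card_le_card_of_injOn (fun C => (C, z)) ?_ (by intro a _ b _ hab; simpa using hab)
        intro C hC
        rw [Finset.mem_coe, mem_filter] at hC
        rw [Finset.mem_coe, mem_filter]
        refine ⟨?_, rfl⟩
        rw [hE3, mem_filter, mem_product]
        exact ⟨⟨hC.1, hzU⟩, (hadjC z hzU C (hHC C hC.1)).mp hC.2.symm⟩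
      · intro p hp
        rw [hE4, mem_filter, mem_product] at hp
        obtain ⟨⟨h1, h2⟩, h3, z, hz, h4, h5⟩ := hp
        exact ⟨h1, h2, h3, z, hz, ((hadjC z (hgU z hz) _ (hHC _ h1)).mpr h4).symm,
          ((hadjC z (hgU z hz) _ (hHC _ h2)).mpr h5).symm⟩
    have hex : ∃ C ∈ Hv, 16 * c * d * (1 + (Hv.filter (rel C)).card) <
        (good.filter (fun z => z ∈ nbr G C)).card := by
      by_contra! hcon
      have h1 : good.card ≤ ∑ C ∈ Hv, (good.filter (fun z => z ∈ nbr G C)).card := by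
        refine le_trans (card_le_card ?_) Finset.card_biUnion_le
        intro z hz
        obtain ⟨C, hC, hzC⟩ := hcase z hz
        rw [Finset.mem_biUnion]
        exact ⟨C, hC, mem_filter.mpr ⟨hz, hzC⟩⟩
      have h2 := h1.trans (Finset.sum_le_sum hcon)
      rw [← Finset.mul_sum, Finset.sum_add_distrib] at h2
      have h3 : ∑ C ∈ Hv, (Hv.filter (rel C)).card = E4.card := by
        rw [hE4, card_filter, Finset.sum_product]
        refine Finset.sum_congr rfl (fun C _ => ?_)
        rw [← card_filter]
      rw [h3, Finset.sum_const, smul_eq_mul, mul_one] at h2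
      have h4 : good.card ≤ 16 * c * d * (1 + d * (1 + 256 * d ^ 2)) * h := by
        refine h2.trans ?_
        calc 16 * c * d * (h + E4.card) ≤ 16 * c * d * (h + (1 + (16 * d) ^ 2) * (d * h)) := by gcongr
          _ = _ := by ring
      have hMpos : 0 < M := by
        have := (Set.ncard_pos (toFinite Z)).mpr hne
        omega
      have h5 : M * k2 ≤ 64 * c * d ^ 2 * (1 + d * (1 + 256 * d ^ 2)) * M := by
        calc M * k2 ≤ 2 * good.card * k2 := Nat.mul_le_mul_right _ gM
          _ ≤ 2 * (16 * c * d * (1 + d * (1 + 256 * d ^ 2)) * h) * k2 := by gcongr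
          _ = 2 * (16 * c * d * (1 + d * (1 + 256 * d ^ 2))) * (h * k2) := by ring
          _ ≤ 2 * (16 * c * d * (1 + d * (1 + 256 * d ^ 2))) * (2 * d * M) := by gcongr
          _ = _ := by ring
      rw [mul_comm M] at h5
      have := Nat.le_of_mul_le_mul_right h5 hMpos
      omega
    obtain ⟨C, hC, hCY⟩ := hex
    set Yf := good.filter (fun z => z ∈ nbr G C) with hYf
    set Hd := Hv.filter (rel C) with hHd
    have hYZ : (↑Yf : Set V) ⊆ Z := by
      intro z hz
      rw [Finset.mem_coe, hYf, mem_filter, hgood, mem_filter] at hz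
      exact hz.1.2.1
    refine ⟨↑Yf, hYZ, ?_, ?_⟩
    · refine le_trans (ncard_le_ncard ?_ (toFinite _)) (hZ C ((mC C).mp (hHC C hC)))
      intro z hz
      exact (mem_filter.mp hz).2
    · have hsub : nbr G (XY G D Z ↑Yf) ⊆
          ↑(Yf.biUnion (fun z => (T.filter (fun p => p.1 = z)).image Prod.snd) ∪
            (insert C Hd).biUnion (fun C' => (toFinite (nbr G C')).toFinset)) := by
        intro x hx
        obtain ⟨hxU, hxz, hh⟩ := nX ↑Yf hYZ x hx
        rw [Finset.mem_coe, Finset.mem_union, Finset.mem_biUnion, Finset.mem_biUnion]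
        have hYU : ∀ z ∈ Yf, z ∈ U := fun z hz => hgU z (mem_filter.mp hz).1
        rcases hh with ⟨z, hz, hh⟩ | ⟨C', hC', ⟨z, hz, hzC⟩, hxC⟩
        · left
          exact ⟨z, hz, lightT z (hYU z hz) x hxU (fun h => hxz (h ▸ hz)) (Or.inl hh)⟩
        · rcases lh C' hC' with h1 | h1
          · left
            exact ⟨z, hz, lightT z (hYU z hz) x hxU (fun h => hxz (h ▸ hz)) (Or.inr ⟨C', h1, hzC, hxC⟩)⟩
          · right
            refine ⟨C', ?_, by simpa using hxC⟩
            rw [Finset.mem_insert]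
            by_cases hCC : C' = C
            · exact Or.inl hCC
            · right
              rw [hHd, mem_filter]
              have hz' := mem_filter.mp hz
              exact ⟨h1, Ne.symm hCC, z, hz'.1, hz'.2, hzC⟩
      have h1 := ncard_le_ncard hsub (toFinite _)
      rw [ncard_coe_finset] at h1
      have h2 := h1.trans (card_union_le _ _)
      have h3 : (Yf.biUnion (fun z => (T.filter (fun p => p.1 = z)).image Prod.snd)).card ≤ Yf.card * μ := by
        refine card_biUnion_le_card_mul _ _ _ ?_
        intro z hz
        refine Finset.card_image_le.trans ?_
        have := (mem_filter.mp hz).1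
        rw [hgood, mem_filter] at this
        exact this.2.2.1.le
      have h4 : ((insert C Hd).biUnion (fun C' => (toFinite (nbr G C')).toFinset)).card ≤
          (1 + Hd.card) * (2 * κ) := by
        refine (card_biUnion_le_card_mul _ _ (2 * κ) ?_).trans ?_
        · intro C' hC'
          rw [← ncard_eq_toFinset_card]
          have : C' ∈ Cs := by
            rw [Finset.mem_insert] at hC'
            rcases hC' with rfl | h
            · exact hHC _ hC
            · exact hHC _ (mem_filter.mp h).1
          have := hZ C' ((mC C').mp this)
          omega
        · have := Finset.card_insert_le C Hd
          gcongr
          omega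
      rw [ncard_coe_finset]
      have hYpos : 0 < Yf.card := by omega
      have h5 : (8 * c * d * μ) * Yf.card < κ * Yf.card := Nat.mul_lt_mul_of_pos_right hκ hYpos
      have h6 : κ * (16 * c * d * (1 + Hd.card)) ≤ κ * Yf.card := Nat.mul_le_mul_left _ hCY.le
      have h7 : 4 * c * d * (nbr G (XY G D Z ↑Yf)).ncard ≤
          4 * c * d * (Yf.card * μ + (1 + Hd.card) * (2 * κ)) := Nat.mul_le_mul_left _ (by omega)
      have h8 : 2 * (4 * c * d * (Yf.card * μ + (1 + Hd.card) * (2 * κ))) =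
          (8 * c * d * μ) * Yf.card + κ * (16 * c * d * (1 + Hd.card)) := by ring
      omega

theorem lemA [Finite V] {Nf : Set V → Prop} {c κ d k2 : ℕ} {D Z : Set V}
    (hsp : Sparse G d) (hc : 1 ≤ c) (hd : 1 ≤ d) (hcκ : c ≤ κ)
    (hκd : 2 * d * (1 + c) ≤ κ)
    (hk2 : 64 * c * d ^ 2 * (1 + d * (1 + 256 * d ^ 2)) < k2) (hk2d : 2 * d ≤ k2)
    (hκ : 8 * c * d * (16 * d * (2 + k2 ^ 2)) < κ)
    (hmono : ∀ X Y, X ⊆ Y → Nf X → Nf Y)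
    (hfree : ∀ X, ¬ Nf X → ∀ C ⊆ X, ∀ β, ¬ HavenIn G C c β)
    (hZ : Adm G Nf (κ + c) D Z) (hmin : ∀ Z', Adm G Nf (κ + c) D Z' → Z.ncard ≤ Z'.ncard)
    (hS : 7 * (nbr G D).ncard ≤ Z.ncard) (hne : Z.Nonempty) :
    ∃ X Y, X ⊆ D ∧ Y ⊆ D ∧ Y.ncard ≤ κ + c ∧ (nbr G X).ncard ≤ κ * (κ + c) ∧ Nf X ∧
      ∀ Q ⊆ X \ Y, Conn G Q → ¬ Nf Q := by
  obtain ⟨Y, hY, hYc, hlt⟩ := exists_Y hsp hc hd hcκ hk2 hk2d hκ hZ.1 (fun C hC => (hZ.2 C hC).2)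
    hS hne
  refine ⟨XY G D Z Y, Y, XY_subset hZ.1 hY, hY.trans hZ.1, hYc, ?_,
    exchange hsp hκd hmono hfree hZ hmin hY hlt, ?_⟩
  · have h1 : κ * Y.ncard ≤ κ * (κ + c) := Nat.mul_le_mul_left _ hYc
    have h2 : 1 * (nbr G (XY G D Z Y)).ncard ≤ 4 * c * d * (nbr G (XY G D Z Y)).ncard :=
      Nat.mul_le_mul_right _ (by nlinarith)
    omega
  · intro Q hQ hQc hQn
    obtain ⟨C, hC, hQC⟩ := conn_in_comp hQc (hQ.trans (XY_diff hY))
    exact (hZ.2 C hC).1 (hmono _ _ hQC hQn)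

def IsWalk (G : SimpleGraph V) (n : ℕ) (f : ℕ → V) : Prop := ∀ i < n, G.Adj (f i) (f (i + 1))

def IsPth (G : SimpleGraph V) (n : ℕ) (f : ℕ → V) : Prop :=
  IsWalk G n f ∧ ∀ i ≤ n, ∀ j ≤ n, f i = f j → i = j

theorem IsWalk.seg_conn {n : ℕ} {f : ℕ → V} (h : IsWalk G n f) {a b : ℕ}
    (hab : a ≤ b) (hb : b ≤ n) : Conn G (f '' {i | a ≤ i ∧ i ≤ b}) := by
  induction b, hab using Nat.le_induction with
  | base =>
    have : f '' {i | a ≤ i ∧ i ≤ a} = {f a} := by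
      ext x
      simp only [Set.mem_image, mem_singleton_iff]
      constructor
      · rintro ⟨i, hi, rfl⟩
        rw [le_antisymm hi.2 hi.1]
      · rintro rfl
        exact ⟨a, ⟨le_refl _, le_refl _⟩, rfl⟩
    rw [this]; exact conn_singleton G _
  | succ b hab ih =>
    have := (ih (by omega)).insert_adj (a := f b) (b := f (b + 1)) ⟨b, ⟨hab, le_refl _⟩, rfl⟩
      (h b (by omega))
    convert this using 1
    ext x
    simp only [Set.mem_image, mem_insert_iff]
    constructor
    · rintro ⟨i, hi, rfl⟩
      by_cases h' : i = b + 1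
      · left; rw [h']
      · right; exact ⟨i, ⟨hi.1, by have := hi.2; omega⟩, rfl⟩
    · rintro (rfl | ⟨i, hi, rfl⟩)
      · exact ⟨b + 1, ⟨by omega, le_refl _⟩, rfl⟩
      · exact ⟨i, ⟨hi.1, by have := hi.2; omega⟩, rfl⟩

theorem IsWalk.splice {n : ℕ} {f : ℕ → V} (h : IsWalk G n f) {i j : ℕ}
    (hij : i < j) (hj : j ≤ n) (hadj : G.Adj (f i) (f j)) :
    IsWalk G (n - (j - i - 1)) (fun k => if k ≤ i then f k else f (k + (j - i - 1))) := by
  intro k hk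
  by_cases h1 : k + 1 ≤ i
  · simp only [h1, if_true, (by omega : k ≤ i)]
    exact h k (by omega)
  · by_cases h2 : k = i
    · subst h2
      simp only [le_refl, if_true, h1, if_false]
      rw [show k + 1 + (j - k - 1) = j by omega]
      exact hadj
    · dsimp only
      rw [if_neg (by omega : ¬ k ≤ i), if_neg h1]
      rw [show k + 1 + (j - i - 1) = (k + (j - i - 1)) + 1 by omega]
      exact h _ (by omega)

theorem exists_path {Q T : Set V} (hQ : Conn G Q) {x : V} (hx : x ∈ Q)
    (hT : (Q ∩ T).Nonempty) : ∃ (n : ℕ) (f : ℕ → V), IsPth G n f ∧ f 0 = x ∧ f n ∈ T ∧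
      (∀ i ≤ n, f i ∈ Q) ∧ (∀ i < n, f i ∉ T) ∧
      (∀ i j, i < j → j ≤ n → G.Adj (f i) (f j) → j = i + 1) := by
  have hex : ∃ n, ∃ f : ℕ → V, IsWalk G n f ∧ f 0 = x ∧ f n ∈ T ∧ (∀ i ≤ n, f i ∈ Q) := by
    have hsub : Q ⊆ {y | ∃ n, ∃ f : ℕ → V, IsWalk G n f ∧ f 0 = x ∧ f n = y ∧ (∀ i ≤ n, f i ∈ Q)} := by
      refine hQ.closed _ hx ⟨0, fun _ => x, fun i hi => absurd hi (by omega), rfl, rfl, fun _ _ => hx⟩ ?_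
      rintro u hu ⟨n, f, h1, h2, h3, h4⟩ v hv huv
      refine ⟨n + 1, fun k => if k ≤ n then f k else v, ?_, by simpa using h2, by simp, ?_⟩
      · intro k hk
        by_cases hkn : k + 1 ≤ n
        · simp only [hkn, if_true, (by omega : k ≤ n)]
          exact h1 k (by omega)
        · have : k = n := by omega
          subst this
          simp only [le_refl, if_true, hkn, if_false]
          rw [h3]; exact huv
      · intro i hi
        by_cases h : i ≤ n
        · simp only [h, if_true]; exact h4 i h
        · simp only [h, if_false]; exact hv
    obtain ⟨y, hy, hyT⟩ := hT
    obtain ⟨n, f, h1, h2, h3, h4⟩ := hsub hy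
    exact ⟨n, f, h1, h2, h3 ▸ hyT, h4⟩
  obtain ⟨f, h1, h2, h3, h4⟩ := Nat.find_spec hex
  set n := Nat.find hex with hn
  have hmin : ∀ m < n, ¬ ∃ f : ℕ → V, IsWalk G m f ∧ f 0 = x ∧ f m ∈ T ∧ (∀ i ≤ m, f i ∈ Q) :=
    fun m hm => Nat.find_min hex hm
  have hfT : ∀ i < n, f i ∉ T := fun i hi hfi =>
    hmin i hi ⟨f, fun j hj => h1 j (by omega), h2, hfi, fun j hj => h4 j (by omega)⟩
  have hch : ∀ i j, i < j → j ≤ n → G.Adj (f i) (f j) → j = i + 1 := by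
    intro i j hij hj hadj
    by_contra hne
    refine hmin (n - (j - i - 1)) (by omega) ⟨_, h1.splice hij hj hadj, by simpa using h2, ?_, ?_⟩
    · rw [if_neg (by omega), show n - (j - i - 1) + (j - i - 1) = n by omega]
      exact h3
    · intro k hk
      split_ifs with h
      · exact h4 k (by omega)
      · exact h4 _ (by omega)
  refine ⟨n, f, ⟨h1, ?_⟩, h2, h3, h4, hfT, hch⟩
  have key : ∀ i j, i < j → j ≤ n → f i ≠ f j := by
    intro i j hij hj he
    by_cases hjn : j = n
    · subst hjn; exact hfT i hij (he ▸ h3)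
    · have := hch i (j + 1) (by omega) (by omega) (he ▸ h1 j (by omega))
      omega
  intro i hi j hj hij
  rcases lt_trichotomy i j with h | h | h
  · exact absurd hij (key i j h hj)
  · exact h
  · exact absurd hij.symm (key j i h hi)

theorem IsPth.append {n m : ℕ} {f g : ℕ → V} (hf : IsPth G n f)
    (hg : IsPth G m g) (h0 : g 0 = f n) (hd : ∀ i < n, ∀ j ≤ m, f i ≠ g j) :
    IsPth G (n + m) (fun k => if k ≤ n then f k else g (k - n)) := by
  constructor
  · intro k hk
    by_cases h1 : k + 1 ≤ n
    · simp only [h1, if_true, (by omega : k ≤ n)]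
      exact hf.1 k (by omega)
    · by_cases h2 : k = n
      · subst h2
        simp only [le_refl, if_true, h1, if_false]
        rw [← h0, show k + 1 - k = 0 + 1 by omega]
        exact hg.1 0 (by omega)
      · dsimp only
        rw [if_neg (by omega : ¬ k ≤ n), if_neg h1]
        rw [show k + 1 - n = (k - n) + 1 by omega]
        exact hg.1 _ (by omega)
  · intro i hi j hj hij
    have hmix : ∀ i j, i ≤ n → n < j → j ≤ n + m → f i ≠ g (j - n) := by
      intro i j hi hj hj' he
      by_cases h : i = n
      · subst h
        rw [← h0] at he
        have := hg.2 0 (by omega) (j - i) (by omega) he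
        omega
      · exact hd i (by omega) (j - n) (by omega) he
    dsimp only at hij
    split_ifs at hij with h1 h2 h2
    · exact hf.2 i h1 j h2 hij
    · exact absurd hij (hmix i j h1 (by omega) hj)
    · exact absurd hij.symm (hmix j i h2 (by omega) hi)
    · have := hg.2 _ (by omega) _ (by omega) hij
      omega

theorem path_meets_all {ι : Type} [Fintype ι] [Nonempty ι] (B : ι → Set V)
    (hB : ∀ i, Conn G (B i)) (hi : ∀ i j, (B i ∩ B j).Nonempty) :
    ∃ n f, IsPth G n f ∧ ∀ i, ∃ k ≤ n, f k ∈ B i := by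
  let cnt : ℕ → (ℕ → V) → ℕ := fun n f => (Finset.univ.filter (fun i => ∃ k ≤ n, f k ∈ B i)).card
  let P : ℕ → Prop := fun m => ∃ n f i, IsPth G n f ∧ f n ∈ B i ∧ (∀ k < n, f k ∉ B i) ∧ cnt n f = m
  have hP0 : ∃ m, P m := by
    obtain ⟨i⟩ := ‹Nonempty ι›
    obtain ⟨x, hx⟩ := (hB i).1
    exact ⟨_, 0, fun _ => x, i, ⟨fun i hi => absurd hi (by omega), fun i hi j hj _ => by omega⟩, hx,
      fun k hk => absurd hk (by omega), rfl⟩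
  have hbd : ∀ m, P m → m ≤ Fintype.card ι := by
    rintro m ⟨n, f, i, _, _, _, rfl⟩
    exact (Finset.card_filter_le _ _).trans (le_of_eq Finset.card_univ)
  obtain ⟨m0, hm0⟩ := hP0
  have hmaxP := Nat.findGreatest_spec (P := P) (hbd m0 hm0) hm0
  have hmax : ∀ m, P m → m ≤ Nat.findGreatest P (Fintype.card ι) := fun m hm =>
    Nat.le_findGreatest (hbd m hm) hm
  obtain ⟨n, f, i, hf, hfi, hfn, hcnt⟩ := hmaxP
  refine ⟨n, f, hf, ?_⟩
  by_contra! hcon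
  obtain ⟨j, hj⟩ := hcon
  obtain ⟨m, g, hg, g0, gm, gQ, gT, _⟩ := exists_path (T := B j) (hB i) hfi (hi i j)
  have happ := hf.append hg g0 (by
    intro k hk l hl he
    exact hfn k hk (he ▸ gQ l hl))
  set F : ℕ → V := fun k => if k ≤ n then f k else g (k - n) with hF
  have hm1 : 1 ≤ m := by
    by_contra h
    have : m = 0 := by omega
    subst this
    rw [g0] at gm
    exact hj n (le_refl _) gm
  have hFe : F (n + m) = g m := by
    simp only [hF, if_neg (by omega : ¬ n + m ≤ n), Nat.add_sub_cancel_left]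
  have hlt : cnt n f < cnt (n + m) F := by
    refine Finset.card_lt_card ?_
    rw [Finset.ssubset_iff_of_subset]
    · refine ⟨j, ?_, ?_⟩
      · simp only [mem_filter, Finset.mem_univ, true_and]
        exact ⟨n + m, le_refl _, hFe ▸ gm⟩
      · simp only [mem_filter, Finset.mem_univ, true_and]
        rintro ⟨k, hk, hk'⟩
        exact hj k hk hk'
    · intro i' hi'
      simp only [mem_filter, Finset.mem_univ, true_and] at hi' ⊢
      obtain ⟨k, hk, hk'⟩ := hi'
      refine ⟨k, by omega, ?_⟩
      simp only [hF, if_pos hk]; exact hk'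
  have := hmax (cnt (n + m) F) ⟨n + m, F, j, happ, hFe ▸ gm, ?_, rfl⟩
  · rw [← hcnt] at this; omega
  · intro k hk
    by_cases h : k ≤ n
    · simp only [hF, if_pos h]; exact hj k h
    · simp only [hF, if_neg h]; exact gT _ (by omega)

theorem comb {n t : ℕ} {f : ℕ → V} (hf : IsPth G n f) {Sp : Set V}
    (hL : Linked G Sp (f '' {i | i ≤ n}) t) : ∃ B : Fin t → Set V, (∀ i, Conn G (B i)) ∧
      (∀ i j, i ≠ j → Disjoint (B i) (B j)) ∧ (∀ i, (B i ∩ Sp).Nonempty) ∧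
      ∀ i j : Fin t, (j : ℕ) = i + 1 → SAdj G (B i) (B j) := by
  obtain ⟨Q, q1, q2, q3, q4⟩ := hL
  have htrim : ∀ i, ∃ R ⊆ Q i, Conn G R ∧ (R ∩ Sp).Nonempty ∧ ∃ p ≤ n, R ∩ (f '' {i | i ≤ n}) = {f p} := by
    intro i
    obtain ⟨x, hx, hxS⟩ := q3 i
    obtain ⟨m, g, hg, g0, gm, gQ, gT, _⟩ := exists_path (T := f '' {i | i ≤ n}) (q1 i) hx (q4 i)
    obtain ⟨p, hp, hpe⟩ := gm
    refine ⟨g '' {k | 0 ≤ k ∧ k ≤ m}, ?_, hg.1.seg_conn (Nat.zero_le _) le_rfl,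
      ⟨x, ⟨0, ⟨le_rfl, Nat.zero_le _⟩, g0⟩, hxS⟩, p, hp, ?_⟩
    · rintro _ ⟨k, hk, rfl⟩
      exact gQ k hk.2
    · ext y
      simp only [Set.mem_inter_iff, mem_singleton_iff]
      constructor
      · rintro ⟨⟨k, hk, rfl⟩, hy⟩
        by_cases hkm : k < m
        · exact absurd hy (gT k hkm)
        · rw [le_antisymm hk.2 (by omega), hpe]
      · rintro rfl
        exact ⟨⟨m, ⟨Nat.zero_le _, le_rfl⟩, hpe.symm⟩, p, hp, rfl⟩
  choose R hRQ hRc hRS pos hpos hRp using htrim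
  have hRdis : ∀ i j, i ≠ j → Disjoint (R i) (R j) := fun i j h => (q2 i j h).mono (hRQ i) (hRQ j)
  have hfR : ∀ i, f (pos i) ∈ R i := by
    intro i
    have : f (pos i) ∈ R i ∩ (f '' {i | i ≤ n}) := by rw [hRp]; rfl
    exact this.1
  have hinj : Function.Injective pos := by
    intro i j hij
    by_contra hne
    exact disj (hRdis i j hne) (hfR i) (hij ▸ hfR j)
  have hcard : (Finset.univ.image pos).card = t := by
    rw [Finset.card_image_of_injective _ hinj]; simp
  set e := (Finset.univ.image pos).orderEmbOfFin hcard with he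
  have hidx : ∀ j, ∃ i, pos i = e j := by
    intro j
    have := Finset.orderEmbOfFin_mem (Finset.univ.image pos) hcard j
    obtain ⟨i, _, hi⟩ := Finset.mem_image.mp this
    exact ⟨i, hi⟩
  choose idx hidx using hidx
  have hidxinj : ∀ i j, i ≠ j → idx i ≠ idx j := by
    intro i j hij h
    apply hij
    apply e.injective
    rw [← hidx, ← hidx, h]
  have hen : ∀ j, e j ≤ n := fun j => hidx j ▸ hpos _
  let seg : Fin t → Set V := fun j => f '' {i | i ≤ e j ∧ ∀ j' < j, e j' < i}
  have hself : ∀ j, f (e j) ∈ seg j := fun j => ⟨e j, ⟨le_rfl, fun j' h => e.strictMono h⟩, rfl⟩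
  have hsegc : ∀ j, Conn G (seg j) := by
    intro j
    refine conn_of_base (f (e j)) (hself j) ?_
    rintro _ ⟨i, hi, rfl⟩
    refine ⟨f '' {k | i ≤ k ∧ k ≤ e j}, ?_, hf.1.seg_conn hi.1 (hen j), ⟨e j, ⟨hi.1, le_rfl⟩, rfl⟩,
      ⟨i, ⟨le_rfl, hi.1⟩, rfl⟩⟩
    rintro _ ⟨k, hk, rfl⟩
    exact ⟨k, ⟨hk.2, fun j' h => lt_of_lt_of_le (hi.2 j' h) hk.1⟩, rfl⟩
  have hsegP : ∀ j, seg j ⊆ f '' {i | i ≤ n} := by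
    rintro j _ ⟨i, hi, rfl⟩
    exact ⟨i, hi.1.trans (hen j), rfl⟩
  have hsegR : ∀ i j, i ≠ j → Disjoint (seg i) (R (idx j)) := by
    intro i j hij
    rw [disjoint_left]
    rintro _ ⟨k, hk, rfl⟩ hkR
    have : f k ∈ R (idx j) ∩ (f '' {i | i ≤ n}) := ⟨hkR, k, hk.1.trans (hen i), rfl⟩
    rw [hRp, mem_singleton_iff] at this
    have := hf.2 k (hk.1.trans (hen i)) _ (hpos _) this
    rw [hidx] at this
    subst this
    rcases lt_or_gt_of_ne hij with h | h
    · have := e.strictMono h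
      exact absurd hk.1 (not_le.mpr this)
    · exact absurd (hk.2 j h) (lt_irrefl _)
  have hsegseg : ∀ i j, i < j → Disjoint (seg i) (seg j) := by
    intro i j hij
    rw [disjoint_left]
    rintro _ ⟨k, hk, rfl⟩ ⟨l, hl, hlk⟩
    have := hf.2 l (hl.1.trans (hen j)) k (hk.1.trans (hen i)) hlk
    subst this
    exact absurd (hl.2 i hij) (not_lt.mpr hk.1)
  refine ⟨fun j => R (idx j) ∪ seg j, ?_, ?_, ?_, ?_⟩
  · intro j
    refine (hRc _).union (hsegc j) ⟨f (e j), ?_, hself j⟩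
    rw [← hidx]; exact hfR _
  · intro i j hij
    have h1 : Disjoint (seg i) (seg j) := by
      rcases lt_or_gt_of_ne hij with h | h
      · exact hsegseg i j h
      · exact (hsegseg j i h).symm
    simp only [Set.disjoint_union_left, Set.disjoint_union_right]
    exact ⟨⟨hRdis _ _ (hidxinj i j hij), hsegR i j hij⟩, (hsegR j i hij.symm).symm, h1⟩
  · intro i
    obtain ⟨x, hx, hxS⟩ := hRS (idx i)
    exact ⟨x, Or.inl hx, hxS⟩
  · intro i j hij
    have hlt : i < j := by rw [Fin.lt_def]; omega
    have hlt' := e.strictMono hlt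
    refine ⟨f (e i), Or.inr (hself i), f (e i + 1), Or.inr ⟨e i + 1, ⟨by omega, ?_⟩, rfl⟩,
      hf.1 _ (lt_of_lt_of_le hlt' (hen j))⟩
    intro j' hj'
    have : j' ≤ i := by rw [Fin.le_def]; rw [Fin.lt_def] at hj'; omega
    have := e.monotone this
    omega

def NL (G : SimpleGraph V) (Nf : Set V → Prop) (t : ℕ) : Prop :=
  ∃ B : Fin t → Set V, (∀ i, Conn G (B i)) ∧ (∀ i, Nf (B i)) ∧
    (∀ i j, i ≠ j → Disjoint (B i) (B j)) ∧ ∀ i j : Fin t, (j : ℕ) = i + 1 → SAdj G (B i) (B j)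

theorem nbr_comp_subset {X C : Set V} (h : IsComp G X C) :
    nbr G C ⊆ nbr G X := by
  rintro y ⟨hy, x, hx, hxy⟩
  exact ⟨fun hyX => hy (h.2.2 x hx y hyX hxy), x, h.2.1 hx, hxy⟩

theorem partA [Finite V] {Nf : Set V → Prop} {c κ d k2 t p : ℕ}
    (hsp : Sparse G d) (hc : 1 ≤ c) (hd : 1 ≤ d) (hcκ : c ≤ κ)
    (hκd : 2 * d * (1 + c) ≤ κ)
    (hk2 : 64 * c * d ^ 2 * (1 + d * (1 + 256 * d ^ 2)) < k2) (hk2d : 2 * d ≤ k2)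
    (hκ : 8 * c * d * (16 * d * (2 + k2 ^ 2)) < κ)
    (hmono : ∀ X Y, X ⊆ Y → Nf X → Nf Y)
    (hcomp : ∀ X, Nf X → ∃ C, IsComp G X C ∧ Nf C)
    (hfree : ∀ X, ¬ Nf X → ∀ C ⊆ X, ∀ β, ¬ HavenIn G C c β)
    (hp : 8 * (t + 1) * (κ * (κ + c)) ≤ p)
    {β : Set V → Set V} (hβ : HavenIn G univ p β) (hβN : ∀ S : Set V, S.ncard ≤ p → Nf (β S)) :
    NL G Nf t := by
  set K1 := κ * (κ + c) with hK1
  have hκ1 : 1 ≤ κ := hc.trans hcκ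
  have hK1c : κ + c ≤ K1 := by nlinarith
  have hK11 : 1 ≤ K1 := by omega
  have hp2 : 2 * K1 ≤ p := by nlinarith
  have hβc : ∀ S : Set V, S.ncard ≤ p → IsComp G Sᶜ (β S) := by
    intro S hS
    have := hβ.1 S (subset_univ _) hS
    rwa [← Set.compl_eq_univ_sdiff] at this
  have hβm : ∀ S S' : Set V, S ⊆ S' → S'.ncard ≤ p → β S' ⊆ β S := fun S S' h h' =>
    hβ.2 S S' h (subset_univ _) h'
  let Sp : Set V → Prop := fun X => Conn G X ∧ Nf X ∧ (nbr G X).ncard ≤ K1 ∧ Disjoint (β (nbr G X)) X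
  have : Fintype (Set V) := Fintype.ofFinite _
  let Fam := (Finset.univ : Finset (Finset (Set V))).filter (fun A => (∀ X ∈ A, Sp X) ∧
    ∀ X ∈ A, ∀ Y ∈ A, X ≠ Y → Disjoint X Y)
  obtain ⟨A, hA, hAmax⟩ := Finset.exists_max_image Fam Finset.card ⟨∅, by simp [Fam]⟩
  simp only [Fam, mem_filter, Finset.mem_univ, true_and] at hA
  obtain ⟨hASp, hAdis⟩ := hA
  have hnew : ∀ X, Sp X → (∀ Y ∈ A, Disjoint X Y) → False := by
    intro X hX hXA
    have hXn : X ∉ A := by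
      intro h
      obtain ⟨x, hx⟩ := hX.1.1
      exact disj (hXA X h) hx hx
    have := hAmax (insert X A) (by
      simp only [Fam, mem_filter, Finset.mem_univ, true_and]
      constructor
      · intro Y hY
        rcases Finset.mem_insert.mp hY with rfl | hY
        · exact hX
        · exact hASp Y hY
      · intro Y hY Y' hY' hne
        rcases Finset.mem_insert.mp hY with hYa | hYa <;> rcases Finset.mem_insert.mp hY' with hYb | hYb
        · exact absurd (hYa.trans hYb.symm) hne
        · rw [hYa]; exact hXA _ hYb
        · rw [hYb]; exact (hXA _ hYa).symm
        · exact hAdis _ hYa _ hYb hne)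
    rw [Finset.card_insert_of_notMem hXn] at this
    omega
  let Bl : Set (Set V) := {X | X ∈ A ∨ ∃ v, X = {v} ∧ ∀ Y ∈ A, v ∉ Y}
  have hBlc : ∀ X ∈ Bl, Conn G X := by
    rintro X (h | ⟨v, rfl, _⟩)
    · exact (hASp X h).1
    · exact conn_singleton G v
  have hBlcov : ∀ v, ∃ X ∈ Bl, v ∈ X := by
    intro v
    by_cases h : ∃ X ∈ A, v ∈ X
    · obtain ⟨X, hX, hv⟩ := h
      exact ⟨X, Or.inl hX, hv⟩
    · push Not at h
      exact ⟨{v}, Or.inr ⟨v, rfl, h⟩, rfl⟩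
  have hBldis : ∀ X ∈ Bl, ∀ Y ∈ Bl, X ≠ Y → Disjoint X Y := by
    rintro X (h | ⟨v, rfl, h⟩) Y (h' | ⟨v', rfl, h'⟩) hne
    · exact hAdis X h Y h' hne
    · simpa using h' X h
    · simpa using h Y h'
    · simpa using fun h => hne (by rw [h])
  let Γ : SimpleGraph (Set V) :=
    { Adj := fun X Y => X ≠ Y ∧ X ∈ Bl ∧ Y ∈ Bl ∧ SAdj G X Y
      symm := ⟨fun _ _ h => ⟨h.1.symm, h.2.2.1, h.2.1, h.2.2.2.symm⟩⟩
      loopless := ⟨fun _ h => h.1 rfl⟩ }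
  let sep : Set (Set V) → Set V := fun σ => ⋃ X ∈ σ ∩ Bl, (if X ∈ A then nbr G X else X)
  have hsepc : ∀ σ : Set (Set V), σ.ncard < t → (sep σ).ncard ≤ t * K1 := by
    intro σ hσ
    have : σ.Finite := toFinite _
    have h1 : sep σ ⊆ ↑(this.toFinset.biUnion (fun X =>
        (toFinite (if X ∈ A then nbr G X else if X ∈ Bl then X else ∅)).toFinset)) := by
      intro v hv
      simp only [sep, mem_iUnion] at hv
      obtain ⟨X, ⟨hXσ, hXB⟩, hv⟩ := hv
      simp only [Finset.coe_biUnion, mem_iUnion, Set.Finite.coe_toFinset]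
      refine ⟨X, hXσ, ?_⟩
      rwa [if_pos hXB]
    refine (ncard_le_ncard h1 (toFinite _)).trans ?_
    rw [ncard_coe_finset]
    refine (card_biUnion_le_card_mul _ _ K1 ?_).trans ?_
    · intro X _
      rw [← ncard_eq_toFinset_card]
      split_ifs with h h'
      · exact (hASp X h).2.2.1
      · rcases h' with h' | ⟨v, rfl, _⟩
        · exact absurd h' h
        · simpa using hK11
      · simp
    · rw [← ncard_eq_toFinset_card]
      exact Nat.mul_le_mul_right _ hσ.le
  have htK : t * K1 + t * K1 ≤ p := by nlinarith
  have hsepd : ∀ σ : Set (Set V), σ.ncard < t → ∀ X ∈ σ ∩ Bl, Disjoint (β (sep σ)) X := by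
    intro σ hσ X hX
    have hsc := hsepc σ hσ
    have hsub : (if X ∈ A then nbr G X else X) ⊆ sep σ := subset_biUnion_of_mem (u := fun X => if X ∈ A then nbr G X else X) hX
    by_cases hXA : X ∈ A
    · rw [if_pos hXA] at hsub
      exact (hASp X hXA).2.2.2.mono_left (hβm _ _ hsub (by omega))
    · rw [if_neg hXA] at hsub
      have := (hβc (sep σ) (by omega)).2.1
      rw [disjoint_left]
      intro x hx hxX
      exact this hx (hsub hxX)
  have hbig : ∀ σ : Set (Set V), ∃ K, σ.ncard < t → IsComp G (⋃₀ (σ ∩ Bl))ᶜ K ∧ β (sep σ) ⊆ K := by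
    intro σ
    by_cases hσ : σ.ncard < t
    · have hsc := hsepc σ hσ
      obtain ⟨K, h1, h2⟩ := conn_in_comp (X := (⋃₀ (σ ∩ Bl))ᶜ) (hβc (sep σ) (by omega)).1 (by
        rintro x hx ⟨X, hX, hxX⟩
        exact disj (hsepd σ hσ X hX) hx hxX)
      exact ⟨K, fun _ => ⟨h1, h2⟩⟩
    · exact ⟨∅, fun h => absurd h hσ⟩
  choose K hK using hbig
  have hKin : ∀ σ : Set (Set V), σ.ncard < t → ∀ X ∈ Bl, (X ∩ K σ).Nonempty → X ⊆ K σ := by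
    intro σ hσ X hX hm
    refine (hK σ hσ).1.subset_of_conn (hBlc X hX) ?_ hm
    rintro x hx ⟨Y, hY, hxY⟩
    obtain ⟨z, hz, hzK⟩ := hm
    have hne : X ≠ Y := by
      rintro rfl
      exact (hK σ hσ).1.2.1 hzK ⟨X, hY, hz⟩
    exact disj (hBldis X hX Y hY.2 hne) hx hxY
  have hspecial : ∀ σ : Set (Set V), σ.ncard < t → ∃ X ∈ A, X ⊆ K σ := by
    intro σ hσ
    by_contra! hcon
    have hsc := hsepc σ hσ
    set S := sep σ with hS
    set D := β S with hD
    have hDc : IsComp G Sᶜ D := hβc S (by omega)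
    have hDA : ∀ X ∈ A, Disjoint D X := by
      intro X hX
      rw [disjoint_left]
      intro x hx hxX
      exact hcon X hX (hKin σ hσ X (Or.inl hX) ⟨x, hxX, (hK σ hσ).2 hx⟩)
    have hnD : (nbr G D).ncard ≤ t * K1 := (ncard_le_ncard hDc.nbr_subset (toFinite _)).trans hsc
    have hexZ : ∃ m, ∃ Z, Adm G Nf (κ + c) D Z ∧ Z.ncard = m := by
      refine ⟨_, D, ⟨subset_rfl, ?_⟩, rfl⟩
      intro C hC
      obtain ⟨x, hx⟩ := hC.1.1
      exact absurd (hC.2.1 hx) (by simp)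
    obtain ⟨Z, hZ, hZm⟩ := Nat.find_spec hexZ
    have hmin : ∀ Z', Adm G Nf (κ + c) D Z' → Z.ncard ≤ Z'.ncard := by
      intro Z' hZ'
      rw [hZm]
      exact Nat.find_min' hexZ ⟨Z', hZ', rfl⟩
    have hbigZ : ¬ (Z ∪ S).ncard ≤ p := by
      intro hle
      have h1 := hβc (Z ∪ S) hle
      have h2 := hβm S (Z ∪ S) subset_union_right hle
      obtain ⟨C, hC, hsub⟩ := conn_in_comp (X := D \ Z) h1.1
        (fun x hx => ⟨h2 hx, fun hz => h1.2.1 hx (Or.inl hz)⟩)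
      exact (hZ.2 C hC).1 (hmono _ _ hsub (hβN _ hle))
    have hu := ncard_union_le Z S
    have hp8 : 7 * (t * K1) + t * K1 + 8 * K1 ≤ p := by nlinarith
    obtain ⟨X, Y, hXD, hYD, hYc, hXc, hXN, hXQ⟩ := lemA hsp hc hd hcκ hκd hk2 hk2d hκ hmono hfree hZ hmin
      (by omega) (by rw [← Set.ncard_pos (toFinite Z)]; omega)
    obtain ⟨X', hX', hX'N⟩ := hcomp X hXN
    have hnX : (nbr G X').ncard ≤ K1 :=
      (ncard_le_ncard (nbr_comp_subset hX') (toFinite _)).trans hXc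
    refine hnew X' ⟨hX'.1, hX'N, hnX, ?_⟩ (fun Y hY => (hDA Y hY).mono_left (hX'.2.1.trans hXD))
    by_contra hnd
    rw [Set.not_disjoint_iff] at hnd
    obtain ⟨x, hx, hxX⟩ := hnd
    have e1 : IsComp G (nbr G X')ᶜ X' := isComp_nbr hX'.1 subset_rfl (by
      rw [disjoint_left]; intro y hy hy'; exact hy'.1 hy)
    have e2 := (hβc (nbr G X') (by omega)).eq_of_inter e1 ⟨x, hx, hxX⟩
    have hun := ncard_union_le (nbr G X') Y
    have hle : (nbr G X' ∪ Y).ncard ≤ p := by omega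
    have h1 := hβc _ hle
    have h2 := hβm (nbr G X') _ subset_union_left hle
    rw [e2] at h2
    exact hXQ _ (fun y hy => ⟨hX'.2.1 (h2 hy), fun hyY => h1.2.1 hy (Or.inr hyY)⟩) h1.1 (hβN _ hle)
  let bs : Set (Set V) → Set (Set V) := fun σ => {X | X ∈ Bl ∧ X ⊆ K σ}
  have hbsc : ∀ σ : Set (Set V), σ.ncard < t → Conn Γ (bs σ) := by
    intro σ hσ
    obtain ⟨X0, hX0, hX0K⟩ := hspecial σ hσ
    refine ⟨⟨X0, Or.inl hX0, hX0K⟩, ?_⟩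
    rintro M ⟨X, hX, hXM⟩ hcl
    obtain ⟨x, hx⟩ := (hBlc X hX.1).1
    have : K σ ⊆ {v | ∃ Y ∈ bs σ, Y ∈ M ∧ v ∈ Y} := by
      refine (hK σ hσ).1.1.closed _ (hX.2 hx) ⟨X, hX, hXM, hx⟩ ?_
      rintro u hu ⟨Y, hY, hYM, huY⟩ v hv huv
      obtain ⟨Y', hY', hvY'⟩ := hBlcov v
      have hY'b : Y' ∈ bs σ := ⟨hY', hKin σ hσ Y' hY' ⟨v, hvY', hv⟩⟩
      refine ⟨Y', hY'b, ?_, hvY'⟩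
      by_cases hYY : Y = Y'
      · exact hYY ▸ hYM
      · exact hcl Y hY hYM Y' hY'b ⟨hYY, hY.1, hY', u, huY, v, hvY', huv⟩
    intro Y hY
    obtain ⟨y, hy⟩ := (hBlc Y hY.1).1
    obtain ⟨Y', hY', hM, hyY'⟩ := this (hY.2 hy)
    by_cases hYY : Y = Y'
    · exact hYY ▸ hM
    · exact absurd hyY' (disj (hBldis Y hY.1 Y' hY'.1 hYY) hy)
  have hbsi : ∀ σ σ' : Set (Set V), σ.ncard < t → σ'.ncard < t → (bs σ ∩ bs σ').Nonempty := by
    intro σ σ' hσ hσ'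
    have h1 := hsepc σ hσ
    have h2 := hsepc σ' hσ'
    have h3 := ncard_union_le (sep σ) (sep σ')
    have hle : (sep σ ∪ sep σ').ncard ≤ p := by omega
    obtain ⟨x, hx⟩ := (hβc _ hle).1.1
    have hx1 := (hK σ hσ).2 (hβm _ _ subset_union_left hle hx)
    have hx2 := (hK σ' hσ').2 (hβm _ _ subset_union_right hle hx)
    obtain ⟨X, hX, hxX⟩ := hBlcov x
    exact ⟨X, ⟨hX, hKin σ hσ X hX ⟨x, hxX, hx1⟩⟩, ⟨hX, hKin σ' hσ' X hX ⟨x, hxX, hx2⟩⟩⟩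
  rcases Nat.eq_zero_or_pos t with ht | ht
  · subst ht
    exact ⟨fun i => i.elim0, fun i => i.elim0, fun i => i.elim0, fun i => i.elim0, fun i => i.elim0⟩
  let ι := {σ : Set (Set V) // σ.ncard < t}
  have : Nonempty ι := ⟨⟨∅, by simpa using ht⟩⟩
  have : Fintype ι := Fintype.ofFinite _
  obtain ⟨n, f, hf, hmeet⟩ := path_meets_all (G := Γ) (fun σ : ι => bs σ.1) (fun σ => hbsc σ.1 σ.2)
    (fun σ σ' => hbsi σ.1 σ'.1 σ.2 σ'.2)
  have hL : Linked Γ (↑A : Set (Set V)) (f '' {i | i ≤ n}) t := by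
    apply menger
    intro W hW
    by_contra! hlt
    obtain ⟨X, hX, hXK⟩ := hspecial W hlt
    obtain ⟨k, hk, hfk⟩ := hmeet ⟨W, hlt⟩
    refine hW (bs W) (hbsc W hlt) ?_ ⟨X, ⟨Or.inl hX, hXK⟩, hX⟩ ⟨f k, hfk, k, hk, rfl⟩
    rw [disjoint_left]
    rintro Y ⟨hYB, hYK⟩ hYW
    obtain ⟨y, hy⟩ := (hBlc Y hYB).1
    exact (hK W hlt).1.2.1 (hYK hy) ⟨Y, ⟨hYW, hYB⟩, hy⟩
  obtain ⟨B, B1, B2, B3, B4⟩ := comb hf hL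
  have hΓB : ∀ Q, Conn Γ Q → (∃ X ∈ Q, X ∈ Bl) → Q ⊆ Bl := by
    rintro Q hQ ⟨X, hX, hXB⟩
    refine hQ.closed Bl hX hXB ?_
    intro u _ _ v _ huv
    exact huv.2.2.1
  have hBB : ∀ i, B i ⊆ Bl := by
    intro i
    obtain ⟨X, hX, hXA⟩ := B3 i
    exact hΓB _ (B1 i) ⟨X, hX, Or.inl hXA⟩
  refine ⟨fun i => ⋃ X ∈ B i, X, ?_, ?_, ?_, ?_⟩
  · intro i
    exact (B1 i).biUnion (fun X => X) (fun X hX => hBlc X (hBB i hX)) (fun X _ Y _ h => h.2.2.2)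
  · intro i
    obtain ⟨X, hX, hXA⟩ := B3 i
    exact hmono X _ (subset_biUnion_of_mem (u := fun X => X) hX) (hASp X hXA).2.1
  · intro i j hij
    rw [disjoint_left]
    intro x hx hx'
    simp only [mem_iUnion] at hx hx'
    obtain ⟨X, hX, hxX⟩ := hx
    obtain ⟨Y, hY, hxY⟩ := hx'
    have hne : X ≠ Y := by
      rintro rfl
      exact disj (B2 i j hij) hX hY
    exact disj (hBldis X (hBB i hX) Y (hBB j hY) hne) hxX hxY
  · intro i j hij
    obtain ⟨X, hX, Y, hY, h⟩ := B4 i j hij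
    exact h.2.2.2.mono (subset_biUnion_of_mem (u := fun X => X) hX)
      (subset_biUnion_of_mem (u := fun X => X) hY)

/-! ### Elimination distance lemmas -/

theorem supp_image_isComp {A : Set V} (C : (G.induce A).ConnectedComponent) :
    IsComp G A (Subtype.val '' C.supp) := by
  refine ⟨⟨?_, ?_⟩, ?_, ?_⟩
  · obtain ⟨x, hx⟩ := C.nonempty_supp
    exact ⟨x, x, hx, rfl⟩
  · rintro M ⟨_, ⟨q, hq, rfl⟩, hqM⟩ hc _ ⟨y, hy, rfl⟩
    have hr : (G.induce A).Reachable q y := by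
      rw [← SimpleGraph.ConnectedComponent.eq]
      exact hq.trans hy.symm
    obtain ⟨w⟩ := hr
    have : ∀ a b : A, (G.induce A).Walk a b → a ∈ C.supp → a.1 ∈ M → b.1 ∈ M := by
      intro a b w
      induction w with
      | nil => exact fun _ h => h
      | @cons a v b h _ ih =>
        intro haC ha
        have hv : v ∈ C.supp := by
          have : (G.induce A).connectedComponentMk a = C := haC
          rw [SimpleGraph.ConnectedComponent.mem_supp_iff, ← this]
          exact SimpleGraph.ConnectedComponent.eq.mpr h.symm.reachable
        exact ih hv (hc _ ⟨a, haC, rfl⟩ ha _ ⟨v, hv, rfl⟩ (by simpa using h))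
    exact this _ _ w hq hqM
  · rintro _ ⟨x, _, rfl⟩
    exact x.2
  · rintro _ ⟨x, hx, rfl⟩ b hb hab
    refine ⟨⟨b, hb⟩, ?_, rfl⟩
    have : (G.induce A).connectedComponentMk x = C := hx
    rw [SimpleGraph.ConnectedComponent.mem_supp_iff, ← this]
    have h : (G.induce A).Adj ⟨b, hb⟩ x := by simpa using hab.symm
    exact SimpleGraph.ConnectedComponent.eq.mpr h.reachable

theorem isComp_supp_image {A C : Set V} (h : IsComp G A C) :
    ∃ D : (G.induce A).ConnectedComponent, Subtype.val '' D.supp = C := by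
  obtain ⟨x, hx⟩ := h.1.1
  refine ⟨(G.induce A).connectedComponentMk ⟨x, h.2.1 hx⟩, ?_⟩
  refine (supp_image_isComp _).eq_of_inter h ⟨x, ⟨⟨x, h.2.1 hx⟩, ?_, rfl⟩, hx⟩
  rfl

theorem elim_step {Base : Set V → Prop} {A : Set V} {k : ℕ}
    (h : ∀ C, IsComp G A C → ∃ v ∈ C, ElimLE G Base (C \ {v}) k) : ElimLE G Base A (k + 1) := by
  have h' : ∀ C : (G.induce A).ConnectedComponent, ∃ v : A, v ∈ C.supp ∧
      ElimLE G Base ((Subtype.val '' C.supp) \ {v.val}) k := by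
    intro C
    obtain ⟨_, ⟨v, hv, rfl⟩, he⟩ := h _ (supp_image_isComp C)
    exact ⟨v, hv, he⟩
  choose v hv he using h'
  exact ElimLE.step A k v hv he

theorem elim_subset {Base : Set V → Prop}
    (hB : ∀ A B : Set V, A ⊆ B → Base B → Base A) {A : Set V} {k : ℕ} (h : ElimLE G Base A k) :
    ∀ (B : Set V), B ⊆ A → ∀ k', k ≤ k' → ElimLE G Base B k' := by
  induction h with
  | base A k h => exact fun B hBA k' _ => ElimLE.base B k' (hB B A hBA h)
  | step A k v hv h ih =>
    intro B hBA k' hk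
    obtain ⟨k', rfl⟩ : ∃ m, k' = m + 1 := ⟨k' - 1, by omega⟩
    refine elim_step fun C hC => ?_
    obtain ⟨C', hC', hCC⟩ := conn_in_comp hC.1 (hC.2.1.trans hBA)
    obtain ⟨D, rfl⟩ := isComp_supp_image hC'
    by_cases hvC : (v D).val ∈ C
    · exact ⟨_, hvC, ih D _ (fun x hx => ⟨hCC hx.1, hx.2⟩) _ (by omega)⟩
    · obtain ⟨x, hx⟩ := hC.1.1
      refine ⟨x, hx, ih D _ (fun y hy => ⟨hCC hy.1, ?_⟩) _ (by omega)⟩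
      rintro rfl
      exact hvC hy.1

theorem elim_comps {Base : Set V → Prop}
    (hB : ∀ A B : Set V, A ⊆ B → Base B → Base A) {A : Set V} {k : ℕ}
    (h : ∀ C, IsComp G A C → ElimLE G Base C k) : ElimLE G Base A (k + 1) := by
  refine elim_step fun C hC => ?_
  obtain ⟨x, hx⟩ := hC.1.1
  exact ⟨x, hx, elim_subset hB (h C hC) _ sdiff_subset _ le_rfl⟩

theorem elim_insert {Base : Set V → Prop}
    (hB : ∀ A B : Set V, A ⊆ B → Base B → Base A) {A : Set V} {k : ℕ} {x : V}
    (h : ElimLE G Base (A \ {x}) k) : ElimLE G Base A (k + 1) := by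
  refine elim_step fun C hC => ?_
  by_cases hx : x ∈ C
  · exact ⟨x, hx, elim_subset hB h _ (fun y hy => ⟨hC.2.1 hy.1, hy.2⟩) _ le_rfl⟩
  · obtain ⟨y, hy⟩ := hC.1.1
    refine ⟨y, hy, elim_subset hB h _ (fun z hz => ⟨hC.2.1 hz.1, ?_⟩) _ le_rfl⟩
    rintro rfl
    exact hx hz.1

theorem elim_sdiff [Finite V] {Base : Set V → Prop}
    (hB : ∀ A B : Set V, A ⊆ B → Base B → Base A) {S : Set V} :
    ∀ {A : Set V} {k : ℕ}, ElimLE G Base (A \ S) k → ElimLE G Base A (k + S.ncard) := by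
  induction S, toFinite S using Set.Finite.induction_on with
  | empty => intro A k h; simpa using h
  | @insert a s ha _ ih =>
    intro A k h
    rw [ncard_insert_of_notMem ha]
    have : ElimLE G Base ((A \ {a}) \ s) k := by rwa [Set.sdiff_sdiff, Set.singleton_union]
    exact elim_insert hB (ih this)

/-! ### The elimination argument -/

theorem elim_main [Finite V] {Nf : Set V → Prop} {T p : ℕ}
    (hmono : ∀ X Y, X ⊆ Y → Nf X → Nf Y)
    (hr : ∀ C r, Conn G C → r ∈ C → ∃ S ⊆ C, r ∈ S ∧ S.ncard ≤ p ∧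
      ∀ D, IsComp G (C \ S) D → Nf D → Nf (comp G (C \ D) r))
    (hNL : ¬ NL G Nf T) :
    ∀ (j ρ : ℕ), ρ + j = T → ∀ (C : Set V) (r : V), Conn G C → r ∈ C → ∀ B : Fin ρ → Set V,
      (∀ i, Conn G (B i)) → (∀ i, Nf (B i)) → (∀ i j, i ≠ j → Disjoint (B i) (B j)) →
      (∀ i j : Fin ρ, (j : ℕ) = i + 1 → SAdj G (B i) (B j)) → (∀ i, Disjoint (B i) C) →
      (∀ i : Fin ρ, (i : ℕ) + 1 = ρ → SAdj G (B i) {r}) →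
      ElimLE G (fun X => ¬ Nf X) C (j * (p + 1)) := by
  have hB : ∀ A B : Set V, A ⊆ B → ¬ Nf B → ¬ Nf A := fun A B h h1 h2 => h1 (hmono A B h h2)
  intro j
  induction j with
  | zero =>
    rintro ρ hρ C r _ _ B b1 b2 b3 b4 _ _
    obtain rfl : ρ = T := by omega
    exact absurd ⟨B, b1, b2, b3, b4⟩ hNL
  | succ j ih =>
    intro ρ hρ C r hC hrC B b1 b2 b3 b4 b5 b6
    obtain ⟨S, hSC, hrS, hSp, hS⟩ := hr C r hC hrC
    have key : ElimLE G (fun X => ¬ Nf X) (C \ S) (j * (p + 1) + 1) := by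
      refine elim_comps hB fun D hD => ?_
      by_cases hND : Nf D
      · have hrD : r ∈ C \ D := ⟨hrC, fun h => (hD.2.1 h).2 hrS⟩
        set E := comp G (C \ D) r with hE
        have hEc : IsComp G (C \ D) E := comp_isComp hrD
        obtain ⟨d, hd⟩ := hD.1.1
        obtain ⟨u, -, huE, v, hvC, hvE, huv⟩ := hC.cross E hrC (mem_comp hrD) (hD.2.1 hd).1
          (fun h => (hEc.2.1 h).2 hd)
        have hvD : v ∈ D := by
          by_contra hvD
          exact hvE (hEc.2.2 u huE v ⟨hvC, hvD⟩ huv)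
        refine ih (ρ + 1) (by omega) D v hD.1 hvD (Fin.snoc (α := fun _ => Set V) B E) ?_ ?_ ?_ ?_ ?_ ?_
        · intro i
          refine Fin.lastCases ?_ (fun i => ?_) i
          · simpa using hEc.1
          · simpa using b1 i
        · intro i
          refine Fin.lastCases ?_ (fun i => ?_) i
          · simpa using hS D hD hND
          · simpa using b2 i
        · have hx : ∀ i, Disjoint (B i) E := fun i =>
            (b5 i).mono_right (hEc.2.1.trans sdiff_subset)
          intro i
          refine Fin.lastCases ?_ (fun i => ?_) i
          · intro i'
            refine Fin.lastCases ?_ (fun i' => ?_) i'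
            · intro h; exact absurd rfl h
            · intro _; simpa using (hx i').symm
          · intro i'
            refine Fin.lastCases ?_ (fun i' => ?_) i'
            · intro _; simpa using hx i
            · intro h
              simpa using b3 i i' (fun h' => h (by rw [h']))
        · intro i
          refine Fin.lastCases ?_ (fun i => ?_) i
          · intro i' hi
            have := i'.2
            simp at hi; omega
          · intro i'
            refine Fin.lastCases ?_ (fun i' => ?_) i'
            · intro hi
              simp only [Fin.snoc_castSucc, Fin.snoc_last]
              refine (b6 i (by simpa using hi.symm)).mono le_rfl ?_
              rintro _ rfl
              exact mem_comp hrD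
            · intro hi
              simpa using b4 i i' (by simpa using hi)
        · intro i
          refine Fin.lastCases ?_ (fun i => ?_) i
          · simp only [Fin.snoc_last]
            exact disjoint_left.mpr fun x hx => (hEc.2.1 hx).2
          · simp only [Fin.snoc_castSucc]
            exact (b5 i).mono_right (hD.2.1.trans sdiff_subset)
        · intro i
          refine Fin.lastCases ?_ (fun i => ?_) i
          · intro _
            simp only [Fin.snoc_last]
            exact ⟨u, huE, v, rfl, huv⟩
          · intro hi
            have := i.2
            simp at hi; omega
      · exact ElimLE.base D _ hND
    refine elim_subset hB (elim_sdiff hB key) C le_rfl _ ?_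
    have : (j + 1) * (p + 1) = j * (p + 1) + (p + 1) := by ring
    omega

/-! ### The `r`-lemma -/

theorem r_lemma [Finite V] {Nf : Set V → Prop} {p : ℕ} {C : Set V} {r : V}
    (hmono : ∀ X Y, X ⊆ Y → Nf X → Nf Y) (hC : Conn G C) (hrC : r ∈ C)
    (hno : ∀ β : Set V → Set V, HavenIn G C p β → (∀ S ⊆ C, S.ncard ≤ p → Nf (β S)) → False) :
    ∃ S ⊆ C, r ∈ S ∧ S.ncard ≤ p + 1 ∧
      ∀ D, IsComp G (C \ S) D → Nf D → Nf (comp G (C \ D) r) := by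
  by_contra! hcon
  have huniq : ∀ S ⊆ C, r ∈ S → ∀ D D', IsComp G (C \ S) D → IsComp G (C \ S) D' → Nf D → Nf D' →
      ¬ Nf (comp G (C \ D) r) → ¬ Nf (comp G (C \ D') r) → D = D' := by
    intro S hSC hrS
    have key : ∀ D D', IsComp G (C \ S) D → IsComp G (C \ S) D' → Nf D → Nf D' → D ≠ D' →
        ¬ Nf (comp G (C \ D') r) → ∀ Q ⊆ C, Conn G Q → r ∈ Q → (Q ∩ D).Nonempty → Disjoint Q D' →
        False := by
      intro D D' hD hD' hN hN' hne hn Q hQC hQ hrQ hQD hQD'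
      refine hn (hmono (Q ∪ D) _ ?_ (hmono D _ subset_union_right hN))
      have hr' : r ∈ C \ D' := ⟨hrC, fun h => (hD'.2.1 h).2 hrS⟩
      refine (comp_isComp hr').subset_of_conn (hQ.union hD.1 hQD) ?_ ⟨r, Or.inl hrQ, mem_comp hr'⟩
      rintro x (hx | hx)
      · exact ⟨hQC hx, disj hQD' hx⟩
      · exact ⟨(hD.2.1 hx).1, disj (hD.disjoint hD' hne) hx⟩
    intro D D' hD hD' hN hN' hn hn'
    by_contra hne
    obtain ⟨d, hd⟩ := hD.1.1
    obtain ⟨m, f, hf, hf0, hfm, hfC, hfb, -⟩ := exists_path hC hrC (T := D ∪ D')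
      ⟨d, (hD.2.1 hd).1, Or.inl hd⟩
    have hQ : Conn G (f '' {i | 0 ≤ i ∧ i ≤ m}) := hf.1.seg_conn (Nat.zero_le _) le_rfl
    have hQC : f '' {i | 0 ≤ i ∧ i ≤ m} ⊆ C := by rintro _ ⟨i, hi, rfl⟩; exact hfC i hi.2
    have hrQ : r ∈ f '' {i | 0 ≤ i ∧ i ≤ m} := ⟨0, ⟨le_rfl, Nat.zero_le _⟩, hf0⟩
    have hDD := hD.disjoint hD' hne
    rcases hfm with h | h
    · refine key D D' hD hD' hN hN' hne hn' _ hQC hQ hrQ ⟨f m, ⟨m, ⟨Nat.zero_le _, le_rfl⟩, rfl⟩, h⟩ ?_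
      rw [disjoint_left]
      rintro _ ⟨i, hi, rfl⟩ hiD
      rcases hi.2.eq_or_lt with rfl | hlt
      · exact disj hDD h hiD
      · exact hfb i hlt (Or.inr hiD)
    · refine key D' D hD' hD hN' hN (Ne.symm hne) hn _ hQC hQ hrQ
        ⟨f m, ⟨m, ⟨Nat.zero_le _, le_rfl⟩, rfl⟩, h⟩ ?_
      rw [disjoint_left]
      rintro _ ⟨i, hi, rfl⟩ hiD
      rcases hi.2.eq_or_lt with rfl | hlt
      · exact disj hDD hiD h
      · exact hfb i hlt (Or.inl hiD)
  have hbad : ∀ S : Set V, ∃ D, S ⊆ C → r ∈ S → S.ncard ≤ p + 1 →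
      IsComp G (C \ S) D ∧ Nf D ∧ ¬ Nf (comp G (C \ D) r) := by
    intro S
    by_cases h : S ⊆ C ∧ r ∈ S ∧ S.ncard ≤ p + 1
    · obtain ⟨D, hD⟩ := hcon S h.1 h.2.1 h.2.2
      exact ⟨D, fun _ _ _ => hD⟩
    · exact ⟨∅, fun a b c => absurd ⟨a, b, c⟩ h⟩
  choose D hD using hbad
  have hDm : ∀ S S', S ⊆ S' → S' ⊆ C → r ∈ S → S'.ncard ≤ p + 1 → D S' ⊆ D S := by
    intro S S' hSS hS'C hrS hp
    obtain ⟨a1, a2, a3⟩ := hD S' hS'C (hSS hrS) hp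
    obtain ⟨b1, b2, b3⟩ := hD S (hSS.trans hS'C) hrS ((ncard_le_ncard hSS).trans hp)
    obtain ⟨E, hE, hDE⟩ := conn_in_comp (X := C \ S) a1.1
      (a1.2.1.trans (sdiff_subset_sdiff_right hSS))
    have hrE : r ∈ C \ E := ⟨hrC, fun h => (hE.2.1 h).2 hrS⟩
    have hrD : r ∈ C \ D S' := ⟨hrC, fun h => hrE.2 (hDE h)⟩
    have : E = D S := by
      refine huniq S (hSS.trans hS'C) hrS E (D S) hE b1 (hmono _ _ hDE a2) b2 (fun h => a3 ?_) b3
      refine hmono _ _ ?_ h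
      exact (comp_isComp hrD).subset_of_conn (comp_conn hrE)
        ((comp_subset G _ r).trans (sdiff_subset_sdiff_right hDE)) ⟨r, mem_comp hrE, mem_comp hrD⟩
    rwa [← this]
  have hins : ∀ S : Set V, S ⊆ C → S.ncard ≤ p → insert r S ⊆ C ∧ (insert r S).ncard ≤ p + 1 :=
    fun S h1 h2 => ⟨insert_subset hrC h1, (ncard_insert_le r S).trans (by omega)⟩
  have hβ : ∀ S : Set V, ∃ B, S ⊆ C → S.ncard ≤ p → IsComp G (C \ S) B ∧ D (insert r S) ⊆ B := by
    intro S
    by_cases h : S ⊆ C ∧ S.ncard ≤ p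
    · obtain ⟨a1, a2⟩ := hins S h.1 h.2
      obtain ⟨b1, b2, b3⟩ := hD _ a1 (Or.inl rfl) a2
      obtain ⟨E, hE, hDE⟩ := conn_in_comp (X := C \ S) b1.1
        (b1.2.1.trans (sdiff_subset_sdiff_right (subset_insert _ _)))
      exact ⟨E, fun _ _ => ⟨hE, hDE⟩⟩
    · exact ⟨∅, fun a b => absurd ⟨a, b⟩ h⟩
  choose β hβ using hβ
  refine hno β ⟨fun S h1 h2 => (hβ S h1 h2).1, ?_⟩ ?_
  · intro S S' hSS hS'C hp
    have a := hβ S (hSS.trans hS'C) ((ncard_le_ncard hSS).trans hp)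
    have b := hβ S' hS'C hp
    obtain ⟨c1, c2⟩ := hins S' hS'C hp
    have hm := hDm (insert r S) (insert r S') (Set.insert_subset_insert hSS) c1 (Or.inl rfl) c2
    obtain ⟨d1, -, -⟩ := hD _ c1 (Or.inl rfl) c2
    obtain ⟨x, hx⟩ := d1.1.1
    exact a.1.subset_of_conn b.1.1 (b.1.2.1.trans (sdiff_subset_sdiff_right hSS))
      ⟨x, b.2 hx, a.2 (hm hx)⟩
  · intro S h1 h2
    obtain ⟨a1, a2⟩ := hins S h1 h2
    exact hmono _ _ (hβ S h1 h2).2 (hD _ a1 (Or.inl rfl) a2).2.1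

theorem HavenIn.inside [Finite V] {C : Set V} {p : ℕ} {β : Set V → Set V}
    (h : HavenIn G C p β) : HavenIn (inside G C) univ p (fun S => β (S ∩ C)) := by
  have hc : ∀ S : Set V, S.ncard ≤ p → (S ∩ C).ncard ≤ p := fun S hS =>
    (ncard_le_ncard Set.inter_subset_left).trans hS
  constructor
  · intro S _ hS
    obtain ⟨a1, a2, a3⟩ := h.1 (S ∩ C) inter_subset_right (hc S hS)
    refine ⟨conn_inside a1 (a2.trans sdiff_subset), fun x hx => ⟨trivial, fun hxS => ?_⟩, ?_⟩
    · exact (a2 hx).2 ⟨hxS, (a2 hx).1⟩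
    · intro a ha b hb hab
      exact a3 a ha b ⟨hab.2.2, fun h => hb.2 h.1⟩ hab.1
  · intro S S' hSS _ hS'
    exact h.2 _ _ (Set.inter_subset_inter_left _ hSS) inter_subset_right (hc S' hS')

theorem MinorIn.spread [Finite V] {W : Type} [Nonempty W] {H : SimpleGraph W}
    {X : Set V} (h : MinorIn G H X) (hX : Conn G X) :
    ∃ φ : W → Set V, (∀ w, Conn G (φ w)) ∧ (∀ w, φ w ⊆ X) ∧
      (∀ w w', w ≠ w' → Disjoint (φ w) (φ w')) ∧
      (∀ w w', H.Adj w w' → SAdj G (φ w) (φ w')) ∧ ∀ x ∈ X, ∃ w, x ∈ φ w := by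
  obtain ⟨φ, h1, h2, h3, h4⟩ := h
  induction hn : (X \ ⋃ w, φ w).ncard using Nat.strong_induction_on generalizing φ with
  | _ n ih =>
    by_cases hcov : ∀ x ∈ X, ∃ w, x ∈ φ w
    · exact ⟨φ, h1, h2, h3, h4, hcov⟩
    push Not at hcov
    obtain ⟨y, hyX, hy⟩ := hcov
    obtain ⟨w0⟩ := ‹Nonempty W›
    obtain ⟨x, hx⟩ := (h1 w0).1
    obtain ⟨u, huX, hu, v, hvX, hv, huv⟩ := hX.cross (⋃ w, φ w) (h2 w0 hx)
      (mem_iUnion.mpr ⟨w0, hx⟩) hyX (by simpa using hy)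
    obtain ⟨w1, hw1⟩ := mem_iUnion.mp hu
    have hv' : ∀ w, v ∉ φ w := by simpa using hv
    let ψ : W → Set V := fun w => if w = w1 then insert v (φ w) else φ w
    have hφψ : ∀ w, φ w ⊆ ψ w := by
      intro w
      by_cases hw : w = w1
      · simp only [ψ, hw, if_true]; exact subset_insert _ _
      · simp only [ψ, hw, if_false]; exact le_rfl
    have hψ : ∀ w, ∀ x ∈ ψ w, x ∈ φ w ∨ (w = w1 ∧ x = v) := by
      intro w x hx
      by_cases hw : w = w1
      · simp only [ψ, hw, if_true] at hx
        rcases hx with h | h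
        · exact Or.inr ⟨hw, h⟩
        · rw [hw]; exact Or.inl h
      · simp only [ψ, hw, if_false] at hx
        exact Or.inl hx
    refine ih _ ?_ ψ ?_ ?_ ?_ ?_ rfl
    · rw [← hn]
      refine ncard_lt_ncard ⟨?_, ?_⟩
      · exact sdiff_subset_sdiff_right (Set.iUnion_mono hφψ)
      · intro hsub
        refine (hsub ⟨hvX, hv⟩).2 (mem_iUnion.mpr ⟨w1, ?_⟩)
        simp [ψ]
    · intro w
      by_cases hw : w = w1
      · simp only [ψ, hw, if_true]; exact (h1 w1).insert_adj hw1 huv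
      · simp only [ψ, hw, if_false]; exact h1 w
    · intro w x hx
      rcases hψ w x hx with h | ⟨_, rfl⟩
      · exact h2 w h
      · exact hvX
    · intro w w' hww
      rw [disjoint_left]
      intro x hx hx'
      rcases hψ w x hx with h | ⟨h, rfl⟩ <;> rcases hψ w' x hx' with h' | ⟨h', h''⟩
      · exact disj (h3 w w' hww) h h'
      · exact hv' w (h'' ▸ h)
      · exact hv' w' h'
      · exact hww (h.trans h'.symm)
    · intro w w' hww
      exact (h4 w w' hww).mono (hφψ w) (hφψ w')

theorem necklace_of_NL [Finite V] {κ : Type} {β : κ → Type} [∀ i, Fintype (β i)]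
    {F : ∀ i : κ, SimpleGraph (β i)} (hF : ∀ i, Nonempty (β i)) {t : ℕ}
    (h : NL G (fun X => ∃ i, MinorIn G (F i) X) t) : HasNecklaceMinor F G t := by
  obtain ⟨B, b1, b2, b3, b4⟩ := h
  choose b hb using b2
  have := fun i => (hb i).spread (b1 i)
  choose φ p1 p2 p3 p4 p5 using this
  have hpq : ∀ i j : Fin t, (j : ℕ) = i + 1 → ∃ (p : β (b i)) (q : β (b j)),
      SAdj G (φ i p) (φ j q) := by
    intro i j hij
    obtain ⟨x, hx, y, hy, hxy⟩ := b4 i j hij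
    obtain ⟨p, hp⟩ := p5 i x hx
    obtain ⟨q, hq⟩ := p5 j y hy
    exact ⟨p, q, x, hp, y, hq, hxy⟩
  choose p q hpq using hpq
  let N : SimpleGraph (Σ i : Fin t, β (b i)) :=
    { Adj := fun a c => (∃ i x y, a = ⟨i, x⟩ ∧ c = ⟨i, y⟩ ∧ (F (b i)).Adj x y) ∨
        (∃ i j h, a = ⟨i, p i j h⟩ ∧ c = ⟨j, q i j h⟩) ∨
        (∃ i j h, c = ⟨i, p i j h⟩ ∧ a = ⟨j, q i j h⟩)
      symm := ⟨by
        rintro a c (⟨i, x, y, h1, h2, h3⟩ | ⟨i, j, h, h1, h2⟩ | ⟨i, j, h, h1, h2⟩)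
        · exact Or.inl ⟨i, y, x, h2, h1, h3.symm⟩
        · exact Or.inr (Or.inr ⟨i, j, h, h1, h2⟩)
        · exact Or.inr (Or.inl ⟨i, j, h, h1, h2⟩)⟩
      loopless := ⟨by
        rintro a (⟨i, x, y, h1, h2, h3⟩ | ⟨i, j, h, h1, h2⟩ | ⟨i, j, h, h1, h2⟩)
        · subst h1
          have : x = y := by simpa using h2
          exact h3.ne this
        · have := congrArg (fun z => (z.1 : ℕ)) (h1.symm.trans h2)
          simp at this; omega
        · have := congrArg (fun z => (z.1 : ℕ)) (h1.symm.trans h2)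
          simp at this; omega⟩ }
  refine ⟨_, inferInstance, N, ⟨fun i => {a | a.1 = i}, ?_, ?_, ?_, ?_, ?_⟩,
    fun a => φ a.1 a.2, ?_, ?_, ?_⟩
  · exact fun v => ⟨v.1, rfl⟩
  · intro i j hij
    rw [disjoint_left]
    rintro a rfl h
    exact hij h
  · intro i
    refine ⟨b i, ⟨?_⟩⟩
    refine SimpleGraph.Iso.symm
      { toFun := fun x => ⟨⟨i, x⟩, rfl⟩
        invFun := fun a => a.2 ▸ a.1.2
        left_inv := fun x => rfl
        right_inv := ?_
        map_rel_iff' := ?_ }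
    · rintro ⟨⟨j, x⟩, h⟩
      obtain rfl : j = i := h
      rfl
    · intro x y
      constructor
      · rintro (⟨i', x', y', h1, h2, h3⟩ | ⟨i', j, h, h1, h2⟩ | ⟨i', j, h, h1, h2⟩)
        · obtain ⟨rfl, h1⟩ := Sigma.mk.inj h1
          obtain ⟨_, h2⟩ := Sigma.mk.inj h2
          rw [eq_of_heq h1, eq_of_heq h2]
          exact h3
        · have e1 : i = i' := (Sigma.mk.inj h1).1
          have e2 : i = j := (Sigma.mk.inj h2).1
          exact absurd h (by rw [← e1, ← e2]; omega)
        · have e1 : i = i' := (Sigma.mk.inj h1).1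
          have e2 : i = j := (Sigma.mk.inj h2).1
          exact absurd h (by rw [← e1, ← e2]; omega)
      · intro h
        exact Or.inl ⟨i, x, y, rfl, rfl, h⟩
  · intro i j hij
    refine ⟨(⟨i, p i j hij⟩, ⟨j, q i j hij⟩), ⟨rfl, rfl, Or.inr (Or.inl ⟨i, j, hij, rfl, rfl⟩)⟩, ?_⟩
    rintro ⟨a, c⟩ ⟨h1, h2, h⟩
    rcases h with ⟨i', x', y', e1, e2, h3⟩ | ⟨i', j', h, e1, e2⟩ | ⟨i', j', h, e1, e2⟩
    · simp only at e1 e2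
      subst e1 e2
      have h1' : i' = i := h1
      have h2' : i' = j := h2
      rw [← h1', ← h2'] at hij; omega
    · simp only at e1 e2
      subst e1 e2
      obtain rfl : i' = i := h1
      obtain rfl : j' = j := h2
      rfl
    · simp only at e1 e2
      subst e1 e2
      have h1' : j' = i := h1
      have h2' : i' = j := h2
      rw [← h1', ← h2'] at hij; omega
  · rintro i j hij x hx y hy (⟨i', x', y', e1, e2, h3⟩ | ⟨i', j', h, e1, e2⟩ | ⟨i', j', h, e1, e2⟩)
    · subst e1 e2
      have h1' : i' = i := hx
      have h2' : i' = j := hy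
      rw [← h1', ← h2'] at hij; omega
    · subst e1 e2
      have h1' : i' = i := hx
      have h2' : j' = j := hy
      rw [← h1', ← h2'] at hij; omega
    · subst e1 e2
      have h1' : j' = i := hx
      have h2' : i' = j := hy
      rw [← h1', ← h2'] at hij; omega
  · exact fun a => conn_iff_induce.mp (p1 _ _)
  · rintro ⟨i, x⟩ ⟨j, y⟩ hne
    by_cases hij : i = j
    · subst hij
      exact p3 i x y (fun h => hne (by rw [h]))
    · exact (b3 i j hij).mono (p2 _ _) (p2 _ _)
  · rintro _ _ (⟨i, x, y, rfl, rfl, h⟩ | ⟨i, j, h, rfl, rfl⟩ | ⟨i, j, h, rfl, rfl⟩)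
    · exact p4 i x y h
    · exact hpq i j h
    · exact (hpq i j h).symm

theorem necklace_bound [Finite V] {κ : Type} {β : κ → Type}
    {F : ∀ i : κ, SimpleGraph (β i)} (hF : ∀ i, Nonempty (β i)) {t : ℕ}
    (h : HasNecklaceMinor F G t) : t ≤ Nat.card V := by
  obtain ⟨W, _, N, ⟨S, s1, s2, s3, -, -⟩, φ, f1, f2, -⟩ := h
  have hS : ∀ i, ∃ w, w ∈ S i := by
    intro i
    obtain ⟨b, ⟨e⟩⟩ := s3 i
    obtain ⟨x⟩ := hF b
    exact ⟨(e.symm x).1, (e.symm x).2⟩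
  choose w hw using hS
  have hv : ∀ i, ∃ v, v ∈ φ (w i) := fun i => (conn_iff_induce.mpr (f1 (w i))).1
  choose v hv using hv
  have : Function.Injective v := by
    intro i j hij
    by_contra hne
    have hww : w i ≠ w j := by
      intro h
      exact disj (s2 i j hne) (hw i) (h ▸ hw j)
    exact disj (f2 _ _ hww) (hv i) (hij ▸ hv j)
  simpa using Nat.card_le_card_of_injective v this

theorem not_NL [Finite V] {κ : Type} {β : κ → Type} [∀ i, Fintype (β i)]
    {F : ∀ i : κ, SimpleGraph (β i)} (hF : ∀ i, Nonempty (β i)) (G : SimpleGraph V) :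
    ¬ NL G (fun X => ∃ i, MinorIn G (F i) X) (necklaceMinorNumber F G + 1) := by
  intro h
  have h1 := necklace_of_NL hF h
  have : necklaceMinorNumber F G + 1 ≤ necklaceMinorNumber F G :=
    le_csSup ⟨Nat.card V, fun t ht => necklace_bound hF ht⟩ h1
  omega

theorem NL_of_kminor {W : Type} [Fintype W] [Nonempty W] {H : SimpleGraph W}
    {Nf : Set V → Prop} (hNf : ∀ X, MinorIn G H X → Nf X) {T : ℕ}
    (h : KMinor G (T * Fintype.card W) univ) : NL G Nf T := by
  obtain ⟨φ, h1, -, h3, h4⟩ := h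
  let e := Fintype.equivFin W
  let g : Fin T → W → Fin (T * Fintype.card W) := fun j w => finProdFinEquiv (j, e w)
  have hg : ∀ j w j' w', g j w = g j' w' → j = j' ∧ w = w' := by
    intro j w j' w' hh
    have := finProdFinEquiv.injective hh
    simp only [Prod.mk.injEq, EmbeddingLike.apply_eq_iff_eq] at this
    exact this
  have hadj : ∀ a b, a ≠ b → SAdj G (φ a) (φ b) := fun a b hab => h4 a b (by simpa using hab)
  refine ⟨fun j => ⋃ w, φ (g j w), ?_, ?_, ?_, ?_⟩
  · intro j
    have hI : Conn (⊤ : SimpleGraph W) univ := by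
      obtain ⟨w⟩ := ‹Nonempty W›
      refine conn_of_base w trivial fun y _ => ?_
      by_cases hy : y = w
      · exact ⟨{w}, by simp, conn_singleton _ _, rfl, hy⟩
      · exact ⟨{w, y}, by simp, conn_pair (by simpa using Ne.symm hy), by simp, by simp⟩
    have := hI.biUnion (G := G) (fun w => φ (g j w)) (fun w _ => h1 _)
      (fun w _ w' _ hw => hadj _ _ (fun hh => by simpa using (hw.ne (hg _ _ _ _ hh).2)))
    simpa using this
  · intro j
    refine hNf _ ⟨fun w => φ (g j w), fun w => h1 _, fun w => subset_iUnion (fun w => φ (g j w)) w, ?_, ?_⟩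
    · intro w w' hw
      exact h3 _ _ (fun hh => hw (hg _ _ _ _ hh).2)
    · intro w w' hw
      exact hadj _ _ (fun hh => hw.ne (hg _ _ _ _ hh).2)
  · intro i j hij
    simp only [Set.disjoint_iUnion_left, Set.disjoint_iUnion_right]
    intro w w'
    exact h3 _ _ (fun hh => by first | exact hij (hg _ _ _ _ hh).1 | exact hij (hg _ _ _ _ hh).1.symm)
  · intro i j hij
    obtain ⟨w⟩ := ‹Nonempty W›
    have hij' : i ≠ j := by rintro rfl; omega
    exact (hadj (g i w) (g j w) (fun hh => hij' (hg _ _ _ _ hh).1)).mono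
      (subset_iUnion (fun w => φ (g i w)) w) (subset_iUnion (fun w => φ (g j w)) w)

/-! ### Polynomial growth -/

def PolyG (f : ℕ → ℕ) : Prop := ∃ C d : ℕ, ∀ t : ℕ, f t ≤ C * (t + 1) ^ d

theorem PolyG.const (k : ℕ) : PolyG (fun _ => k) := ⟨k, 0, fun t => by simp⟩

theorem PolyG.id : PolyG (fun t => t) := ⟨1, 1, fun t => by simp⟩

theorem PolyG.add {f g : ℕ → ℕ} (hf : PolyG f) (hg : PolyG g) : PolyG (fun t => f t + g t) := by
  obtain ⟨C, d, h⟩ := hf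
  obtain ⟨C', d', h'⟩ := hg
  refine ⟨C + C', d + d', fun t => ?_⟩
  have h1 : (t + 1) ^ d ≤ (t + 1) ^ (d + d') := Nat.pow_le_pow_right (by omega) (by omega)
  have h2 : (t + 1) ^ d' ≤ (t + 1) ^ (d + d') := Nat.pow_le_pow_right (by omega) (by omega)
  calc f t + g t ≤ C * (t + 1) ^ d + C' * (t + 1) ^ d' := add_le_add (h t) (h' t)
    _ ≤ C * (t + 1) ^ (d + d') + C' * (t + 1) ^ (d + d') :=
      add_le_add (Nat.mul_le_mul_left _ h1) (Nat.mul_le_mul_left _ h2)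
    _ = _ := by ring

theorem PolyG.mul {f g : ℕ → ℕ} (hf : PolyG f) (hg : PolyG g) : PolyG (fun t => f t * g t) := by
  obtain ⟨C, d, h⟩ := hf
  obtain ⟨C', d', h'⟩ := hg
  refine ⟨C * C', d + d', fun t => ?_⟩
  calc f t * g t ≤ (C * (t + 1) ^ d) * (C' * (t + 1) ^ d') := Nat.mul_le_mul (h t) (h' t)
    _ = _ := by ring

theorem PolyG.pow {f : ℕ → ℕ} (hf : PolyG f) (k : ℕ) : PolyG (fun t => f t ^ k) := by
  induction k with
  | zero => simpa using PolyG.const 1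
  | succ k ih => simpa [pow_succ] using ih.mul hf

/-! ### Assembly from the grid theorem -/

def pd (h T : ℕ) : ℕ := 2 * dd (T * h)
def pk2 (c h T : ℕ) : ℕ :=
  64 * c * pd h T ^ 2 * (1 + pd h T * (1 + 256 * pd h T ^ 2)) + 2 * pd h T + 1
def pκ (c h T : ℕ) : ℕ :=
  8 * c * pd h T * (16 * pd h T * (2 + pk2 c h T ^ 2)) + 2 * pd h T * (1 + c) + c + 1
def pp (c h T : ℕ) : ℕ := 8 * (T + 1) * (pκ c h T * (pκ c h T + c))

theorem polyG_final (c h : ℕ) : PolyG (fun t => (t + 1) * (pp c h (t + 1) + 1 + 1) + 1) := by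
  have hT : PolyG (fun t => t + 1) := PolyG.id.add (PolyG.const 1)
  have hs : PolyG (fun t => (t + 1) * h) := hT.mul (PolyG.const h)
  have hd : PolyG (fun t => pd h (t + 1)) := by
    unfold pd dd
    exact (PolyG.const 2).mul (((PolyG.const 3).mul hs |>.add (PolyG.const 2)).mul
      ((((PolyG.const 2).mul (hs.pow 2)).add hs).add (PolyG.const 1)))
  have hk : PolyG (fun t => pk2 c h (t + 1)) := by
    unfold pk2
    exact ((((PolyG.const (64 * c)).mul (hd.pow 2)).mul ((PolyG.const 1).add (hd.mul
      ((PolyG.const 1).add ((PolyG.const 256).mul (hd.pow 2)))))).add ((PolyG.const 2).mul hd)).add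
      (PolyG.const 1)
  have hκ : PolyG (fun t => pκ c h (t + 1)) := by
    unfold pκ
    exact ((((((PolyG.const (8 * c)).mul hd).mul (((PolyG.const 16).mul hd).mul
      ((PolyG.const 2).add (hk.pow 2)))).add (((PolyG.const 2).mul hd).mul (PolyG.const (1 + c)))).add
      (PolyG.const c)).add (PolyG.const 1))
  have hp : PolyG (fun t => pp c h (t + 1)) := by
    unfold pp
    exact ((PolyG.const 8).mul (hT.add (PolyG.const 1))).mul (hκ.mul (hκ.add (PolyG.const c)))
  exact (hT.mul ((hp.add (PolyG.const 1)).add (PolyG.const 1))).add (PolyG.const 1)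

theorem minorIn_comp {W : Type} {H : SimpleGraph W} (hH : H.Connected)
    {X : Set V} (h : MinorIn G H X) : ∃ C, IsComp G X C ∧ MinorIn G H C := by
  obtain ⟨φ, h1, h2, h3, h4⟩ := h
  have hc : Conn H univ := by
    rw [conn_iff_induce]
    exact (SimpleGraph.Iso.connected_iff (SimpleGraph.induceUnivIso H)).mpr hH
  have hc2 : Conn G (⋃ w ∈ (univ : Set W), φ w) :=
    hc.biUnion φ (fun w _ => h1 w) (fun w _ w' _ hw => h4 w w' hw)
  obtain ⟨C, hC, hsub⟩ := conn_in_comp hc2 (Set.iUnion₂_subset fun w _ => h2 w)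
  exact ⟨C, hC, φ, h1, fun w => (subset_biUnion_of_mem (u := φ) (Set.mem_univ w)).trans hsub, h3, h4⟩

theorem final_of_hfree (n : ℕ) (β : Fin n → Type) (instβ : ∀ i, Fintype (β i))
    (F : ∀ i : Fin n, SimpleGraph (β i)) (hFconn : ∀ i, (F i).Connected) (i0 : Fin n) (c : ℕ)
    (hc : 1 ≤ c)
    (hfree : ∀ (V : Type) [Finite V] (G : SimpleGraph V) (X : Set V),
      ¬ MinorIn G (F i0) X → ∀ C ⊆ X, ∀ γ, ¬ HavenIn G C c γ) :
    ∃ g : ℕ → ℕ, (∃ C d : ℕ, ∀ t : ℕ, g t ≤ C * (t + 1) ^ d) ∧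
      ∀ (V : Type) [Fintype V], ∀ G : SimpleGraph V,
        ElimLE G (fun A => ∀ i, ¬ IsMinorOf (F i) (G.induce A)) univ
          (g (necklaceMinorNumber F G)) := by
  have hF : ∀ i, Nonempty (β i) := fun i => (hFconn i).nonempty
  set h := Fintype.card (β i0) with hh
  refine ⟨_, polyG_final c h, ?_⟩
  intro V _ G
  set T := necklaceMinorNumber F G + 1 with hT
  have hNL : ¬ NL G (fun X => ∃ i, MinorIn G (F i) X) T := not_NL hF G
  have hbase : (fun A => ∀ i, ¬ IsMinorOf (F i) (G.induce A)) =
      (fun A => ¬ ∃ i, MinorIn G (F i) A) := by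
    funext A
    simp only [minorIn_iff_induce, not_exists]
  rw [hbase]
  set Nf : Set V → Prop := fun X => ∃ i, MinorIn G (F i) X with hNf
  have hmono : ∀ X Y, X ⊆ Y → Nf X → Nf Y := fun X Y hXY ⟨i, hi⟩ => ⟨i, hi.mono hXY⟩
  have hk : ¬ KMinor G (T * h) univ := fun hk =>
    hNL (NL_of_kminor (H := F i0) (fun X hX => ⟨i0, hX⟩) hk)
  have hsp : Sparse G (pd h T) := sparse_of_no_kminor hk
  have hr : ∀ C r, Conn G C → r ∈ C → ∃ S ⊆ C, r ∈ S ∧ S.ncard ≤ pp c h T + 1 ∧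
      ∀ D, IsComp G (C \ S) D → Nf D → Nf (comp G (C \ D) r) := by
    intro C r hC hrC
    refine r_lemma hmono hC hrC ?_
    intro γ hγ hγN
    have hpd : 1 ≤ pd h T := by
      have : 0 < dd (T * h) := by unfold dd; positivity
      unfold pd; omega
    have hpA := partA (G := inside G C) (Nf := fun X => ∃ i, MinorIn (inside G C) (F i) X)
      (c := c) (κ := pκ c h T) (d := pd h T) (k2 := pk2 c h T) (t := T) (p := pp c h T)
      (hsp.mono_graph (inside_le G C)) hc hpd (by unfold pκ; omega) (by unfold pκ; omega)
      (by unfold pk2; omega) (by unfold pk2; omega) (by unfold pκ; omega)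
      (fun X Y hXY ⟨i, hi⟩ => ⟨i, hi.mono hXY⟩)
      (by
        rintro X ⟨i, hi⟩
        obtain ⟨D, h1, h2⟩ := minorIn_comp (hFconn i) hi
        exact ⟨D, h1, i, h2⟩)
      (fun X hX D hD γ => hfree V (inside G C) X (fun h => hX ⟨i0, h⟩) D hD γ)
      le_rfl hγ.inside (by
        intro S hS
        have hS' : (S ∩ C).ncard ≤ pp c h T := (ncard_le_ncard Set.inter_subset_left).trans hS
        obtain ⟨i, φ, h1, h2, h3, h4⟩ := hγN (S ∩ C) inter_subset_right hS'
        have hsub : γ (S ∩ C) ⊆ C := (hγ.1 (S ∩ C) inter_subset_right hS').2.1.trans sdiff_subset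
        refine ⟨i, φ, fun w => conn_inside (h1 w) ((h2 w).trans hsub), h2, h3, fun w w' hw => ?_⟩
        obtain ⟨a, ha, b, hb, hab⟩ := h4 w w' hw
        exact ⟨a, ha, b, hb, hab, hsub (h2 w ha), hsub (h2 w' hb)⟩)
    refine hNL ?_
    obtain ⟨B, b1, b2, b3, b4⟩ := hpA
    refine ⟨B, fun i => (b1 i).mono (inside_le G C), fun i => ?_, b3, fun i j hij => ?_⟩
    · obtain ⟨k, hk⟩ := b2 i
      exact ⟨k, hk.mono_graph (inside_le G C)⟩
    · obtain ⟨a, ha, b, hb, hab⟩ := b4 i j hij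
      exact ⟨a, ha, b, hb, hab.1⟩
  have hB : ∀ A B : Set V, A ⊆ B → ¬ Nf B → ¬ Nf A := fun A B h h1 h2 => h1 (hmono A B h h2)
  refine elim_comps hB fun C hC => ?_
  obtain ⟨r, hrC⟩ := hC.1.1
  exact elim_main hmono hr hNL T 0 (by omega) C r hC.1 hrC (fun i => i.elim0) (fun i => i.elim0)
    (fun i => i.elim0) (fun i => i.elim0) (fun i => i.elim0) (fun i => i.elim0) (fun i => i.elim0)

def GG : SimpleGraph (ℕ × ℕ) where
  Adj p q := (p.1 = q.1 ∧ (p.2 = q.2 + 1 ∨ q.2 = p.2 + 1)) ∨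
    (p.2 = q.2 ∧ (p.1 = q.1 + 1 ∨ q.1 = p.1 + 1))
  symm := ⟨fun p q h => by omega⟩
  loopless := ⟨fun p h => by omega⟩

theorem gg_adj {a b c d : ℕ} : GG.Adj (a, b) (c, d) ↔ (a = c ∧ (b = d + 1 ∨ d = b + 1)) ∨
    (b = d ∧ (a = c + 1 ∨ c = a + 1)) := Iff.rfl

def hseg (y a b : ℕ) : Set (ℕ × ℕ) := {p | p.2 = y ∧ a ≤ p.1 ∧ p.1 ≤ b}
def vseg (x a b : ℕ) : Set (ℕ × ℕ) := {p | p.1 = x ∧ a ≤ p.2 ∧ p.2 ≤ b}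

theorem conn_hseg {y a b : ℕ} (h : a ≤ b) : Conn GG (hseg y a b) := by
  have hw : IsWalk GG b (fun i => (i, y)) := fun i _ => by simp [gg_adj]
  have := hw.seg_conn h le_rfl
  convert this using 1
  ext ⟨p, q⟩
  simp only [hseg, mem_ofPred_eq, Set.mem_image, Prod.mk.injEq]
  constructor
  · rintro ⟨h1, h2, h3⟩; exact ⟨p, ⟨h2, h3⟩, rfl, h1.symm⟩
  · rintro ⟨i, ⟨h2, h3⟩, rfl, rfl⟩; exact ⟨rfl, h2, h3⟩

theorem conn_vseg {x a b : ℕ} (h : a ≤ b) : Conn GG (vseg x a b) := by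
  have hw : IsWalk GG b (fun i => (x, i)) := fun i _ => by simp [gg_adj]
  have := hw.seg_conn h le_rfl
  convert this using 1
  ext ⟨p, q⟩
  simp only [vseg, mem_ofPred_eq, Set.mem_image, Prod.mk.injEq]
  constructor
  · rintro ⟨h1, h2, h3⟩; exact ⟨q, ⟨h2, h3⟩, h1.symm, rfl⟩
  · rintro ⟨i, ⟨h2, h3⟩, rfl, rfl⟩; exact ⟨rfl, h2, h3⟩

def cells (w h : ℕ) (o : ℕ → ℕ → V) (v : V) : Set (ℕ × ℕ) := {p | p.1 ≤ w ∧ p.2 ≤ h ∧ o p.1 p.2 = v}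

structure Pic (H : SimpleGraph V) (X : Set V) (w h : ℕ) (o : ℕ → ℕ → V) : Prop where
  mem : ∀ i ≤ w, ∀ j ≤ h, o i j ∈ X
  conn : ∀ v ∈ X, Conn GG (cells w h o v)
  adj : ∀ u ∈ X, ∀ v ∈ X, H.Adj u v → SAdj GG (cells w h o u) (cells w h o v)

def core (s i j : ℕ) : Set (ℕ × ℕ) :=
  hseg (j * s + (s - 1)) (i * s) (i * s + (s - 1)) ∪ vseg (i * s + (s - 1)) (j * s) (j * s + (s - 1))

theorem core_conn (s i j : ℕ) : Conn GG (core s i j) := by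
  refine (conn_hseg (by omega)).union (conn_vseg (by omega)) ⟨(i * s + (s - 1), j * s + (s - 1)), ?_, ?_⟩
  · exact ⟨rfl, by simp, by simp⟩
  · exact ⟨rfl, by simp, by simp⟩

theorem core_adj {s : ℕ} (hs : 1 ≤ s) {a b : ℕ × ℕ} (h : GG.Adj a b) :
    SAdj GG (core s a.1 a.2) (core s b.1 b.2) := by
  have H1 : ∀ i j, SAdj GG (core s i j) (core s (i + 1) j) := by
    intro i j
    refine ⟨(i * s + (s - 1), j * s + (s - 1)), Or.inl ⟨rfl, by simp, le_rfl⟩,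
      ((i + 1) * s, j * s + (s - 1)), Or.inl ⟨rfl, le_rfl, by simp⟩, ?_⟩
    rw [gg_adj]
    right
    refine ⟨rfl, Or.inr ?_⟩
    rw [Nat.succ_mul]; omega
  have H2 : ∀ i j, SAdj GG (core s i j) (core s i (j + 1)) := by
    intro i j
    refine ⟨(i * s + (s - 1), j * s + (s - 1)), Or.inl ⟨rfl, by simp, le_rfl⟩,
      (i * s + (s - 1), (j + 1) * s), Or.inr ⟨rfl, le_rfl, by simp⟩, ?_⟩
    rw [gg_adj]
    left
    refine ⟨rfl, Or.inr ?_⟩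
    rw [Nat.succ_mul]; omega
  obtain ⟨a1, a2⟩ := a
  obtain ⟨b1, b2⟩ := b
  rcases h with ⟨h, h' | h'⟩ | ⟨h, h' | h'⟩ <;> simp only at h h' <;> subst h h'
  · exact (H2 _ _).symm
  · exact H2 _ _
  · exact (H1 _ _).symm
  · exact H1 _ _

theorem succ_block (a : ℕ) {s : ℕ} (hs : 0 < s) : (a + 1) * s + 0 = a * s + (s - 1) + 1 := by
  rw [Nat.succ_mul]; omega

theorem glue {H H1 H2 : SimpleGraph V} {X X1 X2 : Set V} {w1 h1 w2 h2 : ℕ} {o1 o2 : ℕ → ℕ → V}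
    {c d : V} (hX : X = X1 ∪ X2) (P1 : Pic H1 X1 w1 h1 o1) (P2 : Pic H2 X2 w2 h2 o2)
    (hc1 : c ∈ X1) (hc2 : c ∈ X2) (hd1 : d ∈ X1) (hd2 : d ∈ X2) (hcd : c ≠ d)
    (hitr : ∀ v ∈ X1, v ∈ X2 → v = c ∨ v = d)
    {A B : ℕ × ℕ} (hA : A ∈ cells w1 h1 o1 c) (hB : B ∈ cells w1 h1 o1 d)
    (hAB : (B.1 = A.1 + 1 ∧ B.2 = A.2) ∨ (B.1 = A.1 ∧ B.2 = A.2 + 1))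
    (hcl : ∃ y ≤ h2, o2 0 y = c) (hdr : ∃ y ≤ h2, o2 w2 y = d)
    (hadj : ∀ u ∈ X, ∀ v ∈ X, H.Adj u v → (u ∈ X1 ∧ v ∈ X1 ∧ H1.Adj u v) ∨
      (u ∈ X2 ∧ v ∈ X2 ∧ H2.Adj u v)) :
    ∃ w h o, Pic H X w h o ∧ (∀ v, (∃ y ≤ h1, o1 0 y = v) → ∃ y ≤ h, o 0 y = v) ∧
      (∀ v, (∃ y ≤ h1, o1 w1 y = v) → ∃ y ≤ h, o w y = v) := by
  obtain ⟨y1, hy1, hoc⟩ := hcl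
  obtain ⟨y2, hy2, hod⟩ := hdr
  obtain ⟨bi, bj⟩ := B
  obtain ⟨ai, aj⟩ := A
  obtain ⟨hA1, hA2, hA3⟩ := hA
  obtain ⟨hB1, hB2, hB3⟩ := hB
  simp only at hA1 hA2 hA3 hB1 hB2 hB3 hAB
  obtain ⟨s, hs⟩ : ∃ s, s = w2 + h2 + 4 := ⟨_, rfl⟩
  have hs0 : 0 < s := by omega
  let o : ℕ → ℕ → V := fun x y =>
    if x / s = bi ∧ y / s = bj ∧ x % s ≤ w2 + 1 ∧ y % s ≤ h2 + 1 then
      (if x % s = 0 ∨ y % s = 0 then c else o2 (x % s - 1) (y % s - 1)) else o1 (x / s) (y / s)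
  have dm : ∀ i p, p < s → (i * s + p) / s = i ∧ (i * s + p) % s = p := by
    intro i p hp
    rw [mul_comm i s, Nat.mul_add_div hs0, Nat.div_eq_of_lt hp, Nat.mul_add_mod, Nat.mod_eq_of_lt hp]
    exact ⟨rfl, rfl⟩
  have oun : ∀ i j p q, p < s → q < s → ¬ (i = bi ∧ j = bj ∧ p ≤ w2 + 1 ∧ q ≤ h2 + 1) →
      o (i * s + p) (j * s + q) = o1 i j := by
    intro i j p q hp hq hn
    simp only [o, dm i p hp, dm j q hq]
    rw [if_neg hn]
  have oc : ∀ p q, p ≤ w2 + 1 → q ≤ h2 + 1 → (p = 0 ∨ q = 0) → o (bi * s + p) (bj * s + q) = c := by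
    intro p q hp hq h0
    simp only [o, dm bi p (by omega), dm bj q (by omega)]
    rw [if_pos ⟨trivial, trivial, hp, hq⟩, if_pos h0]
  have oo : ∀ p q, p ≤ w2 → q ≤ h2 → o (bi * s + (p + 1)) (bj * s + (q + 1)) = o2 p q := by
    intro p q hp hq
    simp only [o, dm bi (p + 1) (by omega), dm bj (q + 1) (by omega)]
    rw [if_pos ⟨trivial, trivial, by omega, by omega⟩, if_neg (by omega)]
    simp
  obtain ⟨w, hw⟩ : ∃ w, w = w1 * s + (s - 1) := ⟨_, rfl⟩
  obtain ⟨h, hh⟩ : ∃ h, h = h1 * s + (s - 1) := ⟨_, rfl⟩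
  have hle : ∀ i p n, i ≤ n → p < s → i * s + p ≤ n * s + (s - 1) := by
    intro i p n hi hp
    have := Nat.mul_le_mul_right s hi
    omega
  have dec : ∀ n x, x ≤ n * s + (s - 1) → ∃ i p, i ≤ n ∧ p < s ∧ x = i * s + p := by
    intro n x hx
    refine ⟨x / s, x % s, ?_, Nat.mod_lt _ hs0, (Nat.div_add_mod' x s).symm⟩
    rw [← Nat.lt_succ_iff, Nat.div_lt_iff_lt_mul hs0, Nat.succ_mul]
    omega
  have coreSub : ∀ v i j, (i, j) ∈ cells w1 h1 o1 v → core s i j ⊆ cells w h o v := by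
    rintro v i j ⟨hi, hj, hv⟩ ⟨x, y⟩ (⟨e1, e2, e3⟩ | ⟨e1, e2, e3⟩) <;> simp only at e1 e2 e3 hi hj hv
    · obtain ⟨p, rfl⟩ := Nat.exists_eq_add_of_le e2
      subst e1
      refine ⟨?_, ?_, ?_⟩
      · rw [hw]; exact hle _ _ _ hi (by omega)
      · rw [hh]; exact hle _ _ _ hj (by omega)
      · show o _ _ = v
        rw [oun i j p (s - 1) (by omega) (by omega) (by omega), hv]
    · obtain ⟨p, rfl⟩ := Nat.exists_eq_add_of_le e2
      subst e1
      refine ⟨?_, ?_, ?_⟩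
      · rw [hw]; exact hle _ _ _ hi (by omega)
      · rw [hh]; exact hle _ _ _ hj (by omega)
      · show o _ _ = v
        rw [oun i j (s - 1) p (by omega) (by omega) (by omega), hv]
  let base : V → Set (ℕ × ℕ) := fun v => ⋃ a ∈ cells w1 h1 o1 v, core s a.1 a.2
  have baseConn : ∀ v ∈ X1, Conn GG (base v) := fun v hv =>
    (P1.conn v hv).biUnion _ (fun a _ => core_conn s _ _) (fun a _ b _ hab => core_adj hs0 hab)
  have baseSub : ∀ v, base v ⊆ cells w h o v := by
    intro v
    refine Set.iUnion₂_subset ?_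
    rintro ⟨i, j⟩ ha
    exact coreSub v i j ha
  have coreBase : ∀ v i j, (i, j) ∈ cells w1 h1 o1 v → core s i j ⊆ base v := by
    intro v i j hij
    exact subset_biUnion_of_mem (u := fun a : ℕ × ℕ => core s a.1 a.2) hij
  let sh : ℕ × ℕ → ℕ × ℕ := fun a => (bi * s + (a.1 + 1), bj * s + (a.2 + 1))
  have shAdj : ∀ a b, GG.Adj a b → GG.Adj (sh a) (sh b) := by
    rintro ⟨a1, a2⟩ ⟨b1, b2⟩ hab
    simp only [sh, gg_adj] at hab ⊢
    omega
  have shSub : ∀ v, sh '' cells w2 h2 o2 v ⊆ cells w h o v := by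
    rintro v _ ⟨⟨p, q⟩, ⟨hp, hq, hv⟩, rfl⟩
    simp only at hp hq hv
    refine ⟨?_, ?_, ?_⟩
    · rw [hw]; exact hle _ _ _ hB1 (by omega)
    · rw [hh]; exact hle _ _ _ hB2 (by omega)
    · show o _ _ = v
      rw [oo p q hp hq, hv]
  have shConn : ∀ v ∈ X2, Conn GG (sh '' cells w2 h2 o2 v) := fun v hv =>
    (P2.conn v hv).image sh (fun a _ b _ hab => shAdj a b hab)
  have cls : ∀ v, ∀ z ∈ cells w h o v,
      (∃ i j p q, (i, j) ∈ cells w1 h1 o1 v ∧ p < s ∧ q < s ∧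
        ¬ (i = bi ∧ j = bj ∧ p ≤ w2 + 1 ∧ q ≤ h2 + 1) ∧ z = (i * s + p, j * s + q)) ∨
      (v = c ∧ ∃ p q, p ≤ w2 + 1 ∧ q ≤ h2 + 1 ∧ (p = 0 ∨ q = 0) ∧ z = (bi * s + p, bj * s + q)) ∨
      z ∈ sh '' cells w2 h2 o2 v := by
    rintro v ⟨x, y⟩ ⟨hx, hy, hv⟩
    simp only at hx hy hv
    rw [hw] at hx
    rw [hh] at hy
    obtain ⟨i, p, hi, hp, rfl⟩ := dec _ _ hx
    obtain ⟨j, q, hj, hq, rfl⟩ := dec _ _ hy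
    by_cases hpat : i = bi ∧ j = bj ∧ p ≤ w2 + 1 ∧ q ≤ h2 + 1
    · obtain ⟨rfl, rfl, hp', hq'⟩ := hpat
      by_cases h0 : p = 0 ∨ q = 0
      · rw [oc p q hp' hq' h0] at hv
        exact Or.inr (Or.inl ⟨hv.symm, p, q, hp', hq', h0, rfl⟩)
      · obtain ⟨p, rfl⟩ : ∃ p', p = p' + 1 := ⟨p - 1, by omega⟩
        obtain ⟨q, rfl⟩ : ∃ q', q = q' + 1 := ⟨q - 1, by omega⟩
        rw [oo p q (by omega) (by omega)] at hv
        exact Or.inr (Or.inr ⟨(p, q), ⟨by simpa using hp', by simpa using hq', hv⟩, rfl⟩)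
    · rw [oun i j p q hp hq hpat] at hv
      exact Or.inl ⟨i, j, p, q, ⟨hi, hj, hv⟩, hp, hq, hpat, rfl⟩
  have reachBase : ∀ v i j p q, (i, j) ∈ cells w1 h1 o1 v → p < s → q < s →
      ¬ (i = bi ∧ j = bj ∧ p ≤ w2 + 1 ∧ q ≤ h2 + 1) →
      ∃ R ⊆ cells w h o v, Conn GG R ∧ (i * s + p, j * s + q) ∈ R ∧ (R ∩ base v).Nonempty := by
    intro v i j p q hij hp hq hn
    refine ⟨hseg (j * s + q) (i * s + p) (i * s + (s - 1)), ?_, conn_hseg (by omega),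
      ⟨rfl, le_rfl, by simp only; omega⟩, (i * s + (s - 1), j * s + q), ⟨rfl, by simp only; omega, le_rfl⟩,
      coreBase v i j hij (Or.inr ⟨rfl, by simp, by simp only; omega⟩)⟩
    rintro ⟨x, y⟩ ⟨e1, e2, e3⟩
    simp only at e1 e2 e3
    subst e1
    obtain ⟨p', rfl⟩ : ∃ p', x = i * s + p' := ⟨x - i * s, by omega⟩
    refine ⟨?_, ?_, ?_⟩
    · rw [hw]; exact hle _ _ _ hij.1 (by omega)
    · rw [hh]; exact hle _ _ _ hij.2.1 hq
    · show o _ _ = v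
      rw [oun i j p' q (by omega) hq (by omega)]
      exact hij.2.2
  have finish : ∀ v ∈ X1, (∀ z ∈ cells w h o v, ∃ R ⊆ cells w h o v, Conn GG R ∧ z ∈ R ∧
      ((R ∩ base v).Nonempty ∨ SAdj GG (base v) R)) → Conn GG (cells w h o v) := by
    intro v hv hz
    have := (baseConn v hv).union_pieces (U := cells w h o v) (by
      intro z hzc
      obtain ⟨R, r1, r2, r3, r4⟩ := hz z hzc
      exact ⟨R, r1.trans subset_union_left, r2, r3, r4⟩)
    rwa [Set.union_eq_self_of_subset_left (baseSub v)] at this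
  refine ⟨w, h, o, ⟨?_, ?_, ?_⟩, ?_, ?_⟩
  · intro x hx y hy
    rcases cls (o x y) (x, y) ⟨hx, hy, rfl⟩ with ⟨i, j, p, q, ⟨a, b, e⟩, -⟩ | ⟨e, -⟩ | ⟨⟨p, q⟩, ⟨a, b, e⟩, -⟩
    · rw [hX, ← e]; exact Or.inl (P1.mem _ a _ b)
    · rw [hX, e]; exact Or.inl hc1
    · rw [hX, ← e]; exact Or.inr (P2.mem _ a _ b)
  · intro v hv
    by_cases hv1 : v ∈ X1
    · refine finish v hv1 fun z hz => ?_
      rcases cls v z hz with ⟨i, j, p, q, hij, hp, hq, hn, rfl⟩ | hcase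
      · obtain ⟨R, r1, r2, r3, r4⟩ := reachBase v i j p q hij hp hq hn
        exact ⟨R, r1, r2, r3, Or.inl r4⟩
      by_cases hvc : v = c
      · subst hvc
        refine ⟨(vseg (bi * s + 0) (bj * s + 0) (bj * s + (h2 + 1)) ∪ hseg (bj * s + 0) (bi * s + 0) (bi * s + (w2 + 1))) ∪
          sh '' cells w2 h2 o2 v, ?_, ?_, ?_, Or.inr ?_⟩
        · refine union_subset (union_subset ?_ ?_) (shSub v)
          · rintro ⟨x, y⟩ ⟨e1, e2, e3⟩
            simp only at e1 e2 e3
            subst e1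
            obtain ⟨q, rfl⟩ : ∃ q, y = bj * s + q := ⟨y - bj * s, by omega⟩
            refine ⟨?_, ?_, oc 0 q (by omega) (by omega) (Or.inl rfl)⟩
            · rw [hw]; exact hle _ _ _ hB1 (by omega)
            · rw [hh]; exact hle _ _ _ hB2 (by omega)
          · rintro ⟨x, y⟩ ⟨e1, e2, e3⟩
            simp only at e1 e2 e3
            subst e1
            obtain ⟨p, rfl⟩ : ∃ p, x = bi * s + p := ⟨x - bi * s, by omega⟩
            refine ⟨?_, ?_, oc p 0 (by omega) (by omega) (Or.inr rfl)⟩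
            · rw [hw]; exact hle _ _ _ hB1 (by omega)
            · rw [hh]; exact hle _ _ _ hB2 (by omega)
        · refine Conn.union_adj ((conn_vseg (by omega)).union (conn_hseg (by omega))
            ⟨(bi * s + 0, bj * s + 0), ⟨rfl, by simp, by simp only; omega⟩, ⟨rfl, by simp, by simp only; omega⟩⟩)
            (shConn v hc2) ⟨(bi * s + 0, bj * s + (y1 + 1)), Or.inl ⟨rfl, by simp only; omega, by simp only; omega⟩,
            sh (0, y1), ⟨(0, y1), ⟨by simp, hy1, hoc⟩, rfl⟩, ?_⟩
          show GG.Adj (bi * s + 0, bj * s + (y1 + 1)) (bi * s + (0 + 1), bj * s + (y1 + 1))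
          exact Or.inr ⟨rfl, Or.inr rfl⟩
        · rcases hcase with ⟨-, p, q, hp, hq, h0, rfl⟩ | hz'
          · left
            rcases h0 with rfl | rfl
            · left; exact ⟨rfl, by simp, by simp only; omega⟩
            · right; exact ⟨rfl, by simp, by simp only; omega⟩
          · exact Or.inr hz'
        · have hAc : (ai, aj) ∈ cells w1 h1 o1 v := ⟨hA1, hA2, hA3⟩
          rcases hAB with ⟨e1, e2⟩ | ⟨e1, e2⟩
          · refine ⟨(ai * s + (s - 1), aj * s), coreBase v ai aj hAc (Or.inr ⟨rfl, le_rfl, by simp⟩),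
              (bi * s + 0, bj * s + 0), Or.inl (Or.inl ⟨rfl, le_rfl, by simp⟩), ?_⟩
            have e3 : bi * s + 0 = ai * s + (s - 1) + 1 := by rw [e1]; exact succ_block ai hs0
            exact Or.inr ⟨by simp only [e2, Nat.add_zero], Or.inr e3⟩
          · refine ⟨(ai * s, aj * s + (s - 1)), coreBase v ai aj hAc (Or.inl ⟨rfl, le_rfl, by simp⟩),
              (bi * s + 0, bj * s + 0), Or.inl (Or.inl ⟨rfl, le_rfl, by simp⟩), ?_⟩
            have e3 : bj * s + 0 = aj * s + (s - 1) + 1 := by rw [e2]; exact succ_block aj hs0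
            exact Or.inl ⟨by simp only [e1, Nat.add_zero], Or.inr e3⟩
      · have hz' : z ∈ sh '' cells w2 h2 o2 v := by
          rcases hcase with ⟨e, -⟩ | h
          · exact absurd e hvc
          · exact h
        have hv2 : v ∈ X2 := by
          obtain ⟨⟨p, q⟩, ⟨a, b, e⟩, -⟩ := hz'
          rw [← e]; exact P2.mem _ a _ b
        obtain rfl : v = d := (hitr v hv1 hv2).resolve_left hvc
        have hBc : (bi, bj) ∈ cells w1 h1 o1 v := ⟨hB1, hB2, hB3⟩
        obtain ⟨R, r1, r2, r3, r4⟩ := reachBase v bi bj (w2 + 2) (y2 + 1) hBc (by omega) (by omega) (by omega)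
        refine ⟨R ∪ sh '' cells w2 h2 o2 v, union_subset r1 (shSub v), ?_, Or.inr hz', Or.inl ?_⟩
        · refine r2.union_adj (shConn v hd2) ⟨_, r3, sh (w2, y2), ⟨(w2, y2), ⟨le_rfl, hy2, hod⟩, rfl⟩, ?_⟩
          show GG.Adj (bi * s + (w2 + 2), bj * s + (y2 + 1)) (bi * s + (w2 + 1), bj * s + (y2 + 1))
          exact Or.inr ⟨rfl, Or.inl rfl⟩
        · exact r4.mono (Set.inter_subset_inter_left _ subset_union_left)
    · have hv2 : v ∈ X2 := by rw [hX] at hv; exact hv.resolve_left hv1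
      have : cells w h o v = sh '' cells w2 h2 o2 v := by
        refine Set.Subset.antisymm (fun z hz => ?_) (shSub v)
        rcases cls v z hz with ⟨i, j, p, q, ⟨a, b, e⟩, -⟩ | ⟨e, -⟩ | h
        · exact absurd (e ▸ P1.mem _ a _ b) hv1
        · exact absurd (e ▸ hc1) hv1
        · exact h
      rw [this]
      exact shConn v hv2
  · intro u hu v hv huv
    rcases hadj u hu v hv huv with ⟨hu1, hv1, h1'⟩ | ⟨hu2, hv2, h2'⟩
    · obtain ⟨a, ha, b, hb, hab⟩ := P1.adj u hu1 v hv1 h1'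
      exact (core_adj hs0 hab).mono (coreSub u _ _ ha) (coreSub v _ _ hb)
    · obtain ⟨a, ha, b, hb, hab⟩ := P2.adj u hu2 v hv2 h2'
      exact ⟨sh a, shSub u ⟨a, ha, rfl⟩, sh b, shSub v ⟨b, hb, rfl⟩, shAdj a b hab⟩
  · rintro v ⟨y, hy, e⟩
    refine ⟨y * s + (s - 1), by rw [hh]; exact hle _ _ _ hy (by omega), ?_⟩
    have := oun 0 y 0 (s - 1) hs0 (by omega) (by omega)
    rw [Nat.zero_mul, Nat.zero_add] at this
    rw [this, e]
  · rintro v ⟨y, hy, e⟩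
    refine ⟨y * s + (s - 1), by rw [hh]; exact hle _ _ _ hy (by omega), ?_⟩
    rw [hw, oun w1 y (s - 1) (s - 1) (by omega) (by omega) (by omega), e]

structure US (w M : ℕ) (t : ℕ → ℕ) : Prop where
  z : t 0 = 0
  e : t w = M
  s : ∀ c < w, t (c + 1) = t c ∨ t (c + 1) = t c + 1

theorem US.mono {w M : ℕ} {t : ℕ → ℕ} (h : US w M t) : ∀ {x y : ℕ}, x ≤ y → y ≤ w → t x ≤ t y := by
  intro x y hxy
  induction y, hxy using Nat.le_induction with
  | base => intro _; exact le_rfl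
  | succ y hy ih =>
    intro hw
    have := ih (by omega)
    rcases h.s y (by omega) with h | h <;> omega

theorem US.le {w M : ℕ} {t : ℕ → ℕ} (h : US w M t) {x : ℕ} (hx : x ≤ w) : t x ≤ M := by
  have := h.mono hx le_rfl
  rwa [h.e] at this

theorem US.jump {w M : ℕ} {t : ℕ → ℕ} (h : US w M t) {c : ℕ} (hc : c < M) :
    ∃ x < w, t x = c ∧ t (x + 1) = c + 1 := by
  have hex : ∃ x, c < t x := ⟨w, by rw [h.e]; exact hc⟩
  have h1 := Nat.find_spec hex
  have h2 : ∀ y < Nat.find hex, ¬ c < t y := fun y hy => Nat.find_min hex hy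
  have h3 : Nat.find hex ≤ w := Nat.find_min' hex (by rw [h.e]; exact hc)
  obtain ⟨x, hx⟩ : ∃ x, Nat.find hex = x + 1 := by
    refine ⟨Nat.find hex - 1, ?_⟩
    have : Nat.find hex ≠ 0 := by
      intro h0
      rw [h0, h.z] at h1
      omega
    omega
  rw [hx] at h1 h2 h3
  have h4 := h2 x (by omega)
  refine ⟨x, by omega, ?_, ?_⟩ <;> rcases h.s x (by omega) with h5 | h5 <;> omega

theorem US.surj {w M : ℕ} {t : ℕ → ℕ} (h : US w M t) {c : ℕ} (hc : c ≤ M) : ∃ x ≤ w, t x = c := by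
  rcases Nat.lt_or_ge c M with h1 | h1
  · obtain ⟨x, hx, e, -⟩ := h.jump h1
    exact ⟨x, hx.le, e⟩
  · exact ⟨w, le_rfl, by rw [h.e]; omega⟩

theorem US.fiber_conn {w M : ℕ} {t : ℕ → ℕ} (h : US w M t) {c y : ℕ} (hc : c ≤ M) :
    Conn GG {p | p.1 ≤ w ∧ t p.1 = c ∧ p.2 = y} := by
  obtain ⟨x, hx, e⟩ := h.surj hc
  refine conn_of_base (x, y) ⟨hx, e, rfl⟩ ?_
  rintro ⟨x', y'⟩ ⟨hx', e', rfl⟩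
  simp only at hx' e'
  rcases le_total x x' with hle | hle
  · refine ⟨hseg y' x x', ?_, conn_hseg hle, ⟨rfl, le_rfl, hle⟩, ⟨rfl, hle, le_rfl⟩⟩
    rintro ⟨p, q⟩ ⟨e1, e2, e3⟩
    simp only at e1 e2 e3
    have h1 := h.mono e2 (by omega)
    have h2 := h.mono e3 hx'
    exact ⟨by simp only; omega, by simp only; omega, e1⟩
  · refine ⟨hseg y' x' x, ?_, conn_hseg hle, ⟨rfl, hle, le_rfl⟩, ⟨rfl, le_rfl, hle⟩⟩
    rintro ⟨p, q⟩ ⟨e1, e2, e3⟩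
    simp only at e1 e2 e3
    have h1 := h.mono e2 (by omega)
    have h2 := h.mono e3 hx
    exact ⟨by simp only; omega, by simp only; omega, e1⟩

theorem Pic.stretch {H : SimpleGraph V} {X : Set V} {w h : ℕ} {o : ℕ → ℕ → V} (P : Pic H X w h o)
    {w' : ℕ} {σ : ℕ → ℕ} (hσ : US w' w σ) : Pic H X w' h (fun x y => o (σ x) y) := by
  let B : ℕ × ℕ → Set (ℕ × ℕ) := fun a => {p | p.1 ≤ w' ∧ σ p.1 = a.1 ∧ p.2 = a.2}
  have hB : ∀ v, cells w' h (fun x y => o (σ x) y) v = ⋃ a ∈ cells w h o v, B a := by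
    intro v
    ext ⟨x, y⟩
    simp only [mem_iUnion]
    constructor
    · rintro ⟨h1, h2, h3⟩
      exact ⟨(σ x, y), ⟨hσ.le h1, h2, h3⟩, h1, rfl, rfl⟩
    · rintro ⟨⟨a1, a2⟩, ⟨h1, h2, h3⟩, h4, h5, h6⟩
      simp only at h1 h2 h3 h4 h5 h6
      subst h5 h6
      exact ⟨h4, h2, h3⟩
  have hBadj : ∀ a b : ℕ × ℕ, a.1 ≤ w → b.1 ≤ w → GG.Adj a b → SAdj GG (B a) (B b) := by
    have H1 : ∀ i j, i + 1 ≤ w → SAdj GG (B (i, j)) (B (i + 1, j)) := by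
      intro i j hi
      obtain ⟨x, hx, e1, e2⟩ := hσ.jump hi
      exact ⟨(x, j), ⟨hx.le, e1, rfl⟩, (x + 1, j), ⟨hx, e2, rfl⟩, Or.inr ⟨rfl, Or.inr rfl⟩⟩
    have H2 : ∀ i j, i ≤ w → SAdj GG (B (i, j)) (B (i, j + 1)) := by
      intro i j hi
      obtain ⟨x, hx, e1⟩ := hσ.surj hi
      exact ⟨(x, j), ⟨hx, e1, rfl⟩, (x, j + 1), ⟨hx, e1, rfl⟩, Or.inl ⟨rfl, Or.inr rfl⟩⟩
    rintro ⟨a1, a2⟩ ⟨b1, b2⟩ ha hb hab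
    rcases hab with ⟨h, h' | h'⟩ | ⟨h, h' | h'⟩ <;> simp only at h h' <;> subst h h'
    · exact (H2 _ _ ha).symm
    · exact H2 _ _ ha
    · exact (H1 _ _ ha).symm
    · exact H1 _ _ hb
  refine ⟨fun i hi j hj => P.mem _ (hσ.le hi) _ hj, fun v hv => ?_, fun u hu v hv huv => ?_⟩
  · rw [hB]
    exact (P.conn v hv).biUnion B (fun a ha => hσ.fiber_conn ha.1)
      (fun a ha b hb hab => hBadj a b ha.1 hb.1 hab)
  · obtain ⟨a, ha, b, hb, hab⟩ := P.adj u hu v hv huv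
    rw [hB, hB]
    exact (hBadj a b ha.1 hb.1 hab).mono (subset_biUnion_of_mem (u := B) ha)
      (subset_biUnion_of_mem (u := B) hb)

theorem Pic.addRow {H : SimpleGraph V} {S F : Set V} {w h : ℕ} {o : ℕ → ℕ → V} (P : Pic H S w h o)
    {r : ℕ → V} (hr : ∀ x ≤ w, r x ∈ S ∪ F) (hS : ∀ x ≤ w, r x ∈ S → r x = o x h)
    (hF : ∀ v ∈ F, v ∉ S ∧ Conn GG {p : ℕ × ℕ | p.1 ≤ w ∧ r p.1 = v ∧ p.2 = h + 1})
    (hadj : ∀ u ∈ F, ∀ v ∈ S ∪ F, H.Adj u v →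
      (∃ x < w, (r x = u ∧ r (x + 1) = v) ∨ (r x = v ∧ r (x + 1) = u)) ∨ (∃ x ≤ w, r x = u ∧ o x h = v)) :
    Pic H (S ∪ F) w (h + 1) (fun x y => if y ≤ h then o x y else r x) := by
  obtain ⟨o', ho'⟩ : ∃ o' : ℕ → ℕ → V, o' = (fun x y => if y ≤ h then o x y else r x) := ⟨_, rfl⟩
  rw [← ho']
  have o1 : ∀ x y, y ≤ h → o' x y = o x y := fun x y hy => by rw [ho']; simp [hy]
  have o2 : ∀ x, o' x (h + 1) = r x := fun x => by rw [ho']; simp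
  have hsub : ∀ v, cells w h o v ⊆ cells w (h + 1) o' v := by
    rintro v ⟨x, y⟩ ⟨h1, h2, h3⟩
    exact ⟨h1, Nat.le_succ_of_le h2, by rw [o1 _ _ h2, h3]⟩
  have hadj' : ∀ u ∈ F, ∀ v ∈ S ∪ F, H.Adj u v → SAdj GG (cells w (h + 1) o' u) (cells w (h + 1) o' v) := by
    intro u hu v hv huv
    rcases hadj u hu v hv huv with ⟨x, hx, ⟨e1, e2⟩ | ⟨e1, e2⟩⟩ | ⟨x, hx, e1, e2⟩
    · exact ⟨(x, h + 1), ⟨hx.le, le_rfl, by rw [o2, e1]⟩, (x + 1, h + 1), ⟨hx, le_rfl, by rw [o2, e2]⟩,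
        Or.inr ⟨rfl, Or.inr rfl⟩⟩
    · exact ⟨(x + 1, h + 1), ⟨hx, le_rfl, by rw [o2, e2]⟩, (x, h + 1), ⟨hx.le, le_rfl, by rw [o2, e1]⟩,
        Or.inr ⟨rfl, Or.inl rfl⟩⟩
    · exact ⟨(x, h + 1), ⟨hx, le_rfl, by rw [o2, e1]⟩, (x, h), ⟨hx, Nat.le_succ h, by rw [o1 _ _ le_rfl, e2]⟩,
        Or.inl ⟨rfl, Or.inl rfl⟩⟩
  refine ⟨?_, ?_, ?_⟩
  · intro x hx y hy
    rcases Nat.lt_or_ge h y with h1 | h1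
    · obtain rfl : y = h + 1 := by omega
      rw [o2]; exact hr x hx
    · rw [o1 _ _ h1]; exact Or.inl (P.mem x hx y h1)
  · intro v hv
    by_cases hvS : v ∈ S
    · have := (P.conn v hvS).union_pieces (U := cells w (h + 1) o' v) (by
        rintro ⟨x, y⟩ ⟨h1, h2, h3⟩
        simp only at h1 h2 h3
        refine ⟨{(x, y)}, ?_, conn_singleton _ _, rfl, ?_⟩
        · rintro _ rfl
          exact Or.inl ⟨h1, h2, h3⟩
        · rcases Nat.lt_or_ge h y with h4 | h4
          · obtain rfl : y = h + 1 := by omega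
            rw [o2] at h3
            have h5 := hS x h1 (h3 ▸ hvS)
            exact Or.inr ⟨(x, h), ⟨h1, le_rfl, by rw [← h5, h3]⟩, _, rfl, Or.inl ⟨rfl, Or.inr rfl⟩⟩
          · rw [o1 _ _ h4] at h3
            exact Or.inl ⟨_, rfl, h1, h4, h3⟩)
      rwa [Set.union_eq_self_of_subset_left (hsub v)] at this
    · have hvF := hv.resolve_left hvS
      convert (hF v hvF).2 using 1
      ext ⟨x, y⟩
      constructor
      · rintro ⟨h1, h2, h3⟩
        simp only at h1 h2 h3
        rcases Nat.lt_or_ge h y with h4 | h4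
        · obtain rfl : y = h + 1 := by omega
          rw [o2] at h3
          exact ⟨h1, h3, rfl⟩
        · rw [o1 _ _ h4] at h3
          exact absurd (h3 ▸ P.mem x h1 y h4) hvS
      · rintro ⟨h1, h2, h3⟩
        simp only at h1 h2 h3
        subst h3
        exact ⟨h1, le_rfl, by rw [o2, h2]⟩
  · intro u hu v hv huv
    by_cases huF : u ∈ F
    · exact hadj' u huF v hv huv
    by_cases hvF : v ∈ F
    · exact (hadj' v hvF u hu huv.symm).symm
    · exact (P.adj u (hu.resolve_right huF) v (hv.resolve_right hvF) huv).mono (hsub u) (hsub v)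

structure St (H : SimpleGraph V) (X : Set V) (a b : V) (S : Set V) (m : ℕ) (u : ℕ → V) (w h : ℕ)
    (o : ℕ → ℕ → V) (t : ℕ → ℕ) : Prop where
  SX : S ⊆ X
  bX : b ∈ X
  bS : b ∉ S
  ab : H.Adj a b
  Oc : Conn H (X \ S)
  m1 : 1 ≤ m
  u0 : u 0 = a
  um : u (m + 1) = a
  inj : ∀ i ≤ m, ∀ j ≤ m, u i = u j → i = j
  uS : ∀ k ≤ m + 1, u k ∈ S
  uadj : ∀ k ≤ m, H.Adj (u k) (u (k + 1))
  noE : ∀ x ∈ S, ∀ y ∈ X, y ∉ S → H.Adj x y → ∃ k ≤ m, x = u k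
  pic : Pic H S w h o
  us : US w (m + 1) t
  top : ∀ c ≤ w, o c h = u (t c)

structure Ext (H : SimpleGraph V) (X : Set V) (b : V) (S : Set V) (m : ℕ) (u : ℕ → V)
    (n : ℕ) (f : ℕ → V) (i j : ℕ) : Prop where
  ij : i < j
  jm : j ≤ m + 1
  fX : ∀ k ≤ n, f k ∈ X ∧ f k ∉ S ∧ f k ≠ b
  inj : ∀ k ≤ n, ∀ l ≤ n, f k = f l → k = l
  walk : ∀ k < n, H.Adj (f k) (f (k + 1))
  ind : ∀ k l, k < l → l ≤ n → H.Adj (f k) (f l) → l = k + 1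
  fu : ∀ k ≤ n, ∀ v ∈ S, H.Adj (f k) v → ∃ l, i ≤ l ∧ l ≤ j ∧ v = u l ∧
    ((l = i ∧ k = 0) ∨ (l = j ∧ k = n) ∨ n = 0)
  fi : H.Adj (f 0) (u i)
  fj : H.Adj (f n) (u j)
  Wc : Conn H (X \ (S ∪ f '' {k | k ≤ n}))
  noW : ∀ l, i < l → l < j → ∀ x ∈ X, x ∉ S → (∀ k ≤ n, x ≠ f k) → ¬ H.Adj (u l) x

theorem St.step {H : SimpleGraph V} {X : Set V} {a b : V} {S : Set V} {m : ℕ} {u : ℕ → V} {w h : ℕ}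
    {o : ℕ → ℕ → V} {t : ℕ → ℕ} (A : St H X a b S m u w h o t) {n : ℕ} {f : ℕ → V} {i j : ℕ}
    (E : Ext H X b S m u n f i j) :
    ∃ m' u' w' h' o' t', St H X a b (S ∪ f '' {k | k ≤ n}) m' u' w' h' o' t' := by
  have hij := E.ij
  have hjm := E.jm
  obtain ⟨s, hsw, ts, ts1⟩ := A.us.jump (c := i) (by omega)
  let u' : ℕ → V := fun k => if k ≤ i then u k else if k ≤ i + n + 1 then f (k - i - 1)
    else u (k - (i + n + 2) + j)
  have ua : ∀ k ≤ i, u' k = u k := fun k hk => by simp only [u', if_pos hk]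
  have ub : ∀ k ≤ n, u' (i + 1 + k) = f k := fun k hk => by
    simp only [u']
    rw [if_neg (by omega), if_pos (by omega)]
    congr 1; omega
  have uc : ∀ k, u' (i + n + 2 + k) = u (j + k) := fun k => by
    simp only [u']
    rw [if_neg (by omega), if_neg (by omega)]
    congr 1; omega
  have cas : ∀ k, k ≤ i ∨ (∃ k' ≤ n, k = i + 1 + k') ∨ (∃ k', k = i + n + 2 + k') := by
    intro k
    rcases Nat.lt_or_ge i k with h1 | h1
    · rcases Nat.lt_or_ge (i + n + 1) k with h2 | h2
      · exact Or.inr (Or.inr ⟨k - (i + n + 2), by omega⟩)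
      · exact Or.inr (Or.inl ⟨k - i - 1, by omega, by omega⟩)
    · exact Or.inl h1
  obtain ⟨m', hm'⟩ : ∃ m', m' = m + i + n + 2 - j := ⟨_, rfl⟩
  let σ : ℕ → ℕ := fun x => if x ≤ s then x else if x ≤ s + n + 1 then s else x - (n + 1)
  let t' : ℕ → ℕ := fun x => if x ≤ s then t x else if x ≤ s + n + 1 then i + (x - s) else
    if t (x - (n + 1)) < j then i + n + 1 else t (x - (n + 1)) - j + (i + n + 2)
  have σa : ∀ x ≤ s, σ x = x := fun x hx => by simp only [σ, if_pos hx]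
  have σb : ∀ x, s ≤ x → x ≤ s + n + 1 → σ x = s := fun x h1 h2 => by
    rcases Nat.lt_or_ge s x with h3 | h3
    · simp only [σ]; rw [if_neg (by omega), if_pos h2]
    · rw [σa x h3]; omega
  have σc : ∀ x, s ≤ x → σ (x + (n + 1)) = x := fun x h1 => by
    rcases Nat.lt_or_ge s x with h3 | h3
    · simp only [σ]; rw [if_neg (by omega), if_neg (by omega)]; omega
    · rw [σb _ (by omega) (by omega)]; omega
  have ta : ∀ x ≤ s, t' x = t x := fun x hx => by simp only [t', if_pos hx]
  have tb : ∀ x, s ≤ x → x ≤ s + n + 1 → t' x = i + (x - s) := fun x h1 h2 => by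
    rcases Nat.lt_or_ge s x with h3 | h3
    · simp only [t']; rw [if_neg (by omega), if_pos h2]
    · obtain rfl : x = s := by omega
      rw [ta x h3]; omega
  have tc : ∀ x, s < x → t x < j → t' (x + (n + 1)) = i + n + 1 := fun x h1 h2 => by
    simp only [t']; rw [if_neg (by omega), if_neg (by omega), if_pos]
    rwa [Nat.add_sub_cancel]
  have td : ∀ x, s < x → j ≤ t x → t' (x + (n + 1)) = t x - j + (i + n + 2) := fun x h1 h2 => by
    simp only [t']; rw [if_neg (by omega), if_neg (by omega), if_neg, Nat.add_sub_cancel]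
    rw [Nat.add_sub_cancel]; omega
  have xcas : ∀ x, x ≤ s ∨ (s < x ∧ x ≤ s + n + 1) ∨ (∃ c, s < c ∧ x = c + (n + 1)) := by
    intro x
    rcases Nat.lt_or_ge s x with h1 | h1
    · rcases Nat.lt_or_ge (s + n + 1) x with h2 | h2
      · exact Or.inr (Or.inr ⟨x - (n + 1), by omega, by omega⟩)
      · exact Or.inr (Or.inl ⟨h1, h2⟩)
    · exact Or.inl h1
  have tmono : ∀ c, s < c → c ≤ w → i + 1 ≤ t c := fun c h1 h2 => by
    have := A.us.mono (x := s + 1) (y := c) h1 h2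
    omega
  have tle : ∀ c ≤ s, t c ≤ i := fun c hc => by
    have := A.us.mono hc hsw.le
    omega
  have usσ : US (w + (n + 1)) w σ := by
    refine ⟨σa 0 (by omega), σc w hsw.le, ?_⟩
    intro c hc
    rcases xcas (c + 1) with h1 | ⟨h1, h2⟩ | ⟨d, h1, h2⟩
    · right; rw [σa _ h1, σa _ (by omega)]
    · left; rw [σb _ (by omega) h2, σb _ (by omega) (by omega)]
    · right
      obtain ⟨e, rfl⟩ : ∃ e, d = e + 1 := ⟨d - 1, by omega⟩
      obtain rfl : c = e + (n + 1) := by omega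
      rw [h2, σc _ (by omega), σc _ (by omega)]
  have ust : US (w + (n + 1)) (m' + 1) t' := by
    refine ⟨by rw [ta 0 (by omega), A.us.z], ?_, ?_⟩
    · have := A.us.e
      rw [td w hsw (by omega)]; omega
    · intro c hc
      rcases xcas (c + 1) with h1 | ⟨h1, h2⟩ | ⟨d, h1, h2⟩
      · rw [ta _ h1, ta _ (by omega)]; exact A.us.s c (by omega)
      · right; rw [tb _ (by omega) h2, tb _ (by omega) (by omega)]; omega
      · obtain ⟨e, rfl⟩ : ∃ e, d = e + 1 := ⟨d - 1, by omega⟩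
        obtain rfl : c = e + (n + 1) := by omega
        rw [h2]
        rcases Nat.lt_or_ge s e with h3 | h3
        · have hs := A.us.s e (by omega)
          have hm1 := tmono e h3 (by omega)
          rcases Nat.lt_or_ge (t e) j with h4 | h4
          · rw [tc e h3 h4]
            rcases Nat.lt_or_ge (t (e + 1)) j with h5 | h5
            · rw [tc _ h1 h5]; exact Or.inl rfl
            · rw [td _ h1 h5]; omega
          · rw [td e h3 h4, td _ h1 (by omega)]; omega
        · obtain rfl : e = s := by omega
          rw [tb (e + (n + 1)) (by omega) (by omega)]
          rcases Nat.lt_or_ge (t (e + 1)) j with h5 | h5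
          · rw [tc _ h1 h5]; omega
          · rw [td _ h1 h5]; omega
  have fnS : ∀ k ≤ n, f k ∉ S := fun k hk => (E.fX k hk).2.1
  have rval : ∀ x ≤ w + (n + 1), (u' (t' x) = u (t (σ x)) ∧ (t' x ≤ i ∨ i + n + 2 ≤ t' x)) ∨
      (∃ k ≤ n, t' x = i + 1 + k) := by
    intro x hx
    rcases xcas x with h1 | ⟨h1, h2⟩ | ⟨d, h1, rfl⟩
    · have := tle x h1
      left; rw [ta x h1, σa x h1]; exact ⟨ua _ this, Or.inl this⟩
    · right; exact ⟨x - s - 1, by omega, by rw [tb x h1.le h2]; omega⟩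
    · rcases Nat.lt_or_ge (t d) j with h5 | h5
      · right; exact ⟨n, le_rfl, by rw [tc _ h1 h5]; omega⟩
      · left; rw [td _ h1 h5, σc _ h1.le]
        refine ⟨?_, by omega⟩
        rw [Nat.add_comm (t d - j), uc]; congr 1; omega
  have u'S : ∀ k ≤ m' + 1, k ≤ i ∨ i + n + 2 ≤ k → u' k ∈ S := by
    intro k hk hk'
    rcases hk' with h1 | h1
    · rw [ua k h1]; exact A.uS _ (by omega)
    · obtain ⟨k', rfl⟩ := Nat.exists_eq_add_of_le h1
      rw [uc]; exact A.uS _ (by omega)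
  have u'f : ∀ k ≤ m' + 1, ∀ l ≤ n, u' k = f l → k = i + 1 + l := by
    intro k hk l hl e
    by_cases hk' : k ≤ i ∨ i + n + 2 ≤ k
    · exact absurd (e ▸ u'S k hk hk') (fnS l hl)
    · obtain ⟨k', hk1, rfl⟩ : ∃ k' ≤ n, k = i + 1 + k' := ⟨k - i - 1, by omega, by omega⟩
      rw [ub k' hk1] at e
      rw [E.inj k' hk1 l hl e]
  have hpic := (A.pic.stretch usσ).addRow (F := f '' {k | k ≤ n}) (r := fun x => u' (t' x)) ?_ ?_ ?_ ?_
  · refine ⟨m', u', w + (n + 1), h + 1, _, t', ?_, A.bX, ?_, A.ab, E.Wc, by omega, ?_, ?_, ?_, ?_, ?_, ?_, hpic, ust, ?_⟩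
    · rintro x (hx | ⟨k, hk, rfl⟩)
      · exact A.SX hx
      · exact (E.fX k hk).1
    · rintro (hx | ⟨k, hk, e⟩)
      · exact A.bS hx
      · exact (E.fX k hk).2.2 e
    · rw [ua 0 (by omega), A.u0]
    · obtain ⟨k, hk⟩ : ∃ k, m' + 1 = i + n + 2 + k := ⟨m' + 1 - (i + n + 2), by omega⟩
      rw [hk, uc, ← A.um]; congr 1; omega
    · have key : ∀ k ≤ m', ∀ l ≤ m', k < l → u' k ≠ u' l := by
        intro k hk l hl hkl e
        rcases cas l with h1 | ⟨l', h1, rfl⟩ | ⟨l', rfl⟩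
        · rw [ua _ h1, ua _ (by omega)] at e
          have := A.inj _ (by omega) _ (by omega) e
          omega
        · rw [ub l' h1] at e
          have := u'f k (by omega) l' h1 e
          omega
        · rcases cas k with h1 | ⟨k', h1, rfl⟩ | ⟨k', rfl⟩
          · rw [ua _ h1, uc] at e
            have := A.inj _ (by omega) _ (by omega) e
            omega
          · rw [ub k' h1] at e
            have := u'f _ (by omega) k' h1 e.symm
            omega
          · rw [uc, uc] at e
            have := A.inj _ (by omega) _ (by omega) e
            omega
      intro k hk l hl e
      rcases lt_trichotomy k l with h1 | h1 | h1
      · exact absurd e (key k hk l hl h1)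
      · exact h1
      · exact absurd e.symm (key l hl k hk h1)
    · intro k hk
      rcases cas k with h1 | ⟨k', h1, rfl⟩ | ⟨k', rfl⟩
      · exact Or.inl (u'S _ hk (Or.inl h1))
      · rw [ub k' h1]; exact Or.inr ⟨k', h1, rfl⟩
      · exact Or.inl (u'S _ hk (Or.inr (by omega)))
    · intro k hk
      rcases cas k with h1 | ⟨k', h1, rfl⟩ | ⟨k', rfl⟩
      · rw [ua k h1]
        rcases Nat.lt_or_ge k i with h2 | h2
        · rw [ua _ h2]; exact A.uadj k (by omega)
        · obtain rfl : k = i := by omega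
          have := ub 0 (by omega)
          rw [Nat.add_zero] at this
          rw [this]; exact E.fi.symm
      · rw [ub k' h1]
        rcases Nat.lt_or_ge k' n with h2 | h2
        · have := ub (k' + 1) h2
          rw [← Nat.add_assoc] at this
          rw [this]; exact E.walk k' h2
        · obtain rfl : k' = n := by omega
          have := uc 0
          have e : i + 1 + k' + 1 = i + k' + 2 + 0 := by omega
          rw [e, this]; exact E.fj
      · rw [uc]
        have := uc (k' + 1)
        rw [← Nat.add_assoc] at this
        rw [this]; exact A.uadj (j + k') (by omega)
    · intro x hx y hyX hyS hxy
      rcases hx with hx | ⟨k, hk, rfl⟩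
      · obtain ⟨l, hl, rfl⟩ := A.noE x hx y hyX (fun h => hyS (Or.inl h)) hxy
        have h3 : ¬ (i < l ∧ l < j) := by
          rintro ⟨h1, h2⟩
          exact E.noW l h1 h2 y hyX (fun h => hyS (Or.inl h)) (fun k hk e => hyS (Or.inr ⟨k, hk, e.symm⟩)) hxy
        rcases Nat.lt_or_ge i l with h1 | h1
        · refine ⟨i + n + 2 + (l - j), by omega, ?_⟩
          rw [uc]; congr 1; omega
        · exact ⟨l, by omega, (ua l h1).symm⟩
      · have hk' : k ≤ n := hk
        exact ⟨i + 1 + k, by omega, (ub k hk).symm⟩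
    · intro c hc
      simp
  · intro x hx
    rcases rval x hx with ⟨-, e⟩ | ⟨k, hk, e⟩
    · exact Or.inl (u'S _ (ust.le hx) e)
    · right; exact ⟨k, hk, by simp only [e, ub k hk]⟩
  · intro x hx hxS
    rcases rval x hx with ⟨e, -⟩ | ⟨k, hk, e⟩
    · show u' (t' x) = o (σ x) h
      rw [e, A.top _ (usσ.le hx)]
    · simp only [e, ub k hk] at hxS
      exact absurd hxS (fnS k hk)
  · rintro _ ⟨k, hk, rfl⟩
    have hk' : k ≤ n := hk
    refine ⟨fnS k hk, ?_⟩
    convert ust.fiber_conn (c := i + 1 + k) (y := h + 1) (by omega) using 1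
    ext ⟨x, y⟩
    constructor
    · rintro ⟨h1, h2, h3⟩
      exact ⟨h1, u'f _ (ust.le h1) k hk h2, h3⟩
    · rintro ⟨h1, h2, h3⟩
      exact ⟨h1, by simp only at h2 ⊢; rw [h2, ub k hk], h3⟩
  · have jmp : ∀ c, c < m' + 1 → ∃ x < w + (n + 1), u' (t' x) = u' c ∧ u' (t' (x + 1)) = u' (c + 1) := by
      intro c hc
      obtain ⟨x, hx, e1, e2⟩ := ust.jump hc
      exact ⟨x, hx, by rw [e1], by rw [e2]⟩
    rintro _ ⟨k, hk, rfl⟩ v hv hkv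
    have hk' : k ≤ n := hk
    have ffadj : ∀ l < n, ∃ x < w + (n + 1), u' (t' x) = f l ∧ u' (t' (x + 1)) = f (l + 1) := by
      intro l hl
      obtain ⟨x, hx, e1, e2⟩ := jmp (i + 1 + l) (by omega)
      have := ub (l + 1) hl
      rw [← Nat.add_assoc] at this
      exact ⟨x, hx, by rw [e1, ub l hl.le], by rw [e2, this]⟩
    have endi : ∃ x < w + (n + 1), u' (t' x) = u i ∧ u' (t' (x + 1)) = f 0 := by
      obtain ⟨x, hx, e1, e2⟩ := jmp i (by omega)
      exact ⟨x, hx, by rw [e1, ua i le_rfl], by rw [e2]; exact ub 0 (by omega)⟩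
    have endj : ∃ x < w + (n + 1), u' (t' x) = f n ∧ u' (t' (x + 1)) = u j := by
      obtain ⟨x, hx, e1, e2⟩ := jmp (i + 1 + n) (by omega)
      refine ⟨x, hx, by rw [e1, ub n le_rfl], ?_⟩
      have e : i + 1 + n + 1 = i + n + 2 + 0 := by omega
      rw [e2, e, uc]; rfl
    by_cases hvF : v ∈ f '' {k | k ≤ n}
    · obtain ⟨l, hl, rfl⟩ := hvF
      left
      rcases lt_trichotomy k l with h1 | h1 | h1
      · obtain rfl := E.ind k l h1 hl hkv
        obtain ⟨x, hx, e⟩ := ffadj k hl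
        exact ⟨x, hx, Or.inl e⟩
      · rw [h1] at hkv; exact absurd rfl hkv.ne
      · obtain rfl := E.ind l k h1 hk hkv.symm
        obtain ⟨x, hx, e⟩ := ffadj l hk
        exact ⟨x, hx, Or.inr e⟩
    · obtain ⟨l, hil, hlj, rfl, hc⟩ := E.fu k hk v (hv.resolve_right hvF) hkv
      have hci : l = i → k = 0 → (∃ x < w + (n + 1), (u' (t' x) = f k ∧ u' (t' (x + 1)) = u l) ∨
          (u' (t' x) = u l ∧ u' (t' (x + 1)) = f k)) := by
        rintro rfl rfl
        obtain ⟨x, hx, e⟩ := endi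
        exact ⟨x, hx, Or.inr e⟩
      have hcj : l = j → k = n → (∃ x < w + (n + 1), (u' (t' x) = f k ∧ u' (t' (x + 1)) = u l) ∨
          (u' (t' x) = u l ∧ u' (t' (x + 1)) = f k)) := by
        rintro rfl rfl
        obtain ⟨x, hx, e⟩ := endj
        exact ⟨x, hx, Or.inl e⟩
      rcases hc with ⟨h1, h2⟩ | ⟨h1, h2⟩ | h1
      · exact Or.inl (hci h1 h2)
      · exact Or.inl (hcj h1 h2)
      · rcases Nat.lt_or_ge i l with h2 | h2
        · rcases Nat.lt_or_ge l j with h3 | h3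
          · right
            obtain ⟨c, hc, e⟩ := A.us.surj (c := l) (by omega)
            have hsc : s < c := by
              by_contra hcs
              have := tle c (by omega)
              omega
            refine ⟨c + (n + 1), by omega, ?_, ?_⟩
            · show u' (t' (c + (n + 1))) = f k
              rw [tc c hsc (by omega)]
              have e : i + n + 1 = i + 1 + k := by omega
              rw [e, ub k hk]
            · show o (σ (c + (n + 1))) h = u l
              rw [σc c hsc.le, A.top c hc, e]
          · exact Or.inl (hcj (by omega) (by omega))
        · exact Or.inl (hci (by omega) (by omega))

theorem St.finish {H : SimpleGraph V} {X : Set V} {a b : V} {S : Set V} {m : ℕ} {u : ℕ → V} {w h : ℕ}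
    {o : ℕ → ℕ → V} {t : ℕ → ℕ} (A : St H X a b S m u w h o t) (hO : X \ S = {b}) :
    ∃ w h o, Pic H X w h o ∧ (∃ y ≤ h, o 0 y = a) ∧ (∃ y ≤ h, o w y = b) := by
  obtain ⟨o', ho'⟩ : ∃ o' : ℕ → ℕ → V, o' = (fun x y => if x ≤ w ∧ y ≤ h then o x y else b) := ⟨_, rfl⟩
  have o1 : ∀ x y, x ≤ w → y ≤ h → o' x y = o x y := fun x y hx hy => by rw [ho']; simp [hx, hy]
  have o2 : ∀ x y, ¬ (x ≤ w ∧ y ≤ h) → o' x y = b := fun x y hx => by rw [ho']; exact if_neg hx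
  have hX : ∀ x ∈ X, x ∈ S ∨ x = b := by
    intro x hx
    by_cases hxS : x ∈ S
    · exact Or.inl hxS
    · right
      have : x ∈ X \ S := ⟨hx, hxS⟩
      rw [hO] at this
      exact this
  have cS : ∀ v ∈ S, cells (w + 1) (h + 1) o' v = cells w h o v := by
    intro v hv
    ext ⟨x, y⟩
    constructor
    · rintro ⟨h1, h2, h3⟩
      simp only at h1 h2 h3
      by_cases hc : x ≤ w ∧ y ≤ h
      · rw [o1 x y hc.1 hc.2] at h3
        exact ⟨hc.1, hc.2, h3⟩
      · rw [o2 x y hc] at h3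
        exact absurd (h3 ▸ hv) A.bS
    · rintro ⟨h1, h2, h3⟩
      simp only at h1 h2 h3
      exact ⟨Nat.le_succ_of_le h1, Nat.le_succ_of_le h2, by rw [o1 x y h1 h2]; exact h3⟩
  have cb : cells (w + 1) (h + 1) o' b = hseg (h + 1) 0 (w + 1) ∪ vseg (w + 1) 0 (h + 1) := by
    ext ⟨x, y⟩
    constructor
    · rintro ⟨h1, h2, h3⟩
      simp only at h1 h2 h3
      by_cases hc : x ≤ w ∧ y ≤ h
      · rw [o1 x y hc.1 hc.2] at h3
        exact absurd (h3 ▸ A.pic.mem x hc.1 y hc.2) A.bS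
      · by_cases hx : x ≤ w
        · exact Or.inl ⟨by simp only; omega, by simp only; omega, by simp only; omega⟩
        · exact Or.inr ⟨by simp only; omega, by simp only; omega, by simp only; omega⟩
    · rintro (⟨h1, h2, h3⟩ | ⟨h1, h2, h3⟩) <;> simp only at h1 h2 h3
      · exact ⟨h3, h1.le, o2 x y (by omega)⟩
      · exact ⟨h1.le, h3, o2 x y (by omega)⟩
  have hb : ∀ v ∈ S, H.Adj v b → SAdj GG (cells (w + 1) (h + 1) o' v) (cells (w + 1) (h + 1) o' b) := by
    intro v hv hvb
    obtain ⟨k, hk, rfl⟩ := A.noE v hv b A.bX A.bS hvb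
    obtain ⟨x, hx, e⟩ := A.us.surj (c := k) (by omega)
    rw [cS _ hv, cb]
    refine ⟨(x, h), ⟨hx, le_rfl, ?_⟩, (x, h + 1), Or.inl ⟨rfl, by simp, by simp only; omega⟩,
      Or.inl ⟨rfl, Or.inr rfl⟩⟩
    rw [← e]; exact A.top x hx
  refine ⟨w + 1, h + 1, o', ⟨?_, ?_, ?_⟩, ⟨h, by omega, ?_⟩, ⟨h + 1, le_rfl, o2 _ _ (by omega)⟩⟩
  · intro x hx y hy
    by_cases hc : x ≤ w ∧ y ≤ h
    · rw [o1 x y hc.1 hc.2]; exact A.SX (A.pic.mem x hc.1 y hc.2)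
    · rw [o2 x y hc]; exact A.bX
  · intro v hv
    rcases hX v hv with h1 | rfl
    · rw [cS v h1]; exact A.pic.conn v h1
    · rw [cb]
      exact (conn_hseg (by omega)).union (conn_vseg (by omega))
        ⟨(w + 1, h + 1), ⟨rfl, by simp, by simp⟩, ⟨rfl, by simp, by simp⟩⟩
  · intro x hx y hy hxy
    rcases hX x hx with h1 | rfl
    · rcases hX y hy with h2 | rfl
      · rw [cS x h1, cS y h2]; exact A.pic.adj x h1 y h2 hxy
      · exact hb x h1 hxy
    · rcases hX y hy with h2 | rfl
      · exact (hb y h2 hxy.symm).symm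
      · exact absurd rfl hxy.ne
  · rw [o1 0 h (by omega) le_rfl, A.top 0 (by omega), A.us.z, A.u0]

def Ear (H : SimpleGraph V) (C E : Set V) : Prop :=
  Conn H E ∧ ∃ p ∈ C, ∃ q ∈ C, p ≠ q ∧ (∃ x ∈ E, H.Adj x p) ∧ ∃ y ∈ E, H.Adj y q

theorem ear_lemma {H : SimpleGraph V} {O C : Set V} {b : V} (hOf : O.Finite) (hCf : C.Finite)
    (hd : ∀ x ∈ O, x ∉ C) {p0 q0 : V} (hp0 : p0 ∈ C) (hq0 : q0 ∈ C) (hpq0 : p0 ≠ q0)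
    (hO : Conn H O) (hb : b ∈ O) (hOb : O ≠ {b})
    (h3 : ∀ K ⊆ O, Conn H K → b ∉ K → O ∪ C ⊆ K ∪ nbr H K ∨ 3 ≤ (nbr H K ∩ (O ∪ C)).ncard) :
    ∃ n f, ∃ p ∈ C, ∃ q ∈ C, p ≠ q ∧ IsPth H n f ∧ (∀ k ≤ n, f k ∈ O ∧ f k ≠ b) ∧
      (∀ k l, k < l → l ≤ n → H.Adj (f k) (f l) → l = k + 1) ∧ H.Adj (f 0) p ∧ H.Adj (f n) q ∧
      Conn H (O \ f '' {k | k ≤ n}) ∧ SAdj H (O \ f '' {k | k ≤ n}) (f '' {k | k ≤ n}) ∧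
      (∀ k ≤ n, ∀ v ∈ C, H.Adj (f k) v → n = 0 ∨ (k = 0 ∧ v = p) ∨ (k = n ∧ v = q)) := by
  let Ws : Set (Set V) := {W | W ⊆ O ∧ Conn H W ∧ b ∈ W ∧ ∃ E ⊆ O \ W, Ear H C E}
  have hWf : Ws.Finite := hOf.finite_subsets.subset (fun W hW => hW.1)
  have hWne : Ws.Nonempty := by
    refine ⟨{b}, by simpa using hb, conn_singleton _ _, rfl, ?_⟩
    obtain ⟨x, hx⟩ : (O \ {b}).Nonempty := by
      rw [Set.nonempty_iff_ne_empty]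
      intro h
      rw [Set.sdiff_eq_empty] at h
      exact hOb (Set.Subset.antisymm h (by simpa using hb))
    obtain ⟨k1, k2, k3⟩ := comp_isComp (G := H) hx
    set K := comp H (O \ {b}) x
    refine ⟨K, k2, k1, ?_⟩
    have hbK : b ∉ K := fun h => (k2 h).2 rfl
    rcases h3 K (k2.trans sdiff_subset) k1 hbK with h | h
    · have : ∀ c ∈ C, ∃ x ∈ K, H.Adj x c := by
        intro c hc
        rcases h (Or.inr hc) with h1 | h1
        · exact absurd hc (hd c (k2 h1).1)
        · exact h1.2
      exact ⟨p0, hp0, q0, hq0, hpq0, this _ hp0, this _ hq0⟩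
    · obtain ⟨x1, m1, x2, m2, x3, m3, n12, n13, n23⟩ :=
        (Set.two_lt_ncard ((hOf.union hCf).subset inter_subset_right)).1 h
      have key : ∀ y ∈ nbr H K ∩ (O ∪ C), y = b ∨ (y ∈ C ∧ ∃ x ∈ K, H.Adj x y) := by
        rintro y ⟨⟨h1, z, hz, hzy⟩, h2⟩
        by_cases hy : y = b
        · exact Or.inl hy
        · rcases h2 with h2 | h2
          · exact absurd (k3 z hz y ⟨h2, hy⟩ hzy) h1
          · exact Or.inr ⟨h2, z, hz, hzy⟩
      rcases key _ m1 with rfl | ⟨c1, e1⟩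
      · rcases key _ m2 with h | ⟨c2, e2⟩
        · exact absurd h.symm n12
        · rcases key _ m3 with h | ⟨c3, e3⟩
          · exact absurd h.symm n13
          · exact ⟨x2, c2, x3, c3, n23, e2, e3⟩
      · rcases key _ m2 with rfl | ⟨c2, e2⟩
        · rcases key _ m3 with h | ⟨c3, e3⟩
          · exact absurd h.symm n23
          · exact ⟨x1, c1, x3, c3, n13, e1, e3⟩
        · exact ⟨x1, c1, x2, c2, n12, e1, e2⟩
  obtain ⟨W, ⟨hWO, hWc, hbW, hWE⟩, hWmax⟩ := Set.exists_max_image Ws Set.ncard hWf hWne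
  obtain ⟨R, hR⟩ : ∃ R, R = O \ W := ⟨_, rfl⟩
  rw [← hR] at hWE
  have hRO : R ⊆ O := by rw [hR]; exact sdiff_subset
  have hRb : b ∉ R := by rw [hR]; exact fun h => h.2 hbW
  have hRw : ∀ r ∈ R, (∃ x ∈ W, H.Adj x r) → ∀ E ⊆ R, Ear H C E → r ∈ E := by
    rintro r hr ⟨x, hx, hxr⟩ E hE hEar
    by_contra hrE
    have hrW : r ∉ W := by rw [hR] at hr; exact hr.2
    have := hWmax (insert r W) ⟨insert_subset (hRO hr) hWO, hWc.insert_adj hx hxr,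
      Or.inr hbW, E, ?_, hEar⟩
    · rw [ncard_insert_of_notMem hrW (hOf.subset hWO)] at this
      omega
    · intro y hy
      refine ⟨hRO (hE hy), ?_⟩
      rintro (rfl | h)
      · exact hrE hy
      · have := hE hy; rw [hR] at this; exact this.2 h
  obtain ⟨E, ⟨hER, hEear⟩, hEmin⟩ := Set.exists_min_image {E | E ⊆ R ∧ Ear H C E} Set.ncard
    ((hOf.subset hRO).finite_subsets.subset (fun W hW => hW.1)) hWE
  obtain ⟨hEc, p, hp, q', hq', hpq', ⟨x, hx, hxp⟩, y, hy, hyq⟩ := id hEear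
  obtain ⟨n, f, hf, f0, fn, fQ, fT, find⟩ := exists_path hEc hx (T := {z | ∃ c ∈ C, c ≠ p ∧ H.Adj z c})
    ⟨y, hy, q', hq', hpq'.symm, hyq⟩
  obtain ⟨q, hq, hqp, hfq⟩ := fn
  have hsubear : ∀ E' ⊆ E, Ear H C E' → E' = E := by
    intro E' h1 h2
    exact Set.eq_of_subset_of_ncard_le h1 (hEmin E' ⟨h1.trans hER, h2⟩) ((hOf.subset hRO).subset hER)
  have hfp : H.Adj (f 0) p := by rw [f0]; exact hxp
  have segc : ∀ k l, k ≤ l → l ≤ n → Conn H (f '' {i | k ≤ i ∧ i ≤ l}) := fun k l h1 h2 =>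
    hf.1.seg_conn h1 h2
  have segE : ∀ k l, l ≤ n → f '' {i | k ≤ i ∧ i ≤ l} ⊆ E := by
    rintro k l hl _ ⟨i, hi, rfl⟩; exact fQ i (hi.2.trans hl)
  have hfE : f '' {k | k ≤ n} = E := by
    refine hsubear _ ?_ ?_
    · rintro _ ⟨k, hk, rfl⟩; exact fQ k hk
    · have := segc 0 n (by omega) le_rfl
      simp only [Nat.zero_le, true_and] at this
      exact ⟨this, p, hp, q, hq, hqp.symm, ⟨_, ⟨0, Nat.zero_le n, rfl⟩, hfp⟩, ⟨_, ⟨n, le_refl n, rfl⟩, hfq⟩⟩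
  have hC : ∀ k ≤ n, ∀ v ∈ C, H.Adj (f k) v → n = 0 ∨ (k = 0 ∧ v = p) ∨ (k = n ∧ v = q) := by
    intro k hk v hv hkv
    by_contra! hcon
    obtain ⟨c0, c1, c2⟩ := hcon
    rcases Nat.lt_or_ge k n with h1 | h1
    · have hvp : v = p := by
        by_contra h
        exact fT k h1 ⟨v, hv, h, hkv⟩
      have hk0 : k ≠ 0 := fun h => c1 h hvp
      have := hsubear (f '' {i | k ≤ i ∧ i ≤ n}) (segE k n le_rfl) ⟨segc k n hk le_rfl, p, hp, q, hq, hqp.symm,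
        ⟨_, ⟨k, ⟨le_rfl, hk⟩, rfl⟩, hvp ▸ hkv⟩, ⟨_, ⟨n, ⟨hk, le_rfl⟩, rfl⟩, hfq⟩⟩
      have h0 : f 0 ∈ E := fQ 0 (by omega)
      rw [← this] at h0
      obtain ⟨i, hi, e⟩ := h0
      have := hf.2 i hi.2 0 (by omega) e
      have := hi.1
      omega
    · obtain rfl : k = n := by omega
      have hvq := c2 rfl
      have := hsubear {f k} (by simpa using fQ k le_rfl) ⟨conn_singleton _ _, v, hv, q, hq, hvq,
        ⟨_, rfl, hkv⟩, ⟨_, rfl, hfq⟩⟩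
      have h0 : f 0 ∈ E := fQ 0 (by omega)
      rw [← this] at h0
      have := hf.2 0 (by omega) k le_rfl h0
      omega
  have hREq : R = E := by
    refine Set.Subset.antisymm ?_ hER
    by_contra hne
    obtain ⟨r, hrR, hrE⟩ := Set.not_subset.1 hne
    let Rw : Set V := {r | r ∈ R ∧ ∃ x ∈ W, H.Adj x r}
    have hRwE : ∀ r ∈ Rw, r ∈ E := fun r hr => hRw r hr.1 hr.2 E hER hEear
    have hrX : r ∈ R \ Rw := ⟨hrR, fun h => hrE (hRwE r h)⟩
    obtain ⟨k1, k2, k3⟩ := comp_isComp (G := H) hrX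
    set K := comp H (R \ Rw) r
    have hKR : K ⊆ R := k2.trans sdiff_subset
    have hbK : b ∉ K := fun h => hRb (hKR h)
    have key : ∀ y ∈ nbr H K ∩ (O ∪ C), (y ∈ Rw ∧ ∃ x ∈ K, H.Adj x y) ∨ (y ∈ C ∧ ∃ x ∈ K, H.Adj x y) := by
      rintro y ⟨⟨h1, z, hz, hzy⟩, h2⟩
      rcases h2 with h2 | h2
      · left
        refine ⟨?_, z, hz, hzy⟩
        by_cases hyW : y ∈ W
        · exact absurd ⟨hKR hz, y, hyW, hzy.symm⟩ (k2 hz).2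
        · have hyR : y ∈ R := by rw [hR]; exact ⟨h2, hyW⟩
          by_contra hyRw
          exact h1 (k3 z hz y ⟨hyR, hyRw⟩ hzy)
      · exact Or.inr ⟨h2, z, hz, hzy⟩
    have hKnoear : ∀ Y ⊆ R, Ear H C Y → ∀ r ∈ Rw, r ∈ Y := fun Y hY h r hr => hRw r hr.1 hr.2 Y hY h
    have hRwne : Rw.Nonempty := by
      obtain ⟨u, hu, huW, v, hv, hvW, huv⟩ := hO.cross W hb hbW (hRO hrR)
        (by rw [hR] at hrR; exact hrR.2)
      exact ⟨v, by rw [hR]; exact ⟨hv, hvW⟩, u, huW, huv⟩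
    have hone : ∀ c ∈ C, ∀ c' ∈ C, (∃ x ∈ K, H.Adj x c) → (∃ x ∈ K, H.Adj x c') → c = c' := by
      intro c hc c' hc' e e'
      by_contra hne
      obtain ⟨r', hr'⟩ := hRwne
      exact (k2 (hKnoear K hKR ⟨k1, c, hc, c', hc', hne, e, e'⟩ r' hr')).2 hr'
    have hidx : ∀ y ∈ Rw, ∃ k ≤ n, y = f k := by
      intro y hy
      have := hRwE y hy
      rw [← hfE] at this
      obtain ⟨k, hk, e⟩ := this
      exact ⟨k, hk, e.symm⟩
    have hnotK : ∀ y ∈ Rw, y ∉ K := fun y hy h => (k2 h).2 hy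
    have hP : ∀ k l, k < l → l ≤ n → f k ∈ Rw → f l ∈ Rw → (∃ x ∈ K, H.Adj x (f k)) →
        (∃ x ∈ K, H.Adj x (f l)) → ∀ c ∈ C, ¬ ∃ x ∈ K, H.Adj x c := by
      intro k l hkl hl hk' hl' ⟨x1, hx1, e1⟩ ⟨x2, hx2, e2⟩ c hc ⟨x3, hx3, e3⟩
      by_cases hcq : c = q
      · have hcp : c ≠ p := fun h => hqp (hcq.symm.trans h)
        have := hKnoear (K ∪ f '' {i | 0 ≤ i ∧ i ≤ k}) (union_subset hKR ((segE 0 k (by omega)).trans hER))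
          ⟨k1.union_adj (segc 0 k (by omega) (by omega)) ⟨x1, hx1, _, ⟨k, ⟨by omega, le_rfl⟩, rfl⟩, e1⟩,
          c, hc, p, hp, hcp, ⟨x3, Or.inl hx3, e3⟩, ⟨_, Or.inr ⟨0, ⟨le_rfl, by omega⟩, rfl⟩, hfp⟩⟩ _ hl'
        rcases this with h | ⟨i, hi, e⟩
        · exact hnotK _ hl' h
        · have := hf.2 i (hi.2.trans (by omega)) l hl e
          have := hi.2
          omega
      · have := hKnoear (K ∪ f '' {i | l ≤ i ∧ i ≤ n}) (union_subset hKR ((segE l n le_rfl).trans hER))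
          ⟨k1.union_adj (segc l n hl le_rfl) ⟨x2, hx2, _, ⟨l, ⟨le_rfl, hl⟩, rfl⟩, e2⟩,
          c, hc, q, hq, hcq, ⟨x3, Or.inl hx3, e3⟩, ⟨_, Or.inr ⟨n, ⟨hl, le_rfl⟩, rfl⟩, hfq⟩⟩ _ hk'
        rcases this with h | ⟨i, hi, e⟩
        · exact hnotK _ hk' h
        · have := hf.2 i hi.2 k (by omega) e
          have := hi.1
          omega
    have hP' : ∀ y z, y ≠ z → y ∈ Rw → z ∈ Rw → (∃ x ∈ K, H.Adj x y) →
        (∃ x ∈ K, H.Adj x z) → ∀ c ∈ C, ¬ ∃ x ∈ K, H.Adj x c := by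
      intro y z hyz hy hz ey ez
      obtain ⟨k, hk, rfl⟩ := hidx y hy
      obtain ⟨l, hl, rfl⟩ := hidx z hz
      rcases lt_trichotomy k l with h | h | h
      · exact hP k l h hl hy hz ey ez
      · rw [h] at hyz; exact absurd rfl hyz
      · exact hP l k h hk hz hy ez ey
    have hQ : ∀ k l j, k < l → l < j → j ≤ n → f k ∈ Rw → f l ∈ Rw → f j ∈ Rw → (∃ x ∈ K, H.Adj x (f k)) →
        (∃ x ∈ K, H.Adj x (f j)) → False := by
      intro k l j hkl hlj hj hk' hl' hj' ⟨x1, hx1, e1⟩ ⟨x2, hx2, e2⟩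
      have := hKnoear ((K ∪ f '' {i | 0 ≤ i ∧ i ≤ k}) ∪ f '' {i | j ≤ i ∧ i ≤ n})
        (union_subset (union_subset hKR ((segE 0 k (by omega)).trans hER)) ((segE j n le_rfl).trans hER))
        ⟨(k1.union_adj (segc 0 k (by omega) (by omega)) ⟨x1, hx1, _, ⟨k, ⟨by omega, le_rfl⟩, rfl⟩, e1⟩).union_adj
          (segc j n hj le_rfl) ⟨x2, Or.inl hx2, _, ⟨j, ⟨le_rfl, hj⟩, rfl⟩, e2⟩,
        p, hp, q, hq, hqp.symm, ⟨_, Or.inl (Or.inr ⟨0, ⟨le_rfl, by omega⟩, rfl⟩), hfp⟩,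
          ⟨_, Or.inr ⟨n, ⟨hj, le_rfl⟩, rfl⟩, hfq⟩⟩ _ hl'
      rcases this with (h | ⟨i, hi, e⟩) | ⟨i, hi, e⟩
      · exact hnotK _ hl' h
      · have := hf.2 i (hi.2.trans (by omega)) l (by omega) e
        have := hi.2
        omega
      · have := hf.2 i hi.2 l (by omega) e
        have := hi.1
        omega
    rcases h3 K (hKR.trans hRO) k1 hbK with h | h
    · rcases h (Or.inl hb) with h1 | h1
      · exact hbK h1
      · rcases key b ⟨h1, Or.inl hb⟩ with h2 | h2
        · exact hRb h2.1.1
        · exact hd b hb h2.1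
    · obtain ⟨x1, m1, x2, m2, x3, m3, n12, n13, n23⟩ :=
        (Set.two_lt_ncard ((hOf.union hCf).subset inter_subset_right)).1 h
      rcases key _ m1 with ⟨a1, e1⟩ | ⟨a1, e1⟩ <;> rcases key _ m2 with ⟨a2, e2⟩ | ⟨a2, e2⟩ <;>
        rcases key _ m3 with ⟨a3, e3⟩ | ⟨a3, e3⟩
      · obtain ⟨j1, h1, rfl⟩ := hidx _ a1
        obtain ⟨j2, h2, rfl⟩ := hidx _ a2
        obtain ⟨j3, h3, rfl⟩ := hidx _ a3
        have g12 : j1 ≠ j2 := fun h => n12 (by rw [h])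
        have g13 : j1 ≠ j3 := fun h => n13 (by rw [h])
        have g23 : j2 ≠ j3 := fun h => n23 (by rw [h])
        rcases Nat.lt_or_gt_of_ne g12 with l12 | l12 <;> rcases Nat.lt_or_gt_of_ne g13 with l13 | l13 <;>
          rcases Nat.lt_or_gt_of_ne g23 with l23 | l23
        · exact hQ j1 j2 j3 l12 l23 h3 a1 a2 a3 e1 e3
        · exact hQ j1 j3 j2 l13 l23 h2 a1 a3 a2 e1 e2
        · omega
        · exact hQ j3 j1 j2 l13 l12 h2 a3 a1 a2 e3 e2
        · exact hQ j2 j1 j3 l12 l13 h3 a2 a1 a3 e2 e3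
        · omega
        · exact hQ j2 j3 j1 l23 l13 h1 a2 a3 a1 e2 e1
        · exact hQ j3 j2 j1 l23 l12 h1 a3 a2 a1 e3 e1
      · exact hP' _ _ n12 a1 a2 e1 e2 _ a3 e3
      · exact hP' _ _ n13 a1 a3 e1 e3 _ a2 e2
      · exact n23 (hone _ a2 _ a3 e2 e3)
      · exact hP' _ _ n23 a2 a3 e2 e3 _ a1 e1
      · exact n13 (hone _ a1 _ a3 e1 e3)
      · exact n12 (hone _ a1 _ a2 e1 e2)
      · exact n12 (hone _ a1 _ a2 e1 e2)
  have hWeq : O \ f '' {k | k ≤ n} = W := by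
    rw [hfE, ← hREq, hR, sdiff_sdiff_right_self]
    exact Set.inter_eq_right.2 hWO
  refine ⟨n, f, p, hp, q, hq, hqp.symm, hf, ?_, find, hfp, hfq, by rw [hWeq]; exact hWc, ?_, hC⟩
  · intro k hk
    have := hER (fQ k hk)
    exact ⟨hRO this, fun h => hRb (h ▸ this)⟩
  · rw [hWeq]
    have h0 := hER (fQ 0 (by omega))
    obtain ⟨u, hu, huW, v, hv, hvW, huv⟩ := hO.cross W hb hbW (hRO h0)
        (by rw [hR] at h0; exact h0.2)
    refine ⟨u, huW, v, ?_, huv⟩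
    rw [hfE, ← hREq, hR]; exact ⟨hv, hvW⟩

theorem k33_mk {X A B C D E F : Set V}
    (hA : Conn G A ∧ A ⊆ X) (hB : Conn G B ∧ B ⊆ X) (hC : Conn G C ∧ C ⊆ X)
    (hD : Conn G D ∧ D ⊆ X) (hE : Conn G E ∧ E ⊆ X) (hF : Conn G F ∧ F ⊆ X)
    (dAB : Disjoint A B) (dAC : Disjoint A C) (dBC : Disjoint B C)
    (dDE : Disjoint D E) (dDF : Disjoint D F) (dEF : Disjoint E F)
    (dAD : Disjoint A D) (dAE : Disjoint A E) (dAF : Disjoint A F)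
    (dBD : Disjoint B D) (dBE : Disjoint B E) (dBF : Disjoint B F)
    (dCD : Disjoint C D) (dCE : Disjoint C E) (dCF : Disjoint C F)
    (aAD : SAdj G A D) (aAE : SAdj G A E) (aAF : SAdj G A F)
    (aBD : SAdj G B D) (aBE : SAdj G B E) (aBF : SAdj G B F)
    (aCD : SAdj G C D) (aCE : SAdj G C E) (aCF : SAdj G C F) : MinorIn G K33 X := by
  refine ⟨Sum.elim ![A, B, C] ![D, E, F], ?_, ?_, ?_, ?_⟩
  · rintro (i | i) <;> fin_cases i
    exacts [hA.1, hB.1, hC.1, hD.1, hE.1, hF.1]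
  · rintro (i | i) <;> fin_cases i
    exacts [hA.2, hB.2, hC.2, hD.2, hE.2, hF.2]
  · rintro (i | i) (j | j) h <;> fin_cases i <;> fin_cases j <;>
      first
      | exact absurd rfl h
      | exact dAB | exact dAC | exact dBC | exact dDE | exact dDF | exact dEF
      | exact dAD | exact dAE | exact dAF | exact dBD | exact dBE | exact dBF
      | exact dCD | exact dCE | exact dCF
      | exact dAB.symm | exact dAC.symm | exact dBC.symm | exact dDE.symm | exact dDF.symm | exact dEF.symm
      | exact dAD.symm | exact dAE.symm | exact dAF.symm | exact dBD.symm | exact dBE.symm | exact dBF.symm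
      | exact dCD.symm | exact dCE.symm | exact dCF.symm
  · rintro (i | i) (j | j) h
    · simp [K33] at h
    · fin_cases i <;> fin_cases j
      exacts [aAD, aAE, aAF, aBD, aBE, aBF, aCD, aCE, aCF]
    · fin_cases i <;> fin_cases j
      exacts [aAD.symm, aBD.symm, aCD.symm, aAE.symm, aBE.symm, aCE.symm, aAF.symm, aBF.symm, aCF.symm]
    · simp [K33] at h

theorem k5_mk {X A B C D E : Set V}
    (hA : Conn G A ∧ A ⊆ X) (hB : Conn G B ∧ B ⊆ X) (hC : Conn G C ∧ C ⊆ X)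
    (hD : Conn G D ∧ D ⊆ X) (hE : Conn G E ∧ E ⊆ X)
    (dAB : Disjoint A B) (dAC : Disjoint A C) (dBC : Disjoint B C) (dDE : Disjoint D E)
    (dAD : Disjoint A D) (dAE : Disjoint A E)
    (dBD : Disjoint B D) (dBE : Disjoint B E)
    (dCD : Disjoint C D) (dCE : Disjoint C E)
    (aAB : SAdj G A B) (aAC : SAdj G A C) (aBC : SAdj G B C) (aDE : SAdj G D E)
    (aAD : SAdj G A D) (aAE : SAdj G A E)
    (aBD : SAdj G B D) (aBE : SAdj G B E)
    (aCD : SAdj G C D) (aCE : SAdj G C E) : MinorIn G K5 X := by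
  refine ⟨![A, B, C, D, E], ?_, ?_, ?_, ?_⟩
  · intro i; fin_cases i
    exacts [hA.1, hB.1, hC.1, hD.1, hE.1]
  · intro i; fin_cases i
    exacts [hA.2, hB.2, hC.2, hD.2, hE.2]
  · intro i j h
    fin_cases i <;> fin_cases j <;>
      first
      | exact absurd rfl h
      | exact dAB | exact dAC | exact dBC | exact dDE
      | exact dAD | exact dAE | exact dBD | exact dBE
      | exact dCD | exact dCE
      | exact dAB.symm | exact dAC.symm | exact dBC.symm | exact dDE.symm
      | exact dAD.symm | exact dAE.symm | exact dBD.symm | exact dBE.symm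
      | exact dCD.symm | exact dCE.symm
  · intro i j h
    have hne : i ≠ j := h.ne
    fin_cases i <;> fin_cases j <;>
      first
      | exact absurd rfl hne
      | exact aAB | exact aAC | exact aBC | exact aDE
      | exact aAD | exact aAE | exact aBD | exact aBE
      | exact aCD | exact aCE
      | exact aAB.symm | exact aAC.symm | exact aBC.symm | exact aDE.symm
      | exact aAD.symm | exact aAE.symm | exact aBD.symm | exact aBE.symm
      | exact aCD.symm | exact aCE.symm

structure Cyc (H : SimpleGraph V) (X : Set V) (m : ℕ) (u : ℕ → V) (P Q : Set V) : Prop where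
  walk : IsWalk H m u
  close : H.Adj (u m) (u 0)
  inj : ∀ i ≤ m, ∀ j ≤ m, u i = u j → i = j
  uX : ∀ k ≤ m, u k ∈ X
  Pc : Conn H P
  Qc : Conn H Q
  PX : P ⊆ X
  QX : Q ⊆ X
  PQ : Disjoint P Q
  uP : ∀ k ≤ m, u k ∉ P
  uQ : ∀ k ≤ m, u k ∉ Q
  adj : SAdj H P Q

theorem Cyc.symm {H : SimpleGraph V} {X : Set V} {m : ℕ} {u : ℕ → V} {P Q : Set V}
    (h : Cyc H X m u P Q) : Cyc H X m u Q P :=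
  ⟨h.walk, h.close, h.inj, h.uX, h.Qc, h.Pc, h.QX, h.PX, h.PQ.symm, h.uQ, h.uP, h.adj.symm⟩

section
variable {H : SimpleGraph V} {X : Set V} {m : ℕ} {u : ℕ → V} {P Q : Set V}

theorem Cyc.arc (h : Cyc H X m u P Q) {a b : ℕ} (hab : a ≤ b) (hb : b ≤ m) :
    Conn H (u '' {i | a ≤ i ∧ i ≤ b}) ∧ u '' {i | a ≤ i ∧ i ≤ b} ⊆ X := by
  refine ⟨h.walk.seg_conn hab hb, ?_⟩
  rintro _ ⟨k, hk, rfl⟩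
  exact h.uX k (hk.2.trans hb)

theorem Cyc.arc_disj (h : Cyc H X m u P Q) {a b c d : ℕ} (hbc : b < c) (hd : d ≤ m) :
    Disjoint (u '' {i | a ≤ i ∧ i ≤ b}) (u '' {i | c ≤ i ∧ i ≤ d}) := by
  rw [disjoint_left]
  rintro _ ⟨k, hk, rfl⟩ ⟨l, hl, e⟩
  have h1 := hk.2
  have h2 := hl.1
  have h3 := hl.2
  have := h.inj l (by omega) k (by omega) e
  omega

theorem Cyc.arc_P (h : Cyc H X m u P Q) {a b : ℕ} (hb : b ≤ m) : Disjoint (u '' {i | a ≤ i ∧ i ≤ b}) P := by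
  rw [disjoint_left]
  rintro _ ⟨k, hk, rfl⟩
  exact h.uP k (hk.2.trans hb)

theorem Cyc.arc_next (h : Cyc H X m u P Q) {a b c d : ℕ} (hab : a ≤ b) (hbc : c = b + 1) (hcd : c ≤ d) (hd : d ≤ m) :
    SAdj H (u '' {i | a ≤ i ∧ i ≤ b}) (u '' {i | c ≤ i ∧ i ≤ d}) :=
  ⟨_, ⟨b, ⟨hab, le_rfl⟩, rfl⟩, _, ⟨c, ⟨le_rfl, hcd⟩, rfl⟩, by rw [hbc]; exact h.walk b (by omega)⟩

theorem Cyc.arc_close (h : Cyc H X m u P Q) {b c : ℕ} (hc : c ≤ m) :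
    SAdj H (u '' {i | c ≤ i ∧ i ≤ m}) (u '' {i | 0 ≤ i ∧ i ≤ b}) :=
  ⟨_, ⟨m, ⟨hc, le_rfl⟩, rfl⟩, _, ⟨0, ⟨le_rfl, by omega⟩, rfl⟩, h.close⟩

theorem arc_adj {a b k : ℕ} (h1 : a ≤ k) (h2 : k ≤ b) (hk : ∃ x ∈ P, H.Adj x (u k)) :
    SAdj H (u '' {i | a ≤ i ∧ i ≤ b}) P := by
  obtain ⟨x, hx, e⟩ := hk
  exact ⟨_, ⟨k, ⟨h1, h2⟩, rfl⟩, x, hx, e.symm⟩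

theorem Cyc.k33 (h : Cyc H X m u P Q) (hno : ¬ MinorIn H K33 X) {β γ δ : ℕ} (h1 : 0 < β) (h2 : β < γ)
    (h3 : γ < δ) (h4 : δ ≤ m) (hP0 : ∃ x ∈ P, H.Adj x (u 0)) (hPγ : ∃ x ∈ P, H.Adj x (u γ))
    (hQβ : ∃ x ∈ Q, H.Adj x (u β)) (hQδ : ∃ x ∈ Q, H.Adj x (u δ)) : False := by
  refine hno (k33_mk (A := u '' {i | 0 ≤ i ∧ i ≤ β - 1}) (B := u '' {i | γ ≤ i ∧ i ≤ δ - 1}) (C := Q)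
    (D := u '' {i | β ≤ i ∧ i ≤ γ - 1}) (E := u '' {i | δ ≤ i ∧ i ≤ m}) (F := P)
    (h.arc (by omega) (by omega)) (h.arc (by omega) (by omega)) ⟨h.Qc, h.QX⟩
    (h.arc (by omega) (by omega)) (h.arc (by omega) (by omega)) ⟨h.Pc, h.PX⟩
    (h.arc_disj (by omega) (by omega)) (h.symm.arc_P (by omega)) (h.symm.arc_P (by omega))
    (h.arc_disj (by omega) (by omega)) (h.arc_P (by omega)) (h.arc_P (by omega))
    (h.arc_disj (by omega) (by omega)) (h.arc_disj (by omega) (by omega)) (h.arc_P (by omega))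
    (h.arc_disj (by omega) (by omega)).symm (h.arc_disj (by omega) (by omega)) (h.arc_P (by omega))
    (h.symm.arc_P (by omega)).symm (h.symm.arc_P (by omega)).symm h.PQ.symm
    (h.arc_next (by omega) (by omega) (by omega) (by omega)) (h.arc_close (by omega)).symm
    (arc_adj (by omega) (by omega) hP0)
    (h.arc_next (by omega) (by omega) (by omega) (by omega)).symm
    (h.arc_next (by omega) (by omega) (by omega) (by omega)) (arc_adj le_rfl (by omega) hPγ)
    (arc_adj le_rfl (by omega) hQβ).symm (arc_adj le_rfl (by omega) hQδ).symm h.adj.symm)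

theorem Cyc.k5 (h : Cyc H X m u P Q) (hno : ¬ MinorIn H K5 X) {β γ : ℕ} (h1 : 0 < β) (h2 : β < γ)
    (h4 : γ ≤ m) (hP0 : ∃ x ∈ P, H.Adj x (u 0)) (hPβ : ∃ x ∈ P, H.Adj x (u β)) (hPγ : ∃ x ∈ P, H.Adj x (u γ))
    (hQ0 : ∃ x ∈ Q, H.Adj x (u 0)) (hQβ : ∃ x ∈ Q, H.Adj x (u β)) (hQγ : ∃ x ∈ Q, H.Adj x (u γ)) : False := by
  refine hno (k5_mk (A := u '' {i | 0 ≤ i ∧ i ≤ β - 1}) (B := u '' {i | β ≤ i ∧ i ≤ γ - 1})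
    (C := u '' {i | γ ≤ i ∧ i ≤ m}) (D := P) (E := Q)
    (h.arc (by omega) (by omega)) (h.arc (by omega) (by omega)) (h.arc (by omega) (by omega))
    ⟨h.Pc, h.PX⟩ ⟨h.Qc, h.QX⟩
    (h.arc_disj (by omega) (by omega)) (h.arc_disj (by omega) (by omega)) (h.arc_disj (by omega) (by omega)) h.PQ
    (h.arc_P (by omega)) (h.symm.arc_P (by omega)) (h.arc_P (by omega)) (h.symm.arc_P (by omega))
    (h.arc_P (by omega)) (h.symm.arc_P (by omega))
    (h.arc_next (by omega) (by omega) (by omega) (by omega)) (h.arc_close (by omega)).symm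
    (h.arc_next (by omega) (by omega) (by omega) (by omega)) h.adj
    (arc_adj le_rfl (by omega) hP0) (arc_adj le_rfl (by omega) hQ0)
    (arc_adj le_rfl (by omega) hPβ) (arc_adj le_rfl (by omega) hQβ)
    (arc_adj le_rfl (by omega) hPγ) (arc_adj le_rfl (by omega) hQγ))

end

theorem minmax {P : ℕ → Prop} {m k : ℕ} (hk : k ≤ m) (hP : P k) :
    ∃ p q, p ≤ q ∧ q ≤ m ∧ P p ∧ P q ∧ ∀ l ≤ m, P l → p ≤ l ∧ l ≤ q := by
  have hf : {l | l ≤ m ∧ P l}.Finite := (Set.finite_Iic m).subset (fun l hl => hl.1)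
  obtain ⟨p, hp, hp'⟩ := Set.exists_min_image _ id hf ⟨k, hk, hP⟩
  obtain ⟨q, hq, hq'⟩ := Set.exists_max_image _ id hf ⟨k, hk, hP⟩
  exact ⟨p, q, hq' p hp, hq.1, hp.2, hq.2, fun l hl hPl => ⟨hp' l ⟨hl, hPl⟩, hq' l ⟨hl, hPl⟩⟩⟩

theorem interval_lemma {m : ℕ} {Nr Nw : ℕ → Prop} (hw0 : Nw 0) {k1 k2 : ℕ} (hk1 : k1 ≤ m) (hk2 : k2 ≤ m)
    (h12 : k1 < k2) (hn1 : Nr k1) (hn2 : Nr k2)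
    (a33 : ∀ β γ δ, 0 < β → β < γ → γ < δ → δ ≤ m → Nw 0 → Nw γ → Nr β → Nr δ → False)
    (b33 : ∀ β γ δ, 0 < β → β < γ → γ < δ → δ ≤ m → Nr 0 → Nr γ → Nw β → Nw δ → False)
    (a5 : ∀ β γ, 0 < β → β < γ → γ ≤ m → Nr 0 → Nr β → Nr γ → Nw β → Nw γ → False) :
    ∃ i j, i < j ∧ i ≤ m ∧ Nr i ∧ ((j ≤ m ∧ Nr j) ∨ (j = m + 1 ∧ 0 < i ∧ Nr 0)) ∧
      (∀ l ≤ m, Nr l → (i ≤ l ∧ l ≤ j) ∨ (l = 0 ∧ j = m + 1)) ∧ ∀ l, i < l → l < j → ¬ Nw l := by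
  by_cases h0 : Nr 0
  · obtain ⟨p, q, hpq, hqm, hp, hq, hall⟩ := minmax (P := fun l => Nr l ∧ 0 < l) hk2 ⟨hn2, by omega⟩
    by_cases c1 : ∃ d, 0 < d ∧ d < q ∧ Nw d
    · obtain ⟨d1, d1a, d1b, d1c⟩ := c1
      by_cases c2 : ∃ d, p < d ∧ d ≤ m ∧ Nw d
      · exfalso
        obtain ⟨d2, d2a, d2b, d2c⟩ := c2
        have c3 : ∀ d, p < d → d < q → Nw d → False := fun d e1 e2 e3 =>
          a33 p d q hp.2 e1 e2 hqm hw0 e3 hp.1 hq.1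
        have e1 : d1 ≤ p := by
          by_contra h
          exact c3 d1 (by omega) d1b d1c
        have e2 : q ≤ d2 := by
          by_contra h
          exact c3 d2 d2a (by omega) d2c
        rcases Nat.lt_or_ge d1 p with e3 | e3
        · exact b33 d1 p d2 d1a e3 d2a d2b h0 hp.1 d1c d2c
        · obtain rfl : d1 = p := by omega
          rcases Nat.lt_or_ge q d2 with e4 | e4
          · exact b33 d1 q d2 d1a d1b e4 d2b h0 hq.1 d1c d2c
          · obtain rfl : q = d2 := by omega
            exact a5 d1 q d1a d1b hqm h0 hp.1 hq.1 d1c d2c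
      · push Not at c2
        refine ⟨p, m + 1, by omega, by omega, hp.1, Or.inr ⟨rfl, hp.2, h0⟩, ?_, ?_⟩
        · intro l hl hnl
          by_cases hl0 : l = 0
          · exact Or.inr ⟨hl0, rfl⟩
          · have := hall l hl ⟨hnl, by omega⟩
            exact Or.inl ⟨this.1, by omega⟩
        · intro l h1 h2 h3
          exact c2 l h1 (by omega) h3
    · push Not at c1
      refine ⟨0, q, hq.2, by omega, h0, Or.inl ⟨hqm, hq.1⟩, ?_, fun l h1 h2 h3 => c1 l h1 h2 h3⟩
      intro l hl hnl
      by_cases hl0 : l = 0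
      · left; omega
      · have := hall l hl ⟨hnl, by omega⟩
        exact Or.inl ⟨by omega, this.2⟩
  · obtain ⟨p, q, hpq, hqm, hp, hq, hall⟩ := minmax hk2 hn2
    have := hall k1 hk1 hn1
    have := hall k2 hk2 hn2
    have hp0 : 0 < p := by
      rcases Nat.eq_zero_or_pos p with h | h
      · rw [h] at hp; exact absurd hp h0
      · exact h
    exact ⟨p, q, by omega, by omega, hp, Or.inl ⟨hqm, hq⟩, fun l hl hn => Or.inl (hall l hl hn),
      fun l h1 h2 h3 => a33 p l q hp0 h1 h2 hqm hw0 h3 hp hq⟩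

def TC (H : SimpleGraph V) (X : Set V) (a b : V) : Prop :=
  ∀ K ⊆ X, Conn H K → a ∉ K → b ∉ K → X ⊆ K ∪ nbr H K ∨ 3 ≤ (nbr H K ∩ X).ncard

theorem St.ext {H : SimpleGraph V} {X : Set V} {a b : V} {S : Set V} {m : ℕ} {u : ℕ → V} {w h : ℕ}
    {o : ℕ → ℕ → V} {t : ℕ → ℕ} (A : St H X a b S m u w h o t) (hX : X.Finite) (hTC : TC H X a b)
    (h5 : ¬ MinorIn H K5 X) (h33 : ¬ MinorIn H K33 X) (hO : X \ S ≠ {b}) :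
    ∃ n f i j, Ext H X b S m u n f i j := by
  obtain ⟨C, hC⟩ : ∃ C, C = u '' {k | k ≤ m} := ⟨_, rfl⟩
  have uS : ∀ k ≤ m, u k ∈ S := fun k hk => A.uS k (by omega)
  have hCS : C ⊆ S := by rw [hC]; rintro _ ⟨k, hk, rfl⟩; exact uS k hk
  have hCX : C ⊆ X := hCS.trans A.SX
  have uC : ∀ k ≤ m, u k ∈ C := fun k hk => by rw [hC]; exact ⟨k, hk, rfl⟩
  have hm1 := A.m1
  have u1 : u (m + 1) = u 0 := by rw [A.um, A.u0]
  have aS : a ∈ S := A.u0 ▸ uS 0 (by omega)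
  obtain ⟨n, f, p, hp, q, hq, hpq, hf, fO, find, hfp, hfq, Wc, hWR, hfC⟩ :=
    ear_lemma (H := H) (O := X \ S) (C := C) (b := b) (hX.subset sdiff_subset) (hX.subset hCX)
    (fun x hx hxC => hx.2 (hCS hxC)) (uC 0 (by omega)) (uC 1 hm1)
    (fun e => by have := A.inj 0 (by omega) 1 hm1 e; omega) A.Oc ⟨A.bX, A.bS⟩ hO
    (by
      intro K hK hKc hbK
      rcases hTC K (hK.trans sdiff_subset) hKc (fun h => (hK h).2 aS) hbK with h1 | h1
      · left
        exact (union_subset sdiff_subset hCX).trans h1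
      · right
        refine h1.trans (ncard_le_ncard ?_ ((hX.subset (union_subset sdiff_subset hCX)).subset
          inter_subset_right))
        rintro y ⟨hy, hyX⟩
        refine ⟨hy, ?_⟩
        by_cases hyS : y ∈ S
        · obtain ⟨-, z, hz, hzy⟩ := hy
          obtain ⟨k, hk, rfl⟩ := A.noE y hyS z (hK hz).1 (hK hz).2 hzy.symm
          exact Or.inr (uC k hk)
        · exact Or.inl ⟨hyX, hyS⟩)
  obtain ⟨R, hR⟩ : ∃ R, R = f '' {k | k ≤ n} := ⟨_, rfl⟩
  rw [← hR] at Wc hWR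
  have fR : ∀ k ≤ n, f k ∈ R := fun k hk => by rw [hR]; exact ⟨k, hk, rfl⟩
  have hRO : ∀ x ∈ R, x ∈ X ∧ x ∉ S ∧ x ≠ b := by
    rw [hR]; rintro _ ⟨k, hk, rfl⟩
    exact ⟨(fO k hk).1.1, (fO k hk).1.2, (fO k hk).2⟩
  have hbW : b ∈ (X \ S) \ R := ⟨⟨A.bX, A.bS⟩, fun h => (hRO b h).2.2 rfl⟩
  have cyc : Cyc H X m u ((X \ S) \ R) R := by
    refine ⟨fun k hk => A.uadj k hk.le, u1 ▸ A.uadj m le_rfl, A.inj, fun k hk => A.SX (uS k hk), Wc, ?_,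
      sdiff_subset.trans sdiff_subset, fun x hx => (hRO x hx).1, ?_, fun k hk h => h.1.2 (uS k hk),
      fun k hk h => (hRO _ h).2.1 (uS k hk), hWR⟩
    · have := hf.1.seg_conn (a := 0) (b := n) (by omega) le_rfl
      simp only [Nat.zero_le, true_and] at this
      rw [hR]; exact this
    · exact disjoint_left.2 fun x hx => hx.2
  have idx : ∀ v ∈ C, ∃ k ≤ m, v = u k := by rw [hC]; rintro _ ⟨k, hk, rfl⟩; exact ⟨k, hk, rfl⟩
  obtain ⟨kp, hkp, rfl⟩ := idx p hp
  obtain ⟨kq, hkq, rfl⟩ := idx q hq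
  have hNp : ∃ x ∈ R, H.Adj x (u kp) := ⟨_, fR 0 (by omega), hfp⟩
  have hNq : ∃ x ∈ R, H.Adj x (u kq) := ⟨_, fR n le_rfl, hfq⟩
  have hw0 : ∃ x ∈ (X \ S) \ R, H.Adj x (u 0) := ⟨b, hbW, by rw [A.u0]; exact A.ab.symm⟩
  obtain ⟨k1, k2, hk1, hk2, h12, hn1, hn2⟩ : ∃ k1 k2, k1 ≤ m ∧ k2 ≤ m ∧ k1 < k2 ∧
      (∃ x ∈ R, H.Adj x (u k1)) ∧ (∃ x ∈ R, H.Adj x (u k2)) := by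
    rcases lt_trichotomy kp kq with h | h | h
    · exact ⟨kp, kq, hkp, hkq, h, hNp, hNq⟩
    · rw [h] at hpq; exact absurd rfl hpq
    · exact ⟨kq, kp, hkq, hkp, h, hNq, hNp⟩
  obtain ⟨i, j, hij, him, hNi, hNj, hall, hnoW⟩ := interval_lemma (m := m)
    (Nr := fun k => ∃ x ∈ R, H.Adj x (u k)) (Nw := fun k => ∃ x ∈ (X \ S) \ R, H.Adj x (u k)) hw0 hk1 hk2 h12 hn1 hn2
    (fun β γ δ e1 e2 e3 e4 p1 p2 p3 p4 => cyc.k33 h33 e1 e2 e3 e4 p1 p2 p3 p4)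
    (fun β γ δ e1 e2 e3 e4 p1 p2 p3 p4 => cyc.symm.k33 h33 e1 e2 e3 e4 p1 p2 p3 p4)
    (fun β γ e1 e2 e3 p1 p2 p3 p4 p5 => cyc.k5 h5 e1 e2 e3 hw0 p4 p5 p1 p2 p3)
  have hjm : j ≤ m + 1 := by omega
  have hNj' : ∃ x ∈ R, H.Adj x (u j) := by
    rcases hNj with ⟨-, h⟩ | ⟨rfl, -, h⟩
    · exact h
    · rw [u1]; exact h
  have hujC : u j ∈ C := by
    rcases hNj with ⟨h, -⟩ | ⟨rfl, -, -⟩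
    · exact uC j h
    · rw [u1]; exact uC 0 (by omega)
  have hune : u i ≠ u j := by
    rcases hNj with ⟨h, -⟩ | ⟨rfl, h, -⟩
    · intro e
      have := A.inj i him j h e
      omega
    · rw [u1]; intro e
      have := A.inj i him 0 (by omega) e
      omega
  have mk : ∀ g : ℕ → V, IsPth H n g → R = g '' {k | k ≤ n} →
      (∀ k l, k < l → l ≤ n → H.Adj (g k) (g l) → l = k + 1) → H.Adj (g 0) (u i) → H.Adj (g n) (u j) →
      (∀ k ≤ n, ∀ v ∈ C, H.Adj (g k) v → n = 0 ∨ (k = 0 ∧ v = u i) ∨ (k = n ∧ v = u j)) →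
      Ext H X b S m u n g i j := by
    intro g hg hgR gind gi gj gC
    refine ⟨hij, hjm, fun k hk => hRO _ (by rw [hgR]; exact ⟨k, hk, rfl⟩), hg.2, hg.1, gind, ?_, gi, gj, ?_, ?_⟩
    · intro k hk v hv hkv
      have hgk : g k ∈ R := by rw [hgR]; exact ⟨k, hk, rfl⟩
      obtain ⟨l, hl, rfl⟩ := A.noE v hv (g k) (hRO _ hgk).1 (hRO _ hgk).2.1 hkv.symm
      rcases gC k hk _ (uC l hl) hkv with h | ⟨h, e⟩ | ⟨h, e⟩
      · rcases hall l hl ⟨_, hgk, hkv⟩ with h1 | ⟨h1, h2⟩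
        · exact ⟨l, h1.1, h1.2, rfl, Or.inr (Or.inr h)⟩
        · exact ⟨j, hij.le, le_rfl, by rw [h1, h2, u1], Or.inr (Or.inr h)⟩
      · exact ⟨i, le_rfl, hij.le, e, Or.inl ⟨rfl, h⟩⟩
      · exact ⟨j, hij.le, le_rfl, e, Or.inr (Or.inl ⟨rfl, h⟩)⟩
    · rw [← hgR, ← Set.sdiff_sdiff]; exact Wc
    · intro l h1 h2 x hxX hxS hxg hadj
      refine hnoW l h1 h2 ⟨x, ⟨⟨hxX, hxS⟩, ?_⟩, hadj.symm⟩
      rw [hgR]; rintro ⟨k, hk, e⟩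
      exact hxg k hk e.symm
  have who : ∀ v ∈ C, (∃ x ∈ R, H.Adj x v) → n = 0 ∨ v = u kp ∨ v = u kq := by
    rintro v hv ⟨x, hx, hxv⟩
    rw [hR] at hx
    obtain ⟨k, hk, rfl⟩ := hx
    rcases hfC k hk v hv hxv with h | h | h
    · exact Or.inl h
    · exact Or.inr (Or.inl h.2)
    · exact Or.inr (Or.inr h.2)
  rcases Nat.eq_zero_or_pos n with hn0 | hn0
  · refine ⟨n, f, i, j, mk f hf hR find ?_ ?_ (fun _ _ _ _ _ => Or.inl hn0)⟩
    · obtain ⟨x, hx, e⟩ := hNi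
      rw [hR] at hx
      obtain ⟨k, hk, rfl⟩ := hx
      have hk' : k ≤ n := hk
      obtain rfl : k = 0 := by omega
      exact e
    · obtain ⟨x, hx, e⟩ := hNj'
      rw [hR] at hx
      obtain ⟨k, hk, rfl⟩ := hx
      have hk' : k ≤ n := hk
      obtain rfl : k = n := by omega
      exact e
  · have w1 := (who _ (uC i him) hNi).resolve_left (by omega)
    have w2 := (who _ hujC hNj').resolve_left (by omega)
    have w3 : (u i = u kp ∧ u j = u kq) ∨ (u i = u kq ∧ u j = u kp) := by
      rcases w1 with w1 | w1 <;> rcases w2 with w2 | w2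
      · exact absurd (w1.trans w2.symm) hune
      · exact Or.inl ⟨w1, w2⟩
      · exact Or.inr ⟨w1, w2⟩
      · exact absurd (w1.trans w2.symm) hune
    rcases w3 with ⟨w1, w2⟩ | ⟨w1, w2⟩
    · exact ⟨n, f, i, j, mk f hf hR find (w1 ▸ hfp) (w2 ▸ hfq) (by rw [w1, w2]; exact hfC)⟩
    · refine ⟨n, fun k => f (n - k), i, j, mk _ ⟨?_, ?_⟩ ?_ ?_ ?_ ?_ ?_⟩
      · intro k hk
        have := hf.1 (n - (k + 1)) (by omega)
        have e : n - (k + 1) + 1 = n - k := by omega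
        rw [e] at this
        exact this.symm
      · intro k hk l hl e
        have := hf.2 (n - k) (by omega) (n - l) (by omega) e
        omega
      · rw [hR]
        ext x
        constructor
        · rintro ⟨k, hk, rfl⟩
          have hk' : k ≤ n := hk
          refine ⟨n - k, Nat.sub_le n k, ?_⟩
          simp only
          congr 1; omega
        · rintro ⟨k, hk, rfl⟩
          exact ⟨n - k, Nat.sub_le n k, rfl⟩
      · intro k l hkl hl hadj
        have := find (n - l) (n - k) (by omega) (by omega) hadj.symm
        omega
      · simp only [Nat.sub_zero]
        rw [w1]; exact hfq
      · simp only [Nat.sub_self]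
        rw [w2]; exact hfp
      · intro k hk v hv hadj
        rcases hfC (n - k) (by omega) v hv hadj with h | ⟨h, e⟩ | ⟨h, e⟩
        · exact Or.inl h
        · exact Or.inr (Or.inr ⟨by omega, by rw [w2, e]⟩)
        · exact Or.inr (Or.inl ⟨by omega, by rw [w1, e]⟩)

theorem St.loop {H : SimpleGraph V} {X : Set V} {a b : V} (hX : X.Finite) (hTC : TC H X a b)
    (h5 : ¬ MinorIn H K5 X) (h33 : ¬ MinorIn H K33 X) : ∀ (N : ℕ) (S : Set V) (m : ℕ) (u : ℕ → V) (w h : ℕ)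
    (o : ℕ → ℕ → V) (t : ℕ → ℕ), St H X a b S m u w h o t → (X \ S).ncard ≤ N →
    ∃ w h o, Pic H X w h o ∧ (∃ y ≤ h, o 0 y = a) ∧ (∃ y ≤ h, o w y = b) := by
  intro N
  induction N with
  | zero =>
    intro S m u w h o t A hN
    have hfin : (X \ S).Finite := hX.subset sdiff_subset
    have : X \ S = ∅ := by rwa [Nat.le_zero, Set.ncard_eq_zero hfin] at hN
    have hb : b ∈ X \ S := ⟨A.bX, A.bS⟩
    rw [this] at hb
    exact absurd hb (Set.notMem_empty _)
  | succ N ih =>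
    intro S m u w h o t A hN
    by_cases hO : X \ S = {b}
    · exact A.finish hO
    obtain ⟨n, f, i, j, E⟩ := A.ext hX hTC h5 h33 hO
    obtain ⟨m', u', w', h', o', t', A'⟩ := A.step E
    refine ih _ m' u' w' h' o' t' A' ?_
    have hlt : (X \ (S ∪ f '' {k | k ≤ n})).ncard < (X \ S).ncard := by
      refine ncard_lt_ncard ?_ (hX.subset sdiff_subset)
      refine ⟨fun x hx => ⟨hx.1, fun h => hx.2 (Or.inl h)⟩, fun hh => ?_⟩
      have h0 := E.fX 0 (Nat.zero_le _)
      exact (hh ⟨h0.1, h0.2.1⟩).2 (Or.inr ⟨0, Nat.zero_le _, rfl⟩)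
    omega

theorem pic_init {H : SimpleGraph V} {a y : V} (hay : H.Adj a y) :
    Pic H {a, y} 2 1 (fun x z => if x = 1 ∧ z = 1 then y else a) := by
  have hne : a ≠ y := hay.ne
  have ca : cells 2 1 (fun x z => if x = 1 ∧ z = 1 then y else a) a = vseg 0 0 1 ∪ hseg 0 0 2 ∪ vseg 2 0 1 := by
    ext ⟨p, q⟩
    simp only [cells, hseg, vseg, mem_ofPred_eq, mem_union]
    constructor
    · rintro ⟨h1, h2, h3⟩
      split_ifs at h3 with h
      · exact absurd h3.symm hne
      · omega
    · intro h
      refine ⟨by omega, by omega, ?_⟩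
      rw [if_neg (by omega)]
  have cy : cells 2 1 (fun x z => if x = 1 ∧ z = 1 then y else a) y = {((1 : ℕ), (1 : ℕ))} := by
    ext ⟨p, q⟩
    simp only [cells, mem_ofPred_eq, mem_singleton_iff, Prod.mk.injEq]
    constructor
    · rintro ⟨h1, h2, h3⟩
      split_ifs at h3 with h
      · exact h
      · exact absurd h3 hne
    · rintro ⟨rfl, rfl⟩
      simp
  have hs : SAdj GG (vseg 0 0 1 ∪ hseg 0 0 2 ∪ vseg 2 0 1) {((1 : ℕ), (1 : ℕ))} :=
    ⟨(1, 0), Or.inl (Or.inr (by simp [hseg])), (1, 1), rfl, by simp [gg_adj]⟩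
  refine ⟨?_, ?_, ?_⟩
  · intro i _ j _
    split_ifs
    · exact Or.inr rfl
    · exact Or.inl rfl
  · rintro v (rfl | rfl)
    · rw [ca]
      refine Conn.union (Conn.union (conn_vseg (by omega)) (conn_hseg (by omega)) ⟨(0, 0), ?_, ?_⟩)
        (conn_vseg (by omega)) ⟨(2, 0), Or.inr ?_, ?_⟩ <;> simp [hseg, vseg]
    · rw [cy]; exact conn_singleton _ _
  · rintro u (rfl | rfl) v (rfl | rfl) h
    · exact absurd rfl h.ne
    · rw [ca, cy]; exact hs
    · rw [ca, cy]; exact hs.symm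
    · exact absurd rfl h.ne

theorem tc_pic {H : SimpleGraph V} {X : Set V} {a b : V} (hX : X.Finite) (hTC : TC H X a b)
    (h5 : ¬ MinorIn H K5 X) (h33 : ¬ MinorIn H K33 X) (haX : a ∈ X) (hbX : b ∈ X) (hab : H.Adj a b) :
    ∃ w h o, Pic H X w h o ∧ (∃ y ≤ h, o 0 y = a) ∧ (∃ y ≤ h, o w y = b) := by
  have hne : a ≠ b := hab.ne
  have small : ∀ K ⊆ X, Conn H K → a ∉ K → b ∉ K → ∀ p q, nbr H K ∩ X ⊆ {p, q} → X ⊆ K ∪ nbr H K := by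
    intro K hK hc ha hb p q hpq
    rcases hTC K hK hc ha hb with h | h
    · exact h
    · exfalso
      have h1 : (nbr H K ∩ X).ncard ≤ ({p, q} : Set V).ncard := ncard_le_ncard hpq (toFinite _)
      have h2 : ({p, q} : Set V).ncard ≤ 2 := by
        have := ncard_insert_le p {q}; rw [Set.ncard_singleton] at this; exact this
      omega
  by_cases hEx : ∃ x ∈ X, x ≠ a ∧ x ≠ b
  · obtain ⟨x, hx, hxa, hxb⟩ := hEx
    have hxm : x ∈ X \ {a, b} := ⟨hx, by simp [hxa, hxb]⟩
    have hcK := comp_isComp (G := H) hxm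
    obtain ⟨K, hK⟩ : ∃ K, K = comp H (X \ {a, b}) x := ⟨_, rfl⟩
    rw [← hK] at hcK
    have haK : a ∉ K := fun h => (hcK.2.1 h).2 (by simp)
    have hbK : b ∉ K := fun h => (hcK.2.1 h).2 (by simp)
    have hsub : X ⊆ K ∪ nbr H K := by
      refine small K (fun v hv => (hcK.2.1 hv).1) hcK.1 haK hbK a b ?_
      rintro v ⟨⟨hv1, k, hk, hkv⟩, hvX⟩
      by_contra hv
      exact hv1 (hcK.2.2 k hk v ⟨hvX, hv⟩ hkv)
    obtain ⟨y, hyK, hya⟩ : ∃ y ∈ K, H.Adj y a := by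
      rcases hsub haX with h | h
      · exact absurd h haK
      · exact h.2
    have hyX := (hcK.2.1 hyK).1
    have hyb : y ≠ b := fun h => hbK (h ▸ hyK)
    have hya' : y ≠ a := hya.ne
    have hbO : b ∈ X \ {a, y} := ⟨hbX, by simp [hne.symm, hyb.symm]⟩
    have hOc : Conn H (X \ {a, y}) := by
      have hcL := comp_isComp (G := H) hbO
      suffices h : X \ {a, y} = comp H (X \ {a, y}) b by rw [h]; exact hcL.1
      refine Set.Subset.antisymm ?_ (comp_subset _ _ _)
      intro z hz
      by_contra hzL
      have hcZ := comp_isComp (G := H) hz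
      have hbZ : b ∉ comp H (X \ {a, y}) z := by
        intro h
        apply hzL
        rw [← hcZ.eq_comp h]
        exact mem_comp hz
      have haZ : a ∉ comp H (X \ {a, y}) z := fun h => (hcZ.2.1 h).2 (by simp)
      have hs : X ⊆ comp H (X \ {a, y}) z ∪ nbr H (comp H (X \ {a, y}) z) := by
        refine small _ (fun v hv => (hcZ.2.1 hv).1) hcZ.1 haZ hbZ a y ?_
        rintro v ⟨⟨hv1, k, hk, hkv⟩, hvX⟩
        by_contra hv
        exact hv1 (hcZ.2.2 k hk v ⟨hvX, hv⟩ hkv)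
      rcases hs hbX with h | ⟨_, k, hk, hkb⟩
      · exact hbZ h
      · exact hbZ (hcZ.2.2 k hk b hbO hkb)
    refine St.loop hX hTC h5 h33 _ {a, y} 1 (fun k => if k = 1 then y else a) 2 1
      (fun x z => if x = 1 ∧ z = 1 then y else a) (fun x => x) ?_ le_rfl
    refine ⟨?_, hbX, hbO.2, hab, hOc, le_rfl, rfl, rfl, ?_, ?_, ?_, ?_, pic_init hya.symm, ?_, ?_⟩
    · rintro v (rfl | rfl)
      · exact haX
      · exact hyX
    · intro i hi j hj h
      have : i = 0 ∨ i = 1 := by omega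
      have : j = 0 ∨ j = 1 := by omega
      rcases ‹i = 0 ∨ i = 1› with rfl | rfl <;> rcases ‹j = 0 ∨ j = 1› with rfl | rfl <;>
        simp_all
    · intro k _
      split_ifs
      · exact Or.inr rfl
      · exact Or.inl rfl
    · intro k hk
      have : k = 0 ∨ k = 1 := by omega
      rcases this with rfl | rfl
      · simpa using hya.symm
      · simpa using hya
    · rintro v (rfl | rfl) z _ _ _
      · exact ⟨0, by omega, by simp⟩
      · exact ⟨1, by omega, by simp⟩
    · constructor <;> grind
    · intro c _
      simp
  · push Not at hEx
    refine ⟨1, 0, fun x _ => if x = 0 then a else b, ?_, ⟨0, le_rfl, by simp⟩, ⟨0, le_rfl, by simp⟩⟩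
    have hXab : ∀ v ∈ X, v = a ∨ v = b := fun v hv => by
      by_contra h; push Not at h; exact h.2 (hEx v hv h.1)
    have ca : cells 1 0 (fun x _ => if x = 0 then a else b) a = {((0 : ℕ), (0 : ℕ))} := by
      ext ⟨p, q⟩
      simp only [cells, mem_ofPred_eq, mem_singleton_iff, Prod.mk.injEq]
      constructor
      · rintro ⟨h1, h2, h3⟩
        split_ifs at h3 with h
        · omega
        · exact absurd h3.symm hne
      · rintro ⟨rfl, rfl⟩; simp
    have cb : cells 1 0 (fun x _ => if x = 0 then a else b) b = {((1 : ℕ), (0 : ℕ))} := by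
      ext ⟨p, q⟩
      simp only [cells, mem_ofPred_eq, mem_singleton_iff, Prod.mk.injEq]
      constructor
      · rintro ⟨h1, h2, h3⟩
        split_ifs at h3 with h
        · exact absurd h3 hne
        · omega
      · rintro ⟨rfl, rfl⟩; simp
    have hs : SAdj GG {((0 : ℕ), (0 : ℕ))} {((1 : ℕ), (0 : ℕ))} := ⟨_, rfl, _, rfl, by simp [gg_adj]⟩
    refine ⟨?_, ?_, ?_⟩
    · intro i _ j _
      split_ifs
      · exact haX
      · exact hbX
    · intro v hv
      rcases hXab v hv with rfl | rfl
      · rw [ca]; exact conn_singleton _ _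
      · rw [cb]; exact conn_singleton _ _
    · intro u hu v hv h
      rcases hXab u hu with rfl | rfl <;> rcases hXab v hv with rfl | rfl
      · exact absurd rfl h.ne
      · rw [ca, cb]; exact hs
      · rw [ca, cb]; exact hs.symm
      · exact absurd rfl h.ne

def addE (H : SimpleGraph V) (c d : V) : SimpleGraph V := H ⊔ SimpleGraph.edge c d

theorem addE_adj {H : SimpleGraph V} {c d u v : V} : (addE H c d).Adj u v ↔
    H.Adj u v ∨ (((c = u ∧ d = v) ∨ (c = v ∧ d = u)) ∧ u ≠ v) := by
  simp only [addE, SimpleGraph.sup_adj, SimpleGraph.edge_adj]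
  grind

theorem le_addE {H : SimpleGraph V} {c d : V} : H ≤ addE H c d := fun _ _ h => addE_adj.2 (Or.inl h)

theorem minor_addE {W : Type} {H : SimpleGraph V} {M : SimpleGraph W} {c d : V} {L X Y : Set V}
    (h : MinorIn (addE H c d) M Y) (hL : Conn H L) (hLX : L ⊆ X) (hYX : Y ⊆ X) (hd : Disjoint L Y)
    (hc' : ∃ x ∈ L, H.Adj x c) (hd' : ∃ x ∈ L, H.Adj x d) : MinorIn H M X := by
  obtain ⟨x, hx, hxc⟩ := hc'
  obtain ⟨y, hy, hyd⟩ := hd'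
  have hm : ∀ u, u ∈ (if u = c then insert c L else {u} : Set V) := by
    intro u; split_ifs with h
    · exact Or.inl h
    · rfl
  refine h.lift (fun u => if u = c then insert c L else {u}) ?_ ?_ ?_ ?_
  · intro u _
    split_ifs
    · exact hL.insert_adj hx hxc
    · exact conn_singleton _ _
  · intro u hu
    split_ifs with h
    · exact insert_subset (hYX (h ▸ hu)) hLX
    · exact Set.singleton_subset_iff.2 (hYX hu)
  · intro u hu v hv huv
    have key : ∀ v ∈ Y, v ≠ c → Disjoint (insert c L) ({v} : Set V) := by
      intro v hv hvc
      rw [Set.disjoint_singleton_right]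
      rintro (h | h)
      · exact hvc h
      · exact disj hd h hv
    by_cases huc : u = c
    · rw [if_pos huc, if_neg (fun h => huv (huc.trans h.symm))]
      exact key v hv (fun h => huv (huc.trans h.symm))
    · rw [if_neg huc]
      split_ifs with hvc
      · exact (key u hu huc).symm
      · exact Set.disjoint_singleton.2 huv
  · intro u hu v hv huv
    have key : c ≠ d → SAdj H (if c = c then insert c L else {c}) (if d = c then insert c L else {d}) := by
      intro hcd
      rw [if_pos rfl, if_neg (Ne.symm hcd)]
      exact ⟨y, Or.inr hy, d, rfl, hyd⟩
    rcases addE_adj.1 huv with h | ⟨⟨rfl, rfl⟩ | ⟨rfl, rfl⟩, hne⟩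
    · exact ⟨u, hm u, v, hm v, h⟩
    · exact key hne
    · exact (key hne.symm).symm

theorem conn_rest {H H' : SimpleGraph V} {X K : Set V} {c : V} (hX : Conn H X) (hle : H ≤ H')
    (hc : c ∈ X \ K) (hN : ∀ v ∈ X, v ∉ K → (∃ k ∈ K, H.Adj k v) → v = c ∨ H'.Adj v c) :
    Conn H' (X \ K) := by
  have hcL := comp_isComp (G := H') hc
  suffices h : X \ K = comp H' (X \ K) c by rw [h]; exact hcL.1
  refine Set.Subset.antisymm ?_ (comp_subset _ _ _)
  intro z hz
  by_contra hzL
  have hcZ := comp_isComp (G := H') hz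
  have hcZ' : c ∉ comp H' (X \ K) z := by
    intro h
    apply hzL
    rw [← hcZ.eq_comp h]
    exact mem_comp hz
  obtain ⟨u, hu, huZ, v, hv, hvZ, huv⟩ := hX.cross (comp H' (X \ K) z) hz.1 (mem_comp hz) hc.1 hcZ'
  by_cases hvK : v ∈ K
  · rcases hN u hu (hcZ.2.1 huZ).2 ⟨v, hvK, huv.symm⟩ with rfl | h
    · exact hcZ' huZ
    · exact hcZ' (hcZ.2.2 u huZ c hc h)
  · exact hvZ (hcZ.2.2 u huZ v ⟨hv, hvK⟩ (hle huv))

def HasPic (H : SimpleGraph V) (X : Set V) (a b : V) : Prop :=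
  ∃ w h o, Pic H X w h o ∧ (∃ y ≤ h, o 0 y = a) ∧ (∃ y ≤ h, o w y = b)

theorem two_sum {H H' : SimpleGraph V} {X X1 X2 : Set V} {a b c d : V} (hle : H ≤ H')
    (hX : X = X1 ∪ X2) (hc1 : c ∈ X1) (hc2 : c ∈ X2) (hd1 : d ∈ X1) (hd2 : d ∈ X2)
    (hitr : ∀ v ∈ X1, v ∈ X2 → v = c ∨ v = d) (hcd : H'.Adj c d)
    (hsp : ∀ u ∈ X1, ∀ v ∈ X2, H.Adj u v → u ∈ X2 ∨ v ∈ X1)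
    (p1 : HasPic H' X1 a b) (p2 : HasPic H' X2 c d) (p3 : HasPic H' X2 d c) : HasPic H X a b := by
  obtain ⟨w1, h1, o1, P1, ha, hb⟩ := p1
  have hadj : ∀ u ∈ X, ∀ v ∈ X, H.Adj u v → (u ∈ X1 ∧ v ∈ X1 ∧ H'.Adj u v) ∨
      (u ∈ X2 ∧ v ∈ X2 ∧ H'.Adj u v) := by
    intro u hu v hv huv
    rw [hX] at hu hv
    have h' := hle huv
    rcases hu with hu | hu <;> rcases hv with hv | hv
    · exact Or.inl ⟨hu, hv, h'⟩
    · rcases hsp u hu v hv huv with h | h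
      · exact Or.inr ⟨h, hv, h'⟩
      · exact Or.inl ⟨hu, h, h'⟩
    · rcases hsp v hv u hu huv.symm with h | h
      · exact Or.inr ⟨hu, h, h'⟩
      · exact Or.inl ⟨h, hv, h'⟩
    · exact Or.inr ⟨hu, hv, h'⟩
  obtain ⟨A, hA, B, hB, hAB⟩ := P1.adj c hc1 d hd1 hcd
  have hAB' : (((B.1 = A.1 + 1 ∧ B.2 = A.2) ∨ (B.1 = A.1 ∧ B.2 = A.2 + 1))) ∨
      (((A.1 = B.1 + 1 ∧ A.2 = B.2) ∨ (A.1 = B.1 ∧ A.2 = B.2 + 1))) := by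
    obtain ⟨a1, a2⟩ := A
    obtain ⟨b1, b2⟩ := B
    rw [gg_adj] at hAB
    dsimp only
    omega
  rcases hAB' with h | h
  · obtain ⟨w2, h2, o2, P2, hc, hd⟩ := p2
    obtain ⟨w, h, o, P, k1, k2⟩ := glue hX P1 P2 hc1 hc2 hd1 hd2 hcd.ne hitr hA hB h hc hd hadj
    exact ⟨w, h, o, P, k1 a ha, k2 b hb⟩
  · obtain ⟨w2, h2, o2, P2, hc, hd⟩ := p3
    obtain ⟨w, h, o, P, k1, k2⟩ := glue hX P1 P2 hd1 hd2 hc1 hc2 hcd.ne.symm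
      (fun v h1 h2 => (hitr v h1 h2).symm) hB hA h hc hd hadj
    exact ⟨w, h, o, P, k1 a ha, k2 b hb⟩

theorem tri_pic {H : SimpleGraph V} {X : Set V} {a b k : V} (hab : a ≠ b) (hak : a ≠ k) (hbk : b ≠ k)
    (hX : X = {a, b, k}) : HasPic H X a b := by
  obtain ⟨o, ho⟩ : ∃ o : ℕ → ℕ → V, o = fun x y => if x = 1 then b else if y = 0 then a else k := ⟨_, rfl⟩
  have ca : cells 1 1 o a = {((0 : ℕ), (0 : ℕ))} := by
    ext ⟨p, q⟩
    simp only [cells, ho, mem_ofPred_eq, mem_singleton_iff, Prod.mk.injEq]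
    constructor
    · rintro ⟨h1, h2, h3⟩
      split_ifs at h3 with h h'
      · exact absurd h3.symm hab
      · omega
      · exact absurd h3.symm hak
    · rintro ⟨rfl, rfl⟩; simp
  have ck : cells 1 1 o k = {((0 : ℕ), (1 : ℕ))} := by
    ext ⟨p, q⟩
    simp only [cells, ho, mem_ofPred_eq, mem_singleton_iff, Prod.mk.injEq]
    constructor
    · rintro ⟨h1, h2, h3⟩
      split_ifs at h3 with h h'
      · exact absurd h3 hbk
      · exact absurd h3 hak
      · omega
    · rintro ⟨rfl, rfl⟩; simp
  have cb : cells 1 1 o b = vseg 1 0 1 := by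
    ext ⟨p, q⟩
    simp only [cells, ho, vseg, mem_ofPred_eq]
    constructor
    · rintro ⟨h1, h2, h3⟩
      split_ifs at h3 with h h'
      · omega
      · exact absurd h3 hab
      · exact absurd h3.symm hbk
    · rintro ⟨rfl, h1, h2⟩; simp [h2]
  have s1 : SAdj GG (cells 1 1 o a) (cells 1 1 o b) := by
    rw [ca, cb]; exact ⟨_, rfl, (1, 0), by simp [vseg], by simp [gg_adj]⟩
  have s2 : SAdj GG (cells 1 1 o a) (cells 1 1 o k) := by
    rw [ca, ck]; exact ⟨_, rfl, _, rfl, by simp [gg_adj]⟩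
  have s3 : SAdj GG (cells 1 1 o k) (cells 1 1 o b) := by
    rw [ck, cb]; exact ⟨_, rfl, (1, 1), by simp [vseg], by simp [gg_adj]⟩
  refine ⟨1, 1, o, ⟨?_, ?_, ?_⟩, ⟨0, by omega, by simp [ho]⟩, ⟨0, by omega, by simp [ho]⟩⟩
  · intro i _ j _
    rw [hX, ho]
    dsimp only
    split_ifs <;> simp
  · intro v hv
    rw [hX] at hv
    rcases hv with rfl | rfl | rfl
    · rw [ca]; exact conn_singleton _ _
    · rw [cb]; exact conn_vseg (by omega)
    · rw [ck]; exact conn_singleton _ _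
  · intro u hu v hv huv
    rw [hX] at hu hv
    rcases hu with rfl | rfl | rfl <;> rcases hv with rfl | rfl | rfl <;>
      first
      | exact absurd rfl huv.ne
      | assumption
      | (apply SAdj.symm; assumption)

theorem link_exists_aux {H : SimpleGraph V} {X K : Set V} {a b c d z : V}
    (hn : ∀ K ⊆ X, Conn H K → a ∉ K → b ∉ K → ∀ c, ¬ (nbr H K ∩ X ⊆ {c}))
    (hab : H.Adj a b) (haX : a ∈ X) (hbX : b ∈ X) (hKX : K ⊆ X) (hK : Conn H K) (haK : a ∉ K) (hbK : b ∉ K)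
    (hdX : d ∈ X) (hdK : ∃ x ∈ K, H.Adj x d)
    (hN : nbr H K ∩ X ⊆ {c, d})
    (hZ : ∀ Z, IsComp H (X \ (K ∪ {c, d})) Z → a ∈ Z ∨ b ∈ Z)
    (hz : z ∈ X \ (K ∪ {c, d}))
    (hzd : ¬ ∃ x ∈ comp H (X \ (K ∪ {c, d})) z, H.Adj x d) : False := by
  obtain ⟨Y, hY⟩ : ∃ Y, Y = X \ (K ∪ {c, d}) := ⟨_, rfl⟩
  rw [← hY] at hZ hz hzd
  have hcZ := comp_isComp (G := H) hz
  obtain ⟨Z, hZe⟩ : ∃ Z, Z = comp H Y z := ⟨_, rfl⟩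
  rw [← hZe] at hcZ hzd
  have hdY : d ∉ Y := by rw [hY]; exact fun h => h.2 (by simp)
  have main : ∀ p q, H.Adj p q → p ∈ Z → q ∈ X → q ∉ K → (∀ M : Set V, p ∉ M → q ∉ M → a ∉ M ∧ b ∉ M) →
      (∀ M : Set V, a ∈ M ∨ b ∈ M → p ∈ M ∨ q ∈ M) → False := by
    intro p q hpq hp hqX hqK hpq1 hpq2
    have hpY := hcZ.2.1 hp
    have hpd : p ≠ d := fun h => hdY (h ▸ hpY)
    have hqd : q ≠ d := fun h => hzd ⟨p, hp, h ▸ hpq⟩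
    have hpK : p ∉ K := by rw [hY] at hpY; exact fun h => hpY.2 (Or.inl h)
    have h1 := hpq1 (insert d K) (by simp [hpd, hpK]) (by simp [hqd, hqK])
    obtain ⟨x, hx, hxd⟩ := hdK
    refine hn (insert d K) (insert_subset hdX hKX) (hK.insert_adj hx hxd) h1.1 h1.2 c ?_
    rintro v ⟨⟨hv1, k, hk, hkv⟩, hvX⟩
    have hvd : v ≠ d := fun h => hv1 (Or.inl h)
    have hvK : v ∉ K := fun h => hv1 (Or.inr h)
    by_contra hvc
    have hvc' : v ≠ c := hvc
    have hvY : v ∈ Y := by rw [hY]; exact ⟨hvX, by simp [hvK, hvd, hvc']⟩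
    rcases hk with rfl | hk
    · have hcV := comp_isComp (G := H) hvY
      have hVZ : comp H Y v ≠ Z := by
        intro h
        exact hzd ⟨v, h ▸ mem_comp hvY, hkv.symm⟩
      apply hVZ
      rcases hpq2 _ (hZ _ hcV) with h | h
      · exact hcV.eq_of_inter hcZ ⟨p, h, hp⟩
      · exact hcV.eq_of_inter hcZ ⟨q, h, hcZ.2.2 p hp q (hcV.2.1 h) hpq⟩
    · rcases hN ⟨⟨hvK, k, hk, hkv⟩, hvX⟩ with h | h
      · exact hvc' h
      · exact hvd h
  rcases hZ Z hcZ with h | h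
  · exact main a b hab h hbX hbK (fun M h1 h2 => ⟨h1, h2⟩) (fun M h => h)
  · exact main b a hab.symm h haX haK (fun M h1 h2 => ⟨h2, h1⟩) (fun M h => h.symm)

theorem link_exists {H : SimpleGraph V} {X K : Set V} {a b c d z : V}
    (hn : ∀ K ⊆ X, Conn H K → a ∉ K → b ∉ K → ∀ c, ¬ (nbr H K ∩ X ⊆ {c}))
    (hab : H.Adj a b) (haX : a ∈ X) (hbX : b ∈ X) (hKX : K ⊆ X) (hK : Conn H K) (haK : a ∉ K) (hbK : b ∉ K)
    (hcX : c ∈ X) (hdX : d ∈ X) (hcK : ∃ x ∈ K, H.Adj x c) (hdK : ∃ x ∈ K, H.Adj x d)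
    (hN : nbr H K ∩ X ⊆ {c, d}) (hz : z ∈ X \ (K ∪ {c, d})) :
    ∃ L ⊆ X \ (K ∪ {c, d}), Conn H L ∧ (∃ x ∈ L, H.Adj x c) ∧ (∃ x ∈ L, H.Adj x d) := by
  by_contra hcon
  have hcon' : ∀ Z, IsComp H (X \ (K ∪ {c, d})) Z → (∃ x ∈ Z, H.Adj x c) → ¬ (∃ x ∈ Z, H.Adj x d) :=
    fun Z hZ h1 h2 => hcon ⟨Z, hZ.2.1, hZ.1, h1, h2⟩
  have hNZ : ∀ Z, IsComp H (X \ (K ∪ {c, d})) Z → ∀ v ∈ nbr H Z ∩ X, v = c ∨ v = d := by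
    rintro Z hZ v ⟨⟨hv1, k, hk, hkv⟩, hvX⟩
    by_contra! hv
    refine hv1 (hZ.2.2 k hk v ⟨hvX, ?_⟩ hkv)
    have hvK : v ∉ K := by
      intro h
      have hk' := hZ.2.1 hk
      have := hN ⟨⟨fun h => hk'.2 (Or.inl h), v, h, hkv.symm⟩, hk'.1⟩
      exact hk'.2 (Or.inr this)
    simp [hvK, hv.1, hv.2]
  have hZ : ∀ Z, IsComp H (X \ (K ∪ {c, d})) Z → a ∈ Z ∨ b ∈ Z := by
    intro Z hZ
    by_contra! h
    by_cases hc : ∃ x ∈ Z, H.Adj x c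
    · refine hn Z (fun v hv => (hZ.2.1 hv).1) hZ.1 h.1 h.2 c ?_
      intro v hv
      rcases hNZ Z hZ v hv with h | rfl
      · exact h
      · exact absurd hv.1.2 (hcon' Z hZ hc)
    · refine hn Z (fun v hv => (hZ.2.1 hv).1) hZ.1 h.1 h.2 d ?_
      intro v hv
      rcases hNZ Z hZ v hv with rfl | h
      · exact absurd hv.1.2 hc
      · exact h
  have hcZ := comp_isComp (G := H) hz
  by_cases hc : ∃ x ∈ comp H (X \ (K ∪ {c, d})) z, H.Adj x c
  · exact link_exists_aux hn hab haX hbX hKX hK haK hbK hdX hdK hN hZ hz (hcon' _ hcZ hc)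
  · have e : ({c, d} : Set V) = {d, c} := Set.pair_comm _ _
    rw [e] at hN hZ hz hc
    exact link_exists_aux hn hab haX hbX hKX hK haK hbK hcX hcK hN hZ hz hc

theorem wag_pic : ∀ (N : ℕ) (H : SimpleGraph V) (X : Set V) (a b : V), X.Finite → X.ncard ≤ N → Conn H X →
    a ∈ X → b ∈ X → H.Adj a b → ¬ MinorIn H K5 X → ¬ MinorIn H K33 X → HasPic H X a b := by
  intro N
  induction N with
  | zero =>
    intro H X a b hX hN _ ha
    rw [Nat.le_zero, Set.ncard_eq_zero hX] at hN
    rw [hN] at ha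
    exact absurd ha (Set.notMem_empty _)
  | succ N ih =>
    intro H X a b hX hN hcX haX hbX hab h5 h33
    have hne : a ≠ b := hab.ne
    have small : ∀ X1 ⊆ X, (∃ z ∈ X, z ∉ X1) → X1.Finite ∧ X1.ncard ≤ N := by
      rintro X1 h1 ⟨z, hz, hz1⟩
      refine ⟨hX.subset h1, ?_⟩
      have : X1.ncard < X.ncard := ncard_lt_ncard ⟨h1, fun h => hz1 (h hz)⟩ hX
      omega
    by_cases hTri : ∃ k, X = {a, b, k} ∧ a ≠ k ∧ b ≠ k
    · obtain ⟨k, hk, h1, h2⟩ := hTri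
      exact tri_pic hne h1 h2 hk
    by_cases hTC : TC H X a b
    · exact tc_pic hX hTC h5 h33 haX hbX hab
    by_cases hC1 : ∃ K ⊆ X, Conn H K ∧ a ∉ K ∧ b ∉ K ∧ ∃ c, nbr H K ∩ X ⊆ {c}
    · obtain ⟨K, hKX, hK, haK, hbK, c, hc⟩ := hC1
      obtain ⟨k0, hk0⟩ := hK.nonempty
      obtain ⟨k, hkX, hkK, c', hc'X, hc'K, hkc⟩ := hcX.cross K (hKX hk0) hk0 haX haK
      obtain rfl : c' = c := hc ⟨⟨hc'K, k, hkK, hkc⟩, hc'X⟩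
      have hcr : Conn H (X \ K) := by
        refine conn_rest hcX le_rfl ⟨hc'X, hc'K⟩ ?_
        rintro v hv hvK ⟨k, hk, hkv⟩
        exact Or.inl (hc ⟨⟨hvK, k, hk, hkv⟩, hv⟩)
      obtain ⟨z, hzX, hzK, hzc⟩ : ∃ z ∈ X, z ∉ K ∧ z ≠ c' := by
        by_cases h : a = c'
        · exact ⟨b, hbX, hbK, fun h' => hne (h.trans h'.symm)⟩
        · exact ⟨a, haX, haK, h⟩
      obtain ⟨u, -, huc, e, heX, hec, hue⟩ := hcr.cross {c'} ⟨hc'X, hc'K⟩ rfl ⟨hzX, hzK⟩ hzc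
      obtain rfl : u = c' := huc
      have hec' : e ≠ u := hec
      by_cases hK1 : ∃ k' ∈ K, k' ≠ k
      · obtain ⟨k', hk', hkk⟩ := hK1
        have s1 := small ((X \ K) ∪ {k}) (by
          rintro v (h | rfl)
          · exact h.1
          · exact hkX) ⟨k', hKX hk', by rintro (h | h); exacts [h.2 hk', hkk h]⟩
        have hsub2 : insert u K ⊆ X := insert_subset hc'X hKX
        have hsub1 : (X \ K) ∪ {k} ⊆ X := by
          rintro v (h | rfl)
          · exact h.1
          · exact hkX
        have s2 := small (insert u K) hsub2 ⟨z, hzX, by rintro (h | h); exacts [hzc h, hzK h]⟩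
        have c1 : Conn H ((X \ K) ∪ {k}) := hcr.union_adj (conn_singleton _ _) ⟨u, ⟨hc'X, hc'K⟩, k, rfl, hkc.symm⟩
        have c2 : Conn H (insert u K) := hK.insert_adj hkK hkc
        have m1 := fun h => h5 (MinorIn.mono (X := insert u K) h hsub2)
        have m2 := fun h => h33 (MinorIn.mono (X := insert u K) h hsub2)
        refine two_sum (H' := H) (X1 := (X \ K) ∪ {k}) (X2 := insert u K) (c := u) (d := k) le_rfl ?_ ?_ ?_ ?_ ?_ ?_
          hkc.symm ?_ ?_ ?_ ?_
        · apply Set.Subset.antisymm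
          · intro v hv
            by_cases h : v ∈ K
            · exact Or.inr (Or.inr h)
            · exact Or.inl (Or.inl ⟨hv, h⟩)
          · exact union_subset hsub1 hsub2
        · exact Or.inl ⟨hc'X, hc'K⟩
        · exact Or.inl rfl
        · exact Or.inr rfl
        · exact Or.inr hkK
        · rintro v (h | h) (h' | h')
          · exact Or.inl h'
          · exact absurd h' h.2
          · exact Or.inl h'
          · exact Or.inr h
        · rintro v (h | h) w (h' | h') hvw
          · right; left; rw [h']; exact ⟨hc'X, hc'K⟩
          · left; left
            exact hc ⟨⟨h.2, w, h', hvw.symm⟩, h.1⟩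
          · left; rw [show v = k from h]; exact Or.inr hkK
          · left; rw [show v = k from h]; exact Or.inr hkK
        · exact ih H _ a b s1.1 s1.2 c1 (Or.inl ⟨haX, haK⟩) (Or.inl ⟨hbX, hbK⟩) hab
            (fun h => h5 (h.mono hsub1)) (fun h => h33 (h.mono hsub1))
        · exact ih H _ u k s2.1 s2.2 c2 (Or.inl rfl) (Or.inr hkK) hkc.symm m1 m2
        · exact ih H _ k u s2.1 s2.2 c2 (Or.inr hkK) (Or.inl rfl) hkc m1 m2
      · push Not at hK1
        have hKk : K = {k} := Set.Subset.antisymm (fun v hv => hK1 v hv) (Set.singleton_subset_iff.2 hkK)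
        have hsub1 : X \ K ⊆ X := sdiff_subset
        have hsub2 : insert e (insert u K) ⊆ X := insert_subset heX.1 (insert_subset hc'X hKX)
        have hex : ∃ z ∈ X, z ∉ insert e (insert u K) := by
          by_contra! hcon
          apply hTri
          have ha := hcon a haX
          have hb := hcon b hbX
          have hka : a ≠ k := fun h => haK (h ▸ hkK)
          have hkb : b ≠ k := fun h => hbK (h ▸ hkK)
          refine ⟨k, ?_, hka, hkb⟩
          apply Set.Subset.antisymm
          · intro v hv
            have := hcon v hv
            rw [hKk] at ha hb this
            simp only [mem_insert_iff, mem_singleton_iff] at ha hb this ⊢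
            grind
          · rintro v (rfl | rfl | rfl)
            · exact haX
            · exact hbX
            · exact hkX
        have s1 := small (X \ K) hsub1 ⟨k, hkX, fun h => h.2 hkK⟩
        have s2 := small _ hsub2 hex
        have c2 : Conn H (insert e (insert u K)) := (hK.insert_adj hkK hkc).insert_adj (Or.inl rfl) hue
        have m1 := fun h => h5 (MinorIn.mono (X := insert e (insert u K)) h hsub2)
        have m2 := fun h => h33 (MinorIn.mono (X := insert e (insert u K)) h hsub2)
        refine two_sum (H' := H) (X1 := X \ K) (X2 := insert e (insert u K)) (c := u) (d := e) le_rfl ?_ ?_ ?_ ?_ ?_ ?_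
          hue ?_ ?_ ?_ ?_
        · apply Set.Subset.antisymm
          · intro v hv
            by_cases h : v ∈ K
            · exact Or.inr (Or.inr (Or.inr h))
            · exact Or.inl ⟨hv, h⟩
          · exact union_subset hsub1 hsub2
        · exact ⟨hc'X, hc'K⟩
        · exact Or.inr (Or.inl rfl)
        · exact heX
        · exact Or.inl rfl
        · rintro v h (h' | h' | h')
          · exact Or.inr h'
          · exact Or.inl h'
          · exact absurd h' h.2
        · rintro v h w (h' | h' | h') hvw
          · right; rw [h']; exact heX
          · right; rw [h']; exact ⟨hc'X, hc'K⟩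
          · left; right; left
            exact hc ⟨⟨h.2, w, h', hvw.symm⟩, h.1⟩
        · exact ih H _ a b s1.1 s1.2 hcr ⟨haX, haK⟩ ⟨hbX, hbK⟩ hab
            (fun h => h5 (h.mono hsub1)) (fun h => h33 (h.mono hsub1))
        · exact ih H _ u e s2.1 s2.2 c2 (Or.inr (Or.inl rfl)) (Or.inl rfl) hue m1 m2
        · exact ih H _ e u s2.1 s2.2 c2 (Or.inl rfl) (Or.inr (Or.inl rfl)) hue.symm m1 m2
    ·
      have hn : ∀ K ⊆ X, Conn H K → a ∉ K → b ∉ K → ∀ c, ¬ (nbr H K ∩ X ⊆ {c}) :=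
        fun K h1 h2 h3 h4 c h5 => hC1 ⟨K, h1, h2, h3, h4, c, h5⟩
      unfold TC at hTC
      push Not at hTC
      obtain ⟨K, hKX, hK, haK, hbK, hns, hlt⟩ := hTC
      have hfin : (nbr H K ∩ X).Finite := hX.subset inter_subset_right
      have h2 : (nbr H K ∩ X).ncard = 2 := by
        have h0 : (nbr H K ∩ X).ncard ≠ 0 := by
          rw [Ne, Set.ncard_eq_zero hfin]
          intro h
          exact hn K hKX hK haK hbK a (by rw [h]; exact Set.empty_subset _)
        have h1 : (nbr H K ∩ X).ncard ≠ 1 := by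
          intro h
          obtain ⟨c, hc⟩ := Set.ncard_eq_one.1 h
          exact hn K hKX hK haK hbK c hc.le
        omega
      obtain ⟨c, d, hcd, hN⟩ := Set.ncard_eq_two.1 h2
      have hcm : c ∈ nbr H K ∩ X := by rw [hN]; simp
      have hdm : d ∈ nbr H K ∩ X := by rw [hN]; simp
      obtain ⟨⟨hcK, hcA⟩, hcXX⟩ := hcm
      obtain ⟨⟨hdK, hdA⟩, hdXX⟩ := hdm
      obtain ⟨z, hzX, hz⟩ : ∃ z ∈ X, z ∉ K ∪ nbr H K := by by_contra h; push Not at h; exact hns h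
      have hzm : z ∈ X \ (K ∪ {c, d}) := by
        refine ⟨hzX, ?_⟩
        rintro (h | h)
        · exact hz (Or.inl h)
        · rw [← hN] at h; exact hz (Or.inr h.1)
      obtain ⟨L, hL1, hL2, hLc, hLd⟩ := link_exists hn hab haX hbX hKX hK haK hbK hcXX hdXX hcA hdA hN.le hzm
      have hcd' : (addE H c d).Adj c d := addE_adj.2 (Or.inr ⟨Or.inl ⟨rfl, rfl⟩, hcd⟩)
      have hsub1 : X \ K ⊆ X := sdiff_subset
      have hsub2 : K ∪ {c, d} ⊆ X := by
        rintro v (h | rfl | rfl)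
        · exact hKX h
        · exact hcXX
        · exact hdXX
      obtain ⟨k, hk⟩ := hK.nonempty
      have s1 := small (X \ K) hsub1 ⟨k, hKX hk, fun h => h.2 hk⟩
      have s2 := small _ hsub2 ⟨z, hzm⟩
      have c1 : Conn (addE H c d) (X \ K) := by
        refine conn_rest hcX le_addE ⟨hcXX, hcK⟩ ?_
        rintro v hv hvK ⟨k, hk, hkv⟩
        have : v ∈ nbr H K ∩ X := ⟨⟨hvK, k, hk, hkv⟩, hv⟩
        rw [hN] at this
        rcases this with rfl | rfl
        · exact Or.inl rfl
        · exact Or.inr hcd'.symm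
      have c2 : Conn (addE H c d) (K ∪ {c, d}) := by
        obtain ⟨x, hx, hxc⟩ := hcA
        exact (hK.mono le_addE).union_adj (conn_pair hcd') ⟨x, hx, c, by simp, le_addE hxc⟩
      have dKX : Disjoint K (X \ K) := Set.disjoint_sdiff_right
      have dL : Disjoint L (K ∪ {c, d}) := disjoint_left.2 (fun v hv h => (hL1 hv).2 h)
      have hLX : L ⊆ X := fun v hv => (hL1 hv).1
      have m1 : ¬ MinorIn (addE H c d) K5 (K ∪ {c, d}) := fun h => h5 (minor_addE h hL2 hLX hsub2 dL hLc hLd)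
      have m2 : ¬ MinorIn (addE H c d) K33 (K ∪ {c, d}) := fun h => h33 (minor_addE h hL2 hLX hsub2 dL hLc hLd)
      refine two_sum (H' := addE H c d) (X1 := X \ K) (X2 := K ∪ {c, d}) (c := c) (d := d) le_addE ?_ ?_ ?_ ?_ ?_ ?_
          hcd' ?_ ?_ ?_ ?_
      · apply Set.Subset.antisymm
        · intro v hv
          by_cases h : v ∈ K
          · exact Or.inr (Or.inl h)
          · exact Or.inl ⟨hv, h⟩
        · exact union_subset hsub1 hsub2
      · exact ⟨hcXX, hcK⟩
      · simp
      · exact ⟨hdXX, hdK⟩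
      · simp
      · rintro v h (h' | h')
        · exact absurd h' h.2
        · exact h'
      · rintro v h w (h' | h') hvw
        · left; right; rw [← hN]
          exact ⟨⟨h.2, w, h', hvw.symm⟩, h.1⟩
        · right
          rcases h' with rfl | rfl
          · exact ⟨hcXX, hcK⟩
          · exact ⟨hdXX, hdK⟩
      · exact ih _ _ a b s1.1 s1.2 c1 ⟨haX, haK⟩ ⟨hbX, hbK⟩ (le_addE hab)
            (fun h => h5 (minor_addE h hK hKX hsub1 dKX hcA hdA)) (fun h => h33 (minor_addE h hK hKX hsub1 dKX hcA hdA))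
      · exact ih _ _ c d s2.1 s2.2 c2 (by simp) (by simp) hcd' m1 m2
      · exact ih _ _ d c s2.1 s2.2 c2 (by simp) (by simp) hcd'.symm m1 m2

theorem planar_grid {W : Type} [Finite W] (H : SimpleGraph W) (hc : H.Connected)
    (h5 : ¬ IsMinorOf K5 H) (h33 : ¬ IsMinorOf K33 H) :
    ∃ w h : ℕ, MinorIn GG H {p | p.1 ≤ w ∧ p.2 ≤ h} := by
  have hcU : Conn H univ := by
    rw [conn_iff_induce]
    exact (SimpleGraph.induceUnivIso H).connected_iff.2 hc
  by_cases hE : ∃ a b, H.Adj a b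
  · obtain ⟨a, b, hab⟩ := hE
    obtain ⟨w, h, o, P, -, -⟩ := wag_pic _ H univ a b Set.finite_univ le_rfl hcU trivial trivial hab
      (fun h => h5 (minorIn_univ.1 h)) (fun h => h33 (minorIn_univ.1 h))
    refine ⟨w, h, fun v => cells w h o v, fun v => P.conn v trivial, fun v p hp => ⟨hp.1, hp.2.1⟩, ?_,
      fun u v huv => P.adj u trivial v trivial huv⟩
    intro u v huv
    rw [disjoint_left]
    rintro p ⟨_, _, h1⟩ ⟨_, _, h2⟩
    exact huv (h1.symm.trans h2)
  · push Not at hE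
    refine ⟨0, 0, fun _ => {(0, 0)}, fun _ => conn_singleton _ _, ?_, ?_, fun u v huv => absurd huv (hE u v)⟩
    · rintro _ _ rfl; exact ⟨le_rfl, le_rfl⟩
    · intro u v huv
      exfalso
      have := hcU.closed {u} (Set.mem_univ u) rfl (fun x _ _ y _ hxy => absurd hxy (hE x y))
      exact huv (this (Set.mem_univ v)).symm

def GridIn (G : SimpleGraph V) (r w : ℕ) (C : Set V) : Prop :=
  ∃ φ : ℕ → ℕ → Set V, (∀ i < r, ∀ j < w, Conn G (φ i j) ∧ φ i j ⊆ C) ∧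
    (∀ i < r, ∀ j < w, ∀ i' < r, ∀ j' < w, (i ≠ i' ∨ j ≠ j') → Disjoint (φ i j) (φ i' j')) ∧
    (∀ i < r, ∀ j, j + 1 < w → SAdj G (φ i j) (φ i (j + 1))) ∧
    (∀ i, i + 1 < r → ∀ j < w, SAdj G (φ i j) (φ (i + 1) j))

theorem conn_chain (R : ℕ → Set V) (a : ℕ) : ∀ n,
    (∀ s ≤ n, Conn G (R (a + s))) → (∀ s < n, SAdj G (R (a + s)) (R (a + s + 1))) →
    Conn G (⋃ s ∈ {s : ℕ | s ≤ n}, R (a + s)) := by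
  intro n
  induction n with
  | zero =>
    intro h1 _
    have : (⋃ s ∈ {s : ℕ | s ≤ 0}, R (a + s)) = R (a + 0) := by
      ext v
      simp only [mem_iUnion, mem_ofPred_eq]
      constructor
      · rintro ⟨s, hs, h⟩
        obtain rfl : s = 0 := by omega
        exact h
      · intro h; exact ⟨0, le_rfl, h⟩
    rw [this]
    exact h1 0 le_rfl
  | succ n ih =>
    intro h1 h2
    have : (⋃ s ∈ {s : ℕ | s ≤ n + 1}, R (a + s)) = (⋃ s ∈ {s : ℕ | s ≤ n}, R (a + s)) ∪ R (a + (n + 1)) := by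
      ext v
      simp only [mem_iUnion, mem_ofPred_eq, mem_union]
      constructor
      · rintro ⟨s, hs, h⟩
        rcases Nat.lt_or_ge n s with h' | h'
        · obtain rfl : s = n + 1 := by omega
          exact Or.inr h
        · exact Or.inl ⟨s, h', h⟩
      · rintro (⟨s, hs, h⟩ | h)
        · exact ⟨s, by omega, h⟩
        · exact ⟨n + 1, le_rfl, h⟩
    rw [this]
    refine (ih (fun s hs => h1 s (by omega)) (fun s hs => h2 s (by omega))).union_adj (h1 (n + 1) le_rfl) ?_
    refine (h2 n (by omega)).mono ?_ (by rw [← add_assoc])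
    exact subset_biUnion_of_mem (u := fun s => R (a + s)) (show n ∈ {s | s ≤ n} from le_refl n)

structure Cfg3 (G : SimpleGraph V) (r T : ℕ) (R N : ℕ → ℕ → Set V) : Prop where
  Rc : ∀ i < r, ∀ t < T, Conn G (R i t)
  Rd : ∀ i < r, ∀ t < T, ∀ i' < r, ∀ t' < T, (i ≠ i' ∨ t ≠ t') → Disjoint (R i t) (R i' t')
  Ra : ∀ i < r, ∀ t, t + 1 < T → SAdj G (R i t) (R i (t + 1))
  Nc : ∀ i, i + 1 < r → ∀ t < T, Conn G (R i t ∪ N i t)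
  Na : ∀ i, i + 1 < r → ∀ t < T, SAdj G (R i t ∪ N i t) (R (i + 1) t)
  NR : ∀ i, i + 1 < r → ∀ t < T, ∀ i' < r, ∀ t' < T, Disjoint (N i t) (R i' t')
  NN : ∀ i, i + 1 < r → ∀ t < T, ∀ i', i' + 1 < r → ∀ t' < T, t ≠ t' → Disjoint (N i t) (N i' t')

theorem blk_lt {c w r s : ℕ} (hc : c < w) (hs : s < r) : c * r + s < r * w := by
  have : (c + 1) * r ≤ w * r := Nat.mul_le_mul_right r hc
  rw [Nat.succ_mul, Nat.mul_comm w r] at this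
  omega

theorem blk_inj {c c' r s s' : ℕ} (hs : s < r) (hs' : s' < r) (h : c * r + s = c' * r + s') : c = c' ∧ s = s' := by
  have h1 : (c * r + s) / r = c := by
    rw [Nat.mul_comm, Nat.mul_add_div (by omega), Nat.div_eq_of_lt hs]; omega
  have h2 : (c' * r + s') / r = c' := by
    rw [Nat.mul_comm, Nat.mul_add_div (by omega), Nat.div_eq_of_lt hs']; omega
  have : c = c' := by rw [← h1, ← h2, h]
  subst this
  exact ⟨rfl, by omega⟩

theorem Cfg3.grid {r w : ℕ} {R N : ℕ → ℕ → Set V} (h : Cfg3 G r (r * w) R N) :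
    GridIn G r w univ := by
  obtain ⟨A, hA⟩ : ∃ A : ℕ → ℕ → Set V, A = fun i c => ⋃ s ∈ {s : ℕ | s ≤ r - 1}, R i (c * r + s) := ⟨_, rfl⟩
  obtain ⟨B, hB⟩ : ∃ B : ℕ → ℕ → Set V, B = fun i c => if i + 1 < r then N i (c * r + i) else ∅ := ⟨_, rfl⟩
  have memA : ∀ i c v, v ∈ A i c ↔ ∃ s ≤ r - 1, v ∈ R i (c * r + s) := by intro i c v; simp [hA]
  have memB : ∀ i c v, v ∈ B i c → i + 1 < r ∧ v ∈ N i (c * r + i) := by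
    intro i c v hv
    simp only [hB] at hv
    split_ifs at hv with h
    · exact ⟨h, hv⟩
    · exact absurd hv (Set.notMem_empty _)
  have Asub : ∀ i c s, s < r → R i (c * r + s) ⊆ A i c := fun i c s hs v hv => (memA i c v).2 ⟨s, by omega, hv⟩
  have connA : ∀ i < r, ∀ c < w, Conn G (A i c) := by
    intro i hi c hc
    rw [hA]
    refine conn_chain (R i) (c * r) (r - 1) (fun s hs => h.Rc i hi _ (blk_lt hc (by omega)))
      (fun s hs => h.Ra i hi _ ?_)
    have := blk_lt (s := s + 1) (r := r) hc (by omega)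
    omega
  have hsplit : ∀ i < r, ∀ c < w, Conn G (A i c ∪ B i c) := by
    intro i hi c hc
    by_cases hir : i + 1 < r
    · have hBe : B i c = N i (c * r + i) := by simp [hB, hir]
      have := (connA i hi c hc).union (h.Nc i hir _ (blk_lt hc hi)) (by
        obtain ⟨x, hx⟩ := (h.Rc i hi _ (blk_lt hc hi)).nonempty
        exact ⟨x, Asub i c i hi hx, Or.inl hx⟩)
      rwa [← Set.union_assoc, Set.union_eq_self_of_subset_right (Asub i c i hi), ← hBe] at this
    · have hBe : B i c = ∅ := by simp [hB, hir]
      rw [hBe, Set.union_empty]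
      exact connA i hi c hc
  refine ⟨fun i c => A i c ∪ B i c, fun i hi c hc => ⟨hsplit i hi c hc, subset_univ _⟩, ?_, ?_, ?_⟩
  · intro i hi c hc i' hi' c' hc' hne
    rw [disjoint_left]
    rintro v (hv | hv) (hv' | hv')
    · obtain ⟨s, hs, hv⟩ := (memA _ _ _).1 hv
      obtain ⟨s', hs', hv'⟩ := (memA _ _ _).1 hv'
      refine disj (h.Rd i hi _ (blk_lt hc (by omega)) i' hi' _ (blk_lt hc' (by omega)) ?_) hv hv'
      by_contra! hcon
      have := blk_inj (by omega) (by omega) hcon.2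
      rcases hne with h | h
      · exact h hcon.1
      · exact h this.1
    · obtain ⟨s, hs, hv⟩ := (memA _ _ _).1 hv
      obtain ⟨h1, hv'⟩ := memB _ _ _ hv'
      exact disj (h.NR i' h1 _ (blk_lt hc' hi') i hi _ (blk_lt hc (by omega))) hv' hv
    · obtain ⟨s, hs, hv'⟩ := (memA _ _ _).1 hv'
      obtain ⟨h1, hv⟩ := memB _ _ _ hv
      exact disj (h.NR i h1 _ (blk_lt hc hi) i' hi' _ (blk_lt hc' (by omega))) hv hv'
    · obtain ⟨h1, hv⟩ := memB _ _ _ hv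
      obtain ⟨h1', hv'⟩ := memB _ _ _ hv'
      refine disj (h.NN i h1 _ (blk_lt hc hi) i' h1' _ (blk_lt hc' hi') ?_) hv hv'
      intro hcon
      have := blk_inj hi hi' hcon
      rcases hne with h | h
      · exact h this.2
      · exact h this.1
  · intro i hi c hc
    have e : c * r + (r - 1) + 1 = (c + 1) * r + 0 := by rw [Nat.succ_mul]; omega
    have := h.Ra i hi (c * r + (r - 1)) (by
      rw [e]; exact blk_lt hc (by omega))
    rw [e] at this
    exact this.mono ((Asub i c (r - 1) (by omega)).trans subset_union_left)
      ((Asub i (c + 1) 0 (by omega)).trans subset_union_left)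
  · intro i hi c hc
    have hBe : B i c = N i (c * r + i) := by simp [hB, hi]
    refine (h.Na i hi (c * r + i) (blk_lt hc (by omega))).mono ?_
      ((Asub (i + 1) c i (by omega)).trans subset_union_left)
    rw [← hBe]
    exact Set.union_subset_union_left _ (Asub i c i (by omega))

theorem path_or_star {U : Type} [Finite U] {Γ : SimpleGraph U} (hc : Conn Γ univ) (r : ℕ)
    (hU : (r + 1) ^ r < Nat.card U) : ∃ a : ℕ → U, (∀ i < r, ∀ j < r, a i = a j → i = j) ∧
      ∀ i, i + 1 < r → Γ.Adj (a i) (a (i + 1)) ∨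
        ∃ c, (∀ k < r, a k ≠ c) ∧ Γ.Adj (a i) c ∧ Γ.Adj c (a (i + 1)) := by
  by_cases hstar : ∃ c, r ≤ (Γ.neighborSet c).ncard
  · obtain ⟨c, hr⟩ := hstar
    obtain ⟨S, hS, hSr⟩ := Set.exists_subset_card_eq hr
    have : Nonempty (Fin r ≃ S) := by
      have hf : S.Finite := toFinite _
      have : Nat.card S = Nat.card (Fin r) := by rw [Nat.card_coe_set_eq, hSr, Nat.card_fin]
      exact Finite.card_eq.1 this.symm
    obtain ⟨e⟩ := this
    refine ⟨fun i => if h : i < r then (e ⟨i, h⟩ : U) else c, ?_, ?_⟩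
    · intro i hi j hj hij
      simp only [hi, hj, dif_pos] at hij
      have := e.injective (Subtype.ext hij)
      simpa using this
    · intro i hi
      have hm : ∀ k (hk : k < r), Γ.Adj c (e ⟨k, hk⟩) := fun k hk => hS (e ⟨k, hk⟩).2
      right
      refine ⟨c, ?_, ?_, ?_⟩
      · intro k hk
        simp only [hk, dif_pos]
        exact (hm k hk).ne'
      · simp only [show i < r by omega, dif_pos]
        exact (hm _ _).symm
      · simp only [hi, dif_pos]
        exact hm _ _
  · push Not at hstar
    obtain ⟨v⟩ : Nonempty U := by
      have : 0 < Nat.card U := by omega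
      exact (Nat.card_pos_iff.1 this).1
    let Bl : ℕ → Set U := fun n => Nat.rec {v} (fun _ B => B ∪ ⋃ x ∈ B, Γ.neighborSet x) n
    have hB0 : Bl 0 = {v} := rfl
    have hBs : ∀ n, Bl (n + 1) = Bl n ∪ ⋃ x ∈ Bl n, Γ.neighborSet x := fun n => rfl
    have hcard : ∀ n, (Bl n).ncard ≤ (r + 1) ^ n := by
      intro n
      induction n with
      | zero => rw [hB0]; simp
      | succ n ih =>
        rw [hBs]
        have h1 : (⋃ x ∈ Bl n, Γ.neighborSet x).ncard ≤ (Bl n).ncard * r := by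
          have hf : (Bl n).Finite := Set.finite_univ.subset (subset_univ _)
          have e1 : (⋃ x ∈ Bl n, Γ.neighborSet x) = ((hf.toFinset.biUnion fun x => (toFinite (Γ.neighborSet x)).toFinset : Finset U) : Set U) := by
            ext y; simp
          rw [e1, ncard_coe_finset, ncard_eq_toFinset_card _ hf]
          refine card_biUnion_le_card_mul _ _ _ ?_
          intro x _
          rw [← ncard_eq_toFinset_card]
          exact (hstar x).le
        calc _ ≤ (Bl n).ncard + (⋃ x ∈ Bl n, Γ.neighborSet x).ncard := ncard_union_le _ _
          _ ≤ (Bl n).ncard + (Bl n).ncard * r := by omega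
          _ = (Bl n).ncard * (r + 1) := by ring
          _ ≤ (r + 1) ^ n * (r + 1) := Nat.mul_le_mul_right _ ih
          _ = _ := (pow_succ _ _).symm
    obtain ⟨u, hu⟩ : ∃ u, u ∉ Bl r := by
      by_contra! hcon
      have : Bl r = univ := Set.eq_univ_of_forall hcon
      have h2 := hcard r
      rw [this, Set.ncard_univ] at h2
      omega
    obtain ⟨n, f, hp, hf0, hfn, -, -, -⟩ := exists_path (T := {u}) hc (Set.mem_univ v) ⟨u, trivial, rfl⟩
    have hmono : ∀ k l, k ≤ l → Bl k ⊆ Bl l := by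
      intro k l hkl
      induction l, hkl using Nat.le_induction with
      | base => exact subset_rfl
      | succ l _ ih => rw [hBs]; exact ih.trans subset_union_left
    have hfB : ∀ k ≤ n, f k ∈ Bl k := by
      intro k
      induction k with
      | zero => intro _; rw [hf0]; rfl
      | succ k ih =>
        intro hk
        rw [hBs]
        right
        exact mem_biUnion (ih (by omega)) (hp.1 k (by omega))
    have hrn : r < n := by
      by_contra hcon
      apply hu
      have := hmono n r (by omega) (hfB n le_rfl)
      rwa [show f n = u from hfn] at this
    exact ⟨f, fun i hi j hj h => hp.2 i (by omega) j (by omega) h, fun i hi => Or.inl (hp.1 i (by omega))⟩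

structure Cfg (G : SimpleGraph V) (U : Type) (d : ℕ) (R : U → ℕ → Set V) (P : ℕ → Set V) : Prop where
  Rc : ∀ l, ∀ j < d, Conn G (R l j)
  Rd : ∀ l, ∀ j < d, ∀ l', ∀ j' < d, (l ≠ l' ∨ j ≠ j') → Disjoint (R l j) (R l' j')
  Ra : ∀ l, ∀ j, j + 1 < d → SAdj G (R l j) (R l (j + 1))
  Pc : ∀ j < d, Conn G (P j)
  Pd : ∀ j < d, ∀ j' < d, j ≠ j' → Disjoint (P j) (P j')
  PR : ∀ l, ∀ j < d, (P j ∩ R l j).Nonempty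
  PR' : ∀ l, ∀ j < d, ∀ j' < d, j ≠ j' → Disjoint (P j) (R l j')

def Lk (G : SimpleGraph V) (Z A B : Set V) : Prop :=
  SAdj G A B ∨ ∃ M ⊆ Z, Conn G M ∧ SAdj G A M ∧ SAdj G M B

theorem Lk.symm {Z A B : Set V} (h : Lk G Z A B) : Lk G Z B A := by
  rcases h with h | ⟨M, h1, h2, h3, h4⟩
  · exact Or.inl h.symm
  · exact Or.inr ⟨M, h1, h2, h4.symm, h3.symm⟩

theorem Lk.toN {Z A B : Set V} (h : Lk G Z A B) (hA : Conn G A) :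
    ∃ N ⊆ Z, Conn G (A ∪ N) ∧ SAdj G (A ∪ N) B := by
  rcases h with h | ⟨M, h1, h2, h3, h4⟩
  · exact ⟨∅, Set.empty_subset _, by rwa [Set.union_empty], by rwa [Set.union_empty]⟩
  · exact ⟨M, h1, hA.union_adj h2 h3, h4.mono subset_union_right subset_rfl⟩

def slabG (G : SimpleGraph V) {U : Type} (R : U → ℕ → Set V) (P : ℕ → Set V) (j : ℕ) : SimpleGraph U where
  Adj l l' := l ≠ l' ∧ Lk G (P j \ ⋃ i, R i j) (R l j) (R l' j)
  symm := ⟨fun _ _ h => ⟨h.1.symm, h.2.symm⟩⟩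
  loopless := ⟨fun _ h => h.1 rfl⟩

theorem Cfg.slab_conn {U : Type} [Nonempty U] {d : ℕ} {R : U → ℕ → Set V} {P : ℕ → Set V}
    (h : Cfg G U d R P) {j : ℕ} (hj : j < d) : Conn (slabG G R P j) univ := by
  refine ⟨Set.univ_nonempty, ?_⟩
  rintro S ⟨l0, -, hl0⟩ hcl l' -
  obtain ⟨Z, hZ⟩ : ∃ Z, Z = P j \ ⋃ i, R i j := ⟨_, rfl⟩
  have hYc : Conn G (P j ∪ ⋃ i, R i j) := by
    refine (h.Pc j hj).union_pieces ?_
    intro y hy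
    obtain ⟨l, hl⟩ := mem_iUnion.1 hy
    refine ⟨R l j, fun v hv => Or.inl (mem_iUnion.2 ⟨l, hv⟩), h.Rc l j hj, hl, Or.inl ?_⟩
    rw [Set.inter_comm]
    exact h.PR l j hj
  have hadj : ∀ l ∈ S, ∀ l', Lk G Z (R l j) (R l' j) → l' ∈ S := by
    intro l hl l' hk
    by_cases he : l = l'
    · exact he ▸ hl
    · exact hcl l trivial hl l' trivial ⟨he, hZ ▸ hk⟩
  obtain ⟨x0, hx0⟩ := (h.Rc l0 j hj).nonempty
  have hsub := hYc.closed {x | (∃ l ∈ S, x ∈ R l j) ∨ (x ∈ Z ∧ ∃ l ∈ S, SAdj G (R l j) (comp G Z x))}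
    (q := x0) (Or.inr (mem_iUnion.2 ⟨l0, hx0⟩)) (Or.inl ⟨l0, hl0, hx0⟩) (by
      rintro u - hu v hv huv
      have hv' : v ∈ Z ∨ ∃ l, v ∈ R l j := by
        by_cases hvR : v ∈ ⋃ i, R i j
        · exact Or.inr (mem_iUnion.1 hvR)
        · exact Or.inl (hZ ▸ ⟨hv.resolve_right hvR, hvR⟩)
      rcases hu with ⟨l, hl, hu⟩ | ⟨huZ, l, hl, hs⟩
      · rcases hv' with hv' | ⟨l2, hv'⟩
        · exact Or.inr ⟨hv', l, hl, u, hu, v, mem_comp hv', huv⟩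
        · exact Or.inl ⟨l2, hadj l hl l2 (Or.inl ⟨u, hu, v, hv', huv⟩), hv'⟩
      · have hcu := comp_isComp (G := G) huZ
        rcases hv' with hv' | ⟨l2, hv'⟩
        · refine Or.inr ⟨hv', l, hl, ?_⟩
          rw [← hcu.eq_comp (hcu.2.2 u (mem_comp huZ) v hv' huv)]
          exact hs
        · exact Or.inl ⟨l2, hadj l hl l2 (Or.inr ⟨comp G Z u, hcu.2.1, hcu.1, hs, u, mem_comp huZ, v, hv', huv⟩), hv'⟩)
  obtain ⟨x, hx⟩ := (h.Rc l' j hj).nonempty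
  rcases hsub (Or.inr (mem_iUnion.2 ⟨l', hx⟩)) with ⟨l, hl, hxl⟩ | ⟨hxZ, -⟩
  · by_cases he : l = l'
    · exact he ▸ hl
    · exact absurd hx (disj (h.Rd l j hj l' j hj (Or.inl he)) hxl)
  · rw [hZ] at hxZ
    exact absurd (mem_iUnion.2 ⟨l', hx⟩) hxZ.2

theorem mono_class {K : Type} [Finite K] (f : ℕ → K) (D : ℕ) :
    ∃ (k : K) (g : ℕ → ℕ), (∀ i j, i < j → j < D → g i < g j) ∧ (∀ i < D, g i < Nat.card K * D + 1 ∧ f (g i) = k) := by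
  have := Fintype.ofFinite K
  have hcard : Fintype.card K = Nat.card K := Nat.card_eq_fintype_card.symm
  obtain ⟨k, -, hk⟩ := Finset.exists_lt_card_fiber_of_mul_lt_card_of_maps_to
    (s := Finset.range (Nat.card K * D + 1)) (t := (Finset.univ : Finset K)) (f := f) (n := D)
    (fun _ _ => Finset.mem_univ _) (by rw [Finset.card_univ, Finset.card_range, hcard]; omega)
  obtain ⟨s, hs, hsD⟩ := Finset.exists_subset_card_eq hk.le
  refine ⟨k, fun i => if h : i < D then s.orderEmbOfFin hsD ⟨i, h⟩ else 0, ?_, ?_⟩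
  · intro i j hij hj
    simp only [hj, show i < D by omega, dif_pos]
    exact (s.orderEmbOfFin hsD).strictMono (by simpa using hij)
  · intro i hi
    simp only [hi, dif_pos]
    have := hs (s.orderEmbOfFin_mem hsD ⟨i, hi⟩)
    rw [mem_filter, Finset.mem_range] at this
    exact this

theorem mem_seg {R : ℕ → Set V} {a n : ℕ} {v : V} :
    v ∈ (⋃ s ∈ {s : ℕ | s ≤ n}, R (a + s)) ↔ ∃ j, a ≤ j ∧ j ≤ a + n ∧ v ∈ R j := by
  simp only [mem_iUnion, mem_ofPred_eq]
  constructor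
  · rintro ⟨s, hs, h⟩; exact ⟨a + s, by omega, by omega, h⟩
  · rintro ⟨j, h1, h2, h⟩; exact ⟨j - a, by omega, by rwa [show a + (j - a) = j by omega]⟩

theorem conn_seg {R : ℕ → Set V} {a b d : ℕ} (hab : a ≤ b) (hb : b < d)
    (h1 : ∀ j < d, Conn G (R j)) (h2 : ∀ j, j + 1 < d → SAdj G (R j) (R (j + 1))) :
    Conn G {v | ∃ j, a ≤ j ∧ j ≤ b ∧ v ∈ R j} := by
  have := conn_chain R a (b - a) (fun s hs => h1 _ (by omega)) (fun s hs => h2 _ (by omega))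
  convert this using 1
  ext v
  rw [mem_seg]
  rw [show a + (b - a) = b by omega]
  rfl

theorem Cfg.grid {U : Type} [Finite U] {d r w : ℕ} {R : U → ℕ → Set V} {P : ℕ → Set V}
    (h : Cfg G U d R P) (hU : (r + 1) ^ r < Nat.card U)
    (hd : Nat.card (SimpleGraph U) * (2 * (r * w) + 1) + 1 ≤ d) : GridIn G r w univ := by
  obtain ⟨Γ, g, hg1, hg2⟩ := mono_class (slabG G R P) (2 * (r * w) + 1)
  have hne : Nonempty U := by
    have : 0 < Nat.card U := by omega
    exact (Nat.card_pos_iff.1 this).1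
  have hgd : ∀ i < 2 * (r * w) + 1, g i < d := fun i hi => lt_of_lt_of_le (hg2 i hi).1 hd
  have hΓc : Conn Γ univ := by
    rw [← (hg2 0 (by omega)).2]
    exact h.slab_conn (hgd 0 (by omega))
  obtain ⟨a, ha1, ha2⟩ := path_or_star hΓc r hU
  have hgm : ∀ i j, i ≤ j → j < 2 * (r * w) + 1 → g i ≤ g j := by
    intro i j hij hj
    rcases Nat.eq_or_lt_of_le hij with rfl | hlt
    · exact le_rfl
    · exact (hg1 i j hlt hj).le
  obtain ⟨R3, hR3⟩ : ∃ R3 : ℕ → ℕ → Set V, R3 = fun i t =>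
      {v | ∃ j, g (2 * t) ≤ j ∧ j ≤ g (2 * t + 2) - 1 ∧ v ∈ R (a i) j} := ⟨_, rfl⟩
  have idx : ∀ t < r * w, g (2 * t) < g (2 * t + 1) ∧ g (2 * t + 1) < g (2 * t + 2) ∧ g (2 * t + 2) < d :=
    fun t ht => ⟨hg1 _ _ (by omega) (by omega), hg1 _ _ (by omega) (by omega), hgd _ (by omega)⟩
  have idx2 : ∀ t < r * w, ∀ t' < r * w, ∀ j, g (2 * t) ≤ j → j ≤ g (2 * t + 2) - 1 →
      g (2 * t') ≤ j → j ≤ g (2 * t' + 2) - 1 → t = t' := by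
    intro t ht t' ht' j h1 h2 h3 h4
    have i1 := idx t ht
    have i2 := idx t' ht'
    rcases Nat.lt_trichotomy t t' with hlt | he | hlt
    · have := hgm (2 * t + 2) (2 * t') (by omega) (by omega)
      omega
    · exact he
    · have := hgm (2 * t' + 2) (2 * t) (by omega) (by omega)
      omega
  have hR3c : ∀ i t, t < r * w → Conn G (R3 i t) := by
    intro i t ht
    rw [hR3]
    have := idx t ht
    exact conn_seg (by omega) (by omega : g (2 * t + 2) - 1 < d) (h.Rc (a i)) (h.Ra (a i))
  have link : ∀ i, i + 1 < r → ∀ t < r * w, ∃ N : Set V,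
      (∀ v ∈ N, ∃ j, g (2 * t) ≤ j ∧ j ≤ g (2 * t + 2) - 1 ∧ (v ∈ P j ∨ ∃ l, v ∈ R l j)) ∧
      (∀ v ∈ N, ∀ k < r, ∀ j < d, v ∉ R (a k) j) ∧ Conn G (R3 i t ∪ N) ∧ SAdj G (R3 i t ∪ N) (R3 (i + 1) t) := by
    intro i hi t ht
    obtain ⟨i1, i2, i3⟩ := idx t ht
    have Rsub : ∀ k j, g (2 * t) ≤ j → j ≤ g (2 * t + 2) - 1 → R (a k) j ⊆ R3 k t := by
      intro k j h1 h2 v hv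
      rw [hR3]; exact ⟨j, h1, h2, hv⟩
    have offP : ∀ j < d, ∀ N ⊆ P j \ ⋃ l, R l j, ∀ v ∈ N, ∀ l, ∀ j' < d, v ∉ R l j' := by
      intro j hj N hN v hv l j' hj' hvR
      by_cases he : j = j'
      · subst he
        exact (hN hv).2 (mem_iUnion.2 ⟨l, hvR⟩)
      · exact disj (h.PR' l j hj j' hj' he) (hN hv).1 hvR
    have lk1 : ∀ s, s = 2 * t ∨ s = 2 * t + 1 → ∀ l l', Γ.Adj l l' →
        ∃ N ⊆ P (g s) \ ⋃ l, R l (g s), Conn G (R l (g s) ∪ N) ∧ SAdj G (R l (g s) ∪ N) (R l' (g s)) := by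
      intro s hs l l' hll
      have hs2 := hg2 s (by omega)
      rw [← hs2.2] at hll
      exact hll.2.toN (h.Rc l _ (hgd s (by omega)))
    have attach : ∀ j, g (2 * t) ≤ j → j ≤ g (2 * t + 2) - 1 → ∀ N, Conn G (R (a i) j ∪ N) → Conn G (R3 i t ∪ N) := by
      intro j h1 h2 N hN
      obtain ⟨x, hx⟩ := (h.Rc (a i) j (by omega)).nonempty
      have := (hR3c i t ht).union hN ⟨x, Rsub i j h1 h2 hx, Or.inl hx⟩
      rwa [← Set.union_assoc, Set.union_eq_self_of_subset_right (Rsub i j h1 h2)] at this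
    rcases ha2 i hi with hadj | ⟨c, hc, hac, hca⟩
    · obtain ⟨N, hN1, hN2, hN3⟩ := lk1 (2 * t) (Or.inl rfl) _ _ hadj
      refine ⟨N, fun v hv => ⟨g (2 * t), le_rfl, by omega, Or.inl (hN1 hv).1⟩,
        fun v hv k _ j hj => offP _ (by omega) N hN1 v hv _ j hj, attach _ le_rfl (by omega) N hN2, ?_⟩
      exact hN3.mono (Set.union_subset_union_left _ (Rsub i _ le_rfl (by omega))) (Rsub (i + 1) _ le_rfl (by omega))
    · obtain ⟨N1, hN1, hN1c, hN1a⟩ := lk1 (2 * t) (Or.inl rfl) _ _ hac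
      obtain ⟨N2, hN2, hN2c, hN2a⟩ := lk1 (2 * t + 1) (Or.inr rfl) _ _ hca
      obtain ⟨Q, hQ⟩ : ∃ Q : Set V, Q = {v | ∃ j, g (2 * t) ≤ j ∧ j ≤ g (2 * t + 1) ∧ v ∈ R c j} := ⟨_, rfl⟩
      have hQc : Conn G Q := by
        rw [hQ]; exact conn_seg i1.le (by omega : g (2 * t + 1) < d) (h.Rc c) (h.Ra c)
      have s1 : R c (g (2 * t)) ⊆ Q := by intro v hv; rw [hQ]; exact ⟨_, le_rfl, i1.le, hv⟩
      have s2 : R c (g (2 * t + 1)) ⊆ Q := by intro v hv; rw [hQ]; exact ⟨_, i1.le, le_rfl, hv⟩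
      have c1 : Conn G (R (a i) (g (2 * t)) ∪ N1 ∪ Q) := hN1c.union_adj hQc (hN1a.mono subset_rfl s1)
      have c2 : Conn G (Q ∪ N2) := by
        obtain ⟨x, hx⟩ := (h.Rc c (g (2 * t + 1)) (by omega)).nonempty
        have := hQc.union hN2c ⟨x, s2 hx, Or.inl hx⟩
        rwa [← Set.union_assoc, Set.union_eq_self_of_subset_right s2] at this
      have c3 : Conn G (R (a i) (g (2 * t)) ∪ (N1 ∪ (Q ∪ N2))) := by
        obtain ⟨x, hx⟩ := hQc.nonempty
        have := c1.union c2 ⟨x, Or.inr hx, Or.inl hx⟩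
        convert this using 1
        ext v; simp only [mem_union]; tauto
      refine ⟨N1 ∪ (Q ∪ N2), ?_, ?_, attach _ le_rfl (by omega) _ c3, ?_⟩
      · rintro v (hv | hv | hv)
        · exact ⟨g (2 * t), le_rfl, by omega, Or.inl (hN1 hv).1⟩
        · rw [hQ] at hv
          obtain ⟨j, h1, h2, h3⟩ := hv
          exact ⟨j, h1, by omega, Or.inr ⟨c, h3⟩⟩
        · exact ⟨g (2 * t + 1), by omega, by omega, Or.inl (hN2 hv).1⟩
      · rintro v (hv | hv | hv) k hk j hj
        · exact offP _ (by omega) N1 hN1 v hv _ j hj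
        · rw [hQ] at hv
          obtain ⟨j', h1, h2, h3⟩ := hv
          exact disj (h.Rd c j' (by omega) (a k) j hj (Or.inl (Ne.symm (hc k hk)))) h3
        · exact offP _ (by omega) N2 hN2 v hv _ j hj
      · refine hN2a.mono ?_ (Rsub (i + 1) _ (by omega) (by omega))
        rintro v (hv | hv)
        · exact Or.inr (Or.inr (Or.inl (s2 hv)))
        · exact Or.inr (Or.inr (Or.inr hv))
  choose! N hN1 hN2 hN3 hN4 using link
  have hcfg : Cfg3 G r (r * w) R3 N := by
    refine ⟨fun i _ t ht => hR3c i t ht, ?_, ?_, hN3, hN4, ?_, ?_⟩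
    · intro i hi t ht i' hi' t' ht' hne
      rw [disjoint_left, hR3]
      rintro v ⟨j, h1, h2, h3⟩ ⟨j', h1', h2', h3'⟩
      have i1 := idx t ht
      have i2 := idx t' ht'
      by_cases he : a i = a i' ∧ j = j'
      · have := ha1 i hi i' hi' he.1
        obtain rfl := he.2
        rcases hne with hne | hne
        · exact hne this
        · exact hne (idx2 t ht t' ht' j h1 h2 h1' h2')
      · exact disj (h.Rd (a i) j (by omega) (a i') j' (by omega) (by tauto)) h3 h3'
    · intro i hi t ht
      have i1 := idx t (by omega)
      have i2 := idx (t + 1) ht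
      have := h.Ra (a i) (g (2 * t + 2) - 1) (by omega)
      refine this.mono ?_ ?_
      · intro v hv
        rw [hR3]
        exact ⟨_, by omega, le_rfl, hv⟩
      · intro v hv
        rw [hR3]
        refine ⟨_, ?_, ?_, hv⟩
        · rw [show 2 * (t + 1) = 2 * t + 2 by ring]; omega
        · rw [show 2 * (t + 1) = 2 * t + 2 by ring] at i2 ⊢
          omega
    · intro i hi t ht i' hi' t' ht'
      rw [disjoint_left, hR3]
      rintro v hv ⟨j, h1, h2, h3⟩
      have i2 := idx t' ht'
      exact hN2 i hi t ht v hv i' hi' j (by omega) h3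
    · intro i hi t ht i' hi' t' ht' hne
      rw [disjoint_left]
      intro v hv hv'
      obtain ⟨j, h1, h2, h3⟩ := hN1 i hi t ht v hv
      obtain ⟨j', h1', h2', h3'⟩ := hN1 i' hi' t' ht' v hv'
      have i1 := idx t ht
      have i2 := idx t' ht'
      have hjj : j ≠ j' := by
        rintro rfl
        exact hne (idx2 t ht t' ht' j h1 h2 h1' h2')
      rcases h3 with h3 | ⟨l, h3⟩ <;> rcases h3' with h3' | ⟨l', h3'⟩
      · exact disj (h.Pd j (by omega) j' (by omega) hjj) h3 h3'
      · exact disj (h.PR' l' j (by omega) j' (by omega) hjj) h3 h3'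
      · exact disj (h.PR' l j' (by omega) j (by omega) hjj.symm) h3' h3
      · exact disj (h.Rd l j (by omega) l' j' (by omega) (Or.inr hjj)) h3 h3'
  exact hcfg.grid

structure PLk (U : SimpleGraph V) (A B : Set V) (κ : ℕ) (n : Fin κ → ℕ) (f : Fin κ → ℕ → V) : Prop where
  pth : ∀ l, IsPth U (n l) (f l)
  hA : ∀ l, f l 0 ∈ A
  hB : ∀ l, f l (n l) ∈ B
  dj : ∀ l l', l ≠ l' → ∀ i ≤ n l, ∀ j ≤ n l', f l i ≠ f l' j

theorem PLk.cut [Finite V] {U : SimpleGraph V} {A B : Set V} {κ : ℕ} {n : Fin κ → ℕ}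
    {f : Fin κ → ℕ → V} (h : PLk U A B κ n f) (l0 : Fin κ) (t : ℕ) (ht : t < n l0)
    (hmin : ¬ Linked (delE U (f l0 t) (f l0 (t + 1))) A B κ) :
    ∃ W : Set V, W.ncard < κ ∧ ∀ P1 P2, Conn U P1 → Conn U P2 → Disjoint P1 W → Disjoint P2 W →
      ¬ (f l0 t ∈ P1 ∧ f l0 (t + 1) ∈ P1) → ¬ (f l0 t ∈ P2 ∧ f l0 (t + 1) ∈ P2) →
      (∃ a ≤ t, f l0 a ∈ P1) → (∃ c, t < c ∧ c ≤ n l0 ∧ f l0 c ∈ P2) →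
      ∀ l ≠ l0, ∀ a ≤ n l, f l a ∈ P1 → ∀ b ≤ n l, f l b ∈ P2 → a < b := by
  set x := f l0 t with hx
  set y := f l0 (t + 1) with hy
  set D := delE U x y with hD
  have hW : ∃ W, Sep D A B W ∧ W.ncard < κ := by
    by_contra! hcon
    exact hmin (menger D A B κ hcon)
  obtain ⟨W, hS, hWk⟩ := hW
  refine ⟨W, hWk, ?_⟩
  have hwk : ∀ l ≠ l0, IsWalk D (n l) (f l) := by
    intro l hl i hi
    refine ⟨(h.pth l).1 i hi, ?_, ?_⟩
    · rintro ⟨h1, -⟩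
      exact h.dj l l0 hl i hi.le t ht.le h1
    · rintro ⟨h1, -⟩
      exact h.dj l l0 hl i hi.le (t + 1) ht h1
  have hwk0 : ∀ i < n l0, i ≠ t → D.Adj (f l0 i) (f l0 (i + 1)) := by
    intro i hi hit
    refine ⟨(h.pth l0).1 i hi, ?_, ?_⟩
    · rintro ⟨h1, -⟩
      exact hit ((h.pth l0).2 i hi.le t ht.le h1)
    · rintro ⟨h1, h2⟩
      have e1 := (h.pth l0).2 i hi.le (t + 1) ht h1
      have e2 := (h.pth l0).2 (i + 1) hi t ht.le h2
      omega
  have hmeet : ∀ l, ∃ p, l ≠ l0 → p ≤ n l ∧ f l p ∈ W := by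
    intro l
    by_cases hl : l = l0
    · exact ⟨0, fun h => absurd hl h⟩
    by_contra! hcon
    refine hS _ ((hwk l hl).seg_conn (Nat.zero_le (n l)) le_rfl) ?_ ⟨f l 0, ⟨0, ⟨le_rfl, Nat.zero_le _⟩, rfl⟩, h.hA l⟩
      ⟨f l (n l), ⟨n l, ⟨Nat.zero_le _, le_rfl⟩, rfl⟩, h.hB l⟩
    rw [disjoint_left]
    rintro _ ⟨i, hi, rfl⟩
    exact (hcon i).2 hi.2
  choose p hp using hmeet
  have hWeq : W = (fun l => f l (p l)) '' {l | l ≠ l0} := by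
    symm
    apply Set.eq_of_subset_of_ncard_le
    · rintro _ ⟨l, hl, rfl⟩
      exact (hp l hl).2
    · rw [Set.InjOn.ncard_image]
      · have : {l : Fin κ | l ≠ l0} = {l0}ᶜ := rfl
        rw [this, Set.ncard_compl]
        simp
        omega
      · intro l hl l' hl' e
        by_contra hne
        exact h.dj l l' hne _ (hp l hl).1 _ (hp l' hl').1 e
    · exact toFinite _
  have hW0 : ∀ i ≤ n l0, f l0 i ∉ W := by
    intro i hi hiW
    rw [hWeq] at hiW
    obtain ⟨l, hl, e⟩ := hiW
    exact h.dj l l0 hl _ (hp l hl).1 i hi e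
  have hWl : ∀ l ≠ l0, ∀ i ≤ n l, i ≠ p l → f l i ∉ W := by
    intro l hl i hi hne hiW
    rw [hWeq] at hiW
    obtain ⟨l', hl', e⟩ := hiW
    by_cases hll : l' = l
    · subst hll
      exact hne ((h.pth l').2 _ (hp l' hl').1 _ hi e).symm
    · exact h.dj l' l hll _ (hp l' hl').1 i hi e
  set L := reach D A W with hL
  have hBL : ∀ v ∈ L, v ∉ B := by
    rintro v ⟨Q, h1, h2, h3, h4⟩ hvB
    exact hS Q h1 h2 h3 ⟨v, h4, hvB⟩
  have a1 : ∀ i ≤ t, f l0 i ∈ L := by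
    intro i
    induction i with
    | zero => intro _; exact reach_base (h.hA l0) (hW0 0 (Nat.zero_le _))
    | succ i ih =>
      intro hi
      exact reach_step (ih (by omega)) (hwk0 i (by omega) (by omega)) (hW0 _ (by omega))
  have a2 : ∀ i, t < i → i ≤ n l0 → f l0 i ∉ L := by
    intro i hti hi hiL
    have : ∀ s, i + s ≤ n l0 → f l0 (i + s) ∈ L := by
      intro s
      induction s with
      | zero => intro _; exact hiL
      | succ s ih =>
        intro hs
        exact reach_step (ih (by omega)) (hwk0 (i + s) (by omega) (by omega)) (hW0 _ hs)
    have h2 := this (n l0 - i) (by omega)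
    rw [show i + (n l0 - i) = n l0 by omega] at h2
    exact hBL _ h2 (h.hB l0)
  have a3 : ∀ l ≠ l0, ∀ i < p l, f l i ∈ L := by
    intro l hl i
    have hpl := (hp l hl).1
    induction i with
    | zero => intro h0; exact reach_base (h.hA l) (hWl l hl 0 (Nat.zero_le _) (by omega))
    | succ i ih =>
      intro hi
      exact reach_step (ih (by omega)) (hwk l hl i (by omega)) (hWl l hl _ (by omega) (by omega))
  have a4 : ∀ l ≠ l0, ∀ i, p l < i → i ≤ n l → f l i ∉ L := by
    intro l hl i hti hi hiL
    have : ∀ s, i + s ≤ n l → f l (i + s) ∈ L := by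
      intro s
      induction s with
      | zero => intro _; exact hiL
      | succ s ih =>
        intro hs
        exact reach_step (ih (by omega)) (hwk l hl (i + s) (by omega)) (hWl l hl _ hs (by omega))
    have h2 := this (n l - i) (by omega)
    rw [show i + (n l - i) = n l by omega] at h2
    exact hBL _ h2 (h.hB l)
  have cD : ∀ P, Conn U P → ¬ (x ∈ P ∧ y ∈ P) → Conn D P := by
    intro P hP hxy
    refine hP.mono_on ?_
    intro u hu v hv huv
    refine ⟨huv, ?_, ?_⟩
    · rintro ⟨rfl, rfl⟩; exact hxy ⟨hu, hv⟩
    · rintro ⟨rfl, rfl⟩; exact hxy ⟨hv, hu⟩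
  have cL : ∀ P, Conn D P → Disjoint P W → (P ∩ L).Nonempty → P ⊆ L := by
    rintro P hP hd ⟨q, hq, hqL⟩
    exact hP.closed L hq hqL (fun u _ huL v hv huv => reach_step huL huv (disj hd hv))
  intro P1 P2 c1 c2 d1 d2 e1 e2 ⟨a0, ha0, ha0P⟩ ⟨c0, hc0, hc0n, hc0P⟩ l hl a han haP b hbn hbP
  have s1 : P1 ⊆ L := cL P1 (cD P1 c1 e1) d1 ⟨_, ha0P, a1 a0 ha0⟩
  have s2 : ∀ v ∈ P2, v ∉ L := by
    intro v hv hvL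
    exact a2 c0 hc0 hc0n (cL P2 (cD P2 c2 e2) d2 ⟨v, hv, hvL⟩ hc0P)
  have b1 : a < p l := by
    by_contra hcon
    rcases Nat.lt_or_eq_of_le (not_lt.1 hcon) with h' | h'
    · exact a4 l hl a h' han (s1 haP)
    · exact disj d1 haP (h' ▸ (hp l hl).2)
  have b2 : p l < b := by
    by_contra hcon
    rcases Nat.lt_or_eq_of_le (not_lt.1 hcon) with h' | h'
    · exact s2 _ hbP (a3 l hl b h')
    · exact disj d2 hbP (h' ▸ (hp l hl).2)
  omega

theorem GridIn.mono_graph {G G' : SimpleGraph V} {r w : ℕ} {C : Set V} (h : GridIn G r w C) (hG : G ≤ G') :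
    GridIn G' r w C := by
  obtain ⟨φ, h1, h2, h3, h4⟩ := h
  have hs : ∀ A B, SAdj G A B → SAdj G' A B := fun A B ⟨a, ha, b, hb, hab⟩ => ⟨a, ha, b, hb, hG hab⟩
  exact ⟨φ, fun i hi j hj => ⟨(h1 i hi j hj).1.mono hG, (h1 i hi j hj).2⟩, h2,
    fun i hi j hj => hs _ _ (h3 i hi j hj), fun i hi j hj => hs _ _ (h4 i hi j hj)⟩

theorem PLk.slice {U : SimpleGraph V} {A B : Set V} {κ : ℕ} {n : Fin κ → ℕ}
    {f : Fin κ → ℕ → V} (h : PLk U A B κ n f) (J : Set (Fin κ)) (d : ℕ) (P : ℕ → Set V)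
    (Pc : ∀ j ≤ d, Conn U (P j)) (Pd : ∀ j ≤ d, ∀ j' ≤ d, j ≠ j' → Disjoint (P j) (P j'))
    (hm : ∀ l ∈ J, ∀ j ≤ d, ∃ a ≤ n l, f l a ∈ P j)
    (hord : ∀ l ∈ J, ∀ j ≤ d, ∀ j' ≤ d, j < j' → ∀ a ≤ n l, f l a ∈ P j → ∀ b ≤ n l, f l b ∈ P j' → a < b) :
    ∃ R : J → ℕ → Set V, Cfg U J d R P := by
  have hfirst : ∀ l : J, ∀ j, ∃ a, j ≤ d → (a ≤ n l ∧ f l a ∈ P j ∧ ∀ b < a, f l b ∉ P j) := by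
    intro l j
    by_cases hj : j ≤ d
    · have hex : ∃ a, f l a ∈ P j := (hm l l.2 j hj).imp fun a ha => ha.2
      refine ⟨Nat.find hex, fun _ => ⟨?_, Nat.find_spec hex, fun b hb => Nat.find_min hex hb⟩⟩
      obtain ⟨a, ha, haP⟩ := hm l l.2 j hj
      exact (Nat.find_min' hex haP).trans ha
    · exact ⟨0, fun h => absurd h hj⟩
  choose a ha using hfirst
  have hlt : ∀ l : J, ∀ j j', j < j' → j' ≤ d → a l j < a l j' := by
    intro l j j' hjj hj'
    have h1 := ha l j (by omega)
    have h2 := ha l j' hj'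
    exact hord l l.2 j (by omega) j' hj' hjj _ h1.1 h1.2.1 _ h2.1 h2.2.1
  have hle : ∀ l : J, ∀ j j', j ≤ j' → j' ≤ d → a l j ≤ a l j' := by
    intro l j j' hjj hj'
    rcases Nat.lt_or_eq_of_le hjj with h1 | h1
    · exact (hlt l j j' h1 hj').le
    · rw [h1]
  refine ⟨fun l j => f l '' {i | a l j ≤ i ∧ i ≤ a l (j + 1) - 1}, ?_, ?_, ?_, ?_, ?_, ?_, ?_⟩
  · intro l j hj
    have h1 := hlt l j (j + 1) (by omega) (by omega)
    have h2 := (ha l (j + 1) (by omega)).1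
    exact (h.pth l).1.seg_conn (by omega) (by omega)
  · intro l j hj l' j' hj' hne
    rw [disjoint_left]
    rintro _ ⟨i, hi, rfl⟩ ⟨i', hi', e⟩
    have hi1 : a l j ≤ i := hi.1
    have hi2 : i ≤ a l (j + 1) - 1 := hi.2
    have hi3 : a l' j' ≤ i' := hi'.1
    have hi4 : i' ≤ a l' (j' + 1) - 1 := hi'.2
    have n1 := (ha l (j + 1) (by omega)).1
    have n2 := (ha l' (j' + 1) (by omega)).1
    by_cases hll : l = l'
    · subst hll
      have := (h.pth l).2 i' (by omega) i (by omega) e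
      subst this
      have p1 := hlt l j (j + 1) (by omega) (by omega)
      have p2 := hlt l j' (j' + 1) (by omega) (by omega)
      rcases lt_trichotomy j j' with g | g | g
      · have := hle l (j + 1) j' g (by omega)
        omega
      · tauto
      · have := hle l (j' + 1) j g (by omega)
        omega
    · exact h.dj l' l (fun e => hll (Subtype.ext e.symm)) i' (by omega) i (by omega) e
  · intro l j hj
    have p1 := hlt l j (j + 1) (by omega) (by omega)
    have p2 := hlt l (j + 1) (j + 2) (by omega) (by omega)
    have n1 := (ha l (j + 1) (by omega)).1
    refine ⟨f l (a l (j + 1) - 1), ⟨_, ⟨by omega, le_rfl⟩, rfl⟩, f l (a l (j + 1)), ⟨_, ⟨le_rfl, ?_⟩, rfl⟩, ?_⟩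
    · change a l (j + 1) ≤ a l (j + 2) - 1
      omega
    · have := (h.pth l).1 (a l (j + 1) - 1) (by omega)
      rwa [show a l (j + 1) - 1 + 1 = a l (j + 1) by omega] at this
  · intro j hj; exact Pc j hj.le
  · intro j hj j' hj' hne; exact Pd j hj.le j' hj'.le hne
  · intro l j hj
    have p1 := hlt l j (j + 1) (by omega) (by omega)
    exact ⟨f l (a l j), (ha l j hj.le).2.1, _, ⟨le_rfl, by omega⟩, rfl⟩
  · intro l j hj j' hj' hne
    rw [disjoint_left]
    rintro _ hv ⟨i, hi, rfl⟩
    have hi1 : a l j' ≤ i := hi.1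
    have hi2 : i ≤ a l (j' + 1) - 1 := hi.2
    have p1 := hlt l j' (j' + 1) (by omega) (by omega)
    have n1 := (ha l (j' + 1) (by omega)).1
    rcases lt_or_gt_of_ne hne with g | g
    · have h2 := ha l j' (by omega)
      have := hord l l.2 j hj.le j' hj'.le g i (by omega) hv _ h2.1 h2.2.1
      omega
    · have := hle l (j' + 1) j g hj.le
      exact (ha l j hj.le).2.2 i (by omega) hv

theorem enum_by {ι : Type} [Finite ι] [Nonempty ι] (h : ι → ℕ) (hi : Function.Injective h) :
    ∃ e : ℕ → ι, ∀ j < Nat.card ι, ∀ i < j, h (e i) < h (e j) := by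
  have : Fintype ι := Fintype.ofFinite ι
  have hc : (Finset.univ.image h).card = Nat.card ι := by
    rw [Finset.card_image_of_injective _ hi, Finset.card_univ, Nat.card_eq_fintype_card]
  set o := (Finset.univ.image h).orderEmbOfFin hc with ho
  have hex : ∀ k : Fin (Nat.card ι), ∃ x, h x = o k := by
    intro k
    have := Finset.orderEmbOfFin_mem (Finset.univ.image h) hc k
    rw [Finset.mem_image] at this
    obtain ⟨x, -, hx⟩ := this
    exact ⟨x, hx⟩
  choose g hg using hex
  refine ⟨fun i => if hi : i < Nat.card ι then g ⟨i, hi⟩ else Classical.arbitrary ι, ?_⟩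
  intro j hj i hij
  simp only [hj, hij.trans hj, dif_pos]
  rw [hg, hg]
  exact o.strictMono hij

theorem free_index [Finite V] (P : ℕ → Set V) (K : Set V) (a M : ℕ)
    (hd : ∀ i, a ≤ i → i < a + M → ∀ j, a ≤ j → j < a + M → i ≠ j → Disjoint (P i) (P j)) (hK : K.ncard < M) :
    ∃ i, a ≤ i ∧ i < a + M ∧ Disjoint (P i) K := by
  by_contra! hcon
  have : ∀ s : Fin M, ∃ v, v ∈ P (a + s) ∧ v ∈ K := by
    intro s
    have := hcon (a + s) (by omega) (by omega)
    exact Set.not_disjoint_iff.1 this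
  choose v hv using this
  have hle : Nat.card (Fin M) ≤ Nat.card K :=
    Nat.card_le_card_of_injective (fun s => (⟨v s, (hv s).2⟩ : K)) (by
      intro s s' e
      have e' : v s = v s' := congrArg Subtype.val e
      by_contra hne
      have hne' : (a + s : ℕ) ≠ a + s' := by intro h; apply hne; apply Fin.ext; omega
      exact disj (hd _ (by omega) (by omega) _ (by omega) (by omega) hne') (hv s).1
        (e' ▸ (hv s').1))
  rw [Nat.card_fin, Nat.card_coe_set_eq] at hle
  omega

theorem PLk.cols [Finite V] {U : SimpleGraph V} {A B : Set V} {κ : ℕ} {n : Fin κ → ℕ}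
    {f : Fin κ → ℕ → V} (h : PLk U A B κ n f) (l0 : Fin κ) {ι : Type} [Finite ι] [Nonempty ι] (P : ι → Set V)
    (Pc : ∀ i, Conn U (P i)) (Pd : ∀ i j, i ≠ j → Disjoint (P i) (P j))
    (hmin : ∀ i x y, U.Adj x y → x ∈ P i → y ∉ P i → ¬ Linked (delE U x y) A B κ)
    (hit : ∀ i, ∃ a ≤ n l0, f l0 a ∈ P i) (d : ℕ)
    (hn : (d + 1) * ((d + 1) * κ + 1) ≤ Nat.card ι) :
    ∃ σ : ℕ → ι, ∀ j' ≤ d, ∀ j < j', σ j ≠ σ j' ∧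
      ∀ l ≠ l0, ∀ a ≤ n l, f l a ∈ P (σ j) → ∀ b ≤ n l, f l b ∈ P (σ j') → a < b := by
  set M := (d + 1) * κ + 1 with hM
  have hfirst : ∀ i, ∃ a, a ≤ n l0 ∧ f l0 a ∈ P i ∧ ∀ b < a, f l0 b ∉ P i := by
    intro i
    have hex : ∃ a, f l0 a ∈ P i := (hit i).imp fun a ha => ha.2
    refine ⟨Nat.find hex, ?_, Nat.find_spec hex, fun b hb => Nat.find_min hex hb⟩
    obtain ⟨a, ha, haP⟩ := hit i
    exact (Nat.find_min' hex haP).trans ha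
  choose a ha1 ha2 ha3 using hfirst
  have hinj : Function.Injective a := by
    intro i j hij
    by_contra hne
    exact disj (Pd i j hne) (ha2 i) (hij ▸ ha2 j)
  obtain ⟨e, he⟩ := enum_by a hinj
  have hene : ∀ i < Nat.card ι, ∀ j < Nat.card ι, i ≠ j → e i ≠ e j := by
    intro i hi j hj hne heq
    rcases lt_or_gt_of_ne hne with g | g
    · have := he j hj i g; rw [heq] at this; omega
    · have := he i hi j g; rw [heq] at this; omega
  have hle : ∀ i j, i ≤ j → j < Nat.card ι → a (e i) ≤ a (e j) := by
    intro i j hij hj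
    rcases Nat.lt_or_eq_of_le hij with g | g
    · exact (he j hj i g).le
    · rw [g]
  have hjM : ∀ j ≤ d, j * M + M ≤ Nat.card ι := by
    intro j hj
    have : (j + 1) * M ≤ (d + 1) * M := Nat.mul_le_mul_right _ (by omega)
    have h2 : (j + 1) * M = j * M + M := by ring
    omega
  have hcut : ∀ j, ∃ W : Set V, W.ncard ≤ κ ∧ (1 ≤ j → j ≤ d → ∀ i < j * M, ∀ i', j * M ≤ i' →
      i' < Nat.card ι → Disjoint (P (e i)) W → Disjoint (P (e i')) W → ∀ l ≠ l0, ∀ b ≤ n l, f l b ∈ P (e i) →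
      ∀ c ≤ n l, f l c ∈ P (e i') → b < c) := by
    intro j
    by_cases hj : 1 ≤ j ∧ j ≤ d
    swap
    · exact ⟨∅, by simp, fun h1 h2 => absurd ⟨h1, h2⟩ hj⟩
    have m1 := hjM j hj.2
    have m0 : 1 * M ≤ j * M := Nat.mul_le_mul_right _ hj.1
    have mp : 0 < M := by omega
    set q := e (j * M - 1) with hq
    have hlt : a q < a (e (j * M)) := he _ (by omega) _ (by omega)
    have hex : ∃ s, f l0 (a q + s) ∉ P q := by
      refine ⟨a (e (j * M)) - a q, ?_⟩
      rw [show a q + (a (e (j * M)) - a q) = a (e (j * M)) by omega]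
      exact fun hv => disj (Pd _ _ (hene (j * M - 1) (by omega) (j * M) (by omega) (by omega))) hv (ha2 _)
    obtain ⟨s, hs1, hs2⟩ : ∃ s, f l0 (a q + s) ∉ P q ∧ ∀ s' < s, f l0 (a q + s') ∈ P q :=
      ⟨Nat.find hex, Nat.find_spec hex, fun s' hs' => not_not.1 (Nat.find_min hex hs')⟩
    have hs0 : s ≠ 0 := by
      rintro rfl
      exact hs1 (ha2 q)
    have hsle : a q + s ≤ a (e (j * M)) := by
      by_contra hcon
      have := hs2 (a (e (j * M)) - a q) (by omega)
      rw [show a q + (a (e (j * M)) - a q) = a (e (j * M)) by omega] at this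
      exact disj (Pd _ _ (hene (j * M - 1) (by omega) (j * M) (by omega) (by omega))) this (ha2 _)
    have hn0 := ha1 (e (j * M))
    set t := a q + (s - 1) with ht
    have ht1 : f l0 t ∈ P q := hs2 (s - 1) (by omega)
    have ht2 : f l0 (t + 1) ∉ P q := by rw [show t + 1 = a q + s by omega]; exact hs1
    have hno : ¬ ∃ i, f l0 t ∈ P i ∧ f l0 (t + 1) ∈ P i := by
      rintro ⟨i, h1, h2⟩
      by_cases hiq : i = q
      · rw [hiq] at h2; exact ht2 h2
      · exact disj (Pd i q hiq) h1 ht1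
    obtain ⟨W, hW1, hW2⟩ := h.cut l0 t (by omega)
      (hmin q _ _ ((h.pth l0).1 t (by omega)) ht1 ht2)
    refine ⟨W, hW1.le, fun _ _ i hi i' hi' hi'' hd1 hd2 => ?_⟩
    refine hW2 _ _ (Pc _) (Pc _) hd1 hd2 (fun h' => hno ⟨_, h'⟩) (fun h' => hno ⟨_, h'⟩)
      ⟨a (e i), ?_, ha2 _⟩ ⟨a (e i'), ?_, ha1 _, ha2 _⟩
    · have := hle i (j * M - 1) (by omega) (by omega)
      rw [← hq] at this
      omega
    · have := hle (j * M) i' hi' hi''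
      omega
  choose W hW1 hW2 using hcut
  set K := ⋃ j ∈ Finset.range (d + 1), W j with hK
  have hKc : K.ncard < M := by
    have h1 : K.ncard ≤ ∑ j ∈ Finset.range (d + 1), (W j).ncard := Finset.set_ncard_biUnion_le _ _
    have h2 : ∑ j ∈ Finset.range (d + 1), (W j).ncard ≤ (Finset.range (d + 1)).card * κ :=
      Finset.sum_le_card_nsmul _ _ _ (fun j _ => hW1 j)
    rw [Finset.card_range] at h2
    omega
  have hpick : ∀ j, ∃ i, j ≤ d → (j * M ≤ i ∧ i < j * M + M ∧ Disjoint (P (e i)) K) := by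
    intro j
    by_cases hj : j ≤ d
    · have m1 := hjM j hj
      obtain ⟨i, hi⟩ := free_index (fun i => P (e i)) K (j * M) M
        (fun i _ hi j _ hj hne => Pd _ _ (hene i (by omega) j (by omega) hne)) hKc
      exact ⟨i, fun _ => hi⟩
    · exact ⟨0, fun h => absurd h hj⟩
  choose i hi using hpick
  refine ⟨fun j => e (i j), fun j' hj' j hjj => ?_⟩
  have g1 := hi j (by omega)
  have g2 := hi j' hj'
  have m1 := hjM j (by omega)
  have m2 := hjM j' hj'
  have m3 : (j + 1) * M ≤ j' * M := Nat.mul_le_mul_right _ hjj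
  have m4 : (j + 1) * M = j * M + M := by ring
  have hWK : W j' ⊆ K := subset_biUnion_of_mem (u := W) (by simp; omega)
  refine ⟨hene _ (by omega) _ (by omega) (by omega), ?_⟩
  exact hW2 j' (by omega) hj' (i j) (by omega) (i j') g2.1 (by omega) (g1.2.2.mono_right hWK) (g2.2.2.mono_right hWK)

theorem Linked.paths {U : SimpleGraph V} {A B : Set V} {κ : ℕ} (h : Linked U A B κ) :
    ∃ n f, PLk U A B κ n f := by
  obtain ⟨Q, h1, h2, h3, h4⟩ := h
  have : ∀ l, ∃ (n : ℕ) (f : ℕ → V), IsPth U n f ∧ f 0 ∈ A ∧ f n ∈ B ∧ ∀ i ≤ n, f i ∈ Q l := by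
    intro l
    obtain ⟨x, hx, hxA⟩ := h3 l
    obtain ⟨n, f, g1, g2, g3, g4, -⟩ := exists_path (h1 l) hx (h4 l)
    exact ⟨n, f, g1, g2 ▸ hxA, g3, g4⟩
  choose n f g1 g2 g3 g4 using this
  refine ⟨n, f, g1, g2, g3, ?_⟩
  intro l l' hne i hi j hj e
  exact disj (h2 l l' hne) (g4 l i hi) (e ▸ g4 l' j hj)

theorem PLk.grid [Finite V] {U : SimpleGraph V} {A B : Set V} {κ : ℕ} {n : Fin κ → ℕ}
    {f : Fin κ → ℕ → V} (h : PLk U A B κ n f) {ι : Type} [Finite ι] (P : ι → Set V)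
    (Pc : ∀ i, Conn U (P i)) (Pd : ∀ i j, i ≠ j → Disjoint (P i) (P j))
    (hmin : ∀ i x y, U.Adj x y → x ∈ P i → y ∉ P i → ¬ Linked (delE U x y) A B κ)
    (J : Set (Fin κ)) (r w d : ℕ) (hJ : (r + 1) ^ r + 2 ≤ J.ncard)
    (hit : ∀ i, ∀ l ∈ J, ∃ a ≤ n l, f l a ∈ P i)
    (hd : 2 ^ (κ * κ) * (2 * (r * w) + 1) + 1 ≤ d)
    (hn : (d + 1) * ((d + 1) * κ + 1) ≤ Nat.card ι) : GridIn U r w univ := by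
  have hne : Nonempty ι := by
    by_contra hcon
    rw [not_nonempty_iff] at hcon
    rw [Nat.card_of_isEmpty] at hn
    simp at hn
  have hJne : J.Nonempty := by
    rw [Set.nonempty_iff_ne_empty]
    rintro rfl
    simp at hJ
  obtain ⟨l0, hl0⟩ := hJne
  obtain ⟨σ, hσ⟩ := h.cols l0 P Pc Pd hmin (fun i => hit i l0 hl0) d hn
  have hσne : ∀ j ≤ d, ∀ j' ≤ d, j ≠ j' → σ j ≠ σ j' := by
    intro j hj j' hj' hne
    rcases lt_or_gt_of_ne hne with g | g
    · exact (hσ j' hj' j g).1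
    · exact (hσ j hj j' g).1.symm
  obtain ⟨R, hR⟩ := h.slice (J \ {l0}) d (fun j => P (σ j)) (fun j _ => Pc _)
    (fun j hj j' hj' hne => Pd _ _ (hσne j hj j' hj' hne))
    (fun l hl j _ => hit _ l hl.1)
    (fun l hl j hj j' hj' hjj => (hσ j' hj' j hjj).2 l hl.2)
  refine hR.grid ?_ ?_
  · rw [Nat.card_coe_set_eq, Set.ncard_sdiff_singleton_of_mem hl0]
    omega
  · have hcard : Nat.card (SimpleGraph ↥(J \ {l0})) ≤ 2 ^ (κ * κ) := by
      set T := ↥(J \ {l0}) with hT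
      have e1 : Nat.card (SimpleGraph T) ≤ Nat.card (Set (T × T)) :=
        Nat.card_le_card_of_injective (fun G => {p | G.Adj p.1 p.2}) (by
          intro G G' e
          ext x y
          exact Set.ext_iff.1 e (x, y))
      have e2 : Nat.card T ≤ κ := by
        have := Nat.card_le_card_of_injective (Subtype.val : T → Fin κ) Subtype.val_injective
        rwa [Nat.card_fin] at this
      have e3 : Nat.card (Set (T × T)) = 2 ^ (Nat.card T * Nat.card T) := by
        have : Fintype T := Fintype.ofFinite T
        rw [Nat.card_eq_fintype_card, Nat.card_eq_fintype_card, Fintype.card_set, Fintype.card_prod]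
      rw [e3] at e1
      exact e1.trans (Nat.pow_le_pow_right (by norm_num) (Nat.mul_le_mul e2 e2))
    have := Nat.mul_le_mul_right (2 * (r * w) + 1) hcard
    omega

theorem pigeon {ι τ : Type} [Finite ι] [Finite τ] [Nonempty τ] (g : ι → τ) (k : ℕ)
    (h : Nat.card τ * k ≤ Nat.card ι) : ∃ y, k ≤ Nat.card {x // g x = y} := by
  have : Fintype ι := Fintype.ofFinite ι
  have : Fintype τ := Fintype.ofFinite τ
  rw [Nat.card_eq_fintype_card, Nat.card_eq_fintype_card] at h
  obtain ⟨y, hy⟩ := Fintype.exists_le_card_fiber_of_mul_le_card g h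
  refine ⟨y, ?_⟩
  rw [Nat.card_eq_fintype_card, Fintype.card_subtype]
  exact hy

theorem Linked.le {A B : Set V} {k k' : ℕ} (h : Linked G A B k) (hk : k' ≤ k) :
    Linked G A B k' := by
  obtain ⟨Q, h1, h2, h3, h4⟩ := h
  exact ⟨fun i => Q (Fin.castLE hk i), fun i => h1 _, fun i j hij => h2 _ _ (fun e => hij (Fin.castLE_injective hk e)),
    fun i => h3 _, fun i => h4 _⟩

theorem bad_grid [Finite V] {A B : Set V} {κ n' r w d : ℕ} {ι : Type} [Finite ι]
    (P : ι → Set V) (Pc : ∀ i, Conn G (P i)) (Pd : ∀ i j, i ≠ j → Disjoint (P i) (P j))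
    (hL : Linked G A B κ) (hκ : κ = n' + ((r + 1) ^ r + 2))
    (hd : d = 2 ^ (κ * κ) * (2 * (r * w) + 1) + 1)
    (hn : 2 ^ κ * ((d + 1) * ((d + 1) * κ + 1)) ≤ Nat.card ι)
    (hbad : ∀ i, ¬ Linked (inside G (P i)ᶜ) (A \ P i) (B \ P i) n') : GridIn G r w univ := by
  let good : Set (SimpleGraph V) := {U | U ≤ G ∧ (∀ i x y, G.Adj x y → x ∈ P i → y ∈ P i → U.Adj x y) ∧ Linked U A B κ}
  have hwf : WellFoundedLT (SimpleGraph V) := inferInstance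
  obtain ⟨U, ⟨hU1, hU2, hU3⟩, hU4⟩ := hwf.wf.has_min good ⟨G, le_rfl, fun _ _ _ h _ _ => h, hL⟩
  obtain ⟨n, f, hp⟩ := hU3.paths
  have Pc' : ∀ i, Conn U (P i) := fun i => (Pc i).mono_on (fun u hu v hv huv => hU2 i u v huv hu hv)
  have hmin : ∀ i x y, U.Adj x y → x ∈ P i → y ∉ P i → ¬ Linked (delE U x y) A B κ := by
    intro i x y hxy hx hy hLk
    refine hU4 (delE U x y) ⟨(delE_le _ _ _).trans hU1, ?_, hLk⟩ (delE_lt hxy)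
    intro j u v huv hu hv
    refine ⟨hU2 j u v huv hu hv, ?_, ?_⟩
    · rintro ⟨rfl, rfl⟩
      by_cases hij : i = j
      · subst hij; exact hy hv
      · exact disj (Pd i j hij) hx hu
    · rintro ⟨rfl, rfl⟩
      by_cases hij : i = j
      · subst hij; exact hy hu
      · exact disj (Pd i j hij) hx hv
  let J : ι → Set (Fin κ) := fun i => {l | ∃ a ≤ n l, f l a ∈ P i}
  have hJ : ∀ i, (r + 1) ^ r + 2 ≤ (J i).ncard := by
    intro i
    by_contra hcon
    have hc : n' ≤ ((J i)ᶜ).ncard := by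
      have := Set.ncard_add_ncard_compl (J i)
      rw [Nat.card_fin] at this
      omega
    obtain ⟨T, hT1, hT2⟩ := Set.exists_subset_card_eq hc
    obtain ⟨eq⟩ := Finite.card_eq.1 (show Nat.card (Fin n') = Nat.card T by rw [Nat.card_fin, Nat.card_coe_set_eq, hT2])
    have hnot : ∀ s, ∀ a ≤ n (eq s), f (eq s) a ∉ P i := by
      intro s a ha hP
      exact hT1 (eq s).2 ⟨a, ha, hP⟩
    refine hbad i ⟨fun s => f (eq s) '' {a | 0 ≤ a ∧ a ≤ n (eq s)}, ?_, ?_, ?_, ?_⟩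
    · intro s
      refine conn_inside (((hp.pth (eq s)).1.seg_conn (Nat.zero_le _) le_rfl).mono hU1) ?_
      rintro _ ⟨a, ha, rfl⟩
      exact hnot s a ha.2
    · intro s s' hss
      rw [disjoint_left]
      rintro _ ⟨a, ha, rfl⟩ ⟨b, hb, e⟩
      exact hp.dj (eq s') (eq s) (fun e' => hss (eq.injective (Subtype.ext e'.symm))) b hb.2 a ha.2 e
    · intro s
      exact ⟨_, ⟨0, ⟨le_rfl, Nat.zero_le _⟩, rfl⟩, hp.hA _, hnot s 0 (Nat.zero_le _)⟩
    · intro s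
      exact ⟨_, ⟨_, ⟨Nat.zero_le _, le_rfl⟩, rfl⟩, hp.hB _, hnot s _ le_rfl⟩
  obtain ⟨J0, hJ0⟩ := pigeon J ((d + 1) * ((d + 1) * κ + 1)) (by
    have : Nat.card (Set (Fin κ)) = 2 ^ κ := by
      rw [Nat.card_eq_fintype_card, Fintype.card_set, Fintype.card_fin]
    rw [this]; exact hn)
  have hne : Nonempty {x // J x = J0} := by
    by_contra hcon
    rw [not_nonempty_iff] at hcon
    rw [Nat.card_of_isEmpty] at hJ0
    simp at hJ0
  obtain ⟨x0⟩ := hne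
  have := hp.grid (ι := {x // J x = J0}) (fun i => P i) (fun i => Pc' i)
    (fun i j hij => Pd i j (fun e => hij (Subtype.ext e))) (fun i => hmin i) J0 r w d
    (by rw [← x0.2]; exact hJ _) (by
      intro i l hl
      rw [← i.2] at hl
      exact hl) hd.ge hJ0
  exact this.mono_graph hU1

theorem demands (r w : ℕ) : ∀ q : ℕ, ∃ n : ℕ, ∀ (V : Type) [Finite V] (G : SimpleGraph V) (A B : Fin q → Set V),
    (∀ e, Linked G (A e) (B e) n) →
    (∃ C : Fin q → Set V, (∀ e, Conn G (C e)) ∧ (∀ e e', e ≠ e' → Disjoint (C e) (C e')) ∧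
      (∀ e, (C e ∩ A e).Nonempty) ∧ ∀ e, (C e ∩ B e).Nonempty) ∨ GridIn G r w univ := by
  intro q
  induction q with
  | zero =>
    exact ⟨0, fun V _ G A B _ => Or.inl ⟨fun _ => ∅, fun e => e.elim0, fun e => e.elim0, fun e => e.elim0, fun e => e.elim0⟩⟩
  | succ q ih =>
    obtain ⟨n', hn'⟩ := ih
    obtain ⟨κ, hκ⟩ : ∃ κ, κ = n' + ((r + 1) ^ r + 2) := ⟨_, rfl⟩
    obtain ⟨d, hd⟩ : ∃ d, d = 2 ^ (κ * κ) * (2 * (r * w) + 1) + 1 := ⟨_, rfl⟩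
    obtain ⟨N, hN⟩ : ∃ N, N = 2 ^ κ * ((d + 1) * ((d + 1) * κ + 1)) := ⟨_, rfl⟩
    refine ⟨q * N + κ + 1, fun V _ G A B hL => ?_⟩
    obtain ⟨P, Pc, Pd, PA, PB⟩ := hL 0
    by_cases hgood : ∃ i, ∀ e : Fin q, Linked (inside G (P i)ᶜ) (A e.succ \ P i) (B e.succ \ P i) n'
    · obtain ⟨i, hi⟩ := hgood
      rcases hn' V (inside G (P i)ᶜ) (fun e => A e.succ \ P i) (fun e => B e.succ \ P i) hi with ⟨C, c1, c2, c3, c4⟩ | hg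
      · left
        have c5 : ∀ e, C e ⊆ (P i)ᶜ := by
          intro e
          refine conn_inside_subset (c1 e) ?_
          obtain ⟨x, hx, hx'⟩ := c3 e
          exact ⟨x, hx, hx'.2⟩
        have c6 : ∀ e, Disjoint (P i) (C e) := by
          intro e
          rw [disjoint_left]
          intro x hx hx'
          exact c5 e hx' hx
        refine ⟨Fin.cons (P i) C, ?_, ?_, ?_, ?_⟩
        · intro e
          refine Fin.cases ?_ (fun e => ?_) e
          · exact Pc i
          · exact (c1 e).mono (inside_le _ _)
        · intro e
          refine Fin.cases ?_ (fun e => ?_) e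
          · intro e'
            refine Fin.cases ?_ (fun e' => ?_) e'
            · intro h; exact absurd rfl h
            · intro _; exact c6 e'
          · intro e'
            refine Fin.cases ?_ (fun e' => ?_) e'
            · intro h; exact (c6 e).symm
            · intro h; exact c2 e e' (fun h' => h (by rw [h']))
        · intro e
          refine Fin.cases ?_ (fun e => ?_) e
          · exact PA i
          · obtain ⟨x, hx, hx'⟩ := c3 e
            exact ⟨x, hx, hx'.1⟩
        · intro e
          refine Fin.cases ?_ (fun e => ?_) e
          · exact PB i
          · obtain ⟨x, hx, hx'⟩ := c4 e
            exact ⟨x, hx, hx'.1⟩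
      · exact Or.inr (hg.mono_graph (inside_le _ _))
    · right
      push Not at hgood
      choose e he using hgood
      have hq : Nonempty (Fin q) := ⟨e 0⟩
      obtain ⟨e0, he0⟩ := pigeon e N (by rw [Nat.card_fin, Nat.card_fin]; omega)
      refine bad_grid (ι := {i // e i = e0}) (fun i => P i) (fun i => Pc i)
        (fun i j hij => Pd i j (fun h => hij (Subtype.ext h))) ((hL e0.succ).le (k' := κ) (by omega)) hκ hd
        (hN ▸ he0) ?_
      intro i
      have := he i
      rwa [i.2] at this

structure Hv (G : SimpleGraph V) (p : ℕ) (β : Set V → Set V) : Prop where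
  c : ∀ S, S.ncard ≤ p → IsComp G Sᶜ (β S)
  m : ∀ S S', S ⊆ S' → S'.ncard ≤ p → β S' ⊆ β S

def Tight (β : Set V → Set V) (X : Set V) : Prop := ∀ S : Set V, S.ncard < X.ncard → (X ∩ β S).Nonempty

theorem Hv.sub [Finite V] {p : ℕ} {β : Set V → Set V} (h : Hv G p β) {S S' : Set V}
    (hp : S.ncard + S'.ncard ≤ p) (hd : ¬ (S ∩ β S').Nonempty) : β S' ⊆ β S := by
  have hu : (S ∪ S').ncard ≤ p := (ncard_union_le S S').trans hp
  obtain ⟨x, hx⟩ := (h.c _ hu).1.nonempty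
  refine (h.c S (by omega)).subset_of_conn (h.c S' (by omega)).1 ?_
    ⟨x, h.m _ _ subset_union_right hu hx, h.m _ _ subset_union_left hu hx⟩
  intro y hy hyS
  exact hd ⟨y, hyS, hy⟩

theorem Hv.eq_of_nbr [Finite V] {p : ℕ} {β : Set V → Set V} (h : Hv G p β) {S S' : Set V}
    (hS : S ⊆ S') (hp : S'.ncard ≤ p) (hn : nbr G (β S') ⊆ S) : β S = β S' := by
  have c' := h.c S' hp
  have c1 := h.c S ((ncard_le_ncard hS).trans hp)
  have : IsComp G Sᶜ (β S') := isComp_nbr c'.1 hn (by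
    rw [disjoint_left]
    intro x hx hxS
    exact c'.2.1 hx (hS hxS))
  obtain ⟨x, hx⟩ := c'.1.nonempty
  exact c1.eq_of_inter this ⟨x, h.m _ _ hS hp hx, hx⟩

theorem Hv.disj {p : ℕ} {β : Set V → Set V} (h : Hv G p β) {S : Set V}
    (hp : S.ncard ≤ p) {x : V} (hx : x ∈ β S) : x ∉ S := (h.c S hp).2.1 hx

theorem Tight.nb [Finite V] {p : ℕ} {β : Set V → Set V} (h : Hv G p β) {X : Set V}
    (hX : Tight β X) (hp : X.ncard ≤ p) {x : V} (hx : x ∈ X) : ∃ v ∈ β X, G.Adj x v := by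
  by_contra! hcon
  have e := h.eq_of_nbr (S := X \ {x}) (S' := X) sdiff_subset hp (by
    intro y hy
    refine ⟨(h.c X hp).nbr_subset hy, ?_⟩
    rintro rfl
    obtain ⟨-, v, hv, hvy⟩ := hy
    exact hcon v hv hvy.symm)
  obtain ⟨y, hy, hy'⟩ := hX (X \ {x}) (Set.ncard_sdiff_singleton_lt_of_mem hx)
  rw [e] at hy'
  exact h.disj hp hy' hy

structure Msh (G : SimpleGraph V) (β : Set V → Set V) (m k : ℕ) (T X : Fin m → Set V) : Prop where
  Tc : ∀ i, Conn G (T i)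
  Td : ∀ i j, i ≠ j → Disjoint (T i) (T j)
  XT : ∀ i, X i ⊆ T i
  Xn : ∀ i, (X i).Nonempty
  Xk : ∀ i, (X i).ncard ≤ k
  ti : Tight β (⋃ i, X i)
  Tb : ∀ i, ∀ x ∈ T i, x ∉ β (⋃ i, X i)

theorem ncard_iUnion_le' [Finite V] {m k : ℕ} (X : Fin m → Set V) (h : ∀ i, (X i).ncard ≤ k) :
    (⋃ i, X i).ncard ≤ m * k := by
  have h1 : (⋃ i ∈ (Finset.univ : Finset (Fin m)), X i).ncard ≤ ∑ i, (X i).ncard :=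
    Finset.set_ncard_biUnion_le _ _
  have h2 : ∑ i, (X i).ncard ≤ (Finset.univ : Finset (Fin m)).card * k :=
    Finset.sum_le_card_nsmul _ _ _ (fun j _ => h j)
  simp only [Finset.mem_univ, Set.iUnion_true, Finset.card_univ, Fintype.card_fin] at h1 h2
  omega

theorem msh_init [Finite V] {p : ℕ} {β : Set V → Set V} (h : Hv G p β) {m k : ℕ}
    (hk : 1 ≤ k) (hp : 2 * m ≤ p) : ∃ T X, Msh G β m k T X := by
  have hV : m ≤ (univ : Set V).ncard := by
    by_contra hcon
    obtain ⟨x, hx⟩ := (h.c univ (by omega)).1.nonempty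
    exact h.disj (by omega) hx trivial
  obtain ⟨S0, -, hS0⟩ := Set.exists_subset_card_eq hV
  obtain ⟨S, hS, hmin⟩ := exists_minimal_of_wellFoundedLT (fun t : ℕ => ∃ S : Set V, S.ncard = m ∧ (β S).ncard = t)
    ⟨_, S0, hS0, rfl⟩
  obtain ⟨S, hS, rfl⟩ := hS
  have hti : Tight β S := by
    intro S' hS'
    by_contra hcon
    have hsub := h.sub (by omega) hcon
    obtain ⟨v, hv⟩ := (h.c S' (by omega)).1.nonempty
    have hins : (insert v S').ncard ≤ m := (ncard_insert_le _ _).trans (by omega)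
    obtain ⟨S2, hS2, -, hS2c⟩ := Set.exists_subsuperset_card_eq (subset_univ (insert v S')) hins hV
    have hlt : (β S2).ncard < (β S).ncard := by
      refine ncard_lt_ncard (ht := toFinite _) ⟨(h.m _ _ ((subset_insert v S').trans hS2) (by omega)).trans hsub, fun hcon => ?_⟩
      exact h.disj (by omega) (hcon (hsub hv)) (hS2 (Set.mem_insert _ _))
    have := hmin ⟨S2, hS2c, rfl⟩ hlt.le
    omega
  obtain ⟨e⟩ := Finite.card_eq.1 (show Nat.card (Fin m) = Nat.card S by rw [Nat.card_fin, Nat.card_coe_set_eq, hS])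
  have hU : (⋃ i, ({(e i : V)} : Set V)) = S := by
    ext x
    simp only [mem_iUnion, mem_singleton_iff]
    constructor
    · rintro ⟨i, rfl⟩; exact (e i).2
    · intro hx; exact ⟨e.symm ⟨x, hx⟩, by simp⟩
  refine ⟨fun i => {(e i : V)}, fun i => {(e i : V)}, fun i => conn_singleton G _, ?_, fun i => subset_rfl,
    fun i => Set.singleton_nonempty _, fun i => by simpa using hk, by rw [hU]; exact hti, ?_⟩
  · intro i j hij
    rw [Set.disjoint_singleton]
    exact fun h' => hij (e.injective (Subtype.ext h'))
  · intro i x hx hx'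
    rw [hU] at hx'
    rw [mem_singleton_iff] at hx
    subst hx
    exact h.disj (by omega) hx' (e i).2

theorem msh_step [Finite V] {p : ℕ} {β : Set V → Set V} (h : Hv G p β) {m k : ℕ}
    (hp : 2 * (m * k) + 1 ≤ p) {T X : Fin m → Set V} (hM : Msh G β m k T X) (i : Fin m) (hi : (X i).ncard < k) :
    ∃ T' X', Msh G β m k T' X' ∧ (β (⋃ i, X' i)).ncard < (β (⋃ i, X i)).ncard := by
  set Z := ⋃ i, X i with hZ
  have hZk : Z.ncard ≤ m * k := ncard_iUnion_le' X hM.Xk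
  have hXZ : ∀ i, X i ⊆ Z := fun i => subset_iUnion X i
  have hti : Tight β Z := hM.ti
  obtain ⟨x, hx⟩ := hM.Xn i
  obtain ⟨v, hv, hxv⟩ := hti.nb h (by omega) (hXZ i hx)
  have hvT : ∀ j, v ∉ T j := fun j hj => hM.Tb j v hj hv
  have hYk : (insert v Z).ncard ≤ Z.ncard + 1 := ncard_insert_le _ _
  by_cases hY : Tight β (insert v Z)
  · have hU : (⋃ j, if j = i then insert v (X j) else X j) = insert v Z := by
      ext y
      simp only [mem_iUnion, mem_insert_iff, hZ]
      constructor
      · rintro ⟨j, hj⟩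
        split_ifs at hj with hji
        · rcases hj with hj | hj
          · exact Or.inl hj
          · exact Or.inr ⟨j, hj⟩
        · exact Or.inr ⟨j, hj⟩
      · rintro (rfl | ⟨j, hj⟩)
        · exact ⟨i, by simp⟩
        · refine ⟨j, ?_⟩
          split_ifs
          · exact Or.inr hj
          · exact hj
    have hsub : β (insert v Z) ⊆ β Z := h.m _ _ (subset_insert _ _) (by omega)
    refine ⟨fun j => if j = i then insert v (T j) else T j, fun j => if j = i then insert v (X j) else X j,
      ⟨?_, ?_, ?_, ?_, ?_, by rw [hU]; exact hY, ?_⟩, ?_⟩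
    · intro j
      split_ifs with hji
      · subst hji; exact (hM.Tc j).insert_adj (hM.XT j hx) hxv
      · exact hM.Tc j
    · intro j j' hjj
      have := hM.Td j j' hjj
      split_ifs with h1 h2 h2
      · exact absurd (h1.trans h2.symm) hjj
      · rw [Set.disjoint_insert_left]; exact ⟨hvT _, this⟩
      · rw [Set.disjoint_insert_right]; exact ⟨hvT _, this⟩
      · exact this
    · intro j
      split_ifs
      · exact Set.insert_subset_insert (hM.XT j)
      · exact hM.XT j
    · intro j
      split_ifs
      · exact Set.insert_nonempty _ _
      · exact hM.Xn j
    · intro j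
      split_ifs with hji
      · subst hji; exact (ncard_insert_le _ _).trans hi
      · exact hM.Xk j
    · intro j y hy hyb
      rw [hU] at hyb
      split_ifs at hy
      · rcases hy with rfl | hy
        · exact h.disj (by omega) hyb (Set.mem_insert _ _)
        · exact hM.Tb j y hy (hsub hyb)
      · exact hM.Tb j y hy (hsub hyb)
    · rw [hU]
      exact ncard_lt_ncard (ht := toFinite _) ⟨hsub, fun hcon => h.disj (by omega) (hcon hv) (Set.mem_insert _ _)⟩
  · unfold Tight at hY
    push Not at hY
    obtain ⟨S, hS1, hS2⟩ := hY
    have hvS : v ∉ β S := fun h' => by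
      have : v ∈ insert v Z ∩ β S := ⟨Set.mem_insert _ _, h'⟩
      rw [hS2] at this; exact this
    have hZS : ¬ (Z ∩ β S).Nonempty := by
      rintro ⟨y, hy, hy'⟩
      have : y ∈ insert v Z ∩ β S := ⟨Or.inr hy, hy'⟩
      rw [hS2] at this; exact this
    have hSc : S.ncard = Z.ncard := by
      by_contra hne
      exact hZS (hti S (by omega))
    have hSD : β S ⊆ β Z := h.sub (by omega) hZS
    have cS := h.c S (by omega)
    have cZ := h.c Z (by omega)
    have hnb : nbr G (β S) = S := by
      by_contra hne
      have hss : nbr G (β S) ⊂ S := lt_of_le_of_ne cS.nbr_subset hne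
      have e := h.eq_of_nbr (S := nbr G (β S)) (S' := S) hss.subset (by omega) subset_rfl
      have := hti (nbr G (β S)) (by have := ncard_lt_ncard hss; omega)
      rw [e] at this
      exact hZS this
    have hSDZ : S ⊆ β Z ∪ Z := by
      intro y hy
      by_contra hcon
      rw [mem_union, not_or] at hcon
      rw [← hnb] at hy
      obtain ⟨-, a, ha, hay⟩ := hy
      exact hcon.1 (cZ.2.2 a (hSD ha) y hcon.2 hay)
    have hSt : Tight β S := by
      intro S2 hS2
      by_contra hcon
      have := h.sub (by omega) hcon
      obtain ⟨y, hy, hy'⟩ := hti S2 (by omega)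
      exact hZS ⟨y, hy, this hy'⟩
    set R := (β Z ∪ Z) \ β S with hR
    have hSR : S ⊆ R := fun y hy => ⟨hSDZ hy, fun h' => h.disj (by omega) h' hy⟩
    have hZR : Z ⊆ R := fun y hy => ⟨Or.inr hy, fun h' => hZS ⟨y, hy, h'⟩⟩
    have hlink : Linked (inside G R) S Z Z.ncard := by
      apply menger
      intro W hW
      by_contra hcon
      have hcW := h.c W (by omega)
      obtain ⟨y, hy, hyW⟩ := hti W (by omega)
      have huk : (W ∪ S).ncard ≤ p := (ncard_union_le _ _).trans (by omega)
      obtain ⟨z, hz⟩ := (h.c _ huk).1.nonempty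
      have hsub : β W ⊆ β S ∪ reach (inside G R) S W := by
        refine hcW.1.closed _ (h.m _ _ subset_union_left huk hz) (Or.inl (h.m _ _ subset_union_right huk hz)) ?_
        intro a haW ha b hbW hab
        have hbW' : b ∉ W := h.disj (by omega) hbW
        rcases ha with ha | ha
        · by_cases hbS : b ∈ S
          · exact Or.inr (reach_base hbS hbW')
          · exact Or.inl (cS.2.2 a ha b hbS hab)
        · obtain ⟨Q, q1, q2, ⟨s, q3, q3'⟩, q4⟩ := ha
          have hQR : Q ⊆ R := conn_inside_subset q1 ⟨s, q3, hSR q3'⟩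
          have haZ : a ∉ Z := fun h' => hW Q q1 q2 ⟨s, q3, q3'⟩ ⟨a, q4, h'⟩
          have haD : a ∈ β Z := (hQR q4).1.resolve_right haZ
          by_cases hbS : b ∈ β S
          · exact Or.inl hbS
          · right
            have hbR : b ∈ R := by
              refine ⟨?_, hbS⟩
              by_cases hbZ : b ∈ Z
              · exact Or.inr hbZ
              · exact Or.inl (cZ.2.2 a haD b hbZ hab)
            exact reach_step ⟨Q, q1, q2, ⟨s, q3, q3'⟩, q4⟩ ⟨hab, hQR q4, hbR⟩ hbW'
      rcases hsub hyW with h1 | ⟨Q, q1, q2, q3, q4⟩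
      · exact hZS ⟨y, hy, h1⟩
      · exact hW Q q1 q2 q3 ⟨y, q4, hy⟩
    obtain ⟨P, P1, P2, P3, P4⟩ := linked_index hlink rfl
    have hPR : ∀ b ∈ Z, P b ⊆ R := fun b hb => conn_inside_subset (P1 b hb) (by
      have : b ∈ P b ∩ Z := by rw [P4 b hb]; rfl
      exact ⟨b, this.1, hZR hb⟩)
    have hbP : ∀ b ∈ Z, b ∈ P b := fun b hb => by
      have : b ∈ P b ∩ Z := by rw [P4 b hb]; rfl
      exact this.1
    have : ∀ b, ∃ s, b ∈ Z → s ∈ P b ∧ s ∈ S := by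
      intro b
      by_cases hb : b ∈ Z
      · obtain ⟨s, hs⟩ := P3 b hb
        exact ⟨s, fun _ => hs⟩
      · exact ⟨b, fun h' => absurd h' hb⟩
    choose s hs using this
    have hsimg : s '' Z = S := by
      apply Set.eq_of_subset_of_ncard_le
      · rintro _ ⟨b, hb, rfl⟩; exact (hs b hb).2
      · rw [Set.InjOn.ncard_image, hSc]
        intro b hb b' hb' e
        by_contra hne
        exact disj (P2 b hb b' hb' hne) (hs b hb).1 (e ▸ (hs b' hb').1)
      · exact toFinite _
    have hU : (⋃ j, s '' X j) = S := by rw [← Set.image_iUnion]; exact hsimg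
    have hPT : ∀ j, ∀ b ∈ X j, ∀ y ∈ P b, ∀ j', y ∈ T j' → j' = j := by
      intro j b hb y hy j' hyT
      have hbZ := hXZ j hb
      rcases (hPR b hbZ hy).1 with h1 | h1
      · exact absurd h1 (hM.Tb j' y hyT)
      · have : y ∈ P b ∩ Z := ⟨hy, h1⟩
        rw [P4 b hbZ, mem_singleton_iff] at this
        subst this
        by_contra hne
        exact disj (hM.Td j' j hne) hyT (hM.XT j hb)
    refine ⟨fun j => T j ∪ ⋃ b ∈ X j, P b, fun j => s '' X j, ⟨?_, ?_, ?_, ?_, ?_, by rw [hU]; exact hSt, ?_⟩, ?_⟩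
    · intro j
      refine (hM.Tc j).union_pieces ?_
      intro y hy
      simp only [mem_iUnion] at hy
      obtain ⟨b, hb, hy⟩ := hy
      refine ⟨P b, ?_, (P1 b (hXZ j hb)).mono (inside_le _ _), hy, Or.inl ⟨b, hbP b (hXZ j hb), hM.XT j hb⟩⟩
      exact (subset_biUnion_of_mem (u := P) hb).trans subset_union_left
    · intro j j' hjj
      rw [disjoint_left]
      intro y hy hy'
      simp only [mem_union, mem_iUnion] at hy hy'
      rcases hy with hy | ⟨b, hb, hy⟩ <;> rcases hy' with hy' | ⟨b', hb', hy'⟩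
      · exact disj (hM.Td j j' hjj) hy hy'
      · exact hjj (hPT j' b' hb' y hy' j hy)
      · exact hjj (hPT j b hb y hy j' hy').symm
      · by_cases hbb : b = b'
        · subst hbb
          exact disj (hM.Td j j' hjj) (hM.XT j hb) (hM.XT j' hb')
        · exact disj (P2 b (hXZ j hb) b' (hXZ j' hb') hbb) hy hy'
    · rintro j _ ⟨b, hb, rfl⟩
      right
      simp only [mem_iUnion]
      exact ⟨b, hb, (hs b (hXZ j hb)).1⟩
    · intro j; exact (hM.Xn j).image _
    · intro j; exact (Set.ncard_image_le (toFinite _)).trans (hM.Xk j)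
    · intro j y hy hyS
      rw [hU] at hyS
      simp only [mem_union, mem_iUnion] at hy
      rcases hy with hy | ⟨b, hb, hy⟩
      · exact hM.Tb j y hy (hSD hyS)
      · exact (hPR b (hXZ j hb) hy).2 hyS
    · rw [hU]
      exact ncard_lt_ncard (ht := toFinite _) ⟨hSD, fun hcon => hvS (hcon hv)⟩

theorem msh_full [Finite V] {p : ℕ} {β : Set V → Set V} (h : Hv G p β) {m k : ℕ}
    (hk : 1 ≤ k) (hp : 2 * (m * k) + 1 ≤ p) : ∃ T X, Msh G β m k T X ∧ ∀ i, (X i).ncard = k := by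
  have hmk : m * 1 ≤ m * k := Nat.mul_le_mul_left _ hk
  obtain ⟨T0, X0, h0⟩ := msh_init h (m := m) hk (by omega)
  obtain ⟨t, ⟨T, X, hM, rfl⟩, hmin⟩ := exists_minimal_of_wellFoundedLT
    (fun t : ℕ => ∃ T X, Msh G β m k T X ∧ (β (⋃ i, X i)).ncard = t) ⟨_, T0, X0, h0, rfl⟩
  refine ⟨T, X, hM, fun i => ?_⟩
  by_contra hne
  obtain ⟨T', X', hM', hlt⟩ := msh_step h hp hM i (lt_of_le_of_ne (hM.Xk i) hne)
  have := hmin ⟨T', X', hM', rfl⟩ hlt.le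
  omega

theorem Msh.linked [Finite V] {p : ℕ} {β : Set V → Set V} (h : Hv G p β) {m k : ℕ}
    (hp : 2 * (m * k) + k + 1 ≤ p) {T X : Fin m → Set V} (hM : Msh G β m k T X) (hX : ∀ i, (X i).ncard = k)
    (i j : Fin m) : Linked (inside G (β (⋃ i, X i))) {y | y ∈ β (⋃ i, X i) ∧ ∃ x ∈ X i, G.Adj x y}
      {y | y ∈ β (⋃ i, X i) ∧ ∃ x ∈ X j, G.Adj x y} k := by
  set Z := ⋃ i, X i with hZ
  have hZk : Z.ncard ≤ m * k := ncard_iUnion_le' X hM.Xk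
  have hXZ : ∀ i, X i ⊆ Z := fun i => subset_iUnion X i
  have hti : Tight β Z := hM.ti
  apply menger
  intro W hW
  by_contra hcon
  have huk : (Z ∪ W).ncard ≤ p := (ncard_union_le _ _).trans (by omega)
  have hE := h.c _ huk
  have hED : β (Z ∪ W) ⊆ β Z := h.m _ _ subset_union_left huk
  have key : ∀ i, (β (Z ∪ W) ∩ {y | y ∈ β Z ∧ ∃ x ∈ X i, G.Adj x y}).Nonempty := by
    intro i
    by_contra hno
    have e := h.eq_of_nbr (S := (Z \ X i) ∪ W) (S' := Z ∪ W) (Set.union_subset_union_left _ sdiff_subset) huk (by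
      intro y hy
      rcases hE.nbr_subset hy with h1 | h1
      · left
        refine ⟨h1, fun hyX => hno ?_⟩
        obtain ⟨-, a, ha, hay⟩ := hy
        exact ⟨a, ha, hED ha, y, hyX, hay.symm⟩
      · exact Or.inr h1)
    have hc1 := ncard_union_le (Z \ X i) W
    have hc2 := Set.ncard_sdiff_add_ncard_of_subset (hXZ i)
    have hXi := hX i
    obtain ⟨y, hy, hy'⟩ := hti ((Z \ X i) ∪ W) (by omega)
    rw [e] at hy'
    exact h.disj huk hy' (Or.inl hy)
  refine hW (β (Z ∪ W)) (conn_inside hE.1 hED) ?_ (key i) (key j)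
  rw [disjoint_left]
  intro y hy hyW
  exact h.disj huk hy (Or.inr hyW)

theorem haven_grid (m r w : ℕ) : ∃ p : ℕ, 1 ≤ p ∧ ∀ (V : Type) [Finite V] (G : SimpleGraph V) (β : Set V → Set V),
    HavenIn G univ p β → KMinor G m univ ∨ GridIn G r w univ := by
  obtain ⟨n, hn⟩ := demands r w (m * m)
  set k := n + 1 with hk
  refine ⟨2 * (m * k) + k + 1, by omega, fun V _ G β hβ => ?_⟩
  have h : Hv G (2 * (m * k) + k + 1) β :=
    ⟨fun S hS => by rw [Set.compl_eq_univ_sdiff]; exact hβ.1 S (subset_univ _) hS,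
      fun S S' hS hS' => hβ.2 S S' hS (subset_univ _) hS'⟩
  obtain ⟨T, X, hM, hX⟩ := msh_full h (m := m) (k := k) (by omega) (by omega)
  have hL := hM.linked h le_rfl hX
  set D := β (⋃ i, X i) with hD
  let N : Fin m → Set V := fun i => {y | y ∈ D ∧ ∃ x ∈ X i, G.Adj x y}
  rcases hn V (inside G D) (fun e => N (finProdFinEquiv.symm e).1) (fun e => N (finProdFinEquiv.symm e).2)
    (fun e => (hL _ _).le (by omega)) with ⟨C, c1, c2, c3, c4⟩ | hg
  · left
    have c5 : ∀ e, C e ⊆ D := fun e => conn_inside_subset (c1 e) (by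
      obtain ⟨x, hx, hx'⟩ := c3 e
      exact ⟨x, hx, hx'.1⟩)
    have c6 : ∀ i j, SAdj G (T i) (C (finProdFinEquiv (i, j))) := by
      intro i j
      obtain ⟨y, hy, -, x, hx, hxy⟩ := c3 (finProdFinEquiv (i, j))
      rw [Equiv.symm_apply_apply] at hx
      exact ⟨x, hM.XT i hx, y, hy, hxy⟩
    have c7 : ∀ i j, SAdj G (C (finProdFinEquiv (i, j))) (T j) := by
      intro i j
      obtain ⟨y, hy, -, x, hx, hxy⟩ := c4 (finProdFinEquiv (i, j))
      rw [Equiv.symm_apply_apply] at hx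
      exact ⟨y, hy, x, hM.XT j hx, hxy.symm⟩
    refine ⟨fun i => T i ∪ ⋃ j, C (finProdFinEquiv (i, j)), ?_, fun _ => subset_univ _, ?_, ?_⟩
    · intro i
      refine (hM.Tc i).union_pieces ?_
      intro y hy
      rw [mem_iUnion] at hy
      obtain ⟨j, hy⟩ := hy
      exact ⟨C (finProdFinEquiv (i, j)),
        (subset_iUnion (fun j => C (finProdFinEquiv (i, j))) j).trans subset_union_left,
        (c1 _).mono (inside_le _ _), hy, Or.inr (c6 i j)⟩
    · intro i i' hii
      rw [disjoint_left]
      intro y hy hy'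
      simp only [mem_union, mem_iUnion] at hy hy'
      rcases hy with hy | ⟨b, hy⟩ <;> rcases hy' with hy' | ⟨b', hy'⟩
      · exact disj (hM.Td i i' hii) hy hy'
      · exact hM.Tb i y hy (c5 _ hy')
      · exact hM.Tb i' y hy' (c5 _ hy)
      · refine disj (c2 _ _ ?_) hy hy'
        intro e
        exact hii (Prod.ext_iff.1 (finProdFinEquiv.injective e)).1
    · intro i i' hii
      exact (c7 i i').mono ((subset_iUnion (fun j => C (finProdFinEquiv (i, j))) i').trans subset_union_right)
        subset_union_left
  · exact Or.inr (hg.mono_graph (inside_le _ _))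

theorem GridIn.minor {W : Type} {H : SimpleGraph W} {w h : ℕ}
    (hg : GridIn G (w + 1) (h + 1) univ) (hH : MinorIn GG H {p | p.1 ≤ w ∧ p.2 ≤ h}) :
    MinorIn G H univ := by
  obtain ⟨φ, g1, g2, g3, g4⟩ := hg
  refine hH.lift (fun p => φ p.1 p.2) ?_ (fun _ _ => subset_univ _) ?_ ?_
  · rintro ⟨a, b⟩ ⟨ha, hb⟩
    exact (g1 a (Nat.lt_succ_of_le ha) b (Nat.lt_succ_of_le hb)).1
  · rintro ⟨a, b⟩ ⟨ha, hb⟩ ⟨c, d⟩ ⟨hc, hd⟩ hne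
    refine g2 a (Nat.lt_succ_of_le ha) b (Nat.lt_succ_of_le hb) c (Nat.lt_succ_of_le hc) d (Nat.lt_succ_of_le hd) ?_
    by_contra! hcon
    exact hne (Prod.ext hcon.1 hcon.2)
  · rintro ⟨a, b⟩ ⟨ha, hb⟩ ⟨c, d⟩ ⟨hc, hd⟩ hadj
    rw [gg_adj] at hadj
    rcases hadj with ⟨rfl, rfl | rfl⟩ | ⟨rfl, rfl | rfl⟩
    · exact (g3 a (Nat.lt_succ_of_le ha) d (Nat.lt_succ_of_le hb)).symm
    · exact g3 a (Nat.lt_succ_of_le ha) b (Nat.lt_succ_of_le hd)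
    · exact (g4 c (Nat.lt_succ_of_le ha) b (Nat.lt_succ_of_le hb)).symm
    · exact g4 a (Nat.lt_succ_of_le hc) b (Nat.lt_succ_of_le hb)

theorem KMinor.minor {W : Type} [Finite W] {H : SimpleGraph W} {X : Set V}
    (h : KMinor G (Nat.card W) X) : MinorIn G H X := by
  obtain ⟨φ, h1, h2, h3, h4⟩ := h
  have e := Finite.equivFin W
  refine ⟨fun x => φ (e x), fun x => h1 _, fun x => h2 _, fun x y hxy => h3 _ _ (fun h' => hxy (e.injective h')),
    fun x y hxy => h4 _ _ ?_⟩
  rw [SimpleGraph.top_adj]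
  exact fun h' => hxy.ne (e.injective h')

theorem minor_of_inside {W : Type} {H : SimpleGraph W} (hc : H.Connected) {C : Set V}
    (hC : C.Nonempty) (h : MinorIn (inside G C) H univ) : MinorIn G H C := by
  obtain ⟨φ, h1, -, h3, h4⟩ := h
  by_cases hW : Nontrivial W
  · refine ⟨φ, fun x => (h1 x).mono (inside_le _ _), fun x => ?_, h3, fun x y hxy => ?_⟩
    · obtain ⟨y, hy⟩ := hc.preconnected.exists_adj_of_nontrivial x
      obtain ⟨a, ha, b, hb, hab⟩ := h4 x y hy
      exact conn_inside_subset (h1 x) ⟨a, ha, hab.2.1⟩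
    · obtain ⟨a, ha, b, hb, hab⟩ := h4 x y hxy
      exact ⟨a, ha, b, hb, hab.1⟩
  · rw [not_nontrivial_iff_subsingleton] at hW
    obtain ⟨c, hc⟩ := hC
    exact ⟨fun _ => {c}, fun _ => conn_singleton G c, fun _ => by simpa using hc,
      fun x y hxy => absurd (Subsingleton.elim x y) hxy, fun x y hxy => absurd (Subsingleton.elim x y) hxy.ne⟩

theorem hfree_planar {W : Type} [Finite W] (H : SimpleGraph W) (hc : H.Connected) (h5 : ¬ IsMinorOf K5 H)
    (h33 : ¬ IsMinorOf K33 H) : ∃ p, 1 ≤ p ∧ ∀ (V : Type) [Finite V] (G : SimpleGraph V) (X : Set V),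
      ¬ MinorIn G H X → ∀ C ⊆ X, ∀ γ, ¬ HavenIn G C p γ := by
  obtain ⟨w, h, hg⟩ := planar_grid H hc h5 h33
  obtain ⟨p, hp1, hp⟩ := haven_grid (Nat.card W) (w + 1) (h + 1)
  refine ⟨p, hp1, fun V _ G X hX C hCX γ hγ => hX (MinorIn.mono ?_ hCX)⟩
  have hC : C.Nonempty := by
    have := hγ.1 ∅ (Set.empty_subset _) (by simp)
    obtain ⟨x, hx⟩ := this.1.nonempty
    exact ⟨x, (this.2.1 hx).1⟩
  refine minor_of_inside hc hC ?_
  rcases hp V (inside G C) _ hγ.inside with h1 | h1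
  · exact h1.minor
  · exact h1.minor hg

end NK

theorem stmt19 (n : ℕ) (β : Fin n → Type) (instβ : ∀ i, Fintype (β i))
    (F : ∀ i : Fin n, SimpleGraph (β i)) (hFconn : ∀ i, (F i).Connected)
    (h5 : ∀ i, ¬ IsMinorOf K5 (F i)) (h33 : ∀ i, ¬ IsMinorOf K33 (F i)) :
    ∃ g : ℕ → ℕ, (∃ C d : ℕ, ∀ t : ℕ, g t ≤ C * (t + 1) ^ d) ∧
      ∀ (V : Type) [Fintype V], ∀ G : SimpleGraph V,
        ElimLE G (fun A => ∀ i, ¬ IsMinorOf (F i) (G.induce A)) Set.univ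
          (g (necklaceMinorNumber F G)) := by
  rcases Nat.eq_zero_or_pos n with rfl | hn
  · exact ⟨fun _ => 0, ⟨0, 0, fun t => le_of_eq (Nat.zero_mul _).symm⟩,
      fun V _ G => ElimLE.base _ _ (fun i => i.elim0)⟩
  · obtain ⟨p, hp, hfree⟩ := NK.hfree_planar (F ⟨0, hn⟩) (hFconn _) (h5 _) (h33 _)
    exact NK.final_of_hfree n β instβ F hFconn ⟨0, hn⟩ p hp hfree
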